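/- Let n ≥ 2 be an integer, let q be a prime power, and let G be a group with SL_n(q) ≤ G ≤ GL_n(q). Then n/π² < γ(G), where π is the real number pi. -/

import Mathlib

/-- `k` classes of proper subgroups whose conjugates cover `G`. -/
def IsNormalCover (G : Type*) [Group G] (k : ℕ) : Prop :=
  ∃ H : Fin k → Subgroup G, (∀ i, H i ≠ ⊤) ∧
    ∀ g : G, ∃ i : Fin k, ∃ x : G, x * g * x⁻¹ ∈ H i

/-- `γ(G)`: the least number of conjugacy classes of proper subgroups needed to cover `G`. -/
noncomputable def gammaCover (G : Type*) [Group G] : ℕ := sInf {k | IsNormalCover G k}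

/-- A set of conjugacy classes is independent if any pair of elements from two distinct
classes of the set generates `G`. -/
def IsIndependentClasses (G : Type*) [Group G] (S : Finset (ConjClasses G)) : Prop :=
  ∀ c ∈ S, ∀ d ∈ S, c ≠ d → ∀ x ∈ c.carrier, ∀ y ∈ d.carrier,
    Subgroup.closure {x, y} = ⊤

/-- `κ(G)`: the size of the largest independent set of conjugacy classes of `G`. -/
noncomputable def kappaIndep (G : Type*) [Group G] : ℕ :=
  sSup {k | ∃ S : Finset (ConjClasses G), S.card = k ∧ IsIndependentClasses G S}

/-- `ν(n)`: the number of distinct prime divisors of `n`. -/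
def nuPrimes (n : ℕ) : ℕ := n.primeFactors.card

/-- Lehmer's partial totient `φ(k, t, n)`: the number of integers `x` coprime to `n`
with `n t / k < x < n (t+1) / k`. -/
def partialTotient (k t n : ℕ) : ℕ :=
  ((Finset.range (n * (t + 1) + 1)).filter
    (fun x => Nat.Coprime x n ∧ (n * t : ℚ) / k < (x : ℚ) ∧ (x : ℚ) < (n * (t + 1) : ℚ) / k)).card

/-- The copy of `SL_n(F)` inside `GL_n(F)`. -/
def SLinGL (n : ℕ) (F : Type*) [Field F] : Subgroup (GL (Fin n) F) :=
  (Matrix.SpecialLinearGroup.toGL (n := Fin n) (R := F)).range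

set_option linter.unusedSectionVars false

section Tokens

variable {E R A L J M : Type*} [Field E] [CommRing R] [Algebra E R] [AddCommGroup A] [Module E A]
  [AddCommGroup M] [Module E M] {φ : L → E →+* E}

/-- The product of the values of a family of semilinear maps over a multiset of labelled vectors. -/
def tokProd (tk : ∀ r, A →ₛₗ[φ r] R) (s : Multiset (L × A)) : R :=
  (s.map fun x => tk x.1 x.2).prod

/-- The product of the values of a family of semilinear maps on basis vectors. -/
def tokMon (tk : ∀ r, A →ₛₗ[φ r] R) (b : J → A) (s : Multiset (L × J)) : R :=
  (s.map fun x => tk x.1 (b x.2)).prod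

theorem tokProd_cons (tk : ∀ r, A →ₛₗ[φ r] R) (x : L × A) (s : Multiset (L × A)) :
    tokProd tk (x ::ₘ s) = tk x.1 x.2 * tokProd tk s := by
  simp [tokProd]

theorem tokMon_cons (tk : ∀ r, A →ₛₗ[φ r] R) (b : J → A) (x : L × J) (s : Multiset (L × J)) :
    tokMon tk b (x ::ₘ s) = tk x.1 (b x.2) * tokMon tk b s := by
  simp [tokMon]

theorem tokMon_eq_tokProd (tk : ∀ r, A →ₛₗ[φ r] R) (b : J → A) (s : Multiset (L × J)) :
    tokMon tk b s = tokProd tk (s.map fun x => (x.1, b x.2)) := by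
  simp [tokMon, tokProd]

theorem tokProd_ext [Fintype J] (B : Module.Basis J E A) (tk : ∀ r, A →ₛₗ[φ r] R)
    (s : Multiset (L × A)) : ∀ (Φ : R →ₗ[E] M)
    (_ : ∀ t : Multiset (L × J), t.map Prod.fst = s.map Prod.fst → Φ (tokMon tk B t) = 0),
    Φ (tokProd tk s) = 0 := by
  induction s using Multiset.induction_on with
  | empty =>
    intro Φ h
    simpa [tokProd, tokMon] using h 0 rfl
  | cons x s ih =>
    intro Φ h
    have key : ∀ j, Φ (tk x.1 (B j) * tokProd tk s) = 0 := by
      intro j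
      refine ih (Φ ∘ₗ LinearMap.mulLeft E (tk x.1 (B j))) fun t ht => ?_
      have := h ((x.1, j) ::ₘ t) (by simp [ht])
      rwa [tokMon_cons] at this
    rw [tokProd_cons, ← B.sum_repr x.2, map_sum, Finset.sum_mul, map_sum]
    refine Finset.sum_eq_zero fun j _ => ?_
    rw [map_smulₛₗ, smul_mul_assoc, map_smul, key, smul_zero]

/-- First order deformation of a family of semilinear maps. -/
def tokDual (tk ξ : ∀ r, A →ₛₗ[φ r] R) (r : L) : A →ₛₗ[φ r] DualNumber R where
  toFun x := TrivSqZeroExt.inl (tk r x) + TrivSqZeroExt.inr (ξ r x)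
  map_add' x y := by ext <;> simp
  map_smul' c x := by ext <;> simp

theorem snd_tokDual_mon [DecidableEq L] [DecidableEq J] (tk ξ : ∀ r, A →ₛₗ[φ r] R) (b : J → A)
    (s : Multiset (L × J)) :
    (tokMon (tokDual tk ξ) b s).fst = tokMon tk b s ∧
    (tokMon (tokDual tk ξ) b s).snd =
      (s.map fun x => ξ x.1 (b x.2) * tokMon tk b (s.erase x)).sum := by
  induction s using Multiset.induction_on with
  | empty => simp [tokMon]
  | cons x s ih =>
    obtain ⟨h1, h2⟩ := ih
    rw [tokMon_cons]
    constructor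
    · rw [TrivSqZeroExt.fst_mul, h1, tokMon_cons]; simp [tokDual]
    · rw [TrivSqZeroExt.snd_mul, h1, h2]
      have : (s.map fun y => ξ y.1 (b y.2) * tokMon tk b ((x ::ₘ s).erase y)) =
          s.map fun y => tk x.1 (b x.2) * (ξ y.1 (b y.2) * tokMon tk b (s.erase y)) := by
        refine Multiset.map_congr rfl fun y hy => ?_
        by_cases hxy : y = x
        · subst hxy
          rw [Multiset.erase_cons_head]
          conv_lhs => rw [← Multiset.cons_erase hy, tokMon_cons]
          ring
        · rw [Multiset.erase_cons_tail _ (by simpa using Ne.symm hxy), tokMon_cons]; ring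
      rw [Multiset.map_cons, Multiset.sum_cons, this, Multiset.sum_map_mul_left]
      simp [tokDual]
      ring

/-- If the derivative in direction `ξ` of every monomial in one basis is killed by `Ψ`, then so is
that of every monomial in any other basis. -/
theorem sum_deriv_eq_zero [DecidableEq L] {J' : Type*} [DecidableEq J] [DecidableEq J']
    [Fintype J] (B : Module.Basis J E A) (b : J' → A) (tk ξ : ∀ r, A →ₛₗ[φ r] R)
    (Ψ : R →ₗ[E] E) (δ : Multiset L)
    (h : ∀ t : Multiset (L × J), t.map Prod.fst = δ →
      (t.map fun x => Ψ (ξ x.1 (B x.2) * tokMon tk B (t.erase x))).sum = 0)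
    (s : Multiset (L × J')) (hs : s.map Prod.fst = δ) :
    (s.map fun x => Ψ (ξ x.1 (b x.2) * tokMon tk b (s.erase x))).sum = 0 := by
  let sndE : DualNumber R →ₗ[E] R :=
    { toFun := TrivSqZeroExt.snd
      map_add' := fun _ _ => rfl
      map_smul' := fun _ _ => rfl }
  have key := tokProd_ext B (tokDual tk ξ) (s.map fun x => (x.1, b x.2)) (Ψ ∘ₗ sndE) fun t ht => by
    rw [LinearMap.comp_apply]
    change Ψ (tokMon (tokDual tk ξ) B t).snd = 0
    rw [(snd_tokDual_mon tk ξ B t).2, map_multiset_sum, Multiset.map_map]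
    exact h t (by rw [ht, Multiset.map_map, ← hs]; rfl)
  rw [← tokMon_eq_tokProd, LinearMap.comp_apply] at key
  change Ψ (tokMon (tokDual tk ξ) b s).snd = 0 at key
  rwa [(snd_tokDual_mon tk ξ b s).2, map_multiset_sum, Multiset.map_map] at key

end Tokens

section Core

open Multiset

/-- Abstract data for the vanishing argument: a linear functional `Ψ` on an algebra generated by
semilinear tokens, which kills all token products of degree less than `d`. -/
structure PolyCore {E R A L ι : Type*} [Field E] [CommRing R] [Algebra E R] [AddCommGroup A]
    [Module E A] [DecidableEq L] {φ : L → E →+* E} (tk : ∀ r, A →ₛₗ[φ r] R) (Ψ : R →ₗ[E] E)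
    (p m k d top : ℕ) (B : ι → Module.Basis (Fin m ⊕ Fin k) E A) (nxt : L → L) (fr : L → A → A) :
    Prop where
  prime : p.Prime
  char : CharP E p
  hm : 5 ≤ m
  hk : 1 ≤ k
  hkm : k + 1 < m
  hd : d + 1 < top
  min : ∀ s : Multiset (L × A), card s < d → Ψ (tokProd tk s) = 0
  nc : ∀ i (s : Multiset (L × (Fin m ⊕ Fin k))), card s + 1 < top → (∀ x, s.count x < p) →
    Ψ (tokMon tk (B i) s) ≠ 0 → ∀ r a a', s.count (r, Sum.inl a) = s.count (r, Sum.inl a')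
  ov : ∀ r x, tk r x ^ p = tk (nxt r) (fr r x)
  span : ⊤ ≤ Submodule.span E (Set.range fun x : ι × Fin m => B x.1 (Sum.inl x.2))
  sep : ∀ v, (∀ i a, (B i).coord (Sum.inl a) v = 0) → v = 0
  sep' : ∀ i i' b, ∃ c, (B i').coord (Sum.inl c) (B i (Sum.inl b)) ≠ 0
  prop : ∀ i i' a b, ∃ b', b' ≠ a ∧ ∀ t : E, ∃ c, (B i').coord (Sum.inl c) (B i (Sum.inl b')) ≠
    t * (B i').coord (Sum.inl c) (B i (Sum.inl b))
  neq : ∀ i, ∃ i', ∃ c, ∀ t : E, ∀ a, B i' (Sum.inl c) ≠ t • B i (Sum.inl a)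

variable {E R A L ι : Type*} [Field E] [CommRing R] [Algebra E R] [AddCommGroup A]
    [Module E A] [DecidableEq L] {φ : L → E →+* E} {tk : ∀ r, A →ₛₗ[φ r] R} {Ψ : R →ₗ[E] E}
    {p m k d top : ℕ} {B : ι → Module.Basis (Fin m ⊕ Fin k) E A} {nxt : L → L} {fr : L → A → A}

namespace PolyCore

theorem lt_p (C : PolyCore tk Ψ p m k d top B nxt fr) (b : Fin m ⊕ Fin k → A)
    {s : Multiset (L × (Fin m ⊕ Fin k))}
    (hs : card s < d + p - 1) (h0 : Ψ (tokMon tk b s) ≠ 0) (x) : s.count x < p := by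
  by_contra hx
  rw [not_lt, le_count_iff_replicate_le] at hx
  obtain ⟨t, rfl⟩ := Multiset.le_iff_exists_add.1 hx
  apply h0
  have hp := C.prime.two_le
  have : tokMon tk b (replicate p x + t) =
      tokProd tk ((nxt x.1, fr x.1 (b x.2)) ::ₘ t.map fun x => (x.1, b x.2)) := by
    rw [tokProd_cons, ← tokMon_eq_tokProd, ← C.ov]
    simp [tokMon]
  rw [this]
  refine C.min _ ?_
  simp at hs ⊢
  omega

theorem const (C : PolyCore tk Ψ p m k d top B nxt fr) {i : ι}
    {s : Multiset (L × (Fin m ⊕ Fin k))}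
    (hs : card s = d) (h0 : Ψ (tokMon tk (B i) s) ≠ 0) (r a a') :
    s.count (r, Sum.inl a) = s.count (r, Sum.inl a') :=
  C.nc i s (by have := C.hd; omega)
    (C.lt_p _ (by have := C.prime.two_le; omega) h0) h0 r a a'

/-- The family of maps deforming only level `r`, via `X`. -/
def dir (tk : ∀ r, A →ₛₗ[φ r] R) (r : L) (X : A →ₗ[E] A) (r' : L) : A →ₛₗ[φ r'] R :=
  if r' = r then (tk r').comp X else 0

theorem dir_apply (r : L) (X : A →ₗ[E] A) (r' : L) (v : A) :
    dir tk r X r' v = if r' = r then tk r' (X v) else 0 := by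
  unfold dir; split_ifs <;> rfl

theorem expand (b : Module.Basis (Fin m ⊕ Fin k) E A) (r : L) (v : A)
    (t : Multiset (L × (Fin m ⊕ Fin k))) :
    Ψ (tk r v * tokMon tk b t) =
      ∑ y, φ r (b.coord y v) * Ψ (tokMon tk b ((r, y) ::ₘ t)) := by
  conv_lhs => rw [← b.sum_repr v, map_sum, Finset.sum_mul, map_sum]
  refine Finset.sum_congr rfl fun y _ => ?_
  rw [map_smulₛₗ, smul_mul_assoc, map_smul, tokMon_cons, smul_eq_mul]
  rfl

/-- The elementary diagonal derivation. -/
noncomputable def hX (b : Module.Basis (Fin m ⊕ Fin k) E A) (c c' : Fin m) : A →ₗ[E] A :=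
  (b.coord (Sum.inl c)).smulRight (b (Sum.inl c)) -
    (b.coord (Sum.inl c')).smulRight (b (Sum.inl c'))

theorem sum_hX (C : PolyCore tk Ψ p m k d top B nxt fr) (i i' : ι) {c c' : Fin m} (hc : c ≠ c')
    (r : L) (s : Multiset (L × (Fin m ⊕ Fin k))) (hs : card s = d) :
    ∑ x ∈ s.toFinset, s.count x • (if x.1 = r then
      ∑ y, φ r ((B i).coord y (hX (B i') c c' (B i x.2))) *
        Ψ (tokMon tk (B i) ((r, y) ::ₘ s.erase x)) else 0) = 0 := by
  have key := sum_deriv_eq_zero (B i') (B i) tk (dir tk r (hX (B i') c c')) Ψ (s.map Prod.fst)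
    (fun t ht => ?_) s rfl
  · rw [Finset.sum_multiset_map_count] at key
    refine Eq.trans ?_ key
    refine Finset.sum_congr rfl fun x _ => ?_
    congr 1
    rw [dir_apply]
    split_ifs with h
    · rw [h, expand]
    · rw [zero_mul]; exact (_root_.map_zero Ψ).symm
  · have hcard : card t = d := by rw [← hs, ← card_map Prod.fst t, ht, card_map]
    have : ∀ x ∈ t, Ψ (dir tk r (hX (B i') c c') x.1 (B i' x.2) * tokMon tk (B i') (t.erase x)) =
        (if x = (r, Sum.inl c) then Ψ (tokMon tk (B i') t) else 0) -
        (if x = (r, Sum.inl c') then Ψ (tokMon tk (B i') t) else 0) := by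
      rintro ⟨r', x⟩ hx
      have e : Ψ (tokMon tk (B i') t) = Ψ (tk r' (B i' x) * tokMon tk (B i') (t.erase (r', x))) := by
        conv_lhs => rw [← cons_erase hx, tokMon_cons]
      rw [dir_apply, e]
      by_cases hr : r' = r
      · subst hr
        rcases x with x | x
        · by_cases h1 : x = c
          · subst h1
            simp [hX, hc]
          · by_cases h2 : x = c'
            · subst h2
              simp [hX, h1]
            · simp [hX, h1, h2]
        · simp [hX]
      · simp [hr]
    rw [map_congr rfl this, sum_map_sub, Finset.sum_multiset_map_count,
      Finset.sum_multiset_map_count]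
    simp only [smul_ite, smul_zero, Finset.sum_ite_eq', mem_toFinset]
    by_cases h0 : Ψ (tokMon tk (B i') t) = 0
    · simp [h0]
    · have := C.const hcard h0 r c c'
      have h1 : ∀ z, (if z ∈ t then count z t • Ψ (tokMon tk (B i') t) else 0) =
          count z t • Ψ (tokMon tk (B i') t) := by
        intro z
        split_ifs with h
        · rfl
        · simp [count_eq_zero_of_notMem h]
      rw [h1, h1, this, sub_self]

end PolyCore

end Core

section Core

open Multiset

variable {E R A L ι : Type*} [Field E] [CommRing R] [Algebra E R] [AddCommGroup A]
    [Module E A] [DecidableEq L] {φ : L → E →+* E} {tk : ∀ r, A →ₛₗ[φ r] R} {Ψ : R →ₗ[E] E}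
    {p m k d top : ℕ} {B : ι → Module.Basis (Fin m ⊕ Fin k) E A} {nxt : L → L} {fr : L → A → A}

namespace PolyCore

theorem exists_avoid (hm : 5 ≤ m) (a b x y : Fin m ⊕ Fin k) :
    ∃ z : Fin m, Sum.inl z ≠ a ∧ Sum.inl z ≠ b ∧ Sum.inl z ≠ x ∧ Sum.inl z ≠ y := by
  by_contra! h
  have hsub : (Finset.univ.map ⟨Sum.inl, Sum.inl_injective⟩ : Finset (Fin m ⊕ Fin k)) ⊆
      {a, b, x, y} := by
    intro w hw
    simp only [Finset.mem_map, Finset.mem_univ, true_and, Function.Embedding.coeFn_mk] at hw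
    obtain ⟨z, rfl⟩ := hw
    simp only [Finset.mem_insert, Finset.mem_singleton]
    have := h z
    tauto
  have := (Finset.card_le_card hsub).trans Finset.card_le_four
  simp at this
  omega

theorem count_swap {T : Type*} [DecidableEq T] {s : Multiset T} {x : T} (hx : x ∈ s) (y z : T) :
    (y ::ₘ s.erase x).count z + (if z = x then 1 else 0) =
      s.count z + (if z = y then 1 else 0) := by
  conv_rhs => rw [← cons_erase hx]
  rw [count_cons, count_cons]
  omega

theorem balance (C : PolyCore tk Ψ p m k d top B nxt fr) {i : ι}
    {s : Multiset (L × (Fin m ⊕ Fin k))} (hs : card s = d) {r : L} {x : L × (Fin m ⊕ Fin k)}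
    (hx : x ∈ s) (hr : x.1 = r) {y : Fin m ⊕ Fin k}
    (h0 : Ψ (tokMon tk (B i) ((r, y) ::ₘ s.erase x)) ≠ 0) :
    ∃ j', ∀ z : Fin m, j' + (if Sum.inl z = x.2 then 1 else 0) =
      s.count (r, Sum.inl z) + (if Sum.inl z = y then 1 else 0) := by
  have hcard : card ((r, y) ::ₘ s.erase x) = d := by
    rw [card_cons, card_erase_of_mem hx]
    have : 0 < card s := card_pos_iff_exists_mem.2 ⟨x, hx⟩
    simp only [Nat.pred_eq_sub_one]
    omega
  have hm := C.hm
  refine ⟨count (r, Sum.inl ⟨0, by omega⟩) ((r, y) ::ₘ s.erase x), fun z => ?_⟩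
  rw [C.const hcard h0 r _ z]
  have := count_swap hx (r, y) (r, Sum.inl z)
  obtain ⟨x1, x2⟩ := x
  subst hr
  simpa using this

theorem cast_ne_zero (C : PolyCore tk Ψ p m k d top B nxt fr) {j : ℕ} (h1 : 0 < j) (h2 : j < p) :
    (j : E) ≠ 0 := by
  have := C.char
  rw [Ne, CharP.cast_eq_zero_iff E p]
  exact Nat.not_dvd_of_pos_of_lt h1 h2

theorem kappa (C : PolyCore tk Ψ p m k d top B nxt fr) {i : ι}
    {α : Multiset (L × (Fin m ⊕ Fin k))} (hα : card α = d) (h0 : Ψ (tokMon tk (B i) α) ≠ 0)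
    {r : L} {j : ℕ} (hj : ∀ z, α.count (r, Sum.inl z) = j) (hj0 : 0 < j) (hjp : j + 1 < p)
    (i' : ι) {c c' : Fin m} (hc : c ≠ c') {a b : Fin m} (hab : a ≠ b) :
    (B i).coord (Sum.inl a) (hX (B i') c c' (B i (Sum.inl b))) = 0 := by
  have hm := C.hm
  have haα : (r, Sum.inl a) ∈ α := by rw [← count_pos, hj]; exact hj0
  set s := (r, Sum.inl b) ::ₘ α.erase (r, Sum.inl a) with hsdef
  have hs : card s = d := by
    rw [hsdef, card_cons, card_erase_of_mem haα]
    have : 0 < card α := card_pos_iff_exists_mem.2 ⟨_, haα⟩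
    simp only [Nat.pred_eq_sub_one]
    omega
  have hcnt : ∀ z, s.count (r, Sum.inl z) + (if z = a then 1 else 0) =
      j + (if z = b then 1 else 0) := by
    intro z
    have := count_swap haα (r, Sum.inl b) (r, Sum.inl z)
    rw [hj] at this
    simpa using this
  have hbs : (r, Sum.inl b) ∈ s := mem_cons_self _ _
  have hback : (r, Sum.inl a) ::ₘ s.erase (r, Sum.inl b) = α := by
    rw [hsdef, erase_cons_head, cons_erase haα]
  have key := C.sum_hX i i' hc r s hs
  have hzero : ∀ x ∈ s, x.1 = r → ∀ y, ¬ (x.2 = Sum.inl b ∧ y = Sum.inl a) →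
      Ψ (tokMon tk (B i) ((r, y) ::ₘ s.erase x)) = 0 := by
    intro x hx hr y hxy
    by_contra hne
    obtain ⟨j', hj'⟩ := C.balance hs hx hr hne
    obtain ⟨z, h1, h2, h3, h4⟩ := exists_avoid hm (Sum.inl a) (Sum.inl b) x.2 y
    have e0 := hj' z
    have e1 := hcnt z
    simp only [Sum.inl.injEq, ne_eq] at h1 h2
    rw [if_neg h3, if_neg h4] at e0
    rw [if_neg h1, if_neg h2] at e1
    have ea := hj' a
    have ea' := hcnt a
    have eb := hj' b
    have eb' := hcnt b
    rw [if_pos rfl, if_neg hab] at ea'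
    rw [if_pos rfl, if_neg hab.symm] at eb'
    apply hxy
    constructor
    · by_contra hb
      rw [if_neg (show ¬ Sum.inl b = x.2 from fun h => hb h.symm)] at eb
      split_ifs at eb <;> omega
    · by_contra ha
      rw [if_neg (show ¬ Sum.inl a = y from fun h => ha h.symm)] at ea
      split_ifs at ea <;> omega
  rw [Finset.sum_eq_single (r, Sum.inl b)] at key
  · rw [if_pos rfl, Finset.sum_eq_single (Sum.inl a), hback] at key
    · have hcb : s.count (r, Sum.inl b) = j + 1 := by
        have := hcnt b
        rw [if_pos rfl, if_neg hab.symm] at this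
        omega
      rw [hcb, nsmul_eq_mul] at key
      have := C.cast_ne_zero (Nat.succ_pos j) hjp
      rw [mul_eq_zero, mul_eq_zero] at key
      rcases key with h | h | h
      · exact absurd h this
      · exact (map_eq_zero _).1 h
      · exact absurd h h0
    · intro y _ hy
      rw [hzero _ hbs rfl y (fun h => hy h.2), mul_zero]
    · simp
  · rintro ⟨r', x⟩ hx hne
    rw [mem_toFinset] at hx
    split_ifs with hr
    · dsimp only at hr
      subst hr
      rw [Finset.sum_eq_zero, smul_zero]
      intro y _
      rw [hzero _ hx rfl y (fun h => hne (by rw [← h.1])), mul_zero]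
    · exact smul_zero _
  · intro h
    exact absurd (mem_toFinset.2 hbs) h

end PolyCore

end Core

section Core

open Multiset

variable {E R A L ι : Type*} [Field E] [CommRing R] [Algebra E R] [AddCommGroup A]
    [Module E A] [DecidableEq L] {φ : L → E →+* E} {tk : ∀ r, A →ₛₗ[φ r] R} {Ψ : R →ₗ[E] E}
    {p m k d top : ℕ} {B : ι → Module.Basis (Fin m ⊕ Fin k) E A} {nxt : L → L} {fr : L → A → A}

namespace PolyCore

theorem sum_inr_eq_zero (C : PolyCore tk Ψ p m k d top B nxt fr) {i : ι}
    {r : L} {j : ℕ} (hjp : j + 1 < p) (i' : ι) {c c' : Fin m} (hc : c ≠ c') (a : Fin m)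
    {t : Multiset (L × (Fin m ⊕ Fin k))} (ht : card t + 1 = d)
    (hj : ∀ z, t.count (r, Sum.inl z) = j) :
    ∑ b, φ r ((B i).coord (Sum.inr b) (hX (B i') c c' (B i (Sum.inl a)))) *
      Ψ (tokMon tk (B i) ((r, Sum.inr b) ::ₘ t)) = 0 := by
  have hm := C.hm
  set s := (r, Sum.inl a) ::ₘ t with hsdef
  have hs : card s = d := by rw [hsdef, card_cons, ht]
  have has : (r, Sum.inl a) ∈ s := mem_cons_self _ _
  have hback : s.erase (r, Sum.inl a) = t := by rw [hsdef, erase_cons_head]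
  have hcnt : ∀ z, s.count (r, Sum.inl z) = j + (if z = a then 1 else 0) := by
    intro z
    rw [hsdef, count_cons, hj]
    simp
  have key := C.sum_hX i i' hc r s hs
  have hzero : ∀ x ∈ s, x.1 = r → ∀ y, ¬ (x.2 = Sum.inl a ∧ ∃ b, y = Sum.inr b) →
      Ψ (tokMon tk (B i) ((r, y) ::ₘ s.erase x)) = 0 := by
    intro x hx hr y hxy
    by_contra hne
    obtain ⟨j', hj'⟩ := C.balance hs hx hr hne
    obtain ⟨z, h1, -, h3, h4⟩ := exists_avoid hm (Sum.inl a) (Sum.inl a) x.2 y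
    have e0 := hj' z
    have e1 := hcnt z
    simp only [Sum.inl.injEq, ne_eq] at h1
    rw [if_neg h3, if_neg h4] at e0
    rw [if_neg h1] at e1
    have ea := hj' a
    have ea' := hcnt a
    rw [if_pos rfl] at ea'
    have hxa : x.2 = Sum.inl a := by
      by_contra hb
      rw [if_neg (show ¬ Sum.inl a = x.2 from fun h => hb h.symm)] at ea
      split_ifs at ea <;> omega
    refine hxy ⟨hxa, ?_⟩
    rcases y with y | y
    · exfalso
      have ey := hj' y
      have ey' := hcnt y
      rw [hxa] at ey
      simp only [Sum.inl.injEq, if_true] at ey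
      split_ifs at ey ey' <;> omega
    · exact ⟨y, rfl⟩
  rw [Finset.sum_eq_single (r, Sum.inl a)] at key
  · rw [if_pos rfl, hback, Fintype.sum_sum_type, hcnt, if_pos rfl, nsmul_eq_mul, mul_eq_zero] at key
    have := C.cast_ne_zero (Nat.succ_pos j) hjp
    rcases key with h | h
    · exact absurd h this
    · rw [Finset.sum_eq_zero, zero_add] at h
      · exact h
      · intro y _
        have := hzero _ has rfl (Sum.inl y) (by simp)
        rw [hback] at this
        rw [this, mul_zero]
  · rintro ⟨r', x⟩ hx hne
    rw [mem_toFinset] at hx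
    split_ifs with hr
    · dsimp only at hr
      subst hr
      rw [Finset.sum_eq_zero, smul_zero]
      intro y _
      rw [hzero _ hx rfl y (fun h => hne (by rw [← h.1])), mul_zero]
    · exact smul_zero _
  · intro h
    exact absurd (mem_toFinset.2 has) h

theorem sum_inr_eq_zero' (C : PolyCore tk Ψ p m k d top B nxt fr) {i : ι}
    {r : L} {j : ℕ} (hj0 : 0 < j) (i' : ι) {c c' : Fin m} (hc : c ≠ c') (a : Fin m)
    {t : Multiset (L × (Fin m ⊕ Fin k))} (ht : card t = d + 1)
    (hj : ∀ z, t.count (r, Sum.inl z) = j) :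
    ∑ b, t.count (r, Sum.inr b) •
      (φ r ((B i).coord (Sum.inl a) (hX (B i') c c' (B i (Sum.inr b)))) *
        Ψ (tokMon tk (B i) (t.erase (r, Sum.inr b)))) = 0 := by
  have hm := C.hm
  have hat : (r, Sum.inl a) ∈ t := by rw [← count_pos, hj]; exact hj0
  set s := t.erase (r, Sum.inl a) with hsdef
  have hst : (r, Sum.inl a) ::ₘ s = t := cons_erase hat
  have hs : card s = d := by
    have := congrArg card hst
    rw [card_cons] at this
    omega
  have hcnt : ∀ z, s.count (r, Sum.inl z) + (if z = a then 1 else 0) = j := by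
    intro z
    rw [← hj z, ← hst, count_cons]
    simp
  have hcnt' : ∀ b, s.count (r, Sum.inr b) = t.count (r, Sum.inr b) := by
    intro b
    rw [← hst, count_cons]
    simp
  have key := C.sum_hX i i' hc r s hs
  have hzero : ∀ x ∈ s, x.1 = r → ∀ y, ¬ ((∃ b, x.2 = Sum.inr b) ∧ y = Sum.inl a) →
      Ψ (tokMon tk (B i) ((r, y) ::ₘ s.erase x)) = 0 := by
    intro x hx hr y hxy
    by_contra hne
    obtain ⟨j', hj'⟩ := C.balance hs hx hr hne
    obtain ⟨z, h1, -, h3, h4⟩ := exists_avoid hm (Sum.inl a) (Sum.inl a) x.2 y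
    have e0 := hj' z
    have e1 := hcnt z
    simp only [Sum.inl.injEq, ne_eq] at h1
    rw [if_neg h3, if_neg h4] at e0
    rw [if_neg h1] at e1
    have ea := hj' a
    have ea' := hcnt a
    rw [if_pos rfl] at ea'
    have hya : y = Sum.inl a := by
      by_contra hb
      rw [if_neg (show ¬ Sum.inl a = y from fun h => hb h.symm)] at ea
      split_ifs at ea <;> omega
    refine hxy ⟨?_, hya⟩
    rcases hx2 : x.2 with w | w
    · exfalso
      have ey := hj' w
      have ey' := hcnt w
      rw [hya, hx2] at ey
      simp only [Sum.inl.injEq, if_true] at ey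
      split_ifs at ey ey' <;> omega
    · exact ⟨w, rfl⟩
  refine Eq.trans ?_ key
  refine (Finset.sum_map Finset.univ ⟨fun b : Fin k => ((r, Sum.inr b) : L × (Fin m ⊕ Fin k)),
    fun b b' h => by simpa using h⟩ (fun x => t.count x •
      (φ r ((B i).coord (Sum.inl a) (hX (B i') c c' (B i x.2))) *
        Ψ (tokMon tk (B i) (t.erase x))))).symm.trans ?_
  refine Finset.sum_congr_of_eq_on_inter ?_ ?_ ?_
  · intro x hx hxs
    simp only [Finset.mem_map, Finset.mem_univ, true_and] at hx
    obtain ⟨b, rfl⟩ := hx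
    change (r, Sum.inr b) ∉ s.toFinset at hxs
    change t.count (r, Sum.inr b) • _ = 0
    rw [mem_toFinset, ← count_eq_zero, hcnt'] at hxs
    rw [hxs, zero_smul]
  · rintro ⟨r', x⟩ hx hxs
    rw [mem_toFinset] at hx
    split_ifs with hr
    · dsimp only at hr
      subst hr
      rw [Finset.sum_eq_zero, smul_zero]
      intro y _
      rw [hzero _ hx rfl y, mul_zero]
      rintro ⟨⟨b, hb⟩, -⟩
      apply hxs
      dsimp only at hb
      rw [hb]
      exact Finset.mem_map.2 ⟨b, Finset.mem_univ _, rfl⟩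
    · exact smul_zero _
  · intro x hx hxs
    simp only [Finset.mem_map, Finset.mem_univ, true_and] at hx
    obtain ⟨b, rfl⟩ := hx
    change (r, Sum.inr b) ∈ s.toFinset at hxs
    change t.count (r, Sum.inr b) • (φ r ((B i).coord (Sum.inl a)
      (hX (B i') c c' (B i (Sum.inr b)))) * Ψ (tokMon tk (B i) (t.erase (r, Sum.inr b)))) =
      s.count (r, Sum.inr b) • (if r = r then
      ∑ y, φ r ((B i).coord y (hX (B i') c c' (B i (Sum.inr b)))) *
        Ψ (tokMon tk (B i) ((r, y) ::ₘ s.erase (r, Sum.inr b))) else 0)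
    rw [mem_toFinset] at hxs
    rw [hcnt', if_pos rfl, Finset.sum_eq_single (Sum.inl a)]
    · congr 4
      rw [← hst, erase_cons_tail]
      simp
    · intro y _ hy
      rw [hzero _ hxs rfl y (fun h => hy h.2), mul_zero]
    · simp

theorem coord_hX (b b' : Module.Basis (Fin m ⊕ Fin k) E A) (c c' : Fin m) (v : A) (y) :
    b.coord y (hX b' c c' v) = b'.coord (Sum.inl c) v * b.coord y (b' (Sum.inl c)) -
      b'.coord (Sum.inl c') v * b.coord y (b' (Sum.inl c')) := by
  simp [hX]

/-- Constant digits are extreme. -/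
theorem no_middle (C : PolyCore tk Ψ p m k d top B nxt fr) {i : ι}
    {α : Multiset (L × (Fin m ⊕ Fin k))} (hα : card α = d) (h0 : Ψ (tokMon tk (B i) α) ≠ 0)
    {r : L} {j : ℕ} (hj : ∀ z, α.count (r, Sum.inl z) = j) (hj0 : 0 < j) (hjp : j + 1 < p) :
    False := by
  have hm := C.hm
  have : Nontrivial (Fin m) := Fin.nontrivial_iff_two_le.2 (by omega)
  have kap : ∀ i' {a b : Fin m}, a ≠ b → ∀ c c', (B i').coord (Sum.inl c) (B i (Sum.inl b)) *
      (B i).coord (Sum.inl a) (B i' (Sum.inl c)) = (B i').coord (Sum.inl c') (B i (Sum.inl b)) *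
      (B i).coord (Sum.inl a) (B i' (Sum.inl c')) := by
    intro i' a b hab c c'
    by_cases hc : c = c'
    · rw [hc]
    · have := C.kappa hα h0 hj hj0 hjp i' hc hab
      rwa [coord_hX, sub_eq_zero] at this
  have kap0 : ∀ i' {a b : Fin m}, a ≠ b → ∀ c, (B i').coord (Sum.inl c) (B i (Sum.inl b)) *
      (B i).coord (Sum.inl a) (B i' (Sum.inl c)) = 0 := by
    intro i' a b hab c
    by_contra hne
    obtain ⟨b', hb', H⟩ := C.prop i i' a b
    obtain ⟨c', hc'⟩ := H ((B i').coord (Sum.inl c) (B i (Sum.inl b')) /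
      (B i').coord (Sum.inl c) (B i (Sum.inl b)))
    apply hc'
    have e1 := kap i' hab c c'
    have e2 := kap i' hb'.symm c c'
    have n1 := left_ne_zero_of_mul hne
    have n2 : (B i).coord (Sum.inl a) (B i' (Sum.inl c')) ≠ 0 := by
      rw [e1] at hne; exact right_ne_zero_of_mul hne
    have n3 := right_ne_zero_of_mul hne
    rw [div_mul_eq_mul_div, eq_div_iff n1]
    apply mul_right_cancel₀ (mul_ne_zero n2 n3)
    linear_combination (B i').coord (Sum.inl c) (B i (Sum.inl b)) *
      (B i).coord (Sum.inl a) (B i' (Sum.inl c)) * (-e2) +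
      (B i').coord (Sum.inl c) (B i (Sum.inl b')) *
      (B i).coord (Sum.inl a) (B i' (Sum.inl c)) * e1
  obtain ⟨i1, c1, hc1⟩ := C.neq i
  have mat : ∀ i', ∃ f : Fin m → Fin m, Function.Bijective f ∧
      (∀ b, (B i').coord (Sum.inl (f b)) (B i (Sum.inl b)) ≠ 0) ∧
      (∀ b, (B i).coord (Sum.inl b) (B i' (Sum.inl (f b))) ≠ 0) ∧
      (∀ b b', b ≠ b' → (B i').coord (Sum.inl (f b')) (B i (Sum.inl b)) = 0) ∧
      (∀ b b', b ≠ b' → (B i).coord (Sum.inl b) (B i' (Sum.inl (f b'))) = 0) := by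
    intro i'
    choose f hf using C.sep' i i'
    have z1 : ∀ b b', b ≠ b' → (B i).coord (Sum.inl b) (B i' (Sum.inl (f b'))) = 0 := by
      intro b b' hb
      exact (mul_eq_zero.1 (kap0 i' hb (f b'))).resolve_left (hf b')
    have n1 : ∀ b, (B i).coord (Sum.inl b) (B i' (Sum.inl (f b))) ≠ 0 := by
      intro b
      obtain ⟨b2, hb2⟩ := C.sep' i' i (f b)
      by_cases h : b2 = b
      · rwa [h] at hb2
      · exact absurd (z1 b2 b h) hb2
    have z2 : ∀ b b', b ≠ b' → (B i').coord (Sum.inl (f b')) (B i (Sum.inl b)) = 0 := by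
      intro b b' hb
      exact (mul_eq_zero.1 (kap0 i' hb.symm (f b'))).resolve_right (n1 b')
    refine ⟨f, Finite.injective_iff_bijective.1 fun b b' h => ?_, hf, n1, z2, z1⟩
    by_contra hb
    have := z2 b b' hb
    rw [← h] at this
    exact hf b this
  obtain ⟨f, hf, n1, n2, z1, z2⟩ := mat i1
  obtain ⟨b1, rfl⟩ := hf.2 c1
  obtain ⟨b2, hb2⟩ : ∃ b2 : Fin m, b2 ≠ b1 := exists_ne b1
  set η : Fin k → E := fun b => (B i).coord (Sum.inr b) (B i1 (Sum.inl (f b1))) with hη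
  have D2 : ∀ t : Multiset (L × (Fin m ⊕ Fin k)), card t + 1 = d →
      (∀ z, t.count (r, Sum.inl z) = j) →
      ∑ b, φ r (η b) * Ψ (tokMon tk (B i) ((r, Sum.inr b) ::ₘ t)) = 0 := by
    intro t ht htj
    have := C.sum_inr_eq_zero (i := i) hjp i1 (hf.1.ne hb2).symm b1 ht htj
    simp only [coord_hX, z1 b1 b2 hb2.symm, zero_mul, sub_zero, map_mul, mul_assoc] at this
    rw [← Finset.mul_sum] at this
    exact (mul_eq_zero.1 this).resolve_left ((map_ne_zero _).2 (n1 b1))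
  have D3 : ∀ i'' c, ∀ t : Multiset (L × (Fin m ⊕ Fin k)), card t = d + 1 →
      (∀ z, t.count (r, Sum.inl z) = j) →
      ∑ b, t.count (r, Sum.inr b) • (φ r ((B i'').coord (Sum.inl c) (B i (Sum.inr b))) *
        Ψ (tokMon tk (B i) (t.erase (r, Sum.inr b)))) = 0 := by
    intro i'' c t ht htj
    obtain ⟨f', hf', n1', n2', z1', z2'⟩ := mat i''
    obtain ⟨b3, rfl⟩ := hf'.2 c
    obtain ⟨b4, hb4⟩ : ∃ b4 : Fin m, b4 ≠ b3 := exists_ne b3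
    have := C.sum_inr_eq_zero' (i := i) hj0 i'' (hf'.1.ne hb4).symm b3 ht htj
    simp only [coord_hX, z2' b3 b4 hb4.symm, mul_zero, sub_zero, map_mul, mul_assoc] at this
    have e : ∀ b, t.count (r, Sum.inr b) • (φ r ((B i'').coord (Sum.inl (f' b3)) (B i (Sum.inr b))) *
        (φ r ((B i).coord (Sum.inl b3) (B i'' (Sum.inl (f' b3)))) *
        Ψ (tokMon tk (B i) (t.erase (r, Sum.inr b))))) =
        φ r ((B i).coord (Sum.inl b3) (B i'' (Sum.inl (f' b3)))) * (t.count (r, Sum.inr b) •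
        (φ r ((B i'').coord (Sum.inl (f' b3)) (B i (Sum.inr b))) *
        Ψ (tokMon tk (B i) (t.erase (r, Sum.inr b))))) := by
      intro b
      simp only [nsmul_eq_mul]
      ring
    simp only [e] at this
    rw [← Finset.mul_sum] at this
    exact (mul_eq_zero.1 this).resolve_left ((map_ne_zero _).2 (n2' b3))
  have hfin : ∀ i'' c, (B i'').coord (Sum.inl c) (∑ b, η b • B i (Sum.inr b)) = 0 := by
    intro i'' c
    set ε := (B i'').coord (Sum.inl c) with hε
    have e1 : ∀ b, φ r (η b) * (φ r (ε (B i (Sum.inr b))) * Ψ (tokMon tk (B i) α)) +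
        ∑ b', α.count (r, Sum.inr b') • (φ r (ε (B i (Sum.inr b'))) *
          (φ r (η b) * Ψ (tokMon tk (B i) ((r, Sum.inr b) ::ₘ α.erase (r, Sum.inr b'))))) = 0 := by
      intro b
      have := D3 i'' c ((r, Sum.inr b) ::ₘ α) (by simp [hα]) (fun z => by simp [hj])
      have e2 : ∀ b', ((r, Sum.inr b) ::ₘ α).count (r, Sum.inr b') •
          (φ r (ε (B i (Sum.inr b'))) *
            Ψ (tokMon tk (B i) (((r, Sum.inr b) ::ₘ α).erase (r, Sum.inr b')))) =
          (if b' = b then φ r (ε (B i (Sum.inr b'))) * Ψ (tokMon tk (B i) α) else 0) +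
          α.count (r, Sum.inr b') • (φ r (ε (B i (Sum.inr b'))) *
            Ψ (tokMon tk (B i) ((r, Sum.inr b) ::ₘ α.erase (r, Sum.inr b')))) := by
        intro b'
        rw [count_cons]
        by_cases hb : b' = b
        · subst hb
          rw [erase_cons_head]
          by_cases hmem : (r, Sum.inr b') ∈ α
          · rw [cons_erase hmem]
            simp only [if_true, nsmul_eq_mul]
            push_cast
            ring
          · rw [count_eq_zero_of_notMem hmem]
            simp
        · rw [erase_cons_tail _ (by simpa using Ne.symm hb)]
          simp [hb]
      replace this := (Finset.sum_congr rfl fun b' _ => e2 b').symm.trans this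
      rw [Finset.sum_add_distrib, Finset.sum_ite_eq' Finset.univ b, if_pos (Finset.mem_univ _)] at this
      rw [← mul_zero (φ r (η b)), ← this, mul_add, Finset.mul_sum]
      congr 1
      refine Finset.sum_congr rfl fun b' _ => ?_
      simp only [nsmul_eq_mul]
      ring
    have e3 := Finset.sum_eq_zero fun b (_ : b ∈ Finset.univ) => e1 b
    rw [Finset.sum_add_distrib, Finset.sum_comm] at e3
    have e4 : ∀ b', ∑ b, α.count (r, Sum.inr b') • (φ r (ε (B i (Sum.inr b'))) *
          (φ r (η b) * Ψ (tokMon tk (B i) ((r, Sum.inr b) ::ₘ α.erase (r, Sum.inr b'))))) = 0 := by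
      intro b'
      by_cases hmem : (r, Sum.inr b') ∈ α
      · rw [← Finset.smul_sum, ← Finset.mul_sum, D2, mul_zero, smul_zero]
        · rw [← hα, card_erase_add_one hmem]
        · intro z
          rw [count_erase_of_ne (by simp), hj]
      · rw [count_eq_zero_of_notMem hmem]
        simp
    have e5 : ∑ b, φ r (η b * ε (B i (Sum.inr b))) * Ψ (tokMon tk (B i) α) = 0 := by
      rw [Finset.sum_eq_zero fun b' _ => e4 b', add_zero] at e3
      rw [← e3]
      refine Finset.sum_congr rfl fun b _ => ?_
      rw [_root_.map_mul, mul_assoc]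
    rw [← Finset.sum_mul, mul_eq_zero, ← map_sum] at e5
    have := (map_eq_zero _).1 (e5.resolve_right h0)
    rw [map_sum]
    simpa using this
  have hz := C.sep _ hfin
  refine hc1 ((B i).coord (Sum.inl b1) (B i1 (Sum.inl (f b1)))) b1 ?_
  conv_lhs => rw [← (B i).sum_repr (B i1 (Sum.inl (f b1)))]
  rw [Fintype.sum_sum_type]
  have : ∑ b, (B i).repr (B i1 (Sum.inl (f b1))) (Sum.inr b) • B i (Sum.inr b) = 0 := hz
  rw [this, add_zero, Finset.sum_eq_single b1]
  · rfl
  · intro b _ hb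
    have := z2 b b1 hb
    rw [Module.Basis.coord_apply] at this
    rw [this, zero_smul]
  · simp

end PolyCore

end Core

section Core

open Multiset

variable {E R A L ι : Type*} [Field E] [CommRing R] [Algebra E R] [AddCommGroup A]
    [Module E A] [DecidableEq L] {φ : L → E →+* E} {tk : ∀ r, A →ₛₗ[φ r] R} {Ψ : R →ₗ[E] E}
    {p m k d top : ℕ} {B : ι → Module.Basis (Fin m ⊕ Fin k) E A} {nxt : L → L} {fr : L → A → A}

namespace PolyCore

theorem count_map_fst {J : Type*} [Fintype J] [DecidableEq J] (s : Multiset (L × J)) (r : L) :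
    (s.map Prod.fst).count r = ∑ x, s.count (r, x) := by
  induction s using Multiset.induction_on with
  | empty => simp
  | cons y s ih =>
    obtain ⟨y1, y2⟩ := y
    rw [map_cons, count_cons, ih]
    simp only [count_cons, Prod.mk.injEq, Finset.sum_add_distrib]
    congr 1
    by_cases h : r = y1 <;> simp [h]

theorem exists_mon (b : Module.Basis (Fin m ⊕ Fin k) E A) {s : Multiset (L × A)}
    (h : Ψ (tokProd tk s) ≠ 0) : ∃ t : Multiset (L × (Fin m ⊕ Fin k)),
    t.map Prod.fst = s.map Prod.fst ∧ Ψ (tokMon tk b t) ≠ 0 := by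
  by_contra! H
  exact h (tokProd_ext b tk s Ψ H)

theorem digit (C : PolyCore tk Ψ p m k d top B nxt fr) {i : ι}
    {s : Multiset (L × (Fin m ⊕ Fin k))} (hs : card s = d) (h0 : Ψ (tokMon tk (B i) s) ≠ 0)
    (r : L) : (∀ a, s.count (r, Sum.inl a) = 0) ∨ (∀ a, s.count (r, Sum.inl a) = p - 1) := by
  have hm := C.hm
  have hp := C.prime.two_le
  set a0 : Fin m := ⟨0, by omega⟩
  have hj : ∀ z, s.count (r, Sum.inl z) = s.count (r, Sum.inl a0) := fun z =>
    C.const hs h0 r z a0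
  have hlt := C.lt_p (B i) (by omega) h0 (r, Sum.inl a0)
  by_cases h1 : s.count (r, Sum.inl a0) = 0
  · exact Or.inl fun a => (hj a).trans h1
  · right
    intro a
    rw [hj a]
    by_contra h2
    exact C.no_middle hs h0 hj (by omega) (by omega)

theorem digit_zero_iff (C : PolyCore tk Ψ p m k d top B nxt fr) {i : ι}
    {s : Multiset (L × (Fin m ⊕ Fin k))} (hs : card s = d) (h0 : Ψ (tokMon tk (B i) s) ≠ 0)
    (r : L) (a : Fin m) :
    s.count (r, Sum.inl a) = 0 ↔ (s.map Prod.fst).count r < m * (p - 1) := by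
  have hm := C.hm
  have hp := C.prime.two_le
  rw [count_map_fst, Fintype.sum_sum_type]
  rcases C.digit hs h0 r with h | h
  · simp only [h, true_iff, Finset.sum_const_zero, zero_add]
    calc ∑ b, s.count (r, Sum.inr b) ≤ ∑ _b : Fin k, (p - 1) := Finset.sum_le_sum fun b _ => by
          have := C.lt_p (B i) (by omega) h0 (r, Sum.inr b); omega
      _ = k * (p - 1) := by simp
      _ < m * (p - 1) := Nat.mul_lt_mul_of_pos_right (by have := C.hkm; omega) (by omega)
  · simp only [h, Finset.sum_const, Finset.card_univ, Fintype.card_fin, smul_eq_mul]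
    omega

theorem zero_of_digit_zero (C : PolyCore tk Ψ p m k d top B nxt fr) {s : Multiset (L × A)}
    (hs : card s = d) (h0 : Ψ (tokProd tk s) ≠ 0) (r : L)
    (hr : (s.map Prod.fst).count r < m * (p - 1)) : (s.map Prod.fst).count r = 0 := by
  by_contra hne
  have hmem : r ∈ s.map Prod.fst := by
    rw [← count_pos]; omega
  obtain ⟨⟨r', v⟩, hx, rfl⟩ := mem_map.1 hmem
  obtain ⟨s', rfl⟩ := exists_cons_of_mem hx
  have all : ∀ w, Ψ (tk r' w * tokProd tk s') = 0 := by
    intro w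
    have hw : w ∈ Submodule.span E (Set.range fun x : ι × Fin m => B x.1 (Sum.inl x.2)) :=
      C.span trivial
    induction hw using Submodule.span_induction with
    | mem w hw =>
      obtain ⟨⟨i, a⟩, rfl⟩ := hw
      refine tokProd_ext (B i) tk s' (Ψ ∘ₗ LinearMap.mulLeft E (tk r' (B i (Sum.inl a)))) ?_
      intro t ht
      change Ψ (tk r' (B i (Sum.inl a)) * tokMon tk (B i) t) = 0
      rw [← tokMon_cons tk (B i) (r', Sum.inl a) t]
      by_contra h1
      have hcard : card ((r', Sum.inl a) ::ₘ t) = d := by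
        rw [← hs, card_cons, card_cons, ← card_map Prod.fst t, ht, card_map]
      have := (C.digit_zero_iff hcard h1 r' a).2 (by rw [map_cons, ht, ← map_cons Prod.fst (r', v)]; exact hr)
      simp at this
    | zero => rw [_root_.map_zero, zero_mul]; exact _root_.map_zero Ψ
    | add x y _ _ hx hy => rw [_root_.map_add, add_mul, _root_.map_add, hx, hy, add_zero]
    | smul c x _ hx => rw [map_smulₛₗ, smul_mul_assoc, map_smul, hx, smul_zero]
  exact h0 (by rw [tokProd_cons]; exact all v)

/-- The family of maps replacing a token at level `r` by a constant. -/
def cst (R : Type*) [CommRing R] [Algebra E R] (φ : L → E →+* E) (r : L) (X : A →ₗ[E] E) (r' : L) :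
    A →ₛₗ[φ r'] R where
  toFun v := if r' = r then φ r' (X v) • (1 : R) else 0
  map_add' v w := by split_ifs <;> simp [add_smul]
  map_smul' c v := by split_ifs <;> simp [mul_smul]

theorem sum_cst (C : PolyCore tk Ψ p m k d top B nxt fr) (b : Module.Basis (Fin m ⊕ Fin k) E A)
    (i : ι) (a : Fin m) (r : L) (t : Multiset (L × (Fin m ⊕ Fin k))) (ht : card t = d + 1)
    (hr : m * (p - 1) ≤ (t.map Prod.fst).count r - 1) :
    ∑ y, φ r ((B i).coord (Sum.inl a) (b y)) *
      (t.count (r, y) * Ψ (tokMon tk b (t.erase (r, y)))) = 0 := by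
  have hm := C.hm
  have hp := C.prime.two_le
  have := C.char
  have key := sum_deriv_eq_zero (B i) b tk (cst R φ r ((B i).coord (Sum.inl a))) Ψ (t.map Prod.fst)
    (fun s hs => ?_) t rfl
  · refine Eq.trans ?_ key
    rw [Finset.sum_multiset_map_count]
    refine (Finset.sum_map Finset.univ ⟨fun y => ((r, y) : L × (Fin m ⊕ Fin k)),
      fun b b' h => by simpa using h⟩ (fun x => φ r ((B i).coord (Sum.inl a) (b x.2)) *
      (t.count x * Ψ (tokMon tk b (t.erase x))))).symm.trans ?_
    refine Finset.sum_congr_of_eq_on_inter ?_ ?_ ?_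
    · intro x hx hxs
      rw [mem_toFinset, ← count_eq_zero] at hxs
      rw [hxs]
      simp
    · rintro ⟨r', x⟩ hx hxs
      have : r' ≠ r := by
        rintro rfl
        exact hxs (Finset.mem_map.2 ⟨x, Finset.mem_univ _, rfl⟩)
      simp [cst, this]
    · intro x hx hxs
      obtain ⟨y, -, rfl⟩ := Finset.mem_map.1 hx
      change φ r ((B i).coord (Sum.inl a) (b y)) *
        (t.count (r, y) * Ψ (tokMon tk b (t.erase (r, y)))) = t.count (r, y) •
        Ψ (cst R φ r ((B i).coord (Sum.inl a)) r (b y) * tokMon tk b (t.erase (r, y)))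
      have : cst R φ r ((B i).coord (Sum.inl a)) r (b y) =
          φ r ((B i).coord (Sum.inl a) (b y)) • (1 : R) := by simp [cst]
      rw [this, smul_mul_assoc, one_mul, map_smul, smul_eq_mul, nsmul_eq_mul]
      ring
  · rw [Finset.sum_multiset_map_count]
    refine Finset.sum_eq_zero fun x hx => ?_
    rw [mem_toFinset] at hx
    obtain ⟨r', x⟩ := x
    by_cases hrx : (r', x) = (r, Sum.inl a)
    · simp only [Prod.mk.injEq] at hrx
      obtain ⟨rfl, rfl⟩ := hrx
      by_cases h0 : Ψ (tokMon tk (B i) (s.erase (r', Sum.inl a))) = 0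
      · simp [cst, h0]
      · have hcs : card s = d + 1 := by rw [← ht, ← card_map Prod.fst s, hs, card_map]
        have hcard : card (s.erase (r', Sum.inl a)) = d := by
          rw [card_erase_of_mem hx, hcs]; rfl
        have h1 := C.digit_zero_iff hcard h0 r' a
        have h2 : ((s.erase (r', Sum.inl a)).map Prod.fst).count r' + 1 =
            (t.map Prod.fst).count r' := by
          rw [← hs]
          conv_rhs => rw [← cons_erase hx]
          simp
        have h3 : ¬ s.count (r', Sum.inl a) - 1 = 0 := by
          rw [← count_erase_self, h1]; omega
        have h4 : s.count (r', Sum.inl a) = p := by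
          rcases C.digit hcard h0 r' with h | h
          · have := h a
            rw [count_erase_self] at this
            omega
          · have := h a
            rw [count_erase_self] at this
            omega
        rw [h4, nsmul_eq_mul, CharP.cast_eq_zero, zero_mul]
    · by_cases hr' : r' = r
      · subst hr'
        have : x ≠ Sum.inl a := fun h => hrx (by rw [h])
        simp [cst, Finsupp.single_apply, this]
      · simp [cst, hr']

theorem full [Finite E] (C : PolyCore tk Ψ p m k d top B nxt fr) {i : ι}
    {s : Multiset (L × (Fin m ⊕ Fin k))} (hs : card s = d) (h0 : Ψ (tokMon tk (B i) s) ≠ 0)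
    (r : L) (hr : m * (p - 1) ≤ (s.map Prod.fst).count r) (y) : s.count (r, y) = p - 1 := by
  have hp := C.prime.two_le
  have := C.char
  set t := (r, y) ::ₘ s with ht
  have hsurj : Function.Surjective (φ r) := Finite.surjective_of_injective (φ r).injective
  choose g hg using hsurj
  set v := ∑ z, g (t.count (r, z) * Ψ (tokMon tk (B i) (t.erase (r, z)))) • B i z with hv
  have hv0 : v = 0 := by
    refine C.sep v fun i' a => ?_
    apply (φ r).injective
    have := C.sum_cst (B i) i' a r t (by rw [ht, card_cons, hs]) (by
      rw [ht, map_cons, count_cons_self]; omega)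
    rw [_root_.map_zero, ← this, hv, map_sum, map_sum]
    refine Finset.sum_congr rfl fun z _ => ?_
    rw [map_smul, smul_eq_mul, _root_.map_mul, hg, mul_comm]
  have h1 : (B i).coord y v = 0 := by rw [hv0, _root_.map_zero]
  rw [hv, map_sum, Finset.sum_eq_single y] at h1
  · rw [map_smul, Module.Basis.coord_apply, Module.Basis.repr_self, Finsupp.single_eq_same,
      smul_eq_mul, mul_one] at h1
    have h2 := hg (t.count (r, y) * Ψ (tokMon tk (B i) (t.erase (r, y))))
    rw [h1, _root_.map_zero, ht, erase_cons_head, count_cons_self] at h2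
    have h3 := (mul_eq_zero.1 h2.symm).resolve_right h0
    rw [CharP.cast_eq_zero_iff E p] at h3
    have h4 := C.lt_p (B i) (by omega) h0 (r, y)
    have := Nat.le_of_dvd (by omega) h3
    omega
  · intro z _ hz
    rw [map_smul, Module.Basis.coord_apply, Module.Basis.repr_self, Finsupp.single_eq_of_ne hz.symm,
      smul_zero]
  · simp

theorem rigid [Finite E] [Nonempty ι] (C : PolyCore tk Ψ p m k d top B nxt fr)
    {s : Multiset (L × A)} (hs : card s = d) (h0 : Ψ (tokProd tk s) ≠ 0) (r : L) :
    (s.map Prod.fst).count r = 0 ∨ (s.map Prod.fst).count r = (m + k) * (p - 1) := by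
  by_cases h : (s.map Prod.fst).count r < m * (p - 1)
  · exact Or.inl (C.zero_of_digit_zero hs h0 r h)
  · right
    inhabit ι
    obtain ⟨t, ht, h1⟩ := exists_mon (B default) h0
    have hcard : card t = d := by rw [← hs, ← card_map Prod.fst t, ht, card_map]
    rw [← ht, count_map_fst, Finset.sum_congr rfl fun y _ => C.full hcard h1 r
      (by rw [ht]; omega) y]
    simp

end PolyCore

end Core

section Core

open Multiset

variable {E R A L ι : Type*} [Field E] [CommRing R] [Algebra E R] [AddCommGroup A]
    [Module E A] [DecidableEq L] {φ : L → E →+* E} {tk : ∀ r, A →ₛₗ[φ r] R} {Ψ : R →ₗ[E] E}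
    {p m k d top : ℕ} {B : ι → Module.Basis (Fin m ⊕ Fin k) E A} {nxt : L → L} {fr : L → A → A}

namespace PolyCore

/-- Replacing a token by `p` tokens of the previous level. -/
theorem overflow (C : PolyCore tk Ψ p m k d top B nxt fr) (i : ι) {r : L}
    {c c'' : Fin m} (hc : ∀ y, y ≠ Sum.inl c → (B i).coord (Sum.inl c'') (fr r (B i y)) = 0)
    {α : Multiset (L × (Fin m ⊕ Fin k))} (hα : card α = d)
    (hfull : ∀ y, α.count (nxt r, y) = p - 1) {y : Fin m ⊕ Fin k} (hy : y ≠ Sum.inl c) :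
    Ψ (tk r (B i y) ^ p * tokMon tk (B i) (α.erase (nxt r, Sum.inl c''))) = 0 := by
  have hp := C.prime.two_le
  have hmem : (nxt r, Sum.inl c'') ∈ α := by rw [← count_pos, hfull]; omega
  rw [C.ov, expand (B i)]
  refine Finset.sum_eq_zero fun z _ => ?_
  by_cases hz : z = Sum.inl c''
  · rw [hz, hc y hy, _root_.map_zero, zero_mul]
  · by_contra h
    have := C.lt_p (B i) (s := (nxt r, z) ::ₘ α.erase (nxt r, Sum.inl c'')) (by
      have : 0 < card α := card_pos_iff_exists_mem.2 ⟨_, hmem⟩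
      rw [card_cons, card_erase_of_mem hmem, Nat.pred_eq_sub_one]; omega)
      (right_ne_zero_of_mul h) (nxt r, z)
    rw [count_cons_self, count_erase_of_ne (by simpa using hz), hfull] at this
    omega

theorem zero_of_coord_eq_zero (C : PolyCore tk Ψ p m k d top B nxt fr) (hd : d + p < top)
    (i : ι) {r : L} {c c'' : Fin m}
    (hc : ∀ y, y ≠ Sum.inl c → (B i).coord (Sum.inl c'') (fr r (B i y)) = 0)
    {α : Multiset (L × (Fin m ⊕ Fin k))} (hα : card α = d)
    (h0 : Ψ (tokMon tk (B i) α) ≠ 0) (hr : ∀ y, α.count (r, y) = 0)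
    (hfull : ∀ y, α.count (nxt r, y) = p - 1) {v : A} (hv : (B i).coord (Sum.inl c) v = 0)
    (T : Multiset A) (hT : card T = p - 1) :
    Ψ (tk r v * (tokProd tk (T.map fun w => (r, w)) *
      tokMon tk (B i) (α.erase (nxt r, Sum.inl c'')))) = 0 := by
  have hp := C.prime.two_le
  have hm := C.hm
  have hmem : (nxt r, Sum.inl c'') ∈ α := by rw [← count_pos, hfull]; omega
  have hne : nxt r ≠ r := by
    intro h
    have h1 := hfull (Sum.inl c'')
    rw [h, hr] at h1
    omega
  set Q := α.erase (nxt r, Sum.inl c'') with hQ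
  have hQle : ∀ x, Q.count x < p := fun x =>
    (count_le_of_le x (erase_le _ _)).trans_lt (C.lt_p (B i) (by omega) h0 x)
  have hQr : ∀ y, Q.count (r, y) = 0 := fun y =>
    Nat.le_zero.1 ((count_le_of_le _ (erase_le _ _)).trans (hr y).le)
  have hQd : card Q + 1 = d := by
    have : 0 < card α := card_pos_iff_exists_mem.2 ⟨_, hmem⟩
    rw [hQ, card_erase_of_mem hmem, Nat.pred_eq_sub_one]; omega
  have key := tokProd_ext (B i) tk (T.map fun w => (r, w))
    (Ψ ∘ₗ LinearMap.mulLeft E (tk r v * tokMon tk (B i) Q)) fun t ht => ?_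
  · rw [← key]
    change _ = Ψ (_ * _)
    congr 1; ring
  · change Ψ (tk r v * tokMon tk (B i) Q * tokMon tk (B i) t) = 0
    have htr : ∀ x ∈ t, x.1 = r := by
      intro x hx
      have : x.1 ∈ t.map Prod.fst := mem_map_of_mem _ hx
      rw [ht, map_map] at this
      obtain ⟨w, -, h⟩ := mem_map.1 this
      exact h.symm
    have htc : card t = p - 1 := by
      rw [← hT, ← card_map Prod.fst t, ht, card_map, card_map]
    have e : tk r v * tokMon tk (B i) Q * tokMon tk (B i) t =
        tk r v * tokMon tk (B i) (t + Q) := by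
      simp only [tokMon, Multiset.map_add, prod_add]; ring
    rw [e, expand (B i)]
    refine Finset.sum_eq_zero fun y _ => ?_
    by_cases hy : y = Sum.inl c
    · rw [hy, hv, _root_.map_zero, zero_mul]
    · refine mul_eq_zero_of_right _ ?_
      by_contra h
      by_cases hlt : ∀ x, ((r, y) ::ₘ (t + Q)).count x < p
      · obtain ⟨z, hz, -, -, -⟩ := exists_avoid hm (Sum.inl c'' : Fin m ⊕ Fin k)
          (Sum.inl c'') (Sum.inl c'') (Sum.inl c'')
        have h1 := C.nc i _ (by rw [card_cons, card_add]; omega) hlt h (nxt r) c'' z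
        have h2 : ∀ y', t.count (nxt r, y') = 0 := fun y' =>
          count_eq_zero.2 fun h => hne (htr _ h)
        have h3 : ∀ y', ((nxt r, y') : L × (Fin m ⊕ Fin k)) ≠ (r, y) := fun y' h =>
          hne (congrArg Prod.fst h)
        rw [count_cons_of_ne (h3 _), count_cons_of_ne (h3 _), count_add, count_add, h2, h2, hQ,
          count_erase_self, count_erase_of_ne (by simpa using hz), hfull, hfull] at h1
        omega
      · push Not at hlt
        obtain ⟨x, hx⟩ := hlt
        have hxt : t.count x ≤ p - 1 := htc ▸ count_le_card x t
        rw [count_cons, count_add] at hx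
        by_cases hxr : x.1 = r
        · obtain ⟨x1, x2⟩ := x
          simp only at hxr
          subst hxr
          rw [hQr] at hx
          split_ifs at hx with hxy
          · simp only [Prod.mk.injEq, true_and] at hxy
            subst hxy
            have ht' : t = replicate (p - 1) (x1, x2) := by
              refine eq_replicate.2 ⟨htc, fun b hb => ?_⟩
              exact (count_eq_card.1 (by omega : count (x1, x2) t = card t) b hb).symm
            apply h
            rw [← C.overflow i hc hα hfull hy, ← hQ, ht']
            congr 1
            rw [tokMon_cons]
            simp only [tokMon, Multiset.map_add, prod_add, map_replicate, prod_replicate]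
            rw [← mul_assoc, ← pow_succ', Nat.sub_add_cancel (by omega)]
          · omega
        · have h2 : t.count x = 0 := count_eq_zero.2 fun h => hxr (htr _ h)
          have h3 : x ≠ (r, y) := fun h => hxr (by rw [h])
          have := hQle x
          rw [if_neg h3] at hx
          omega

theorem prod_level (C : PolyCore tk Ψ p m k d top B nxt fr) (hd : d + p < top)
    (i : ι) {r : L} {c c'' : Fin m}
    (hc : ∀ y, y ≠ Sum.inl c → (B i).coord (Sum.inl c'') (fr r (B i y)) = 0)
    (hc' : fr r (B i (Sum.inl c)) = B i (Sum.inl c''))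
    {α : Multiset (L × (Fin m ⊕ Fin k))} (hα : card α = d)
    (h0 : Ψ (tokMon tk (B i) α) ≠ 0) (hr : ∀ y, α.count (r, y) = 0)
    (hfull : ∀ y, α.count (nxt r, y) = p - 1) (U : Multiset A) :
    ∀ j, card U + j = p → Ψ (tokProd tk (U.map fun w => (r, w)) * (tk r (B i (Sum.inl c)) ^ j *
      tokMon tk (B i) (α.erase (nxt r, Sum.inl c'')))) =
      (U.map fun w => φ r ((B i).coord (Sum.inl c) w)).prod * Ψ (tokMon tk (B i) α) := by
  have hp := C.prime.two_le
  induction U using Multiset.induction_on with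
  | empty =>
    intro j hj
    have hmem : (nxt r, Sum.inl c'') ∈ α := by rw [← count_pos, hfull]; omega
    simp only [card_zero, zero_add] at hj
    subst hj
    rw [C.ov, hc', ← tokMon_cons tk (B i) (nxt r, Sum.inl c''), cons_erase hmem]
    simp [tokProd]
  | cons v U ih =>
    intro j hj
    have hj' : card U + (j + 1) = p := by rw [← hj, card_cons]; ring
    set w := B i (Sum.inl c) with hw
    have hz := C.zero_of_coord_eq_zero hd i hc hα h0 hr hfull
      (v := v - (B i).coord (Sum.inl c) v • w) (by simp [hw]) (U + replicate j w)
      (by rw [card_add, card_replicate]; omega)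
    rw [map_sub, map_smulₛₗ, sub_mul, map_sub, sub_eq_zero] at hz
    rw [Multiset.map_cons, tokProd_cons, Multiset.map_cons, prod_cons, mul_assoc, mul_assoc, ← ih _ hj']
    have e : tokProd tk ((U + replicate j w).map fun w => (r, w)) =
        tokProd tk (U.map fun w => (r, w)) * tk r w ^ j := by
      simp [tokProd]
    rw [e, mul_assoc] at hz
    rw [hz, smul_mul_assoc, map_smul, smul_eq_mul]
    congr 2
    ring

theorem zero_of_coord_eq_zero' [Finite E] [Nonempty ι] (C : PolyCore tk Ψ p m k d top B nxt fr)
    (hd : d + p < top) (i : ι) {r : L} {a : Fin m} {v : A} (hv : (B i).coord (Sum.inl a) v = 0)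
    (Q : Multiset (L × A)) (hQ : card Q + 1 = d) (hr : (Q.map Prod.fst).count r = 0) :
    Ψ (tk r (B i (Sum.inl a)) ^ (p - 1) * tk r v * tokProd tk Q) = 0 := by
  have hp := C.prime.two_le
  have hm := C.hm
  refine tokProd_ext (B i) tk Q
    (Ψ ∘ₗ LinearMap.mulLeft E (tk r (B i (Sum.inl a)) ^ (p - 1) * tk r v)) fun t ht => ?_
  change Ψ (tk r (B i (Sum.inl a)) ^ (p - 1) * tk r v * tokMon tk (B i) t) = 0
  have htc : card t + 1 = d := by rw [← hQ, ← card_map Prod.fst t, ht, card_map]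
  have htr : ∀ y, t.count (r, y) = 0 := by
    rw [← ht, count_map_fst, Finset.sum_eq_zero_iff] at hr
    exact fun y => hr y (Finset.mem_univ y)
  have e : tk r (B i (Sum.inl a)) ^ (p - 1) * tk r v * tokMon tk (B i) t =
      tk r v * tokMon tk (B i) (replicate (p - 1) (r, Sum.inl a) + t) := by
    simp only [tokMon, Multiset.map_add, prod_add, map_replicate, prod_replicate]; ring
  rw [e, expand (B i)]
  refine Finset.sum_eq_zero fun y _ => ?_
  by_cases hy : y = Sum.inl a
  · rw [hy, hv, _root_.map_zero, zero_mul]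
  refine mul_eq_zero_of_right _ ?_
  by_contra h
  set M := (r, y) ::ₘ (replicate (p - 1) (r, Sum.inl a) + t) with hM
  by_cases hlt : ∀ x, M.count x < p
  · obtain ⟨z, hz, hz', -, -⟩ := exists_avoid hm (Sum.inl a : Fin m ⊕ Fin k) y y y
    have h1 := C.nc i _ (by rw [hM, card_cons, card_add, card_replicate]; omega) hlt h r a z
    rw [hM, count_cons_of_ne (by simpa using Ne.symm hy), count_add, htr,
      count_cons_of_ne (by simpa using hz'), count_add, htr, count_replicate_self,
      count_replicate, if_neg (by simpa using hz.symm)] at h1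
    omega
  · push Not at hlt
    obtain ⟨x, hx⟩ := hlt
    have hxr : x.1 ≠ r := by
      obtain ⟨x1, x2⟩ := x
      simp only
      rintro rfl
      rw [hM, count_cons, count_add, htr, count_replicate] at hx
      split_ifs at hx with h1 h2
      · simp only [Prod.mk.injEq, true_and] at h1 h2
        subst h1
        exact hy (by simpa using h2.symm)
      all_goals omega
    have hxt : p ≤ t.count x := by
      rwa [hM, count_cons_of_ne (fun h => hxr (by rw [h])), count_add, count_replicate,
        if_neg (fun h => hxr (by rw [← h])), zero_add] at hx
    obtain ⟨t', rfl⟩ := Multiset.le_iff_exists_add.1 (le_count_iff_replicate_le.1 hxt)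
    have e2 : tokMon tk (B i) M = tokProd tk ((nxt x.1, fr x.1 (B i x.2)) ::ₘ
        ((r, y) ::ₘ (replicate (p - 1) (r, Sum.inl a) + t')).map fun x => (x.1, B i x.2)) := by
      rw [tokProd_cons, ← tokMon_eq_tokProd, ← C.ov]
      simp only [hM, tokMon, Multiset.map_add, prod_add, map_replicate, prod_replicate,
        Multiset.map_cons, prod_cons]
      ring
    rw [e2] at h
    have ht'r : ∀ y, t'.count (r, y) = 0 := fun y =>
      Nat.le_zero.1 ((count_le_of_le _ (Multiset.le_add_left _ _)).trans (htr y).le)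
    have h3 := C.rigid (by
      simp only [card_cons, card_map, card_add, card_replicate] at htc ⊢; omega) h r
    have h4 : (t'.map Prod.fst).count r = 0 := by
      rw [count_map_fst]; exact Finset.sum_eq_zero fun y _ => ht'r y
    rw [Multiset.map_cons, count_cons, Multiset.map_map] at h3
    have h5 : count r (((r, y) ::ₘ (replicate (p - 1) (r, Sum.inl a) + t')).map
        (Prod.fst ∘ fun x : L × (Fin m ⊕ Fin k) => (x.1, B i x.2))) = p := by
      have : (Prod.fst ∘ fun x : L × (Fin m ⊕ Fin k) => (x.1, B i x.2)) = Prod.fst := rfl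
      rw [this, Multiset.map_cons, count_cons_self, Multiset.map_add, count_add, h4,
        map_replicate, count_replicate_self]
      omega
    rw [h5] at h3
    have hk := C.hk
    have h6 : 6 * (p - 1) ≤ (m + k) * (p - 1) := Nat.mul_le_mul_right _ (by omega)
    split_ifs at h3 <;> rcases h3 with h3 | h3 <;> omega

theorem false [Finite E] [Nonempty ι] [Fintype L] (C : PolyCore tk Ψ p m k d top B nxt fr)
    (htop : top = Fintype.card L * ((m + k) * (p - 1)))
    (cyc : ∀ S : Set L, S.Nonempty → (∀ r, nxt r ∈ S → r ∈ S) → S = Set.univ)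
    (h1 : Ψ 1 = 0)
    (hfr : ∀ r i c, ∃ c'', fr r (B i (Sum.inl c)) = B i (Sum.inl c'') ∧
      ∀ y, y ≠ Sum.inl c → (B i).coord (Sum.inl c'') (fr r (B i y)) = 0)
    (last : ∃ i i', ∀ a c, ∃ v, (B i).coord (Sum.inl a) v = 0 ∧ (B i').coord (Sum.inl c) v ≠ 0)
    (s : Multiset (L × A)) (hs : card s = d) (h0 : Ψ (tokProd tk s) ≠ 0) : False := by
  have hp := C.prime.two_le
  have hm := C.hm
  obtain ⟨i, i', last⟩ := last
  have hsum : ∑ r, (s.map Prod.fst).count r = d := by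
    rw [← hs, ← card_map Prod.fst s]
    exact Multiset.sum_count_eq_card fun x _ => Finset.mem_univ x
  obtain ⟨r, hr', hr⟩ : ∃ r, (s.map Prod.fst).count (nxt r) ≠ 0 ∧ (s.map Prod.fst).count r = 0 := by
    by_contra! H
    have := cyc {r | (s.map Prod.fst).count r ≠ 0} ?_ H
    · have h2 : ∀ r, (s.map Prod.fst).count r = (m + k) * (p - 1) := fun r =>
        (C.rigid hs h0 r).resolve_left (by
          have h3 : r ∈ {r | (s.map Prod.fst).count r ≠ 0} := by rw [this]; trivial
          exact h3)
      rw [Finset.sum_congr rfl fun r _ => h2 r] at hsum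
      simp only [Finset.sum_const, Finset.card_univ, smul_eq_mul] at hsum
      have := C.hd
      omega
    · by_contra hne
      rw [Set.not_nonempty_iff_eq_empty, Set.eq_empty_iff_forall_notMem] at hne
      have : s = 0 := by
        rw [← Multiset.map_eq_zero (f := Prod.fst)]
        refine eq_zero_of_forall_notMem fun r => ?_
        rw [← count_eq_zero]
        simpa using hne r
      rw [this] at h0
      exact h0 (by simpa [tokProd] using h1)
  have hN : 6 * (p - 1) ≤ (m + k) * (p - 1) :=
    Nat.mul_le_mul_right _ (by have := C.hk; omega)
  have hdtop : d + p < top := by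
    have : ∑ r ∈ Finset.univ.erase r, (s.map Prod.fst).count r ≤
        (Fintype.card L - 1) * ((m + k) * (p - 1)) := by
      refine (Finset.sum_le_card_nsmul _ _ ((m + k) * (p - 1)) fun r _ => ?_).trans ?_
      · rcases C.rigid hs h0 r with h | h <;> omega
      · rw [Finset.card_erase_of_mem (Finset.mem_univ r), Finset.card_univ, smul_eq_mul]
    rw [← Finset.add_sum_erase _ _ (Finset.mem_univ r), hr, zero_add] at hsum
    have hL : 0 < Fintype.card L := Fintype.card_pos_iff.2 ⟨r⟩
    obtain ⟨l, hl⟩ := Nat.exists_eq_add_of_lt hL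
    rw [htop]
    rw [hl] at this ⊢
    simp only [zero_add, Nat.add_sub_cancel] at this ⊢
    rw [add_mul]
    omega
  have hfull' : (s.map Prod.fst).count (nxt r) = (m + k) * (p - 1) :=
    (C.rigid hs h0 _).resolve_left hr'
  set a : Fin m := ⟨0, by omega⟩
  obtain ⟨c, hc⟩ := C.sep' i i' a
  obtain ⟨c'', hc1, hc2⟩ := hfr r i' c
  obtain ⟨α, hα, hα0⟩ := exists_mon (B i') h0
  have hαd : card α = d := by rw [← hs, ← card_map Prod.fst α, hα, card_map]
  have hαfull : ∀ y, α.count (nxt r, y) = p - 1 := C.full hαd hα0 _ (by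
    rw [hα, hfull']; exact Nat.mul_le_mul_right _ (by omega))
  have hαr : ∀ y, α.count (r, y) = 0 := by
    rw [← hα, count_map_fst, Finset.sum_eq_zero_iff] at hr
    exact fun y => hr y (Finset.mem_univ y)
  have hmem : (nxt r, Sum.inl c'') ∈ α := by rw [← count_pos, hαfull]; omega
  obtain ⟨v, hv, hv'⟩ := last a c
  have h2 := C.prod_level hdtop i' hc2 hc1 hαd hα0 hαr hαfull
    (v ::ₘ replicate (p - 1) (B i (Sum.inl a))) 0 (by simp; omega)
  have h3 := C.zero_of_coord_eq_zero' hdtop i hv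
    ((α.erase (nxt r, Sum.inl c'')).map fun x => (x.1, B i' x.2)) (by
      have : 0 < card α := card_pos_iff_exists_mem.2 ⟨_, hmem⟩
      rw [card_map, card_erase_of_mem hmem, Nat.pred_eq_sub_one]; omega) (r := r) (by
      rw [Multiset.map_map]
      change count r ((α.erase _).map Prod.fst) = 0
      rw [count_map_fst]
      exact Finset.sum_eq_zero fun y _ => Nat.le_zero.1
        ((count_le_of_le _ (erase_le _ _)).trans (hαr y).le))
  rw [← tokMon_eq_tokProd] at h3
  have e : tokProd tk ((v ::ₘ replicate (p - 1) (B i (Sum.inl a))).map fun w => (r, w)) *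
      (tk r (B i' (Sum.inl c)) ^ 0 * tokMon tk (B i') (α.erase (nxt r, Sum.inl c''))) =
      tk r (B i (Sum.inl a)) ^ (p - 1) * tk r v *
        tokMon tk (B i') (α.erase (nxt r, Sum.inl c'')) := by
    simp only [tokProd, Multiset.map_cons, prod_cons, map_replicate, prod_replicate]
    ring
  rw [e, h3, Multiset.map_cons, prod_cons, map_replicate, prod_replicate] at h2
  have h4 : ∀ x : E, x ≠ 0 → φ r x ≠ 0 := fun x hx => (map_ne_zero (φ r)).2 hx
  exact mul_ne_zero (mul_ne_zero (h4 _ hv') (pow_ne_zero _ (h4 _ hc))) hα0 h2.symm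

end PolyCore

end Core

section Vanishing

/-- A product of few additive functions on a finite elementary abelian group sums to zero. -/
theorem sum_prod_coord_eq_zero {N : ℕ} {E : Type*} [Field E] (p : ℕ) [Fact p.Prime] [CharP E p]
    (s : Multiset ((Fin N → ZMod p) →+ E)) : ∀ (t : Multiset (Fin N)),
    Multiset.card s + Multiset.card t < N * (p - 1) →
    ∑ v : Fin N → ZMod p, (s.map fun g => g v).prod * (t.map fun i => (v i : ZMod p).cast).prod =
      (0 : E) := by
  induction s using Multiset.induction_on with
  | empty =>
    intro t ht
    have h := MvPolynomial.sum_eval_eq_zero (K := ZMod p)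
      ((t.map fun i => (MvPolynomial.X i : MvPolynomial (Fin N) (ZMod p))).prod) (by
        refine (MvPolynomial.totalDegree_multiset_prod _).trans_lt ?_
        rw [Multiset.map_map]
        refine (Multiset.sum_le_card_nsmul _ 1 ?_).trans_lt ?_
        · intro x hx
          obtain ⟨i, -, rfl⟩ := Multiset.mem_map.1 hx
          simp
        · simpa [mul_comm] using ht)
    have h2 := congrArg (ZMod.castHom (dvd_refl p) E) h
    rw [map_sum, map_zero] at h2
    rw [← h2]
    refine Finset.sum_congr rfl fun v _ => ?_
    rw [map_multiset_prod, map_multiset_prod, Multiset.map_map, Multiset.map_map]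
    simp [Function.comp_def]
  | cons g s ih =>
    intro t ht
    have hg : ∀ v : Fin N → ZMod p, g v = ∑ i, g (Pi.single i 1) * (v i).cast := by
      intro v
      conv_lhs => rw [← Finset.univ_sum_single v, map_sum]
      refine Finset.sum_congr rfl fun i _ => ?_
      have : (Pi.single i (v i) : Fin N → ZMod p) = (v i).val • Pi.single i 1 := by
        rw [← Pi.single_smul]; simp
      rw [this, map_nsmul, nsmul_eq_mul, mul_comm, ZMod.cast_eq_val]
    have : ∀ v : Fin N → ZMod p, ((g ::ₘ s).map fun g => g v).prod *
        (t.map fun i => (v i : ZMod p).cast).prod = ∑ i, g (Pi.single i 1) *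
        ((s.map fun g => g v).prod * ((i ::ₘ t).map fun i => (v i : ZMod p).cast).prod) := by
      intro v
      simp only [Multiset.map_cons, Multiset.prod_cons]
      rw [hg v, Finset.sum_mul, Finset.sum_mul]
      refine Finset.sum_congr rfl fun i _ => ?_
      ring
    rw [Finset.sum_congr rfl fun v _ => this v, Finset.sum_comm]
    refine Finset.sum_eq_zero fun i _ => ?_
    rw [← Finset.mul_sum, ih (i ::ₘ t) (by simp only [Multiset.card_cons] at ht ⊢; omega), mul_zero]

theorem sum_prod_addMonoidHom_eq_zero {V E : Type*} [Field E] [AddCommGroup V] [Fintype V]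
    (p : ℕ) [Fact p.Prime] [CharP E p] [Module (ZMod p) V] {N : ℕ} (hV : Fintype.card V = p ^ N)
    (s : Multiset (V →+ E)) (hs : Multiset.card s < N * (p - 1)) :
    ∑ v : V, (s.map fun g => g v).prod = 0 := by
  have hN : Module.finrank (ZMod p) V = N := by
    have := Module.card_eq_pow_finrank (K := ZMod p) (V := V)
    rw [hV, ZMod.card] at this
    exact (Nat.pow_right_injective (Fact.out : p.Prime).two_le this).symm
  let b := ((Module.finBasis (ZMod p) V).reindex (finCongr hN)).equivFun
  have := sum_prod_coord_eq_zero p (E := E) (s.map fun g => g.comp (b.symm : _ ≃+ _).toAddMonoidHom) 0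
    (by simpa using hs)
  rw [← this]
  refine Fintype.sum_equiv b.toEquiv _ _ fun v => ?_
  simp [Multiset.map_map, Function.comp_def]

theorem digits_unique {b : ℕ} (n : ℕ) : ∀ x y : Fin n → ℕ, (∀ i, x i < b) → (∀ i, y i < b) →
    ∑ i, x i * b ^ (i : ℕ) = ∑ i, y i * b ^ (i : ℕ) → x = y := by
  induction n with
  | zero => intro x y _ _ _; exact Subsingleton.elim _ _
  | succ n ih =>
    intro x y hx hy h
    simp only [Fin.sum_univ_succ, Fin.val_zero, pow_zero, mul_one, Fin.val_succ, pow_succ,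
      ← mul_assoc, ← Finset.sum_mul] at h
    have h0 : x 0 = y 0 := by
      have := congrArg (· % b) h
      simpa [Nat.add_mul_mod_self_right, Nat.mod_eq_of_lt (hx 0), Nat.mod_eq_of_lt (hy 0)] using this
    have hb : 0 < b := (Nat.zero_le _).trans_lt (hx 0)
    rw [h0] at h
    have h1 := ih (fun i => x i.succ) (fun i => y i.succ) (fun i => hx _) (fun i => hy _)
      (Nat.eq_of_mul_eq_mul_right hb (Nat.add_left_cancel h))
    funext i
    refine Fin.cases h0 (fun i => congrFun h1 i) i

theorem digits_sum_le {p : ℕ} (hp : 1 ≤ p) (e : ℕ) (x : Fin e → ℕ) (hx : ∀ i, x i < p) :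
    ∑ i, x i * p ^ (i : ℕ) < p ^ e := by
  calc ∑ i, x i * p ^ (i : ℕ) ≤ ∑ i : Fin e, (p - 1) * p ^ (i : ℕ) :=
        Finset.sum_le_sum fun i _ => Nat.mul_le_mul_right _ (by have := hx i; omega)
    _ = p ^ e - 1 := by
        rw [← Finset.mul_sum, Fin.sum_univ_eq_sum_range (fun i => p ^ i), mul_comm]
        have := geom_sum_mul_add (p - 1) e
        rw [Nat.sub_add_cancel hp] at this
        omega
    _ < p ^ e := Nat.sub_lt (pow_pos hp e) one_pos

theorem digits_const {q m : ℕ} (hq : 2 ≤ q) (x : Fin m → ℕ) (hx : ∀ i, x i < q)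
    (h : ∑ i : Fin m, q ^ (i : ℕ) ∣ ∑ i, x i * q ^ (i : ℕ)) (i j : Fin m) : x i = x j := by
  obtain ⟨c, hc⟩ := h
  have hpos : 0 < ∑ i : Fin m, q ^ (i : ℕ) :=
    Finset.sum_pos (fun _ _ => by positivity) ⟨i, Finset.mem_univ _⟩
  have hle : ∑ i, x i * q ^ (i : ℕ) ≤ (∑ i : Fin m, q ^ (i : ℕ)) * (q - 1) := by
    rw [Finset.sum_mul]
    exact Finset.sum_le_sum fun i _ => by
      rw [mul_comm]; exact Nat.mul_le_mul_left _ (by have := hx i; omega)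
  have hcq : c < q := by
    rw [hc] at hle
    have := Nat.le_of_mul_le_mul_left hle hpos
    omega
  have := digits_unique m x (fun _ => c) hx (fun _ => hcq) (by
    rw [hc, mul_comm, Finset.mul_sum])
  rw [this]

end Vanishing

section Frames

open Module

variable (F E : Type*) [Field F] [Field E] [Algebra F E] [Fintype F] [Finite E]

/-- The basis of powers of the Frobenius of the space of `F`-linear endomorphisms of `E`. -/
noncomputable def frobBasis : Basis (Fin (finrank F E)) E (E →ₗ[F] E) :=
  haveI : Nonempty (Fin (finrank F E)) := ⟨⟨0, finrank_pos⟩⟩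
  basisOfLinearIndependentOfCardEqFinrank
    (b := fun a : Fin (finrank F E) => (FiniteField.frobeniusAlgHom F E ^ (a : ℕ)).toLinearMap)
    ((linearIndependent_toLinearMap F E E).comp _ (by
      have : Fintype E := Fintype.ofFinite E
      exact (FiniteField.bijective_frobeniusAlgHom_pow F E).1))
    (by rw [Fintype.card_fin, finrank_linearMap_self])

theorem frobBasis_apply (a : Fin (finrank F E)) (x : E) :
    frobBasis F E a x = x ^ Fintype.card F ^ (a : ℕ) := by
  have : Nonempty (Fin (finrank F E)) := ⟨a⟩
  unfold frobBasis
  rw [coe_basisOfLinearIndependentOfCardEqFinrank, AlgHom.toLinearMap_apply, AlgHom.coe_pow,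
    FiniteField.coe_frobeniusAlgHom, pow_iterate]

variable {F E}

theorem frobBasis_coord_ne_zero {g : E →ₗ[F] F} (hg : g ≠ 0) (c : Fin (finrank F E)) :
    (frobBasis F E).coord c ((Algebra.linearMap F E).comp g) ≠ 0 := by
  obtain ⟨β, rfl⟩ := ((Algebra.traceForm F E).toDual (traceForm_nondegenerate F E)).surjective g
  have e : (Algebra.linearMap F E).comp
      ((Algebra.traceForm F E).toDual (traceForm_nondegenerate F E) β) =
      ∑ a : Fin (finrank F E), (β ^ Fintype.card F ^ (a : ℕ)) • frobBasis F E a := by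
    ext x
    rw [LinearMap.comp_apply, LinearMap.BilinForm.toDual_def, Algebra.traceForm_apply,
      Algebra.linearMap_apply, FiniteField.algebraMap_trace_eq_sum_pow, LinearMap.sum_apply,
      ← Fin.sum_univ_eq_sum_range (fun i => (β * x) ^ (Nat.card F) ^ i)]
    refine Finset.sum_congr rfl fun a _ => ?_
    rw [LinearMap.smul_apply, frobBasis_apply, smul_eq_mul, mul_pow, Nat.card_eq_fintype_card]
  intro h
  rw [e, map_sum, Finset.sum_eq_single c] at h
  · simp only [map_smul, Basis.coord_apply, Basis.repr_self, Finsupp.single_eq_same, smul_eq_mul,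
      mul_one] at h
    have := pow_eq_zero_iff (by positivity) |>.1 h
    rw [this, map_zero] at hg
    exact hg rfl
  · intro b _ hb
    simp [hb]
  · simp

variable {V : Type*} [AddCommGroup V] [Module F V] [Module.Finite F V]

/-- The functionals vanishing on the range of `σ`. -/
def vanishing (σ : E →ₗ[F] V) : Submodule E (V →ₗ[F] E) where
  carrier := {l | ∀ x, l (σ x) = 0}
  add_mem' ha hb x := by simp [ha x, hb x]
  zero_mem' x := rfl
  smul_mem' c l hl x := by simp [hl x]

instance (σ : E →ₗ[F] V) : Module.Free E (vanishing σ) :=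
  Module.Free.of_divisionRing E (vanishing σ)

/-- Splitting `E`-valued functionals along a section. -/
def frameEquiv (π : V →ₗ[F] E) (σ : E →ₗ[F] V) (h : ∀ x, π (σ x) = x) :
    ((E →ₗ[F] E) × vanishing σ) ≃ₗ[E]
      (V →ₗ[F] E) where
  toFun x := x.1.comp π + x.2.1
  map_add' x y := by
    ext v; simp; abel
  map_smul' c x := by
    ext v; simp
  invFun l := ⟨l.comp σ, l - (l.comp σ).comp π, by
    intro x; simp [h]⟩
  left_inv x := by
    have h2 : ∀ y, x.2.1 (σ y) = 0 := x.2.2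
    ext y
    · simp [h, h2]
    · simp [h, h2]
  right_inv l := by ext v; simp

variable {m k : ℕ}

/-- The basis of `E`-valued functionals adapted to a complement of the kernel of `π`. -/
noncomputable def frameBasis (hm : finrank F E = m) (hk : finrank F V = m + k)
    (π : V →ₗ[F] E) (σ : E →ₗ[F] V) (h : ∀ x, π (σ x) = x) :
    Basis (Fin m ⊕ Fin k) E (V →ₗ[F] E) :=
  (((frobBasis F E).reindex (finCongr hm)).prod ((Module.finBasis E (vanishing σ)).reindex (finCongr (by
    have : Module.Finite E (V →ₗ[F] E) := inferInstance
    have h1 := (frameEquiv π σ h).finrank_eq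
    rw [finrank_prod, finrank_linearMap_self, finrank_linearMap_self, hm, hk] at h1
    exact Nat.add_left_cancel h1)))).map (frameEquiv π σ h)

variable (hm : finrank F E = m) (hk : finrank F V = m + k)
    (π : V →ₗ[F] E) (σ : E →ₗ[F] V) (h : ∀ x, π (σ x) = x)

theorem frameBasis_inl (a : Fin m) (v : V) :
    frameBasis hm hk π σ h (Sum.inl a) v = π v ^ Fintype.card F ^ (a : ℕ) := by
  simp [frameBasis, frameEquiv, frobBasis_apply]

theorem frameBasis_inr (b : Fin k) (x : E) : frameBasis hm hk π σ h (Sum.inr b) (σ x) = 0 := by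
  simp only [frameBasis, frameEquiv, Basis.map_apply, LinearEquiv.coe_mk, LinearMap.coe_mk,
    AddHom.coe_mk, Basis.prod_apply_inr_fst, LinearMap.zero_comp, zero_add]
  exact Subtype.property (p := fun l : V →ₗ[F] E => l ∈ vanishing σ) _ x

theorem frameBasis_coord (a : Fin m) (l : V →ₗ[F] E) :
    (frameBasis hm hk π σ h).coord (Sum.inl a) l =
      (frobBasis F E).coord (Fin.cast hm.symm a) (l.comp σ) := by
  simp [frameBasis, frameEquiv]

theorem frameBasis_coord_eq_zero_iff (l : V →ₗ[F] E) :
    (∀ a, (frameBasis hm hk π σ h).coord (Sum.inl a) l = 0) ↔ ∀ x, l (σ x) = 0 := by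
  constructor
  · intro H x
    have : l.comp σ = 0 := by
      apply (frobBasis F E).ext_elem
      intro a
      have := H (Fin.cast hm a)
      rw [frameBasis_coord] at this
      simpa using this
    exact LinearMap.congr_fun this x
  · intro H a
    rw [frameBasis_coord, show l.comp σ = 0 from LinearMap.ext H, map_zero]

end Frames

section PolyTokens

open Module

variable {F E V : Type*} [Field F] [Field E] [Algebra F E] [Fintype F] [Finite E]
  [AddCommGroup V] [Module F V] [Fintype V] (p e : ℕ) [Fact p.Prime] [CharP E p]

/-- The semilinear map raising a functional to the power `p ^ r`. -/
def powTok (r : Fin e) : (V →ₗ[F] E) →ₛₗ[iterateFrobenius E p r] (V → E) where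
  toFun l v := l v ^ p ^ (r : ℕ)
  map_add' l l' := by
    funext v
    exact (iterateFrobenius E p r).map_add (l v) (l' v)
  map_smul' c l := by
    funext v
    simp [iterateFrobenius_def, mul_pow]

/-- Integration of functions against `f`. -/
def pairing (f : V → E) : (V → E) →ₗ[E] E where
  toFun G := ∑ v, f v * G v
  map_add' G G' := by simp [mul_add, Finset.sum_add_distrib]
  map_smul' c G := by
    simp only [Pi.smul_apply, smul_eq_mul, RingHom.id_apply, Finset.mul_sum]
    exact Finset.sum_congr rfl fun v _ => by ring

/-- The additive function given by a token. -/
def tokHom (x : Fin e × (V →ₗ[F] E)) : V →+ E where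
  toFun v := x.2 v ^ p ^ (x.1 : ℕ)
  map_zero' := by simp [(Fact.out : p.Prime).ne_zero]
  map_add' v w := by rw [map_add]; exact (iterateFrobenius E p x.1).map_add (x.2 v) (x.2 w)

theorem powTok_apply (r : Fin e) (l : V →ₗ[F] E) (v : V) :
    powTok p e r l v = l v ^ p ^ (r : ℕ) := rfl

theorem tokProd_powTok (s : Multiset (Fin e × (V →ₗ[F] E))) (v : V) :
    tokProd (powTok p e) s v = (s.map fun x => tokHom p e x v).prod := by
  induction s using Multiset.induction_on with
  | empty => simp [tokProd]
  | cons x s ih =>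
    rw [tokProd_cons, Pi.mul_apply, ih, Multiset.map_cons, Multiset.prod_cons]
    rfl

theorem sum_addMonoidHom_eq_zero (F : Type*) {E V : Type*} [Field F] [Field E] [Algebra F E]
    [Finite E] [AddCommGroup V] [Module F V] [Fintype V] (p : ℕ) [Fact p.Prime] [CharP E p]
    {N : ℕ} (hV : Fintype.card V = p ^ N) (s : Multiset (V →+ E))
    (hs : Multiset.card s < N * (p - 1)) : ∑ v : V, (s.map fun g => g v).prod = 0 := by
  have : CharP F p := (algebraMap F E).charP (algebraMap F E).injective p
  let _ := ZMod.algebra F p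
  let _ := Module.compHom V (algebraMap (ZMod p) F)
  exact sum_prod_addMonoidHom_eq_zero p hV s hs

theorem pairing_affine {N : ℕ} (hV : Fintype.card V = p ^ N) (c : E) (Λ : V →+ E)
    (s : Multiset (Fin e × (V →ₗ[F] E))) (hs : Multiset.card s + 1 < N * (p - 1)) :
    ∑ v, (c + Λ v) * tokProd (powTok p e) s v = 0 := by
  simp only [add_mul, Finset.sum_add_distrib, ← Finset.mul_sum, tokProd_powTok]
  have h1 := sum_addMonoidHom_eq_zero F p hV (s.map (tokHom p e))
    (by rw [Multiset.card_map]; omega)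
  have h2 := sum_addMonoidHom_eq_zero F p hV (Λ ::ₘ s.map (tokHom p e)) (by simpa using hs)
  simp only [Multiset.map_map, Multiset.map_cons, Multiset.prod_cons, Function.comp_def] at h1 h2
  rw [h1, h2, mul_zero, zero_add]

/-- Functions spanned by products of at most `D` tokens. -/
def tokFil (F : Type*) (E V : Type*) [Field F] [Field E] [Algebra F E] [Fintype F] [Finite E]
    [AddCommGroup V] [Module F V] [Fintype V] (p e : ℕ) [Fact p.Prime] [CharP E p] (D : ℕ) :
    Submodule E (V → E) :=
  Submodule.span E {G | ∃ s : Multiset (Fin e × (V →ₗ[F] E)), Multiset.card s < D ∧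
    tokProd (powTok p e) s = G}

variable {p e}

theorem tokProd_mem_tokFil {D : ℕ} {s : Multiset (Fin e × (V →ₗ[F] E))}
    (hs : Multiset.card s < D) : tokProd (powTok p e) s ∈ tokFil F E V p e D :=
  Submodule.subset_span ⟨s, hs, rfl⟩

theorem tokFil_mono {D D' : ℕ} (h : D ≤ D') : tokFil F E V p e D ≤ tokFil F E V p e D' :=
  Submodule.span_mono fun _ ⟨s, hs, h'⟩ => ⟨s, hs.trans_le h, h'⟩

theorem mul_mem_tokFil {D D' : ℕ} {G G' : V → E} (hG : G ∈ tokFil F E V p e (D + 1))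
    (hG' : G' ∈ tokFil F E V p e D') : G * G' ∈ tokFil F E V p e (D + D') := by
  have := Submodule.mul_mem_mul hG hG'
  rw [tokFil, tokFil, Submodule.span_mul_span] at this
  refine Submodule.span_le.2 ?_ this
  rintro _ ⟨_, ⟨s, hs, rfl⟩, _, ⟨s', hs', rfl⟩, rfl⟩
  have : tokProd (powTok p e) s * tokProd (powTok p e) s' = tokProd (powTok p e) (s + s') := by
    simp [tokProd]
  change tokProd _ _ * tokProd _ _ ∈ _
  rw [this]
  exact tokProd_mem_tokFil (by rw [Multiset.card_add]; omega)

/-- The difference operator. -/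
def diffOp (a : V) : (V → E) →ₗ[E] (V → E) where
  toFun G v := G (v + a) - G v
  map_add' G G' := by funext v; simp; ring
  map_smul' c G := by funext v; simp; ring

theorem diffOp_apply (a : V) (G : V → E) (v : V) : diffOp a G v = G (v + a) - G v := rfl

theorem diffOp_mem_tokFil {D : ℕ} (a : V) {G : V → E} (hG : G ∈ tokFil F E V p e (D + 1)) :
    diffOp a G ∈ tokFil F E V p e D := by
  have key : ∀ s : Multiset (Fin e × (V →ₗ[F] E)),
      diffOp a (tokProd (powTok p e) s) ∈ tokFil F E V p e (Multiset.card s) := by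
    intro s
    induction s using Multiset.induction_on with
    | empty =>
      convert Submodule.zero_mem _
      funext v
      simp [tokProd, diffOp]
    | cons x s ih =>
      have : diffOp a (tokProd (powTok p e) (x ::ₘ s)) =
          powTok p e x.1 x.2 * diffOp a (tokProd (powTok p e) s) +
          (x.2 a ^ p ^ (x.1 : ℕ)) • (tokProd (powTok p e) s +
            diffOp a (tokProd (powTok p e) s)) := by
        funext v
        have h2 := (tokHom p e x).map_add v a
        change x.2 (v + a) ^ p ^ (x.1 : ℕ) = x.2 v ^ p ^ (x.1 : ℕ) + x.2 a ^ p ^ (x.1 : ℕ) at h2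
        simp only [tokProd_cons, diffOp_apply, Pi.mul_apply, Pi.add_apply, Pi.smul_apply,
          powTok_apply, h2, smul_eq_mul]
        ring
      rw [this, Multiset.card_cons]
      have hx : powTok p e x.1 x.2 ∈ tokFil F E V p e (1 + 1) := by
        have h3 : powTok p e x.1 x.2 = tokProd (powTok p e) {x} := by simp [tokProd]
        rw [h3]
        exact tokProd_mem_tokFil (by simp)
      refine Submodule.add_mem _ ?_ (Submodule.smul_mem _ _ (Submodule.add_mem _
        (tokProd_mem_tokFil (by omega)) (tokFil_mono (Nat.le_succ _) ih)))
      rw [add_comm]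
      exact mul_mem_tokFil hx ih
  have : tokFil F E V p e (D + 1) ≤ (tokFil F E V p e D).comap (diffOp a) := by
    refine Submodule.span_le.2 ?_
    rintro _ ⟨s, hs, rfl⟩
    exact tokFil_mono (by omega) (key s)
  exact this hG

theorem pow_mem_tokFil (hq : Fintype.card F = p ^ e) (l : V →ₗ[F] E) :
    (fun v => l v ^ (Fintype.card F - 1)) ∈ tokFil F E V p e (e * (p - 1) + 1) := by
  have h1 : p ^ e - 1 = ∑ r : Fin e, p ^ (r : ℕ) * (p - 1) := by
    rw [← Finset.sum_mul, Fin.sum_univ_eq_sum_range (fun i => p ^ i)]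
    have := geom_sum_mul_add (p - 1) e
    rw [Nat.sub_add_cancel (Fact.out : p.Prime).one_le] at this
    omega
  have h2 : ∀ S : Finset (Fin e), tokProd (powTok p e) (∑ r ∈ S, Multiset.replicate (p - 1) (r, l)) =
      ∏ r ∈ S, powTok p e r l ^ (p - 1) := by
    classical
    intro S
    induction S using Finset.induction_on with
    | empty => simp [tokProd]
    | insert r S hr ih =>
      rw [Finset.sum_insert hr, Finset.prod_insert hr, ← ih]
      simp [tokProd]
  have h3 : (fun v => l v ^ (Fintype.card F - 1)) =
      tokProd (powTok p e) (∑ r : Fin e, Multiset.replicate (p - 1) (r, l)) := by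
    funext v
    rw [h2, Finset.prod_apply, hq, h1, ← Finset.prod_pow_eq_pow_sum]
    refine Finset.prod_congr rfl fun r _ => ?_
    rw [Pi.pow_apply, powTok_apply, pow_mul]
  rw [h3]
  exact tokProd_mem_tokFil (by simp)

theorem one_mem_tokFil {D : ℕ} (hD : 0 < D) : (1 : V → E) ∈ tokFil F E V p e D := by
  have h : (1 : V → E) = tokProd (powTok p e (F := F)) 0 := by simp [tokProd]
  rw [h]
  exact tokProd_mem_tokFil (by simpa using hD)

theorem delta_mem_tokFil [DecidableEq V] (hq : Fintype.card F = p ^ e) :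
    (fun v : V => if v = 0 then (1 : E) else 0) ∈
      tokFil F E V p e (finrank F V * (e * (p - 1)) + 1) := by
  let b := finBasis F V
  have key : ∀ S : Finset (Fin (finrank F V)),
      ∏ j ∈ S, (fun v => 1 - ((Algebra.linearMap F E).comp (b.coord j)) v ^ (Fintype.card F - 1)) ∈
        tokFil F E V p e (S.card * (e * (p - 1)) + 1) := by
    classical
    intro S
    induction S using Finset.induction_on with
    | empty =>
      exact one_mem_tokFil (by simp)
    | insert j S hj ih =>
      rw [Finset.prod_insert hj, Finset.card_insert_of_notMem hj]
      have := mul_mem_tokFil (D := e * (p - 1)) (G := (fun v => 1 -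
        ((Algebra.linearMap F E).comp (b.coord j)) v ^ (Fintype.card F - 1))) ?_ ih
      · convert this using 2
        ring
      · refine Submodule.sub_mem _ ?_ (pow_mem_tokFil hq _)
        exact one_mem_tokFil (by simp)
  have := key Finset.univ
  rw [Finset.card_univ, Fintype.card_fin] at this
  convert this using 1
  funext v
  rw [Finset.prod_apply]
  split_ifs with h
  · subst h
    simp [Nat.sub_ne_zero_of_lt Fintype.one_lt_card]
  · symm
    obtain ⟨j, hj⟩ : ∃ j, b.coord j v ≠ 0 := by
      by_contra! H
      exact h (b.ext_elem fun j => by simpa using H j)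
    refine Finset.prod_eq_zero (Finset.mem_univ j) ?_
    rw [LinearMap.comp_apply, Algebra.linearMap_apply, ← map_pow,
      FiniteField.pow_card_sub_one_eq_one _ hj, map_one, sub_self]

theorem affine_of_pairing_eq_zero (hq : Fintype.card F = p ^ e) (f : V → E)
    (hf : ∀ s : Multiset (Fin e × (V →ₗ[F] E)),
      Multiset.card s + 1 < finrank F V * (e * (p - 1)) → pairing f (tokProd (powTok p e) s) = 0)
    (h2 : 2 ≤ finrank F V * (e * (p - 1))) :
    ∃ Λ : V →+ E, ∀ v, f v = f 0 + Λ v := by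
  classical
  have key : ∀ a b : V, f (a + b) = f a + f b - f 0 := by
    intro a b
    obtain ⟨D, hD⟩ := Nat.exists_eq_add_of_le h2
    have h1 := delta_mem_tokFil (E := E) (V := V) (p := p) (e := e) hq
    rw [hD, show 2 + D + 1 = D + 1 + 1 + 1 by ring] at h1
    have h3 := diffOp_mem_tokFil (-b) (diffOp_mem_tokFil (-a) h1)
    have h4 : tokFil F E V p e (D + 1) ≤ LinearMap.ker (pairing f) := by
      refine Submodule.span_le.2 ?_
      rintro _ ⟨s, hs, rfl⟩
      exact hf s (by omega)
    have h5 : pairing f _ = 0 := h4 h3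
    change ∑ v, f v * _ = 0 at h5
    simp only [diffOp_apply, ← sub_eq_add_neg, mul_sub, Finset.sum_sub_distrib, mul_ite, mul_one,
      mul_zero, sub_eq_zero, sub_sub] at h5
    simp only [Finset.sum_ite_eq', Finset.mem_univ, if_true] at h5
    simp only [mul_add, mul_sub, Finset.sum_add_distrib, Finset.sum_sub_distrib, mul_ite, mul_one,
      mul_zero, Finset.sum_ite_eq', Finset.mem_univ, if_true] at h5
    rw [add_comm a b, h5]
    ring
  refine ⟨⟨⟨fun v => f v - f 0, by simp⟩, fun a b => ?_⟩, fun v => ?_⟩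
  · simp only [key]; ring
  · change f v = f 0 + (f v - f 0)
    ring

end PolyTokens

section FrameProps

open Module

variable {F E V : Type*} [Field F] [Field E] [Algebra F E] [Fintype F] [Finite E]
  [AddCommGroup V] [Module F V] [Module.Finite F V] {m k : ℕ}

theorem mem_range_algebraMap_of_pow_card (x : E) (hx : x ^ Fintype.card F = x) :
    ∃ y : F, algebraMap F E y = x := by
  classical
  by_contra! H
  have hq := Fintype.one_lt_card (α := F)
  have hne : (Polynomial.X ^ Fintype.card F - Polynomial.X : Polynomial E) ≠ 0 :=
    FiniteField.X_pow_card_sub_X_ne_zero E hq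
  have h1 : insert x ((Finset.univ : Finset F).image (algebraMap F E)) ⊆
      (Polynomial.X ^ Fintype.card F - Polynomial.X : Polynomial E).roots.toFinset := by
    intro y hy
    rw [Multiset.mem_toFinset, Polynomial.mem_roots hne, Polynomial.IsRoot.def]
    simp only [Polynomial.eval_sub, Polynomial.eval_pow, Polynomial.eval_X, sub_eq_zero]
    rcases Finset.mem_insert.1 hy with rfl | hy
    · exact hx
    · obtain ⟨z, -, rfl⟩ := Finset.mem_image.1 hy
      rw [← map_pow, FiniteField.pow_card]
  have h2 := (Finset.card_le_card h1).trans ((Multiset.toFinset_card_le _).trans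
    (Polynomial.card_roots' _))
  rw [FiniteField.X_pow_card_sub_X_natDegree_eq E hq, Finset.card_insert_of_notMem (by
    simpa using H), Finset.card_image_of_injective _ (algebraMap F E).injective,
    Finset.card_univ] at h2
  omega

theorem frame_ker (hm : finrank F E = m) (hk : finrank F V = m + k) (π : V →ₗ[F] E)
    (σ : E →ₗ[F] V) (h : ∀ x, π (σ x) = x) : finrank F (LinearMap.ker π) = k := by
  have h1 := π.finrank_range_add_finrank_ker
  rw [LinearMap.range_eq_top.2 fun x => ⟨σ x, h x⟩, finrank_top] at h1
  omega

theorem frame_comp_ne_zero (hm : finrank F E = m) (hk : finrank F V = m + k) (hkm : k < m)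
    (π : V →ₗ[F] E) (σ σ' : E →ₗ[F] V) (h : ∀ x, π (σ x) = x) (hσ' : Function.Injective σ') :
    ∃ x, π (σ' x) ≠ 0 := by
  by_contra! H
  have h1 := LinearMap.finrank_range_of_inj hσ'
  have h2 := Submodule.finrank_mono (s := LinearMap.range σ') (t := LinearMap.ker π) (by
    rintro _ ⟨x, rfl⟩
    exact H x)
  rw [frame_ker hm hk π σ h] at h2
  omega

theorem frame_not_semilinear (hm : finrank F E = m) (hk : finrank F V = m + k) (hkm : k + 1 < m)
    (π : V →ₗ[F] E) (σ σ' : E →ₗ[F] V) (h : ∀ x, π (σ x) = x) (hσ' : Function.Injective σ')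
    (b : ℕ) (t : E) (H : ∀ x, π (σ' x) ^ Fintype.card F ^ (b + 1) =
      t * π (σ' x) ^ Fintype.card F ^ b) : False := by
  obtain ⟨x, hx⟩ := frame_comp_ne_zero hm hk (by omega) π σ σ' h hσ'
  have key : ∀ y, ∃ c : F, π (σ' y) = c • π (σ' x) := by
    intro y
    obtain ⟨c, hc⟩ := mem_range_algebraMap_of_pow_card (F := F) (π (σ' y) / π (σ' x)) (by
      have hinj : Function.Injective fun z : E => z ^ Fintype.card F ^ b := by
        have := ((FiniteField.frobeniusAlgHom F E) ^ b).toRingHom.injective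
        convert this using 2
        simp [FiniteField.coe_frobeniusAlgHom, pow_iterate]
      apply hinj
      have ht : t ≠ 0 := by
        rintro rfl
        have := H x
        rw [zero_mul] at this
        exact hx (pow_eq_zero_iff (by positivity) |>.1 this)
      simp only [← pow_mul, ← pow_succ', div_pow, H]
      rw [mul_div_mul_left _ _ ht])
    refine ⟨c, ?_⟩
    rw [Algebra.smul_def, hc]
    field_simp
  have h1 := (π.comp σ').finrank_range_add_finrank_ker
  have h2 : finrank F (LinearMap.range (π.comp σ')) ≤ 1 := by
    refine (Submodule.finrank_mono (t := Submodule.span F {π (σ' x)}) ?_).trans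
      (finrank_span_singleton hx).le
    rintro _ ⟨y, rfl⟩
    obtain ⟨c, hc⟩ := key y
    exact Submodule.mem_span_singleton.2 ⟨c, hc.symm⟩
  have h3 := Submodule.finrank_mono (s := (LinearMap.ker (π.comp σ')).map σ')
    (t := LinearMap.ker π) (by
      rintro _ ⟨y, hy, rfl⟩
      exact hy)
  rw [frame_ker hm hk π σ h, ← LinearEquiv.finrank_eq
    (Submodule.equivMapOfInjective σ' hσ' _)] at h3
  omega

variable {ι : Type*} [Finite ι] (π : ι → V →ₗ[F] E)

theorem span_frobenius_frames (hm : finrank F E = m) (hker : ∀ v, (∀ i, π i v = 0) → v = 0)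
    (S : Submodule E (V →ₗ[F] E))
    (hS : ∀ i (a : Fin m), ∃ l ∈ S, ∀ v, l v = π i v ^ Fintype.card F ^ (a : ℕ)) : S = ⊤ := by
  classical
  have : Fintype ι := Fintype.ofFinite ι
  subst hm
  obtain ⟨g, hg⟩ := (LinearMap.pi π).exists_leftInverse_of_injective (by
    rw [LinearMap.ker_eq_bot']
    intro v hv
    exact hker v fun i => congrFun hv i)
  rw [eq_top_iff]
  intro l _
  have h1 : l = ∑ i, ((l.comp g).comp (LinearMap.single F (fun _ => E) i)).comp (π i) := by
    ext v
    have h2 : g (LinearMap.pi π v) = v := LinearMap.congr_fun hg v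
    conv_lhs => rw [← h2]
    have h3 : LinearMap.pi π v = ∑ i, LinearMap.single F (fun _ => E) i (π i v) := by
      rw [← LinearMap.sum_single_apply _ (LinearMap.pi π v)]
      rfl
    rw [h3]
    simp
  rw [h1]
  refine Submodule.sum_mem _ fun i _ => ?_
  generalize (l.comp g).comp (LinearMap.single F (fun _ => E) i) = u
  rw [← (frobBasis F E).sum_repr u]
  have h4 : (∑ a, (frobBasis F E).repr u a • frobBasis F E a).comp (π i) =
      ∑ a, (frobBasis F E).repr u a • (frobBasis F E a).comp (π i) := by
    ext v
    rw [LinearMap.comp_apply, LinearMap.sum_apply, LinearMap.sum_apply]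
    rfl
  rw [h4]
  refine Submodule.sum_mem _ fun a _ => Submodule.smul_mem _ _ ?_
  obtain ⟨l, hl, h⟩ := hS i a
  convert hl
  ext v
  rw [h, LinearMap.comp_apply, frobBasis_apply]

end FrameProps

section Poly

open Module

variable {F E V : Type*} [Field F] [Field E] [Algebra F E] [Fintype F] [Finite E]
  [AddCommGroup V] [Module F V] [Fintype V] {m k p e : ℕ} [Fact p.Prime] [CharP E p]

/-- The successor on frequencies. -/
def nxtFreq (r : Fin e) : Fin e := if h : r + 1 < e then ⟨r + 1, h⟩ else ⟨0, r.pos⟩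

/-- The effect of an overflow on functionals. -/
def ovFrob (F : Type*) {E V : Type*} [Field F] [Field E] [Algebra F E] [Fintype F]
    [AddCommGroup V] [Module F V] (r : Fin e) (l : V →ₗ[F] E) : V →ₗ[F] E :=
  if (r : ℕ) + 1 < e then l else (FiniteField.frobeniusAlgHom F E).toLinearMap.comp l

theorem nxtFreq_cyclic (S : Set (Fin e)) (hne : S.Nonempty) (h : ∀ r, nxtFreq r ∈ S → r ∈ S) :
    S = Set.univ := by
  obtain ⟨r0, hr0⟩ := hne
  have down : ∀ n (r : Fin e), (r : ℕ) = n → r ∈ S → ∀ r' : Fin e, r' ≤ r → r' ∈ S := by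
    intro n
    induction n with
    | zero =>
      intro r hr hS r' hr'
      have : r' = r := by ext; have := Fin.le_def.1 hr'; omega
      exact this ▸ hS
    | succ n ih =>
      intro r hr hS r' hr'
      rcases hr'.eq_or_lt with rfl | hlt
      · exact hS
      · have hn : n < e := by have := r.2; omega
        refine ih ⟨n, hn⟩ rfl (h _ ?_) r' (Fin.le_def.2 (by have := Fin.lt_def.1 hlt; simp; omega))
        have : nxtFreq ⟨n, hn⟩ = r := by
          ext
          rw [nxtFreq, dif_pos (by have := r.2; simp; omega)]
          simp [hr]
        rwa [this]
  have he := r0.pos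
  have h0 : (⟨0, he⟩ : Fin e) ∈ S := down _ r0 rfl hr0 _ (Fin.le_def.2 (Nat.zero_le _))
  have hl : (⟨e - 1, by omega⟩ : Fin e) ∈ S := by
    apply h
    rw [nxtFreq, dif_neg (by simp; omega)]
    exact h0
  exact Set.eq_univ_of_forall fun r => down _ _ rfl hl r (Fin.le_def.2 (by have := r.2; simp; omega))

theorem powTok_overflow (hq : Fintype.card F = p ^ e) (r : Fin e) (l : V →ₗ[F] E) :
    powTok p e r l ^ p = powTok p e (nxtFreq r) (ovFrob F r l) := by
  funext v
  rw [Pi.pow_apply, powTok_apply, powTok_apply, ← pow_mul, ← pow_succ, nxtFreq, ovFrob]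
  split_ifs with h
  · rfl
  · have : (r : ℕ) + 1 = e := by have := r.2; omega
    rw [this, ← hq]
    simp [FiniteField.coe_frobeniusAlgHom]

theorem ovFrob_frameBasis (hm : finrank F E = m) (hk : finrank F V = m + k)
    (π : V →ₗ[F] E) (σ : E →ₗ[F] V) (h : ∀ x, π (σ x) = x) (r : Fin e) (c : Fin m) :
    ∃ c'', ovFrob F r (frameBasis hm hk π σ h (Sum.inl c)) = frameBasis hm hk π σ h (Sum.inl c'') ∧
      ∀ y, y ≠ Sum.inl c →
        (frameBasis hm hk π σ h).coord (Sum.inl c'')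
          (ovFrob F r (frameBasis hm hk π σ h y)) = 0 := by
  by_cases hr : (r : ℕ) + 1 < e
  · refine ⟨c, by rw [ovFrob, if_pos hr], fun y hy => ?_⟩
    rw [ovFrob, if_pos hr, Basis.coord_apply, Basis.repr_self, Finsupp.single_apply, if_neg hy]
  · have hov : ∀ l : V →ₗ[F] E, ovFrob F r l =
      (FiniteField.frobeniusAlgHom F E).toLinearMap.comp l := fun l => by rw [ovFrob, if_neg hr]
    have key : ∀ c : Fin m, ovFrob F r (frameBasis hm hk π σ h (Sum.inl c)) =
        frameBasis hm hk π σ h (Sum.inl ⟨(c + 1) % m, Nat.mod_lt _ c.pos⟩) := by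
      intro c
      rw [hov]
      ext v
      rw [frameBasis_inl, LinearMap.comp_apply, frameBasis_inl, AlgHom.toLinearMap_apply,
        FiniteField.coe_frobeniusAlgHom]
      simp only
      rw [← pow_mul, ← pow_succ]
      rcases (Nat.succ_le_of_lt c.2).eq_or_lt with hc | hc
      · have : Fintype E := Fintype.ofFinite E
        have hE : Fintype.card F ^ m = Fintype.card E := by
          rw [← hm]; exact (Module.card_eq_pow_finrank (K := F) (V := E)).symm
        rw [show (c : ℕ) + 1 = m from hc, Nat.mod_self, hE, FiniteField.pow_card, pow_zero, pow_one]
      · rw [Nat.mod_eq_of_lt hc]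
    refine ⟨⟨(c + 1) % m, Nat.mod_lt _ c.pos⟩, key c, fun y hy => ?_⟩
    rcases y with c' | b
    · rw [key, Basis.coord_apply, Basis.repr_self, Finsupp.single_apply, if_neg]
      intro heq
      apply hy
      have h1 : ((c' : ℕ) + 1) % m = (c + 1) % m := by simpa using heq
      have h2 : (c' : ℕ) ≡ c [MOD m] := Nat.ModEq.add_right_cancel' 1 h1
      congr 1
      ext
      exact Nat.ModEq.eq_of_lt_of_lt h2 c'.2 c.2
    · refine (frameBasis_coord_eq_zero_iff hm hk π σ h _).2 (fun x => ?_) _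
      rw [hov, LinearMap.comp_apply, frameBasis_inr, map_zero]

theorem exists_last {ι : Type*} (hm : finrank F E = m) (hk : finrank F V = m + k) (hk1 : 1 ≤ k)
    (π : ι → V →ₗ[F] E)
    (σ : ι → E →ₗ[F] V) (h : ∀ i x, π i (σ i x) = x) (hran : ⨆ i, LinearMap.range (σ i) = ⊤)
    (i : ι) : ∃ i', ∀ a c, ∃ v,
      (frameBasis hm hk (π i) (σ i) (h i)).coord (Sum.inl a) v = 0 ∧
      (frameBasis hm hk (π i') (σ i') (h i')).coord (Sum.inl c) v ≠ 0 := by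
  obtain ⟨l, hl, hle⟩ := Submodule.exists_le_ker_of_lt_top (LinearMap.range (σ i)) (by
    rw [lt_top_iff_ne_top]
    intro htop
    have h1 := (σ i).finrank_range_le
    rw [htop, finrank_top] at h1
    omega)
  obtain ⟨i', hi'⟩ : ∃ i', l.comp (σ i') ≠ 0 := by
    by_contra! H
    apply hl
    rw [← LinearMap.ker_eq_top, eq_top_iff, ← hran, iSup_le_iff]
    rintro i _ ⟨x, rfl⟩
    exact LinearMap.congr_fun (H i) x
  refine ⟨i', fun a c => ⟨(Algebra.linearMap F E).comp l, ?_, ?_⟩⟩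
  · refine (frameBasis_coord_eq_zero_iff hm hk _ _ (h i) _).2 (fun x => ?_) a
    have : l (σ i x) = 0 := hle ⟨x, rfl⟩
    rw [LinearMap.comp_apply, this, map_zero]
  · rw [frameBasis_coord]
    exact frobBasis_coord_ne_zero hi' _

end Poly

section Poly

open Module

variable {F E V : Type*} [Field F] [Field E] [Algebra F E] [Fintype F] [Finite E]
  [AddCommGroup V] [Module F V] [Fintype V] {m k p e : ℕ} [Fact p.Prime] [CharP E p]

theorem exists_norm_one_generator (hm : finrank F E = m) :
    ∃ y : E, y ≠ 0 ∧ y ^ (∑ a ∈ Finset.range m, Fintype.card F ^ a) = 1 ∧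
      ∀ N, y ^ N = 1 → (∑ a ∈ Finset.range m, Fintype.card F ^ a) ∣ N := by
  have : Fintype E := Fintype.ofFinite E
  obtain ⟨g, hg⟩ := IsCyclic.exists_ofOrder_eq_natCard (α := Eˣ)
  have hq := Fintype.one_lt_card (α := F)
  have hE : Nat.card Eˣ = (Fintype.card F - 1) * ∑ a ∈ Finset.range m, Fintype.card F ^ a := by
    rw [Nat.card_units, Nat.card_eq_fintype_card, Module.card_eq_pow_finrank (K := F) (V := E), hm]
    have := geom_sum_mul_add (Fintype.card F - 1) m
    rw [Nat.sub_add_cancel (by omega)] at this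
    rw [← this, mul_comm]
    omega
  have ho : orderOf (g ^ (Fintype.card F - 1)) =
      ∑ a ∈ Finset.range m, Fintype.card F ^ a := by
    rw [orderOf_pow_of_dvd (by omega) (by rw [hg, hE]; exact dvd_mul_right _ _), hg, hE,
      Nat.mul_div_cancel_left _ (by omega)]
  refine ⟨(g ^ (Fintype.card F - 1) : Eˣ), Units.ne_zero _, ?_, fun N hN => ?_⟩
  · rw [← ho, ← Units.val_pow_eq_pow_val, pow_orderOf_eq_one, Units.val_one]
  · rw [← ho]
    apply orderOf_dvd_of_pow_eq_one
    rwa [← Units.val_pow_eq_pow_val, Units.val_eq_one] at hN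

variable (hm : finrank F E = m) (hk : finrank F V = m + k)
    (π : V →ₗ[F] E) (σ : E →ₗ[F] V) (h : ∀ x, π (σ x) = x)

theorem tokMon_frame_comp (s : Multiset (Fin e × (Fin m ⊕ Fin k))) (y : E) (v : V) :
    tokMon (powTok p e) (frameBasis hm hk π σ h) s (v + σ ((y - 1) * π v)) =
      y ^ (∑ a : Fin m, (∑ r : Fin e, s.count (r, Sum.inl a) * p ^ (r : ℕ)) *
        Fintype.card F ^ (a : ℕ)) *
      tokMon (powTok p e) (frameBasis hm hk π σ h) s v := by
  induction s using Multiset.induction_on with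
  | empty => simp [tokMon]
  | cons x s ih =>
    rw [tokMon_cons, Pi.mul_apply, ih, Pi.mul_apply, powTok_apply, powTok_apply]
    obtain ⟨r, a | b⟩ := x
    · simp only [frameBasis_inl]
      have h1 : π (v + σ ((y - 1) * π v)) = y * π v := by rw [map_add, h]; ring
      have h2 : ∑ a' : Fin m, (∑ r' : Fin e, ((r, Sum.inl a) ::ₘ s).count (r', Sum.inl a') *
          p ^ (r' : ℕ)) * Fintype.card F ^ (a' : ℕ) =
          (∑ a' : Fin m, (∑ r' : Fin e, s.count (r', Sum.inl a') *
          p ^ (r' : ℕ)) * Fintype.card F ^ (a' : ℕ)) + p ^ (r : ℕ) * Fintype.card F ^ (a : ℕ) := by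
        have h3 : ∀ a' : Fin m, ∀ r' : Fin e, ((r, Sum.inl a) ::ₘ s).count (r', Sum.inl a') =
            s.count (r', Sum.inl a') + if r' = r then (if a' = a then 1 else 0) else 0 := by
          intro a' r'
          rw [Multiset.count_cons]
          congr 1
          by_cases h4 : r' = r <;> by_cases h5 : a' = a <;> simp [h4, h5]
        simp only [h3, add_mul, Finset.sum_add_distrib, ite_mul, zero_mul, one_mul,
          Finset.sum_ite_eq', Finset.mem_univ, if_true]
      rw [h1, h2, pow_add, mul_pow, mul_pow, ← pow_mul,
        mul_comm (p ^ (r : ℕ)) (Fintype.card F ^ (a : ℕ))]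
      ring
    · have h1 : frameBasis hm hk π σ h (Sum.inr b) (v + σ ((y - 1) * π v)) =
          frameBasis hm hk π σ h (Sum.inr b) v := by
        rw [map_add, frameBasis_inr, add_zero]
      have h2 : ∀ a' : Fin m, ∀ r' : Fin e, ((r, Sum.inr b) ::ₘ s).count (r', Sum.inl a') =
          s.count (r', Sum.inl a') := by
        intro a' r'
        rw [Multiset.count_cons_of_ne (by simp)]
      simp only [h1, h2]
      ring

/-- The homologies attached to a frame, as permutations. -/
def homologyEquiv (y : E) (hy : y ≠ 0) : V ≃ V where
  toFun v := v + σ ((y - 1) * π v)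
  invFun v := v + σ ((y⁻¹ - 1) * π v)
  left_inv v := by
    have : (y⁻¹ - 1) * π (v + σ ((y - 1) * π v)) = - ((y - 1) * π v) := by
      rw [map_add, h]; field_simp; ring
    beta_reduce
    rw [this, map_neg, add_neg_cancel_right]
  right_inv v := by
    have : (y - 1) * π (v + σ ((y⁻¹ - 1) * π v)) = - ((y⁻¹ - 1) * π v) := by
      rw [map_add, h]; field_simp; ring
    beta_reduce
    rw [this, map_neg, add_neg_cancel_right]

theorem count_const_of_pairing_ne_zero (hq : Fintype.card F = p ^ e) (f : V → E)
    (hf : ∀ y : E, y ^ (∑ a ∈ Finset.range m, Fintype.card F ^ a) = 1 →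
      ∃ (c : E) (Λ : V →+ E), ∀ v, f (v + σ ((y - 1) * π v)) = f v + c + Λ v)
    (s : Multiset (Fin e × (Fin m ⊕ Fin k)))
    (hs : Multiset.card s + 1 < e * ((m + k) * (p - 1))) (hlt : ∀ x, s.count x < p)
    (h0 : pairing f (tokMon (powTok p e) (frameBasis hm hk π σ h) s) ≠ 0) (r : Fin e)
    (a a' : Fin m) : s.count (r, Sum.inl a) = s.count (r, Sum.inl a') := by
  obtain ⟨y, hy0, hy1, hy⟩ := exists_norm_one_generator hm
  obtain ⟨c, Λ, hΛ⟩ := hf y hy1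
  have hp := (Fact.out : p.Prime).two_le
  have hV : Fintype.card V = p ^ (e * (m + k)) := by
    rw [Module.card_eq_pow_finrank (K := F), hq, hk, pow_mul]
  set N := ∑ a : Fin m, (∑ r : Fin e, s.count (r, Sum.inl a) * p ^ (r : ℕ)) *
        Fintype.card F ^ (a : ℕ) with hN
  have key : pairing f (tokMon (powTok p e) (frameBasis hm hk π σ h) s) =
      y ^ N * pairing f (tokMon (powTok p e) (frameBasis hm hk π σ h) s) := by
    have haff := pairing_affine (F := F) p e hV c Λ
      (s.map fun x => (x.1, frameBasis hm hk π σ h x.2))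
      (by rw [Multiset.card_map, mul_assoc]; exact hs)
    rw [← tokMon_eq_tokProd] at haff
    change ∑ v, f v * _ = y ^ N * ∑ v, f v * _
    conv_lhs => rw [← Equiv.sum_comp (homologyEquiv π σ h y hy0)]
    change ∑ v, f (v + σ ((y - 1) * π v)) *
      tokMon (powTok p e) (frameBasis hm hk π σ h) s (v + σ ((y - 1) * π v)) = _
    have h1 : ∀ v, f (v + σ ((y - 1) * π v)) *
      tokMon (powTok p e) (frameBasis hm hk π σ h) s (v + σ ((y - 1) * π v)) =
      y ^ N * (f v * tokMon (powTok p e) (frameBasis hm hk π σ h) s v) +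
      y ^ N * ((c + Λ v) * tokMon (powTok p e) (frameBasis hm hk π σ h) s v) := by
      intro v
      rw [hΛ, tokMon_frame_comp, ← hN]
      ring
    rw [Finset.sum_congr rfl fun v _ => h1 v, Finset.sum_add_distrib, ← Finset.mul_sum,
      ← Finset.mul_sum, haff, mul_zero, add_zero]
  have hdvd := hy N (by
    have : (1 - y ^ N) * pairing f (tokMon (powTok p e) (frameBasis hm hk π σ h) s) = 0 := by
      linear_combination key
    rcases mul_eq_zero.1 this with h | h
    · linear_combination -h
    · exact absurd h h0)
  have hx : ∀ a : Fin m, ∑ r : Fin e, s.count (r, Sum.inl a) * p ^ (r : ℕ) < Fintype.card F :=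
    fun a => hq ▸ digits_sum_le (by omega) e _ fun r => hlt _
  have h2 := digits_const (Fintype.one_lt_card (α := F)) _ hx (by
    rw [Fin.sum_univ_eq_sum_range (fun i => Fintype.card F ^ i)]
    exact hdvd) a a'
  exact congrFun (digits_unique e _ _ (fun r => hlt _) (fun r => hlt _) h2) r

end Poly

section Poly

open Module

variable {F E V : Type*} [Field F] [Field E] [Algebra F E] [Fintype F] [Finite E]
  [AddCommGroup V] [Module F V] [Fintype V] {m k p e : ℕ} [Fact p.Prime] [CharP E p]
  {ι : Type*} [Finite ι] [Nonempty ι]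

theorem frame_not_multiple (hm : finrank F E = m) (hk : finrank F V = m + k) (hkm : k + 1 < m)
    (h5 : 5 ≤ m) (π π' : V →ₗ[F] E) (σ σ' : E →ₗ[F] V) (h : ∀ x, π (σ x) = x)
    (h' : ∀ x, π' (σ' x) = x) (a b : Fin m) :
    ∃ b', b' ≠ a ∧ ∀ t : E, ∃ c, (frameBasis hm hk π' σ' h').coord (Sum.inl c)
      (frameBasis hm hk π σ h (Sum.inl b')) ≠
      t * (frameBasis hm hk π' σ' h').coord (Sum.inl c) (frameBasis hm hk π σ h (Sum.inl b)) := by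
  have hinj : Function.Injective σ' := fun x y hxy => by rw [← h' x, hxy, h']
  by_contra! H
  have key : ∀ b', b' ≠ a → ∃ t : E, ∀ x, π (σ' x) ^ Fintype.card F ^ (b' : ℕ) =
      t * π (σ' x) ^ Fintype.card F ^ (b : ℕ) := by
    intro b' hb'
    obtain ⟨t, ht⟩ := H b' hb'
    refine ⟨t, fun x => ?_⟩
    have := (frameBasis_coord_eq_zero_iff hm hk π' σ' h' (frameBasis hm hk π σ h (Sum.inl b') -
      t • frameBasis hm hk π σ h (Sum.inl b))).1 (fun c => by
        rw [map_sub, map_smul, smul_eq_mul, ht c, sub_self]) x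
    rw [LinearMap.sub_apply, LinearMap.smul_apply, frameBasis_inl, frameBasis_inl, smul_eq_mul,
      sub_eq_zero] at this
    exact this
  obtain ⟨b1, hb1, hb2⟩ : ∃ b1 : ℕ, ∃ h1 : b1 + 1 < m, (⟨b1, by omega⟩ : Fin m) ≠ a ∧
      (⟨b1 + 1, h1⟩ : Fin m) ≠ a := by
    by_cases ha : 2 ≤ (a : ℕ)
    · exact ⟨0, by omega, by rw [Ne, Fin.ext_iff]; simp; omega, by
        rw [Ne, Fin.ext_iff]; simp; omega⟩
    · exact ⟨2, by omega, by rw [Ne, Fin.ext_iff]; simp; omega, by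
        rw [Ne, Fin.ext_iff]; simp; omega⟩
  obtain ⟨t1, ht1⟩ := key _ hb2.1
  obtain ⟨t2, ht2⟩ := key _ hb2.2
  obtain ⟨x0, hx0⟩ := frame_comp_ne_zero hm hk (by omega) π σ σ' h hinj
  have ht0 : t1 ≠ 0 := by
    rintro rfl
    have := ht1 x0
    rw [zero_mul] at this
    exact hx0 (pow_eq_zero_iff (by positivity) |>.1 this)
  refine frame_not_semilinear hm hk hkm π σ σ' h hinj b1 (t2 / t1) fun x => ?_
  rw [ht2, ht1]
  field_simp

theorem exists_frame_not_multiple (hm : finrank F E = m) (hk : finrank F V = m + k) (hm0 : 0 < m)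
    (hk1 : 1 ≤ k) (π : ι → V →ₗ[F] E) (σ : ι → E →ₗ[F] V) (h : ∀ i x, π i (σ i x) = x)
    (hker : ∀ v, (∀ i, π i v = 0) → v = 0) (i : ι) :
    ∃ i' c, ∀ t : E, ∀ a, frameBasis hm hk (π i') (σ i') (h i') (Sum.inl c) ≠
      t • frameBasis hm hk (π i) (σ i) (h i) (Sum.inl a) := by
  by_contra! H
  have h1 := frame_ker hm hk (π i) (σ i) (h i)
  have h2 : LinearMap.ker (π i) = ⊥ := by
    rw [LinearMap.ker_eq_bot']
    intro v hv
    refine hker v fun i' => ?_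
    obtain ⟨t, a, hta⟩ := H i' ⟨0, hm0⟩
    have := LinearMap.congr_fun hta v
    rw [LinearMap.smul_apply, frameBasis_inl, frameBasis_inl, hv, zero_pow (by positivity),
      smul_zero] at this
    exact pow_eq_zero_iff (by positivity) |>.1 this
  rw [h2, finrank_bot] at h1
  omega

/-- A function which is quasi-invariant, up to affine functions, under the homologies of a
generating family of frames is affine off the origin. -/
theorem affine_of_frames (hq : Fintype.card F = p ^ e) (hm : finrank F E = m)
    (hk : finrank F V = m + k) (h5 : 5 ≤ m) (hk1 : 1 ≤ k) (hkm : k + 1 < m)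
    (π : ι → V →ₗ[F] E) (σ : ι → E →ₗ[F] V) (h : ∀ i x, π i (σ i x) = x)
    (hker : ∀ v, (∀ i, π i v = 0) → v = 0) (hran : ⨆ i, LinearMap.range (σ i) = ⊤) (f : V → E)
    (hf : ∀ i, ∀ y : E, y ^ (∑ a ∈ Finset.range m, Fintype.card F ^ a) = 1 →
      ∃ (c : E) (Λ : V →+ E), ∀ v, f (v + σ i ((y - 1) * π i v)) = f v + c + Λ v) :
    ∃ (c : E) (Λ : V →+ E), ∀ v ≠ 0, f v = c + Λ v := by
  classical
  have he : 1 ≤ e := by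
    by_contra he
    have := Fintype.one_lt_card (α := F)
    rw [hq, show e = 0 by omega, pow_zero] at this
    omega
  have hp := (Fact.out : p.Prime).two_le
  set f' : V → E := fun v => f v - if v = 0 then ∑ w, f w else 0 with hf'
  suffices H : ∃ Λ : V →+ E, ∀ v, f' v = f' 0 + Λ v by
    obtain ⟨Λ, hΛ⟩ := H
    refine ⟨f' 0, Λ, fun v hv => ?_⟩
    have := hΛ v
    rw [hf'] at this ⊢
    simpa only [hv, if_false, sub_zero] using this
  have hinv : ∀ i, ∀ y : E, y ^ (∑ a ∈ Finset.range m, Fintype.card F ^ a) = 1 →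
      ∃ (c : E) (Λ : V →+ E), ∀ v, f' (v + σ i ((y - 1) * π i v)) = f' v + c + Λ v := by
    intro i y hy
    obtain ⟨c, Λ, hΛ⟩ := hf i y hy
    refine ⟨c, Λ, fun v => ?_⟩
    have hy0 : y ≠ 0 := by
      rintro rfl
      rw [zero_pow] at hy
      · exact zero_ne_one hy
      · exact (Finset.sum_pos (fun _ _ => by positivity) ⟨0, Finset.mem_range.2 (by omega)⟩).ne'
    have h0 : v + σ i ((y - 1) * π i v) = 0 ↔ v = 0 := by
      have h1 := (homologyEquiv (π i) (σ i) (h i) y hy0).injective.eq_iff (a := v) (b := 0)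
      change v + σ i ((y - 1) * π i v) = 0 + σ i ((y - 1) * π i 0) ↔ _ at h1
      simpa using h1
    simp only [hf', h0, hΛ]
    ring
  have hΨ1 : pairing f' (1 : V → E) = 0 := by
    change ∑ v, f' v * 1 = 0
    simp [hf']
  have h2 : 2 ≤ finrank F V * (e * (p - 1)) := by
    have h1 : 1 ≤ e * (p - 1) := Nat.mul_pos he (by omega)
    rw [hk]
    nlinarith
  by_contra hcon
  have hex : ∃ d, ∃ s : Multiset (Fin e × (V →ₗ[F] E)), Multiset.card s = d ∧
      pairing f' (tokProd (powTok p e) s) ≠ 0 := by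
    by_contra! H
    exact hcon (affine_of_pairing_eq_zero hq f' (fun s _ => H _ s rfl) h2)
  set d := Nat.find hex with hd
  obtain ⟨s, hs, hs0⟩ := Nat.find_spec hex
  have htop : d + 1 < e * ((m + k) * (p - 1)) := by
    by_contra! H
    refine hcon (affine_of_pairing_eq_zero hq f' (fun s' hs' => ?_) h2)
    by_contra h0
    have := Nat.find_min' hex ⟨s', rfl, h0⟩
    rw [hk, ← mul_assoc, mul_comm (m + k), mul_assoc] at hs'
    omega
  have C : PolyCore (powTok p e) (pairing f') p m k d (e * ((m + k) * (p - 1)))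
      (fun i => frameBasis hm hk (π i) (σ i) (h i)) nxtFreq (ovFrob F) :=
    { prime := Fact.out
      char := inferInstance
      hm := h5
      hk := hk1
      hkm := hkm
      hd := htop
      min := fun s' hs' => by
        by_contra h0
        exact Nat.find_min hex hs' ⟨s', rfl, h0⟩
      nc := fun i s' hs' hlt h0 r a a' =>
        count_const_of_pairing_ne_zero hm hk (π i) (σ i) (h i) hq f' (hinv i) s' hs' hlt
          h0 r a a'
      ov := powTok_overflow hq
      span := by
        rw [top_le_iff]
        refine span_frobenius_frames π hm hker _ fun i a => ?_
        exact ⟨_, Submodule.subset_span ⟨(i, a), rfl⟩, fun v => frameBasis_inl ..⟩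
      sep := fun v hv => by
        have h1 : ∀ i, LinearMap.range (σ i) ≤ LinearMap.ker v := by
          rintro i _ ⟨x, rfl⟩
          exact (frameBasis_coord_eq_zero_iff hm hk _ _ (h i) v).1 (hv i) x
        have h2 := iSup_le h1
        rw [hran, top_le_iff, LinearMap.ker_eq_top] at h2
        exact h2
      sep' := fun i i' b => by
        by_contra! H
        obtain ⟨x, hx⟩ := frame_comp_ne_zero hm hk (by omega) (π i) (σ i) (σ i') (h i)
          (fun x y hxy => by rw [← h i' x, hxy, h])
        have := (frameBasis_coord_eq_zero_iff hm hk _ _ (h i') _).1 H x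
        rw [frameBasis_inl] at this
        exact hx (pow_eq_zero_iff (by positivity) |>.1 this)
      prop := fun i i' a b => frame_not_multiple hm hk hkm h5 (π i) (π i') (σ i) (σ i') (h i)
        (h i') a b
      neq := exists_frame_not_multiple hm hk (by omega) hk1 π σ h hker }
  obtain ⟨i⟩ := ‹Nonempty ι›
  have : Nonempty ι := ⟨i⟩
  exact C.false (by rw [Fintype.card_fin]) nxtFreq_cyclic hΨ1
    (fun r i c => ovFrob_frameBasis hm hk (π i) (σ i) (h i) r c)
    ⟨i, exists_last hm hk hk1 π σ h hran i⟩ s hs hs0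

end Poly

section Transitivity

open Module

variable {F E V : Type*} [Field F] [Field E] [Algebra F E] [Fintype F] [Finite E]
  [AddCommGroup V] [Module F V] [Finite V] {m k : ℕ}

theorem exists_addMonoidHom_ne_zero (F E : Type*) {D : Type*} [Field F] [Field E] [Algebra F E]
    [Finite F] [AddCommGroup D] [Module F D] (D0 : AddSubgroup D) (d : D) (hd : d ∉ D0) :
    ∃ f : D →+ E, f ≠ 0 ∧ ∀ x ∈ D0, f x = 0 := by
  obtain ⟨p, _⟩ := CharP.exists F
  have hp : Fact p.Prime := ⟨CharP.char_is_prime F p⟩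
  have : CharP E p := (algebraMap F E).charP_iff (algebraMap F E).injective p |>.1 inferInstance
  let _ := ZMod.algebra F p
  let _ := ZMod.algebra E p
  let _ := Module.compHom D (algebraMap (ZMod p) F)
  let D1 : Submodule (ZMod p) D := AddSubgroup.toZModSubmodule p D0
  obtain ⟨f, hf0, hf⟩ := Submodule.exists_le_ker_of_lt_top D1 (by
    rw [lt_top_iff_ne_top]
    intro h
    apply hd
    have : d ∈ D1 := h ▸ Submodule.mem_top
    exact this)
  refine ⟨(algebraMap (ZMod p) E).toAddMonoidHom.comp f.toAddMonoidHom, ?_, fun x hx => ?_⟩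
  · intro h
    apply hf0
    ext x
    have h1 := DFunLike.congr_fun h x
    apply (algebraMap (ZMod p) E).injective
    rw [LinearMap.zero_apply, map_zero]
    exact h1
  · have : f x = 0 := hf hx
    change algebraMap (ZMod p) E (f x) = 0
    rw [this, map_zero]

variable {ι : Type*} [Finite ι]

theorem exists_norm_one_ne_one (hm : finrank F E = m) (hm1 : 2 ≤ m) :
    ∃ y : E, y ^ (∑ a ∈ Finset.range m, Fintype.card F ^ a) = 1 ∧ y ≠ 1 := by
  obtain ⟨y, -, h1, h2⟩ := exists_norm_one_generator (F := F) hm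
  refine ⟨y, h1, ?_⟩
  rintro rfl
  have h3 := Nat.dvd_one.1 (h2 1 (one_pow 1))
  have h4 : ∑ a ∈ Finset.range 2, Fintype.card F ^ a ≤ ∑ a ∈ Finset.range m, Fintype.card F ^ a :=
    Finset.sum_le_sum_of_subset (Finset.range_mono hm1)
  simp [Finset.sum_range_succ] at h4
  have := Fintype.one_lt_card (α := F)
  omega

theorem addMonoidHom_eq_zero_of_frames (hm : finrank F E = m) (hm1 : 2 ≤ m)
    (π : ι → V →ₗ[F] E) (σ : ι → E →ₗ[F] V) (h : ∀ i x, π i (σ i x) = x)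
    (hran : ⨆ i, LinearMap.range (σ i) = ⊤) (D : Submodule F V) (hD : ∀ i, D ≤ LinearMap.ker (π i))
    (M : V →+ E) (hM : ∀ i, ∀ y : E, y ^ (∑ a ∈ Finset.range m, Fintype.card F ^ a) = 1 →
      ∀ v ∉ D, M (σ i ((y - 1) * π i v)) = 0) : M = 0 := by
  obtain ⟨y, hy, hy1⟩ := exists_norm_one_ne_one (F := F) hm hm1
  ext v
  have hv : v ∈ ⨆ i, LinearMap.range (σ i) := hran ▸ Submodule.mem_top
  induction hv using Submodule.iSup_induction' with
  | mem i x hx =>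
    obtain ⟨x, rfl⟩ := hx
    by_cases hx : x = 0
    · simp [hx]
    · have hy2 := sub_ne_zero.2 hy1
      have := hM i y hy (σ i ((y - 1)⁻¹ * x)) (fun hmem => by
        have h1 := hD i hmem
        rw [LinearMap.mem_ker, h] at h1
        exact mul_ne_zero (inv_ne_zero hy2) hx h1)
      rwa [h, mul_inv_cancel_left₀ hy2] at this
  | zero => simp
  | add x y _ _ hx hy =>
    rw [map_add, hx, hy]
    simp

theorem exists_prime_char (F E : Type*) [Field F] [Field E] [Algebra F E] [Fintype F] :
    ∃ p e : ℕ, Fact p.Prime ∧ CharP E p ∧ Fintype.card F = p ^ e := by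
  obtain ⟨p, _⟩ := CharP.exists F
  obtain ⟨e, hp, he⟩ := FiniteField.card F p
  exact ⟨p, e, ⟨hp⟩, (algebraMap F E).charP_iff (algebraMap F E).injective p |>.1 inferInstance, he⟩

/-- A relation preserved by the homologies of a generating family of frames is transitive on
nonzero vectors. -/
theorem rel_of_frames [Nonempty ι] (hm : finrank F E = m) (hk : finrank F V = m + k) (h5 : 5 ≤ m)
    (hk1 : 1 ≤ k)
    (hkm : k + 1 < m) (π : ι → V →ₗ[F] E) (σ : ι → E →ₗ[F] V) (h : ∀ i x, π i (σ i x) = x)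
    (hker : ∀ v, (∀ i, π i v = 0) → v = 0) (hran : ⨆ i, LinearMap.range (σ i) = ⊤)
    (r : V → V → Prop) (hr : Equivalence r)
    (hT : ∀ i, ∀ y : E, y ^ (∑ a ∈ Finset.range m, Fintype.card F ^ a) = 1 →
      ∀ v, r v (v + σ i ((y - 1) * π i v))) (v w : V) (hv : v ≠ 0) (hw : w ≠ 0) : r v w := by
  classical
  have : Fintype V := Fintype.ofFinite V
  obtain ⟨p, e, _, _, hq⟩ := exists_prime_char F E
  let f : V → E := fun x => if r v x then 1 else 0
  have hinv : ∀ i, ∀ y : E, y ^ (∑ a ∈ Finset.range m, Fintype.card F ^ a) = 1 →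
      ∀ x, f (x + σ i ((y - 1) * π i x)) = f x := by
    intro i y hy x
    have : r v (x + σ i ((y - 1) * π i x)) ↔ r v x :=
      ⟨fun h => hr.trans h (hr.symm (hT i y hy x)), fun h => hr.trans h (hT i y hy x)⟩
    simp only [f, this]
  obtain ⟨c, Λ, hΛ⟩ := affine_of_frames hq hm hk h5 hk1 hkm π σ h hker hran f
    fun i y hy => ⟨0, 0, fun x => by simp [hinv i y hy x]⟩
  have hne : ∀ i, ∀ y : E, y ^ (∑ a ∈ Finset.range m, Fintype.card F ^ a) = 1 → ∀ x ≠ 0,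
      x + σ i ((y - 1) * π i x) ≠ 0 := by
    intro i y hy x hx h0
    have hy0 : y ≠ 0 := by
      rintro rfl
      rw [zero_pow] at hy
      · exact zero_ne_one hy
      · exact (Finset.sum_pos (fun _ _ => by positivity) ⟨0, Finset.mem_range.2 (by omega)⟩).ne'
    apply hx
    apply (homologyEquiv (π i) (σ i) (h i) y hy0).injective
    change x + σ i ((y - 1) * π i x) = 0 + σ i ((y - 1) * π i 0)
    rw [h0]; simp
  have hΛ0 : Λ = 0 := by
    refine addMonoidHom_eq_zero_of_frames hm (by omega) π σ h hran ⊥ (fun _ => bot_le) Λ ?_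
    intro i y hy x hx
    have h1 := hinv i y hy x
    rw [hΛ _ (hne i y hy x hx), hΛ x hx, map_add] at h1
    linear_combination h1
  have h1 : f v = 1 := if_pos (hr.refl v)
  have h2 := hΛ w hw
  rw [hΛ0, show c = 1 by rw [← h1, hΛ v hv, hΛ0]; simp] at h2
  by_contra h3
  simp [f, h3] at h2

/-- A relation preserved by translations by `D` and by the homologies of a family of frames whose
kernels intersect in `D` is transitive outside `D`. -/
theorem rel_of_frames_quotient (hm : finrank F E = m) (hk : finrank F V = m + k) (h5 : 5 ≤ m)
    (hkm : k + 1 < m) (π : ι → V →ₗ[F] E) (σ : ι → E →ₗ[F] V) (h : ∀ i x, π i (σ i x) = x)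
    (D : Submodule F V) (hDk : finrank F D < k) (hD : ∀ v, v ∈ D ↔ ∀ i, π i v = 0)
    (hran : ⨆ i, LinearMap.range (σ i) = ⊤)
    (r : V → V → Prop) (hr : Equivalence r) (hrD : ∀ d ∈ D, ∀ v w, r v w → r (v + d) (w + d))
    (hT : ∀ i, ∀ y : E, y ^ (∑ a ∈ Finset.range m, Fintype.card F ^ a) = 1 →
      ∀ v, r v (v + σ i ((y - 1) * π i v))) (v w : V) (hv : v ∉ D) (hw : w ∉ D) : r v w := by
  classical
  have : Fintype V := Fintype.ofFinite V
  have hDle : ∀ i, D ≤ LinearMap.ker (π i) := fun i x hx => (hD x).1 hx i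
  have hne : Nonempty ι := by
    by_contra H
    rw [not_nonempty_iff] at H
    exact hv ((hD v).2 fun i => H.elim i)
  let π' : ι → V ⧸ D →ₗ[F] E := fun i => D.liftQ (π i) (hDle i)
  let σ' : ι → E →ₗ[F] V ⧸ D := fun i => D.mkQ.comp (σ i)
  have hπ' : ∀ i v, π' i (D.mkQ v) = π i v := fun i v => D.liftQ_apply _ _
  have h' : ∀ i x, π' i (σ' i x) = x := fun i x => by
    change π' i (D.mkQ (σ i x)) = x
    rw [hπ', h]
  have hk' : finrank F (V ⧸ D) = m + (k - finrank F D) := by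
    have := D.finrank_quotient_add_finrank
    omega
  have hker' : ∀ v, (∀ i, π' i v = 0) → v = 0 := by
    intro v
    obtain ⟨v, rfl⟩ := D.mkQ_surjective v
    intro hv
    rw [← LinearMap.mem_ker, D.ker_mkQ, hD]
    exact fun i => (hπ' i v).symm.trans (hv i)
  have hran' : ⨆ i, LinearMap.range (σ' i) = ⊤ := by
    simp only [σ', LinearMap.range_comp]
    rw [← Submodule.map_iSup, hran, Submodule.map_top, D.range_mkQ]
  have hT' : ∀ i (y : E) (v : V), D.mkQ v + σ' i ((y - 1) * π' i (D.mkQ v)) =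
      D.mkQ (v + σ i ((y - 1) * π i v)) := by
    intro i y v
    rw [map_add, hπ']
    rfl
  have step : ∀ v w : V, v ∉ D → w ∉ D → ∃ d ∈ D, r v (w + d) := by
    intro v w hv hw
    let R : V ⧸ D → V ⧸ D → Prop := fun a b => ∀ x y, D.mkQ x = a → D.mkQ y = b →
      ∃ d ∈ D, r x (y + d)
    have hsub : ∀ x y : V, D.mkQ x = D.mkQ y → x - y ∈ D := fun x y hxy => by
      rw [← D.ker_mkQ, LinearMap.mem_ker, map_sub, hxy, sub_self]
    have hR : ∀ x y : V, (∃ d ∈ D, r x (y + d)) → R (D.mkQ x) (D.mkQ y) := by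
      rintro x y ⟨d, hd, hxy⟩ x' y' hx' hy'
      refine ⟨y - y' + d + (x' - x), D.add_mem (D.add_mem (hsub _ _ hy'.symm) hd) (hsub _ _ hx'),
        ?_⟩
      have := hrD _ (hsub _ _ hx') _ _ hxy
      convert this using 1 <;> abel
    have hRe : Equivalence R := by
      refine ⟨fun a => ?_, fun {a b} hab => ?_, fun {a b c} hab hbc => ?_⟩
      · obtain ⟨x, rfl⟩ := D.mkQ_surjective a
        exact hR x x ⟨0, D.zero_mem, by simpa using hr.refl x⟩
      · obtain ⟨x, rfl⟩ := D.mkQ_surjective a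
        obtain ⟨y, rfl⟩ := D.mkQ_surjective b
        obtain ⟨d, hd, hxy⟩ := hab x y rfl rfl
        refine hR y x ⟨-d, D.neg_mem hd, ?_⟩
        have := hrD _ (D.neg_mem hd) _ _ (hr.symm hxy)
        rwa [add_neg_cancel_right] at this
      · obtain ⟨x, rfl⟩ := D.mkQ_surjective a
        obtain ⟨y, rfl⟩ := D.mkQ_surjective b
        obtain ⟨z, rfl⟩ := D.mkQ_surjective c
        obtain ⟨d, hd, hxy⟩ := hab x y rfl rfl
        obtain ⟨d', hd', hyz⟩ := hbc y z rfl rfl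
        refine hR x z ⟨d' + d, D.add_mem hd' hd, hr.trans hxy ?_⟩
        have := hrD d hd _ _ hyz
        rwa [add_assoc] at this
    have key := rel_of_frames hm hk' h5 (by omega) (by omega) π' σ' h' hker' hran' R hRe (by
      intro i y hy a
      obtain ⟨x, rfl⟩ := D.mkQ_surjective a
      rw [hT']
      exact hR _ _ ⟨0, D.zero_mem, by simpa using hT i y hy x⟩) (D.mkQ v) (D.mkQ w)
      (by rwa [Ne, ← LinearMap.mem_ker, D.ker_mkQ]) (by rwa [Ne, ← LinearMap.mem_ker, D.ker_mkQ])
    exact key v w rfl rfl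
  let D0 : AddSubgroup D :=
    { carrier := {d | r v (v + d)}
      add_mem' := fun {a b} ha hb => by
        have := hr.trans hb (hrD b b.2 _ _ ha)
        change r v _
        convert this using 1
        push_cast; abel
      zero_mem' := by simpa using hr.refl v
      neg_mem' := fun {a} ha => by
        have := hrD (-a : V) (D.neg_mem a.2) _ _ (hr.symm ha)
        rw [add_neg_cancel_right] at this
        simpa using this }
  suffices H : D0 = ⊤ by
    obtain ⟨d, hd, hvw⟩ := step w v hw hv
    have : (⟨d, hd⟩ : D) ∈ D0 := H ▸ AddSubgroup.mem_top _
    exact hr.trans this (hr.symm hvw)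
  by_contra hD0
  obtain ⟨d0, hd0⟩ : ∃ d, d ∉ D0 := by
    by_contra! H
    exact hD0 (eq_top_iff.2 fun d _ => H d)
  obtain ⟨lam, hlam, hlam0⟩ := exists_addMonoidHom_ne_zero F E D0 d0 hd0
  obtain ⟨pr, hpr⟩ := D.subtype.exists_leftInverse_of_injective (by simp)
  have hpr : ∀ d : D, pr d = d := fun d => LinearMap.congr_fun hpr d
  let L : V →+ E := lam.comp pr.toAddMonoidHom
  have hL : ∀ d : D, L d = lam d := fun d => by
    change lam (pr d) = _
    rw [hpr]
  choose! δ hδ hδr using fun x hx => step x v hx hv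
  let f : V → E := fun x => if x ∈ D then 0 else L (δ x)
  have hf : ∀ x ∉ D, ∀ d ∈ D, r x (v + d) → f x = L d := by
    intro x hx d hd hxd
    simp only [f, if_neg hx]
    have h1 := hrD _ (D.neg_mem hd) _ _ (hr.trans (hr.symm hxd) (hδr x hx))
    rw [add_neg_cancel_right, add_assoc] at h1
    have h2 : (⟨δ x + -d, D.add_mem (hδ x hx) (D.neg_mem hd)⟩ : D) ∈ D0 := h1
    have h3 := hlam0 _ h2
    rw [← hL] at h3
    simp only [map_add, map_neg] at h3
    linear_combination h3
  have hTD : ∀ i (y : E), y ^ (∑ a ∈ Finset.range m, Fintype.card F ^ a) = 1 → ∀ x ∉ D,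
      x + σ i ((y - 1) * π i x) ∉ D := by
    intro i y hy x hx h0
    have h1 := (hD _).1 h0
    have h2 := h1 i
    rw [map_add, h] at h2
    have h3 : y * π i x = 0 := by linear_combination h2
    have hy0 : y ≠ 0 := by
      rintro rfl
      rw [zero_pow] at hy
      · exact zero_ne_one hy
      · exact (Finset.sum_pos (fun _ _ => by positivity) ⟨0, Finset.mem_range.2 (by omega)⟩).ne'
    rw [(mul_eq_zero.1 h3).resolve_left hy0, mul_zero, map_zero, add_zero] at h0
    exact hx h0
  have hfT : ∀ i (y : E), y ^ (∑ a ∈ Finset.range m, Fintype.card F ^ a) = 1 → ∀ x ∉ D,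
      f (x + σ i ((y - 1) * π i x)) = f x := by
    intro i y hy x hx
    rw [hf x hx _ (hδ x hx) (hδr x hx)]
    exact hf _ (hTD i y hy x hx) _ (hδ x hx) (hr.trans (hr.symm (hT i y hy x)) (hδr x hx))
  have hfD : ∀ x ∉ D, ∀ d ∈ D, f (x + d) = f x + L d := by
    intro x hx d hd
    rw [hf x hx _ (hδ x hx) (hδr x hx), ← map_add]
    refine hf _ (fun h0 => hx ?_) _ (D.add_mem (hδ x hx) hd) ?_
    · simpa using D.sub_mem h0 hd
    · rw [← add_assoc]
      exact hrD d hd _ _ (hδr x hx)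
  let s := Function.surjInv D.mkQ_surjective
  have hs : ∀ a, D.mkQ (s a) = a := Function.surjInv_eq D.mkQ_surjective
  let f' : V ⧸ D → E := fun a => if a = 0 then 0 else f (s a) - L (s a)
  have hmk0 : ∀ x, D.mkQ x = 0 ↔ x ∈ D := fun x => by rw [← LinearMap.mem_ker, D.ker_mkQ]
  have hf' : ∀ x ∉ D, f' (D.mkQ x) = f x - L x := by
    intro x hx
    have hsx : s (D.mkQ x) ∉ D := by rwa [← hmk0, hs, hmk0]
    have hd : x - s (D.mkQ x) ∈ D := by rw [← hmk0, map_sub, hs, sub_self]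
    have h1 := hfD _ hsx _ hd
    rw [add_sub_cancel, map_sub] at h1
    simp only [f', hmk0, if_neg hx, h1]
    ring
  have : Fintype (V ⧸ D) := Fintype.ofFinite _
  obtain ⟨p, e, _, _, hq⟩ := exists_prime_char F E
  obtain ⟨c, Λ, hΛ⟩ := affine_of_frames hq hm hk' h5 (by omega) (by omega) π' σ' h' hker' hran' f'
    (by
      intro i y hy
      refine ⟨0, -(L.comp ((σ i).toAddMonoidHom.comp
        ((AddMonoidHom.mulLeft (y - 1)).comp (π' i).toAddMonoidHom))), fun a => ?_⟩
      obtain ⟨x, rfl⟩ := D.mkQ_surjective a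
      change _ = f' (D.mkQ x) + 0 + -(L (σ i ((y - 1) * π' i (D.mkQ x))))
      rw [hT', hπ']
      by_cases hx : x ∈ D
      · simp [(hD x).1 hx i]
      · rw [hf' _ (hTD i y hy x hx), hf' x hx, hfT i y hy x hx, map_add]
        ring)
  have hM : Λ.comp D.mkQ.toAddMonoidHom + L = 0 := by
    refine addMonoidHom_eq_zero_of_frames hm (by omega) π σ h hran D hDle _ fun i y hy x hx => ?_
    have h1 := hΛ (D.mkQ (x + σ i ((y - 1) * π i x))) (by
      rw [Ne, hmk0]; exact hTD i y hy x hx)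
    have h2 := hΛ (D.mkQ x) (by rwa [Ne, hmk0])
    rw [hf' _ (hTD i y hy x hx), hfT i y hy x hx, map_add, map_add, map_add] at h1
    rw [hf' x hx] at h2
    change Λ (D.mkQ _) + L _ = 0
    linear_combination h2 - h1
  apply hlam
  ext d
  have := DFunLike.congr_fun hM (d : V)
  change Λ (D.mkQ d) + L d = 0 at this
  rw [(hmk0 _).2 d.2, map_zero, zero_add, hL] at this
  exact this

end Transitivity

section FrameGeometry

open Module

variable {F E V : Type*} [Field F] [Field E] [Algebra F E] [Fintype F] [Finite E]
  [AddCommGroup V] [Module F V] [Finite V] {m k : ℕ}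

instance finite_frames : Finite ((V →ₗ[F] E) × (E →ₗ[F] V)) :=
  have : Finite (V →ₗ[F] E) := DFunLike.finite _
  have : Finite (E →ₗ[F] V) := DFunLike.finite _
  inferInstance

/-- A subspace of prescribed dimension between two given ones. -/
theorem exists_between_finrank {B A : Submodule F V} (hBA : B ≤ A) {t : ℕ} (h1 : finrank F B ≤ t)
    (h2 : t ≤ finrank F A) : ∃ C, B ≤ C ∧ C ≤ A ∧ finrank F C = t := by
  induction t, h1 using Nat.le_induction with
  | base => exact ⟨B, le_rfl, hBA, rfl⟩
  | succ t ht ih =>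
    obtain ⟨C, hBC, hCA, hC⟩ := ih (by omega)
    have hlt : C < A := lt_of_le_of_ne hCA (by rintro rfl; omega)
    obtain ⟨z, hz, hzC⟩ := SetLike.exists_of_lt hlt
    refine ⟨C ⊔ Submodule.span F {z}, hBC.trans le_sup_left, sup_le hCA ?_, ?_⟩
    · rwa [Submodule.span_singleton_le_iff_mem]
    · rw [Submodule.finrank_sup_span_singleton hzC, hC]

theorem eq_sup_span_of_finrank {C D : Submodule F V} {s : ℕ} (hCD : C ≤ D) (hC : finrank F C = s)
    (hD : finrank F D = s + 1) {z : V} (hz : z ∈ D) (hzC : z ∉ C) :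
    D = C ⊔ Submodule.span F {z} := by
  symm
  apply Submodule.eq_of_le_of_finrank_eq
  · exact sup_le hCD (by rwa [Submodule.span_singleton_le_iff_mem])
  · rw [Submodule.finrank_sup_span_singleton hzC, hC, hD]

theorem exists_eq_sup_span {D : Submodule F V} {s : ℕ} (hD : finrank F D = s + 1) :
    ∃ C : Submodule F V, ∃ z ∉ C, finrank F C = s ∧ D = C ⊔ Submodule.span F {z} := by
  obtain ⟨C, -, hCD, hC⟩ := exists_between_finrank (bot_le : ⊥ ≤ D) (t := s) (by simp) (by omega)
  have hlt : C < D := lt_of_le_of_ne hCD (by rintro rfl; omega)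
  obtain ⟨z, hz, hzC⟩ := SetLike.exists_of_lt hlt
  exact ⟨C, z, hzC, hC, eq_sup_span_of_finrank hCD hC hD hz hzC⟩

/-- The frames of homologies contained in `H` whose axis contains `D`. -/
def framesOver (H : Subgroup (V ≃ₗ[F] V)) (E : Type*) [Field E] [Algebra F E]
    (D : Submodule F V) : Set ((V →ₗ[F] E) × (E →ₗ[F] V)) :=
  {i | (∀ x, i.1 (i.2 x) = x) ∧ D ≤ LinearMap.ker i.1 ∧
    ∀ y : E, y ^ (∑ a ∈ Finset.range (finrank F E), Fintype.card F ^ a) = 1 →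
      ∃ h ∈ H, ∀ v, h v = v + i.2 ((y - 1) * i.1 v)}

/-- The intersection of the axes containing `D`. -/
def axisMeet (H : Subgroup (V ≃ₗ[F] V)) (E : Type*) [Field E] [Algebra F E] (D : Submodule F V) :
    Submodule F V := ⨅ i : framesOver H E D, LinearMap.ker i.1.1

/-- The span of the centers of the homologies whose axis contains `D`. -/
def centerJoin (H : Subgroup (V ≃ₗ[F] V)) (E : Type*) [Field E] [Algebra F E]
    (D : Submodule F V) : Submodule F V := ⨆ i : framesOver H E D, LinearMap.range i.1.2

/-- The pointwise stabilizers of `s`-dimensional subspaces are transitive off the subspace. -/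
def TransOff (H : Subgroup (V ≃ₗ[F] V)) (s : ℕ) : Prop :=
  ∀ D : Submodule F V, finrank F D = s → ∀ v w, v ∉ D → w ∉ D →
    ∃ h ∈ H, (∀ d ∈ D, h d = d) ∧ h v = w

variable {H : Subgroup (V ≃ₗ[F] V)} {D D' : Submodule F V}

theorem framesOver_anti (h : D ≤ D') : framesOver H E D' ⊆ framesOver H E D :=
  fun _ hi => ⟨hi.1, h.trans hi.2.1, hi.2.2⟩

theorem mem_axisMeet {v : V} : v ∈ axisMeet H E D ↔ ∀ i ∈ framesOver H E D, i.1 v = 0 := by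
  simp [axisMeet, Submodule.mem_iInf]

theorem le_axisMeet : D ≤ axisMeet H E D := fun _ hv => mem_axisMeet.2 fun _ hi => hi.2.1 hv

theorem axisMeet_le {i} (hi : i ∈ framesOver H E D) : axisMeet H E D ≤ LinearMap.ker i.1 :=
  fun _ hv => mem_axisMeet.1 hv _ hi

theorem le_centerJoin {i} (hi : i ∈ framesOver H E D) : LinearMap.range i.2 ≤ centerJoin H E D :=
  le_iSup (fun i : framesOver H E D => LinearMap.range i.1.2) ⟨i, hi⟩

theorem centerJoin_le {S : Submodule F V} (h : ∀ i ∈ framesOver H E D, LinearMap.range i.2 ≤ S) :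
    centerJoin H E D ≤ S := iSup_le fun i => h i.1 i.2

/-- Conjugation of frames. -/
def conjFrame (h : V ≃ₗ[F] V) (i : (V →ₗ[F] E) × (E →ₗ[F] V)) : (V →ₗ[F] E) × (E →ₗ[F] V) :=
  (i.1.comp h.symm.toLinearMap, h.toLinearMap.comp i.2)

theorem conjFrame_injective (h : V ≃ₗ[F] V) : Function.Injective (conjFrame (E := E) h) := by
  intro i j hij
  have h1 := congrArg Prod.fst hij
  have h2 := congrArg Prod.snd hij
  ext x
  · have := LinearMap.congr_fun h1 (h x)
    simpa [conjFrame] using this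
  · have := LinearMap.congr_fun h2 x
    simpa [conjFrame] using this

theorem conjFrame_mem {h : V ≃ₗ[F] V} (hh : h ∈ H) {i} (hi : i ∈ framesOver H E D) :
    conjFrame h i ∈ framesOver H E (D.map h.toLinearMap) := by
  refine ⟨fun x => ?_, ?_, fun y hy => ?_⟩
  · simp [conjFrame, hi.1]
  · rintro _ ⟨d, hd, rfl⟩
    have : i.1 d = 0 := hi.2.1 hd
    simp [conjFrame, this]
  · obtain ⟨g, hg, hgv⟩ := hi.2.2 y hy
    refine ⟨h * g * h⁻¹, H.mul_mem (H.mul_mem hh hg) (H.inv_mem hh), fun v => ?_⟩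
    change h (g (h.symm v)) = v + h (i.2 ((y - 1) * i.1 (h.symm v)))
    rw [hgv, map_add, LinearEquiv.apply_symm_apply]

theorem map_map_symm (h : V ≃ₗ[F] V) (D : Submodule F V) :
    (D.map h.toLinearMap).map (h⁻¹ : V ≃ₗ[F] V).toLinearMap = D := by
  rw [← Submodule.map_comp]
  convert Submodule.map_id D
  ext v
  exact h.symm_apply_apply v

theorem ncard_framesOver_map {h : V ≃ₗ[F] V} (hh : h ∈ H) :
    (framesOver H E (D.map h.toLinearMap)).ncard = (framesOver H E D).ncard := by
  have key : ∀ {h : V ≃ₗ[F] V} (_ : h ∈ H) (D : Submodule F V), (framesOver H E D).ncard ≤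
      (framesOver H E (D.map h.toLinearMap)).ncard := by
    intro h hh D
    rw [← Set.ncard_image_of_injective _ (conjFrame_injective h)]
    refine Set.ncard_le_ncard ?_ (Set.toFinite _)
    rintro _ ⟨i, hi, rfl⟩
    exact conjFrame_mem hh hi
  refine le_antisymm ?_ (key hh D)
  have := key (H.inv_mem hh) (D.map h.toLinearMap)
  rwa [map_map_symm] at this

theorem axisMeet_map {h : V ≃ₗ[F] V} (hh : h ∈ H) :
    axisMeet H E (D.map h.toLinearMap) = (axisMeet H E D).map h.toLinearMap := by
  have key : ∀ {h : V ≃ₗ[F] V} (_ : h ∈ H) (D : Submodule F V),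
      (axisMeet H E D).map h.toLinearMap ≤ axisMeet H E (D.map h.toLinearMap) := by
    rintro h hh D _ ⟨v, hv, rfl⟩
    refine mem_axisMeet.2 fun i hi => ?_
    have := conjFrame_mem (H.inv_mem hh) hi
    rw [map_map_symm] at this
    exact mem_axisMeet.1 hv _ this
  refine le_antisymm ?_ (key hh D)
  intro v hv
  have := key (H.inv_mem hh) (D.map h.toLinearMap)
  rw [map_map_symm] at this
  exact ⟨h⁻¹ v, this ⟨v, hv, rfl⟩, h.apply_symm_apply v⟩

theorem centerJoin_map {h : V ≃ₗ[F] V} (hh : h ∈ H) :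
    centerJoin H E (D.map h.toLinearMap) = (centerJoin H E D).map h.toLinearMap := by
  have key : ∀ {h : V ≃ₗ[F] V} (_ : h ∈ H) (D : Submodule F V),
      (centerJoin H E D).map h.toLinearMap ≤ centerJoin H E (D.map h.toLinearMap) := by
    intro h hh D
    rw [Submodule.map_le_iff_le_comap]
    refine centerJoin_le fun i hi => ?_
    rintro _ ⟨x, rfl⟩
    exact le_centerJoin (conjFrame_mem hh hi) ⟨x, rfl⟩
  refine le_antisymm ?_ (key hh D)
  intro v hv
  have := key (H.inv_mem hh) (D.map h.toLinearMap)
  rw [map_map_symm] at this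
  exact ⟨h⁻¹ v, this ⟨v, hv, rfl⟩, h.apply_symm_apply v⟩

theorem map_eq_of_fixes {h : V ≃ₗ[F] V} (hD : ∀ d ∈ D, h d = d) : D.map h.toLinearMap = D := by
  ext v
  constructor
  · rintro ⟨d, hd, rfl⟩
    change h d ∈ D
    rwa [hD d hd]
  · intro hv
    exact ⟨v, hv, hD v hv⟩

theorem map_sup_span {h : V ≃ₗ[F] V} {v w : V} (hD : ∀ d ∈ D, h d = d) (hv : h v = w) :
    (D ⊔ Submodule.span F {v}).map h.toLinearMap = D ⊔ Submodule.span F {w} := by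
  rw [Submodule.map_sup, map_eq_of_fixes hD, Submodule.map_span, Set.image_singleton]
  simp [hv]

/-- Transitivity of pointwise stabilizers on the span of the centers. -/
theorem trans_centerJoin (hm : finrank F E = m) (h5 : 5 ≤ m) {k' : ℕ}
    (hk' : finrank F (centerJoin H E D) = m + k') (hkm : k' + 1 < m)
    (hR : axisMeet H E D = D) (hDk : finrank F (D ⊓ centerJoin H E D : Submodule F V) < k')
    {v w : V} (hv : v ∈ centerJoin H E D) (hw : w ∈ centerJoin H E D) (hv' : v ∉ D)
    (hw' : w ∉ D) : ∃ h ∈ H, (∀ d ∈ D, h d = d) ∧ h v = w := by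
  set M := centerJoin H E D with hM
  let π : framesOver H E D → M →ₗ[F] E := fun i => i.1.1.comp M.subtype
  let σ : framesOver H E D → E →ₗ[F] M := fun i =>
    i.1.2.codRestrict M fun x => le_centerJoin i.2 ⟨x, rfl⟩
  let r : M → M → Prop := fun v w => ∃ h ∈ H, (∀ d ∈ D, h d = d) ∧ h v = w
  have hr : Equivalence r := by
    refine ⟨fun a => ⟨1, H.one_mem, fun _ _ => rfl, rfl⟩, ?_, ?_⟩
    · rintro a b ⟨h, hh, hd, hab⟩
      refine ⟨h⁻¹, H.inv_mem hh, fun d hdD => ?_, ?_⟩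
      · change h.symm d = d
        rw [LinearEquiv.symm_apply_eq, hd d hdD]
      · change h.symm b = a
        rw [LinearEquiv.symm_apply_eq, hab]
    · rintro a b c ⟨h, hh, hd, hab⟩ ⟨g, hg, hgd, hbc⟩
      refine ⟨g * h, H.mul_mem hg hh, fun d hdD => ?_, ?_⟩
      · change g (h d) = d
        rw [hd d hdD, hgd d hdD]
      · change g (h a) = c
        rw [hab, hbc]
  have key := rel_of_frames_quotient hm hk' h5 hkm π σ (fun i x => i.2.1 x) (D.comap M.subtype)
    (by
      rw [LinearEquiv.finrank_eq (Submodule.equivMapOfInjective M.subtype M.subtype_injective _),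
        Submodule.map_comap_eq, Submodule.range_subtype, inf_comm]
      exact hDk)
    (fun v => by
      rw [Submodule.mem_comap]
      conv_lhs => rw [← hR]
      rw [mem_axisMeet]
      exact ⟨fun h i => h i.1 i.2, fun h i hi => h ⟨i, hi⟩⟩)
    (by
      have h1 : ⨆ i, LinearMap.range (σ i) = (⨆ i : framesOver H E D, LinearMap.range i.1.2).comap
          M.subtype := by
        apply Submodule.map_injective_of_injective M.subtype_injective
        rw [Submodule.map_iSup, Submodule.map_comap_eq, Submodule.range_subtype]
        have : ∀ i, (LinearMap.range (σ i)).map M.subtype = LinearMap.range i.1.2 := by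
          intro i
          rw [← LinearMap.range_comp]
          rfl
        simp only [this]
        exact (inf_eq_right.2 le_rfl).symm
      rw [h1]
      exact Submodule.comap_subtype_self M)
    r hr
    (by
      rintro d hd a b ⟨h, hh, hhd, hab⟩
      refine ⟨h, hh, hhd, ?_⟩
      change h ((a : V) + d) = b + d
      rw [map_add, hab, hhd d hd])
    (by
      intro i y hy a
      subst hm
      obtain ⟨h, hh, hhv⟩ := i.2.2.2 y hy
      refine ⟨h, hh, fun d hd => ?_, hhv a⟩
      have : i.1.1 d = 0 := i.2.2.1 hd
      rw [hhv, this, mul_zero, map_zero, add_zero])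
    ⟨v, hv⟩ ⟨w, hw⟩ hv' hw'
  exact key

/-- Transitivity off `D` once `D` is an intersection of axes and the centers span. -/
theorem transOff_of (hm : finrank F E = m) (hk : finrank F V = m + k) (h5 : 5 ≤ m)
    (hkm : k + 1 < m) {s : ℕ} (hs : s < k) (hR : ∀ D : Submodule F V, finrank F D = s →
      axisMeet H E D = D) (hM : ∀ D : Submodule F V, finrank F D = s → centerJoin H E D = ⊤) :
    TransOff H s := by
  intro D hD v w hv hw
  have hM := hM D hD
  refine trans_centerJoin hm h5 (k' := k) (by rw [hM, finrank_top, hk]) hkm (hR D hD)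
    (by rw [hM, inf_top_eq, hD]; exact hs) (by rw [hM]; trivial) (by rw [hM]; trivial) hv hw

theorem exists_map_eq {s : ℕ} (hT : ∀ j < s, TransOff H j) (D1 D2 : Submodule F V)
    (h1 : finrank F D1 = s) (h2 : finrank F D2 = s) : ∃ h ∈ H, D1.map h.toLinearMap = D2 := by
  induction s generalizing D1 D2 with
  | zero =>
    rw [Submodule.finrank_eq_zero] at h1 h2
    exact ⟨1, H.one_mem, by rw [h1, h2, Submodule.map_bot]⟩
  | succ s ih =>
    obtain ⟨C1, z1, hz1, hC1, rfl⟩ := exists_eq_sup_span h1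
    obtain ⟨C2, z2, hz2, hC2, rfl⟩ := exists_eq_sup_span h2
    obtain ⟨h, hh, hC⟩ := ih (fun j hj => hT j (by omega)) C1 C2 hC1 hC2
    obtain ⟨g, hg, hgC, hgz⟩ := hT s (by omega) C2 hC2 (h z1) z2 (by
      rw [← hC]
      rintro ⟨x, hx, hxz⟩
      exact hz1 (h.injective hxz ▸ hx)) hz2
    refine ⟨g * h, H.mul_mem hg hh, ?_⟩
    have : (g * h : V ≃ₗ[F] V).toLinearMap = g.toLinearMap.comp h.toLinearMap := rfl
    rw [this, Submodule.map_comp, Submodule.map_sup, hC, Submodule.map_span, Set.image_singleton]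
    exact map_sup_span hgC hgz

end FrameGeometry

section FrameGeometry

open Module

variable {F E V : Type*} [Field F] [Field E] [Algebra F E] [Fintype F] [Finite E]
  [AddCommGroup V] [Module F V] [Finite V] {m k : ℕ}

/-- The contragredient action on the dual space. -/
abbrev dualAction (X : Subgroup (V ≃ₗ[F] V)) : MulAction X (Dual F V) where
  smul h φ := φ.comp (h⁻¹ : V ≃ₗ[F] V).toLinearMap
  one_smul _ := rfl
  mul_smul g h φ := by
    change φ.comp ((g * h : V ≃ₗ[F] V)⁻¹).toLinearMap = _
    rw [mul_inv_rev]
    rfl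

theorem card_fixed_dual (h : V ≃ₗ[F] V) :
    Nat.card {φ : Dual F V // φ.comp h.toLinearMap = φ} = Nat.card {v : V // h v = v} := by
  have e1 : Nat.card {v : V // h v = v} =
      Nat.card (LinearMap.ker (h.toLinearMap - LinearMap.id)) := by
    apply Nat.card_congr
    refine Equiv.subtypeEquivRight fun v => ?_
    simp [LinearMap.mem_ker, sub_eq_zero]
  have e2 : Nat.card {φ : Dual F V // φ.comp h.toLinearMap = φ} =
      Nat.card (LinearMap.ker (h.toLinearMap - LinearMap.id).dualMap) := by
    apply Nat.card_congr
    refine Equiv.subtypeEquivRight fun v => ?_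
    rw [LinearMap.mem_ker, LinearMap.dualMap_apply', LinearMap.comp_sub, sub_eq_zero]
    rfl
  rw [e1, e2, Module.natCard_eq_pow_finrank (K := F) (V := LinearMap.ker _),
    Module.natCard_eq_pow_finrank (K := F) (V := LinearMap.ker (h.toLinearMap - LinearMap.id))]
  congr 1
  have h1 := LinearMap.finrank_range_add_finrank_ker (h.toLinearMap - LinearMap.id)
  have h2 := LinearMap.finrank_range_add_finrank_ker (h.toLinearMap - LinearMap.id).dualMap
  rw [LinearMap.finrank_range_dualMap_eq_finrank_range, Subspace.dual_finrank_eq] at h2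
  omega

/-- A group acting on a finite vector space has as many orbits on the dual. -/
theorem card_orbits_dual (X : Subgroup (V ≃ₗ[F] V)) :
    Nat.card (Quotient (MulAction.orbitRel X V)) =
      Nat.card (Quotient (@MulAction.orbitRel X (Dual F V) _ (dualAction X))) := by
  classical
  have : Finite (V ≃ₗ[F] V) := DFunLike.finite _
  have : Finite (Dual F V) := DFunLike.finite _
  have : Fintype X := Fintype.ofFinite X
  let _ := dualAction X
  have : ∀ a : X, Fintype (MulAction.fixedBy V a) := fun a => Fintype.ofFinite _
  have : ∀ a : X, Fintype (MulAction.fixedBy (Dual F V) a) := fun a => Fintype.ofFinite _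
  have : Fintype (Quotient (MulAction.orbitRel X V)) := Fintype.ofFinite _
  have : Fintype (Quotient (MulAction.orbitRel X (Dual F V))) := Fintype.ofFinite _
  have h1 := MulAction.sum_card_fixedBy_eq_card_orbits_mul_card_group X V
  have h2 := MulAction.sum_card_fixedBy_eq_card_orbits_mul_card_group X (Dual F V)
  have h3 : ∑ a : X, Fintype.card (MulAction.fixedBy V a) =
      ∑ a : X, Fintype.card (MulAction.fixedBy (Dual F V) a) := by
    rw [← Equiv.sum_comp (Equiv.inv X)]
    refine Finset.sum_congr rfl fun a _ => ?_
    rw [← Nat.card_eq_fintype_card, ← Nat.card_eq_fintype_card]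
    exact (card_fixed_dual ((a⁻¹ : X) : V ≃ₗ[F] V)).symm
  rw [Nat.card_eq_fintype_card, Nat.card_eq_fintype_card]
  exact Nat.eq_of_mul_eq_mul_right Fintype.card_pos (h1.symm.trans (h3.trans h2))

/-- A group fixing `D` pointwise and transitive off `D` is transitive on the nonzero functionals
vanishing on `D`. -/
theorem exists_comp_eq (X : Subgroup (V ≃ₗ[F] V)) (D : Submodule F V)
    (hfix : ∀ h ∈ X, ∀ d ∈ D, h d = d) (htr : ∀ v w, v ∉ D → w ∉ D → ∃ h ∈ X, h v = w)
    (φ ψ : Dual F V) (hφ : φ ≠ 0) (hψ : ψ ≠ 0) (hφD : ∀ d ∈ D, φ d = 0) (hψD : ∀ d ∈ D, ψ d = 0) :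
    ∃ h ∈ X, ∀ v, φ (h v) = ψ v := by
  classical
  have : Finite (Dual F V) := DFunLike.finite _
  have : Finite (Dual F D) := DFunLike.finite _
  let _ := dualAction X
  obtain ⟨v0, hv0⟩ : ∃ v, φ v ≠ 0 := by
    by_contra! h
    exact hφ (LinearMap.ext h)
  have hv0D : v0 ∉ D := fun h => hv0 (hφD _ h)
  have hle : Nat.card (Quotient (MulAction.orbitRel X V)) ≤ Nat.card (Option D) := by
    let f : Option D → Quotient (MulAction.orbitRel X V) := fun o =>
      Quotient.mk _ (o.elim v0 Subtype.val)
    apply Nat.card_le_card_of_surjective f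
    intro x
    induction x using Quotient.inductionOn with
    | h v =>
      by_cases hv : v ∈ D
      · exact ⟨some ⟨v, hv⟩, rfl⟩
      · obtain ⟨h, hh, hv⟩ := htr v v0 hv hv0D
        exact ⟨none, Quotient.sound ⟨⟨h, hh⟩, hv⟩⟩
  by_contra! hno
  have hres : ∀ (f : Dual F D), ∃ g : Dual F V, g.comp D.subtype = f := fun f =>
    LinearMap.exists_extend f
  choose ext hext using hres
  let f : Option (Option {f : Dual F D // f ≠ 0}) ⊕ Unit → Dual F V := fun o =>
    match o with
    | .inl none => φ
    | .inl (some none) => 0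
    | .inl (some (some f)) => ext f.1
    | .inr _ => ψ
  have hinv : ∀ φ ψ : Dual F V, (MulAction.orbitRel X (Dual F V)).r φ ψ →
      ∃ h : X, ∀ v, φ (h.1 v) = ψ v := by
    rintro φ ψ ⟨h, rfl⟩
    refine ⟨h, fun v => ?_⟩
    change ψ (h.1.symm (h.1 v)) = ψ v
    rw [LinearEquiv.symm_apply_apply]
  have hle2 : Nat.card (Option (Option {f : Dual F D // f ≠ 0}) ⊕ Unit) ≤
      Nat.card (Quotient (MulAction.orbitRel X (Dual F V))) := by
    apply Nat.card_le_card_of_injective fun o => Quotient.mk _ (f o)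
    intro a b hab
    obtain ⟨h, hh⟩ := hinv _ _ (Quotient.exact hab)
    have hD : ∀ d : D, f a d = f b d := fun d => by
      rw [← hh, hfix h.1 h.2 d d.2]
    have hext' : ∀ f : {f : Dual F D // f ≠ 0}, ∃ d : D, ext f.1 d ≠ 0 := by
      intro f
      by_contra! h
      apply f.2
      rw [← hext f.1]
      exact LinearMap.ext h
    have h0 : ∀ χ : Dual F V, (∀ v, χ (h.1 v) = 0) → χ = 0 := fun χ h' => LinearMap.ext fun v => by
      rw [← h.1.apply_symm_apply v]
      exact h' _
    rcases a with (_ | _ | f1) | _ <;> rcases b with (_ | _ | f2) | _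
    · rfl
    · exact (hφ (h0 _ hh)).elim
    · obtain ⟨d, hd⟩ := hext' f2
      exact (hd ((hD d).symm.trans (hφD d d.2))).elim
    · obtain ⟨v, hv⟩ := hno h.1 h.2
      exact (hv (hh v)).elim
    · exact (hφ (LinearMap.ext fun v => (hh v).symm)).elim
    · rfl
    · obtain ⟨d, hd⟩ := hext' f2
      exact (hd (hD d).symm).elim
    · exact (hψ (LinearMap.ext fun v => (hh v).symm)).elim
    · obtain ⟨d, hd⟩ := hext' f1
      exact (hd ((hD d).trans (hφD d d.2))).elim
    · obtain ⟨d, hd⟩ := hext' f1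
      exact (hd (hD d)).elim
    · have : f1 = f2 := by
        apply Subtype.ext
        rw [← hext f1.1, ← hext f2.1]
        exact LinearMap.ext hD
      rw [this]
    · obtain ⟨d, hd⟩ := hext' f1
      exact (hd ((hD d).trans (hψD d d.2))).elim
    · obtain ⟨v, hv⟩ := hno (h.1⁻¹) (X.inv_mem h.2)
      refine (hv ?_).elim
      rw [← hh]
      exact congrArg ψ (h.1.apply_symm_apply v)
    · exact (hψ (h0 _ hh)).elim
    · obtain ⟨d, hd⟩ := hext' f2
      exact (hd ((hD d).symm.trans (hψD d d.2))).elim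
    · rfl
  have hcard : Nat.card (Dual F D) = Nat.card D := by
    rw [Module.natCard_eq_pow_finrank (K := F) (V := D),
      Module.natCard_eq_pow_finrank (K := F) (V := Dual F D), Subspace.dual_finrank_eq]
  have h4 : Nat.card (Option {f : Dual F D // f ≠ 0}) = Nat.card (Dual F D) :=
    Nat.card_congr (Equiv.optionSubtypeNe 0)
  have := card_orbits_dual X
  rw [Nat.card_sum, Finite.card_option, h4, hcard] at hle2
  rw [Finite.card_option] at hle
  simp only [Nat.card_unique] at hle2
  omega

end FrameGeometry

section FrameGeometry

open Module

variable {F E V : Type*} [Field F] [Field E] [Algebra F E] [Fintype F] [Finite E]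
  [AddCommGroup V] [Module F V] [Finite V] {m k : ℕ}

theorem dvd_of_pow_sub_one_dvd {q a b : ℕ} (hq : 2 ≤ q) (h : q ^ a - 1 ∣ q ^ b - 1) : a ∣ b := by
  have h1 := Nat.pow_sub_one_gcd_pow_sub_one q a b
  rw [Nat.gcd_eq_left h] at h1
  have h2 : q ^ a = q ^ Nat.gcd a b := by
    have := Nat.one_le_pow a q (by omega)
    have := Nat.one_le_pow (Nat.gcd a b) q (by omega)
    omega
  have h3 := Nat.pow_right_injective hq h2
  rw [h3]
  exact Nat.gcd_dvd_right a b

theorem ncard_sdiff {D A : Submodule F V} (h : D ≤ A) :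
    ((A : Set V) \ D).ncard = Fintype.card F ^ finrank F D *
      (Fintype.card F ^ (finrank F A - finrank F D) - 1) := by
  rw [Set.ncard_sdiff h (Set.toFinite _)]
  have h1 : ∀ S : Submodule F V, (S : Set V).ncard = Fintype.card F ^ finrank F S := fun S => by
    rw [← Nat.card_coe_set_eq, ← Nat.card_eq_fintype_card]
    exact Module.natCard_eq_pow_finrank (K := F) (V := S)
  rw [h1, h1, Nat.mul_sub, mul_one, ← pow_add, Nat.add_sub_cancel' (Submodule.finrank_mono h)]

/-- Subspaces partitioning the complement of `D` in `A` have dimension dividing that of `A`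
modulo `D`. -/
theorem dvd_of_partition {D A : Submodule F V} (hDA : D ≤ A) (R : V → Submodule F V) {e : ℕ}
    (hR : ∀ z ∈ A, z ∉ D → z ∈ R z ∧ D ≤ R z ∧ R z ≤ A ∧ finrank F (R z) = e + finrank F D)
    (hp : ∀ z ∈ A, z ∉ D → ∀ z' ∈ R z, z' ∉ D → R z' = R z) :
    e ∣ finrank F A - finrank F D := by
  classical
  have : Fintype V := Fintype.ofFinite V
  have hq := Fintype.one_lt_card (α := F)
  let T : Finset V := Finset.univ.filter fun z => z ∈ A ∧ z ∉ D
  have hT : ∀ z, z ∈ T ↔ z ∈ A ∧ z ∉ D := fun z => by simp [T]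
  have hTc : T.card = Fintype.card F ^ finrank F D *
      (Fintype.card F ^ (finrank F A - finrank F D) - 1) := by
    rw [← ncard_sdiff hDA, ← Set.ncard_coe_finset]
    congr 1
    ext z
    simp [hT]
  have hfib := Finset.card_eq_sum_card_image R T
  have hc : ∀ S ∈ T.image R, (T.filter fun z => R z = S).card = Fintype.card F ^ finrank F D *
      (Fintype.card F ^ e - 1) := by
    intro S hS
    obtain ⟨z, hz, rfl⟩ := Finset.mem_image.1 hS
    obtain ⟨hzA, hzD⟩ := (hT z).1 hz
    obtain ⟨h1, h2, h3, h4⟩ := hR z hzA hzD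
    have := ncard_sdiff h2
    rw [h4, Nat.add_sub_cancel] at this
    rw [← this, ← Set.ncard_coe_finset]
    congr 1
    ext z'
    simp only [Finset.coe_filter, hT, Set.mem_ofPred_eq, Set.mem_sdiff, SetLike.mem_coe]
    constructor
    · rintro ⟨⟨h5, h6⟩, h7⟩
      exact ⟨h7 ▸ (hR z' h5 h6).1, h6⟩
    · rintro ⟨h5, h6⟩
      exact ⟨⟨h3 h5, h6⟩, hp z hzA hzD z' h5 h6⟩
  rw [Finset.sum_congr rfl hc, Finset.sum_const, smul_eq_mul, hTc, mul_left_comm] at hfib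
  apply dvd_of_pow_sub_one_dvd hq
  refine ⟨(T.image R).card, ?_⟩
  rw [mul_comm]
  exact Nat.eq_of_mul_eq_mul_left (by positivity) hfib

variable {H : Subgroup (V ≃ₗ[F] V)}

theorem axisMeet_eq_of_mem {s : ℕ} (hT : TransOff H s) {D : Submodule F V} (hD : finrank F D = s)
    {z z' : V} (hz : z ∉ D) (hz' : z' ∉ D) (h : z' ∈ axisMeet H E (D ⊔ Submodule.span F {z})) :
    framesOver H E (D ⊔ Submodule.span F {z'}) = framesOver H E (D ⊔ Submodule.span F {z}) ∧
    axisMeet H E (D ⊔ Submodule.span F {z'}) = axisMeet H E (D ⊔ Submodule.span F {z}) := by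
  have hsub : framesOver H E (D ⊔ Submodule.span F {z}) ⊆
      framesOver H E (D ⊔ Submodule.span F {z'}) := by
    intro i hi
    refine ⟨hi.1, sup_le (le_sup_left.trans hi.2.1) ?_, hi.2.2⟩
    rw [Submodule.span_singleton_le_iff_mem]
    exact mem_axisMeet.1 h i hi
  obtain ⟨g, hg, hgD, hgz⟩ := hT D hD z z' hz hz'
  have := Set.eq_of_subset_of_ncard_le hsub (by
    rw [← map_sup_span hgD hgz, ncard_framesOver_map hg]) (Set.toFinite _)
  refine ⟨this.symm, ?_⟩
  unfold axisMeet
  rw [this]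

theorem finrank_axisMeet {s : ℕ} (hT : ∀ j < s, TransOff H j) (D1 D2 : Submodule F V)
    (h1 : finrank F D1 = s) (h2 : finrank F D2 = s) :
    finrank F (axisMeet H E D1) = finrank F (axisMeet H E D2) := by
  obtain ⟨h, hh, rfl⟩ := exists_map_eq hT D1 D2 h1 h2
  rw [axisMeet_map hh]
  exact (LinearEquiv.finrank_map_eq h _).symm

/-- An irreducible group containing the homologies of one frame, and elements moving only part of
its axis. -/
structure RichGroup (H : Subgroup (V ≃ₗ[F] V)) (E : Type*) [Field E] [Algebra F E] (m k : ℕ)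
    (i : (V →ₗ[F] E) × (E →ₗ[F] V)) : Prop where
  hm : finrank F E = m
  hk : finrank F V = m + k
  hkm : k + 1 < m
  h5 : 5 ≤ k
  irr : ∀ S : Submodule F V, (∀ h ∈ H, ∀ v ∈ S, h v ∈ S) → S = ⊥ ∨ S = ⊤
  ndvd : ¬ k ∣ m
  frame : i ∈ framesOver H E ⊥
  aux : ∀ e, 1 < e → e ∣ m → ∃ c ∈ H, ∃ A B : Submodule F V, IsCompl A B ∧
    A ≤ LinearMap.ker i.1 ∧ LinearMap.range i.2 ≤ B ∧ (∀ b ∈ B, c b = b) ∧ (∀ a ∈ A, c a ∈ A) ∧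
    (∀ S ≤ A, (∀ v ∈ S, c v ∈ S) → S = ⊥ ∨ S = A) ∧ ¬ e ∣ finrank F A ∧ 2 ≤ finrank F A ∧
    ∀ S, A ≤ S → S ≤ LinearMap.ker i.1 →
      (∀ h ∈ H, (∀ a ∈ A, h a = a) → ∀ v ∈ S, h v ∈ S) → S = A ∨ S = LinearMap.ker i.1

namespace RichGroup

variable {i : (V →ₗ[F] E) × (E →ₗ[F] V)}

theorem finrank_ker (K : RichGroup H E m k i) : finrank F (LinearMap.ker i.1) = k := by
  have := LinearMap.finrank_range_add_finrank_ker i.1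
  rw [LinearMap.range_eq_top.2 (fun x => ⟨i.2 x, K.frame.1 x⟩), finrank_top, K.hm, K.hk] at this
  omega

theorem mem_framesOver (K : RichGroup H E m k i)
    {D : Submodule F V} (h : D ≤ LinearMap.ker i.1) : i ∈ framesOver H E D :=
  ⟨K.frame.1, h, K.frame.2.2⟩

theorem transOff_zero (K : RichGroup H E m k i) : TransOff H 0 := by
  have inv : ∀ h ∈ H, (⊥ : Submodule F V).map h.toLinearMap = ⊥ := fun h _ => Submodule.map_bot _
  have hi := K.mem_framesOver bot_le
  have hk' := K.hkm
  have h5' := K.h5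
  have hR : axisMeet H E (⊥ : Submodule F V) = ⊥ := by
    refine (K.irr (axisMeet H E ⊥) fun h hh v hv => ?_).resolve_right fun h => ?_
    · have := axisMeet_map (E := E) (D := ⊥) hh
      rw [Submodule.map_bot] at this
      rw [this]
      exact ⟨v, hv, rfl⟩
    · have := Submodule.finrank_mono (axisMeet_le hi)
      rw [h, finrank_top, K.hk, K.finrank_ker] at this
      omega
  have hM : centerJoin H E (⊥ : Submodule F V) = ⊤ := by
    refine (K.irr (centerJoin H E ⊥) fun h hh v hv => ?_).resolve_left fun h => ?_
    · have := centerJoin_map (E := E) (D := ⊥) hh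
      rw [Submodule.map_bot] at this
      rw [this]
      exact ⟨v, hv, rfl⟩
    · have h1 := le_centerJoin hi
      rw [h] at h1
      have h2 : i.2 1 = 0 := h1 ⟨1, rfl⟩
      have h3 := hi.1 1
      rw [h2, map_zero] at h3
      exact zero_ne_one h3
  refine transOff_of K.hm K.hk (by omega) K.hkm (by omega) (fun D hD => ?_) (fun D hD => ?_) <;>
    rw [Submodule.finrank_eq_zero] at hD <;> subst hD
  · exact hR
  · exact hM

theorem dvd_sub (K : RichGroup H E m k i) {s e : ℕ} (hT : ∀ j < s + 1, TransOff H j)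
    (he : ∀ D : Submodule F V, finrank F D = s + 1 → finrank F (axisMeet H E D) = e + s)
    {D A : Submodule F V} (hD : finrank F D = s) (hDA : D ≤ A)
    (hA : ∀ z ∈ A, z ∉ D → axisMeet H E (D ⊔ Submodule.span F {z}) ≤ A) :
    e ∣ finrank F A - s := by
  rw [← hD]
  refine dvd_of_partition hDA (fun z => axisMeet H E (D ⊔ Submodule.span F {z})) ?_ ?_
  · intro z hz hzD
    refine ⟨le_axisMeet (le_sup_right (a := D) (Submodule.mem_span_singleton_self z)),
      le_sup_left.trans le_axisMeet, hA z hz hzD, ?_⟩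
    rw [he _ (by rw [Submodule.finrank_sup_span_singleton hzD, hD]), hD]
  · intro z hz hzD z' hz' hzD'
    exact (axisMeet_eq_of_mem (hT s (by omega)) hD hzD hzD' hz').2

theorem axisMeet_eq (K : RichGroup H E m k i)
    {s : ℕ} (hs : s + 1 ≤ k) (hT : ∀ j < s + 1, TransOff H j)
    (D : Submodule F V) (hD : finrank F D = s + 1) : axisMeet H E D = D := by
  have hkm := K.hkm
  obtain ⟨e, he⟩ : ∃ e, finrank F (axisMeet H E D) = e + s := by
    have := Submodule.finrank_mono (le_axisMeet (H := H) (E := E) (D := D))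
    exact ⟨finrank F (axisMeet H E D) - s, by omega⟩
  have he' : ∀ D : Submodule F V, finrank F D = s + 1 → finrank F (axisMeet H E D) = e + s :=
    fun D' hD' => by rw [finrank_axisMeet hT D' D hD' hD, he]
  obtain ⟨D0, -, hD0, hD0s⟩ := exists_between_finrank (bot_le : ⊥ ≤ LinearMap.ker i.1) (t := s)
    (by simp) (by rw [K.finrank_ker]; omega)
  have hd1 : e ∣ m + k - s := by
    have := K.dvd_sub hT he' hD0s le_top (fun z _ _ => le_top)
    rwa [finrank_top, K.hk] at this
  have hd2 : e ∣ k - s := by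
    have := K.dvd_sub hT he' hD0s hD0 (fun z hz _ => axisMeet_le (K.mem_framesOver
      (sup_le hD0 (by rwa [Submodule.span_singleton_le_iff_mem]))))
    rwa [K.finrank_ker] at this
  have hem : e ∣ m := by
    have := Nat.dvd_sub hd1 hd2
    rwa [show m + k - s - (k - s) = m by omega] at this
  have he0 : e ≠ 0 := by
    rintro rfl
    rw [zero_dvd_iff] at hem
    omega
  have he1 : e = 1 := by
    by_contra he1
    obtain ⟨c, hc, A, B, hAB, hAU, hWB, hcB, hcA, hirr, hndvd, hA2, hmax⟩ :=
      K.aux e (by omega) hem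
    have hfr := Submodule.finrank_add_eq_of_isCompl hAB
    have hAk := Submodule.finrank_mono hAU
    rw [K.finrank_ker] at hAk
    rw [K.hk] at hfr
    have hdisj : ∀ x ∈ A, x ∈ B → x = 0 := fun x h1 h2 =>
      Submodule.disjoint_def.1 hAB.disjoint x h1 h2
    have claim : ∀ D' ≤ B, finrank F D' = s → ∃ f ∈ B, f ∉ D' ∧
        A ≤ axisMeet H E (D' ⊔ Submodule.span F {f}) := by
      intro D' hD' hD's
      obtain ⟨f, hf, hfD, hfR⟩ : ∃ f ∈ B, f ∉ D' ∧
          ¬ axisMeet H E (D' ⊔ Submodule.span F {f}) ≤ B := by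
        by_contra! hno
        have := K.dvd_sub hT he' hD's hD' hno
        apply hndvd
        have h3 := Nat.dvd_sub hd1 this
        rwa [show m + k - s - (finrank F B - s) = finrank F A by omega] at h3
      refine ⟨f, hf, hfD, ?_⟩
      set R := axisMeet H E (D' ⊔ Submodule.span F {f}) with hRdef
      have hcR : ∀ v ∈ R, c v ∈ R := by
        intro v hv
        have h1 := axisMeet_map (E := E) (D := D' ⊔ Submodule.span F {f}) hc
        rw [map_sup_span (fun d hd => hcB d (hD' hd)) (hcB f hf), ← hRdef] at h1
        rw [h1]
        exact ⟨v, hv, rfl⟩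
      obtain ⟨v, hv, hvB⟩ := SetLike.not_le_iff_exists.1 hfR
      obtain ⟨a, ha, b, hb, rfl⟩ := Submodule.mem_sup.1
        (hAB.sup_eq_top ▸ Submodule.mem_top : v ∈ A ⊔ B)
      have ha0 : a ≠ 0 := by
        rintro rfl
        exact hvB (by rwa [zero_add])
      have hca : c a - a ∈ R := by
        have := R.sub_mem (hcR _ hv) hv
        rwa [map_add, hcB b hb, add_sub_add_right_eq_sub] at this
      have hca0 : c a - a ≠ 0 := by
        intro h0
        rw [sub_eq_zero] at h0
        rcases hirr (Submodule.span F {a}) (by rwa [Submodule.span_singleton_le_iff_mem]) (by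
          intro v hv
          obtain ⟨x, rfl⟩ := Submodule.mem_span_singleton.1 hv
          rw [map_smul, h0]
          exact hv) with h1 | h1
        · exact ha0 (Submodule.span_singleton_eq_bot.1 h1)
        · rw [← h1, finrank_span_singleton ha0] at hA2
          omega
      rcases hirr (R ⊓ A) inf_le_right (fun v hv => ⟨hcR v hv.1, hcA v hv.2⟩) with h1 | h1
      · exact (hca0 ((Submodule.mem_bot F).1 (h1 ▸ ⟨hca, A.sub_mem (hcA a ha) ha⟩))).elim
      · exact inf_eq_right.1 h1
    obtain ⟨u, hu, hu0⟩ : ∃ u ∈ A, u ≠ 0 := by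
      apply Submodule.exists_mem_ne_zero_of_ne_bot
      rintro rfl
      simp at hA2
    rcases Nat.eq_zero_or_pos s with rfl | hs0
    · obtain ⟨f, hf, hf0, hAR⟩ := claim ⊥ bot_le (by simp)
      have hR := (axisMeet_eq_of_mem (E := E) (hT 0 (by omega)) (D := (⊥ : Submodule F V)) (by simp)
        hf0 (by simpa using hu0) (hAR hu)).2
      set R := axisMeet H E (⊥ ⊔ Submodule.span F {u}) with hRdef
      rw [← hR] at hAR
      have hfR : f ∈ R := by
        rw [hR]
        exact le_axisMeet (Submodule.mem_sup_right (Submodule.mem_span_singleton_self f))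
      rcases hmax R hAR (axisMeet_le (K.mem_framesOver (sup_le bot_le
        (by rw [Submodule.span_singleton_le_iff_mem]; exact hAU hu)))) (by
          intro h hh hhA v hv
          have h1 := axisMeet_map (E := E) (D := ⊥ ⊔ Submodule.span F {u}) hh
          rw [map_sup_span (w := u) (by simp) (hhA u hu), ← hRdef] at h1
          rw [h1]
          exact ⟨v, hv, rfl⟩) with h1 | h1
      · exact hf0 ((Submodule.mem_bot F).2 (hdisj f (h1 ▸ hfR) hf))
      · have := he' (⊥ ⊔ Submodule.span F {u}) (by
          rw [Submodule.finrank_sup_span_singleton (by simpa using hu0), finrank_bot])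
        rw [← hRdef, h1, K.finrank_ker, add_zero] at this
        exact K.ndvd (this ▸ hem)
    · obtain ⟨C, -, hCB, hCs⟩ := exists_between_finrank (bot_le : ⊥ ≤ B) (t := s - 1)
        (by simp) (by omega)
      have hspan : Submodule.span F {u} < A := by
        refine lt_of_le_of_ne (by rwa [Submodule.span_singleton_le_iff_mem]) fun h => ?_
        rw [← h, finrank_span_singleton hu0] at hA2
        omega
      obtain ⟨u', hu', huu'⟩ := SetLike.exists_of_lt hspan
      have huC : u ∉ C := fun h => hu0 (hdisj u hu (hCB h))
      have hD's : finrank F (C ⊔ Submodule.span F {u} : Submodule F V) = s := by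
        rw [Submodule.finrank_sup_span_singleton huC, hCs]
        omega
      have hsep : ∀ d ∈ B, ∀ a ∈ A, d + a = 0 → d = 0 ∧ a = 0 := by
        intro d hd a ha h
        have h1 : d = -a := eq_neg_of_add_eq_zero_left h
        have h2 : d = 0 := hdisj d (h1 ▸ A.neg_mem ha) hd
        rw [h2, zero_add] at h
        exact ⟨h2, h⟩
      have hu'D : u' ∉ C ⊔ Submodule.span F {u} := by
        intro h
        obtain ⟨c', hc', y, hy, hcy⟩ := Submodule.mem_sup.1 h
        obtain ⟨-, h2⟩ := hsep c' (hCB hc') (y - u') (A.sub_mem (hspan.le hy) hu') (by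
          rw [← hcy]; abel)
        exact huu' (sub_eq_zero.1 h2 ▸ hy)
      have hBR : B ≤ axisMeet H E (C ⊔ Submodule.span F {u} ⊔ Submodule.span F {u'}) := by
        intro d hd
        by_cases hdC : d ∈ C
        · exact le_axisMeet (le_sup_left (b := Submodule.span F {u'})
            (le_sup_left (b := Submodule.span F {u}) hdC))
        obtain ⟨f, hf, hfD, hAR⟩ := claim (C ⊔ Submodule.span F {d})
          (sup_le hCB (by rwa [Submodule.span_singleton_le_iff_mem]))
          (by rw [Submodule.finrank_sup_span_singleton hdC, hCs]; omega)
        have hDB : C ⊔ Submodule.span F {d} ≤ B :=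
          sup_le hCB (by rwa [Submodule.span_singleton_le_iff_mem])
        have hR := (axisMeet_eq_of_mem (E := E) (hT s (by omega))
          (D := C ⊔ Submodule.span F {d})
          (by rw [Submodule.finrank_sup_span_singleton hdC, hCs]; omega)
          hfD (fun h => hu0 (hdisj u hu (hDB h))) (hAR hu)).2
        rw [← hR, sup_assoc, sup_comm (Submodule.span F {d}), ← sup_assoc] at hAR
        have hdD : d ∉ C ⊔ Submodule.span F {u} := by
          intro h
          obtain ⟨c', hc', y, hy, hcy⟩ := Submodule.mem_sup.1 h
          obtain ⟨h2, -⟩ := hsep (c' - d) (B.sub_mem (hCB hc') hd) y (hspan.le hy) (by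
            rw [← hcy]; abel)
          exact hdC (sub_eq_zero.1 h2 ▸ hc')
        have hR2 := (axisMeet_eq_of_mem (E := E) (hT s (by omega)) hD's hdD hu'D (hAR hu')).2
        rw [hR2]
        exact le_axisMeet (le_sup_right (a := C ⊔ Submodule.span F {u})
          (Submodule.mem_span_singleton_self d))
      have h1 := he' (C ⊔ Submodule.span F {u} ⊔ Submodule.span F {u'}) (by
        rw [Submodule.finrank_sup_span_singleton hu'D, hD's])
      obtain ⟨D1, -, hD1, hD1s⟩ := exists_between_finrank (bot_le : ⊥ ≤ LinearMap.ker i.1)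
        (t := s + 1) (by simp) (by rw [K.finrank_ker]; omega)
      have h2 := he' D1 hD1s
      have h3 := Submodule.finrank_mono (axisMeet_le (K.mem_framesOver hD1))
      rw [K.finrank_ker] at h3
      have h4 := Submodule.finrank_mono hBR
      omega
  symm
  apply Submodule.eq_of_le_of_finrank_eq le_axisMeet
  rw [he, hD, he1, add_comm]

end RichGroup

end FrameGeometry

section FrameGeometry

open Module

variable {F E V : Type*} [Field F] [Field E] [Algebra F E] [Fintype F] [Finite E]
  [AddCommGroup V] [Module F V] [Finite V] {m k : ℕ}

theorem ncard_mul_eq_ncard_mul {α β : Type*} [Finite α] [Finite β] (r : α → β → Prop) (S : Set α)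
    (T : Set β) {x y : ℕ} (hx : ∀ a ∈ S, {b | b ∈ T ∧ r a b}.ncard = x)
    (hy : ∀ b ∈ T, {a | a ∈ S ∧ r a b}.ncard = y) : S.ncard * x = T.ncard * y := by
  classical
  have : Fintype α := Fintype.ofFinite α
  have : Fintype β := Fintype.ofFinite β
  rw [Set.ncard_eq_toFinset_card' S, Set.ncard_eq_toFinset_card' T]
  refine Finset.card_mul_eq_card_mul r (fun a ha => ?_) (fun b hb => ?_)
  · rw [← hx a (by simpa using ha), Set.ncard_eq_toFinset_card']
    congr 1
    ext b
    simp [Finset.mem_bipartiteAbove]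
  · rw [← hy b (by simpa using hb), Set.ncard_eq_toFinset_card']
    congr 1
    ext b
    simp [Finset.mem_bipartiteBelow]

instance finite_dual : Finite (Dual F V) := DFunLike.finite _

/-- The nonzero functionals vanishing on `D`. -/
def annNonzero (D : Submodule F V) : Set (Dual F V) := {ξ | ξ ≠ 0 ∧ ∀ d ∈ D, ξ d = 0}

theorem ncard_annNonzero (D : Submodule F V) :
    (annNonzero D).ncard = Fintype.card F ^ (finrank F V - finrank F D) - 1 := by
  have h1 := ncard_sdiff (bot_le : ⊥ ≤ D.dualAnnihilator)
  have h2 := Subspace.finrank_add_finrank_dualAnnihilator_eq D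
  rw [finrank_bot, pow_zero, one_mul, Nat.sub_zero] at h1
  rw [← h2, Nat.add_sub_cancel_left, ← h1]
  congr 1
  ext ξ
  simp [annNonzero, Submodule.mem_dualAnnihilator, and_comm]

theorem ncard_compl (D : Submodule F V) : {z | z ∉ D}.ncard = Fintype.card F ^ finrank F D *
      (Fintype.card F ^ (finrank F V - finrank F D) - 1) := by
  have h1 := ncard_sdiff (le_top : D ≤ ⊤)
  rw [finrank_top] at h1
  rw [← h1]
  congr 1
  ext z
  simp

/-- The pointwise stabilizer of `D` in `H`. -/
def fixSub (H : Subgroup (V ≃ₗ[F] V)) (D : Submodule F V) : Subgroup (V ≃ₗ[F] V) where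
  carrier := {h | h ∈ H ∧ ∀ d ∈ D, h d = d}
  one_mem' := ⟨H.one_mem, fun _ _ => rfl⟩
  mul_mem' := by
    rintro a b ⟨ha, ha'⟩ ⟨hb, hb'⟩
    refine ⟨H.mul_mem ha hb, fun d hd => ?_⟩
    change a (b d) = d
    rw [hb' d hd, ha' d hd]
  inv_mem' := by
    rintro a ⟨ha, ha'⟩
    refine ⟨H.inv_mem ha, fun d hd => ?_⟩
    change a.symm d = d
    rw [LinearEquiv.symm_apply_eq, ha' d hd]

variable {H : Subgroup (V ≃ₗ[F] V)} {D : Submodule F V}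

theorem exists_dual_map {s : ℕ} (hT : TransOff H s) (hD : finrank F D = s) {ξ ψ : Dual F V}
    (hξ : ξ ∈ annNonzero D) (hψ : ψ ∈ annNonzero D) :
    ∃ h ∈ H, (∀ d ∈ D, h d = d) ∧ ∀ v, ξ (h v) = ψ v := by
  obtain ⟨h, hh, hv⟩ := exists_comp_eq (fixSub H D) D (fun h hh => hh.2) (fun v w hv hw => by
    obtain ⟨h, hh, hd, hvw⟩ := hT D hD v w hv hw
    exact ⟨h, ⟨hh, hd⟩, hvw⟩) ξ ψ hξ.1 hψ.1 hξ.2 hψ.2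
  exact ⟨h, hh.1, hh.2, hv⟩

theorem conjFrame_image {h : V ≃ₗ[F] V} (hh : h ∈ H) :
    framesOver H E (D.map h.toLinearMap) = conjFrame h '' framesOver H E D := by
  symm
  apply Set.eq_of_subset_of_ncard_le
  · rintro _ ⟨i, hi, rfl⟩
    exact conjFrame_mem hh hi
  · rw [Set.ncard_image_of_injective _ (conjFrame_injective h), ncard_framesOver_map hh]
  · exact Set.toFinite _

/-- The frames over `D` whose center is killed by `ξ`. -/
def framesUnder (H : Subgroup (V ≃ₗ[F] V)) (E : Type*) [Field E] [Algebra F E]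
    (D : Submodule F V) (ξ : Dual F V) : Set ((V →ₗ[F] E) × (E →ₗ[F] V)) :=
  {i | i ∈ framesOver H E D ∧ ∀ x, ξ (i.2 x) = 0}

theorem framesUnder_image {h : V ≃ₗ[F] V} (hh : h ∈ H) (hD : ∀ d ∈ D, h d = d) {ξ ψ : Dual F V}
    (hv : ∀ v, ξ (h v) = ψ v) : framesUnder H E D ξ = conjFrame h '' framesUnder H E D ψ := by
  have h1 := conjFrame_image (E := E) (D := D) hh
  rw [map_eq_of_fixes hD] at h1
  ext i
  constructor
  · rintro ⟨hi, hi'⟩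
    rw [h1] at hi
    obtain ⟨j, hj, rfl⟩ := hi
    refine ⟨j, ⟨hj, fun x => ?_⟩, rfl⟩
    rw [← hv]
    exact hi' x
  · rintro ⟨j, ⟨hj, hj'⟩, rfl⟩
    refine ⟨h1 ▸ ⟨j, hj, rfl⟩, fun x => ?_⟩
    exact (hv _).trans (hj' x)

/-- `ξ` and `z` determine the same frames over `D`. -/
def IsPolar (H : Subgroup (V ≃ₗ[F] V)) (E : Type*) [Field E] [Algebra F E]
    (D : Submodule F V) (ξ : Dual F V) (z : V) : Prop :=
  framesOver H E (D ⊔ Submodule.span F {z}) = framesUnder H E D ξ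

theorem isPolar_map {h : V ≃ₗ[F] V} (hh : h ∈ H) (hD : ∀ d ∈ D, h d = d) {ξ ψ : Dual F V}
    (hv : ∀ v, ξ (h v) = ψ v) {z : V} : IsPolar H E D ξ (h z) ↔ IsPolar H E D ψ z := by
  unfold IsPolar
  rw [framesUnder_image hh hD hv, ← map_sup_span hD rfl, conjFrame_image hh]
  exact (conjFrame_injective h).image_injective.eq_iff

namespace RichGroup

variable {i : (V →ₗ[F] E) × (E →ₗ[F] V)}

theorem finrank_ker_of_mem (K : RichGroup H E m k i)
    {j} (hj : j ∈ framesOver H E D) : finrank F (LinearMap.ker j.1) = k := by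
  have := LinearMap.finrank_range_add_finrank_ker j.1
  rw [LinearMap.range_eq_top.2 (fun x => ⟨j.2 x, hj.1 x⟩), finrank_top, K.hm, K.hk] at this
  omega

theorem finrank_sup_range (K : RichGroup H E m k i) {j} (hj : j ∈ framesOver H E D) :
    finrank F (D ⊔ LinearMap.range j.2 : Submodule F V) = finrank F D + m := by
  have h1 := Submodule.finrank_sup_add_finrank_inf_eq D (LinearMap.range j.2)
  have h2 : D ⊓ LinearMap.range j.2 = ⊥ := by
    rw [Submodule.eq_bot_iff]
    rintro _ ⟨h3, x, rfl⟩
    have := hj.2.1 h3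
    rw [LinearMap.mem_ker, hj.1] at this
    rw [this, map_zero]
  rw [h2, finrank_bot, LinearMap.finrank_range_of_inj
    (fun x y hxy => by rw [← hj.1 x, hxy, hj.1]), K.hm] at h1
  exact h1

theorem ncard_framesUnder (K : RichGroup H E m k i)
    {s : ℕ} (hT : TransOff H s) (hD : finrank F D = s) (hs : s < k)
    {ξ : Dual F V} (hξ : ξ ∈ annNonzero D) {z : V} (hz : z ∉ D) :
    (framesUnder H E D ξ).ncard = (framesOver H E (D ⊔ Submodule.span F {z})).ncard := by
  have hq := Fintype.one_lt_card (α := F)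
  have h1 := ncard_mul_eq_ncard_mul (fun (ξ : Dual F V) (j : (V →ₗ[F] E) × (E →ₗ[F] V)) =>
    ∀ x, ξ (j.2 x) = 0) (annNonzero D) (framesOver H E D) (x := (framesUnder H E D ξ).ncard)
    (y := Fintype.card F ^ (k - s) - 1) (fun ψ hψ => by
      obtain ⟨h, hh, hd, hv⟩ := exists_dual_map hT hD hψ hξ
      change (framesUnder H E D ψ).ncard = _
      rw [framesUnder_image hh hd hv, Set.ncard_image_of_injective _ (conjFrame_injective h)])
    (fun j hj => by
      have := ncard_annNonzero (D ⊔ LinearMap.range j.2)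
      rw [K.finrank_sup_range hj, hD, K.hk, show m + k - (s + m) = k - s by omega] at this
      rw [← this]
      congr 1
      ext ψ
      constructor
      · rintro ⟨⟨h1, h2⟩, h3⟩
        refine ⟨h1, fun d hd => ?_⟩
        obtain ⟨a, ha, _, ⟨x, rfl⟩, rfl⟩ := Submodule.mem_sup.1 hd
        rw [map_add, h2 a ha, h3, add_zero]
      · rintro ⟨h1, h2⟩
        exact ⟨⟨h1, fun d hd => h2 d (Submodule.mem_sup_left hd)⟩,
          fun x => h2 _ (Submodule.mem_sup_right ⟨x, rfl⟩)⟩)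
  have h2 := ncard_mul_eq_ncard_mul (fun (z : V) (j : (V →ₗ[F] E) × (E →ₗ[F] V)) =>
    j.1 z = 0) {z | z ∉ D} (framesOver H E D)
    (x := (framesOver H E (D ⊔ Submodule.span F {z})).ncard)
    (y := Fintype.card F ^ s * (Fintype.card F ^ (k - s) - 1)) (fun z' hz' => by
      obtain ⟨h, hh, hd, hv⟩ := hT D hD z z' hz hz'
      rw [← ncard_framesOver_map hh, map_sup_span hd hv]
      congr 1
      ext j
      constructor
      · rintro ⟨⟨h1, h2, h3⟩, h4⟩
        refine ⟨h1, sup_le h2 ?_, h3⟩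
        rwa [Submodule.span_singleton_le_iff_mem]
      · rintro ⟨h1, h2, h3⟩
        exact ⟨⟨h1, le_sup_left.trans h2, h3⟩,
          h2 (Submodule.mem_sup_right (Submodule.mem_span_singleton_self z'))⟩)
    (fun j hj => by
      have := ncard_sdiff hj.2.1
      rw [K.finrank_ker_of_mem hj, hD] at this
      rw [← this]
      congr 1
      ext z
      simp [and_comm])
  rw [ncard_annNonzero, hD] at h1
  rw [ncard_compl, hD, mul_assoc, mul_left_comm _ (Fintype.card F ^ s)] at h2
  have h3 := Nat.eq_of_mul_eq_mul_left (by positivity) h2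
  rw [← h3] at h1
  refine Nat.eq_of_mul_eq_mul_left ?_ h1
  have : 1 < Fintype.card F ^ (finrank F V - s) :=
    Nat.one_lt_pow (by rw [K.hk]; omega) hq
  omega

/-- A functional killing the span of the centers is polar. -/
theorem isPolar_of_kills (K : RichGroup H E m k i)
    {s : ℕ} (hT : TransOff H s) (hD : finrank F D = s) (hs : s < k)
    {ξ : Dual F V} (hξ : ξ ∈ annNonzero D) {z : V} (hz : z ∉ D)
    (h : ∀ v ∈ centerJoin H E (D ⊔ Submodule.span F {z}), ξ v = 0) : IsPolar H E D ξ z := by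
  apply Set.eq_of_subset_of_ncard_le
  · intro j hj
    exact ⟨framesOver_anti le_sup_left hj, fun x => h _ (le_centerJoin hj ⟨x, rfl⟩)⟩
  · rw [K.ncard_framesUnder hT hD hs hξ hz]
  · exact Set.toFinite _

theorem isPolar_kills (K : RichGroup H E m k i) {ξ : Dual F V} {z : V} (h : IsPolar H E D ξ z) :
    ∀ v ∈ centerJoin H E (D ⊔ Submodule.span F {z}), ξ v = 0 := by
  have : centerJoin H E (D ⊔ Submodule.span F {z}) ≤ LinearMap.ker ξ := by
    refine centerJoin_le fun j hj => ?_
    rintro _ ⟨x, rfl⟩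
    rw [h] at hj
    exact hj.2 x
  exact fun v hv => this hv

/-- Polar functionals are unique up to scalars. -/
theorem isPolar_unique (K : RichGroup H E m k i)
    {s : ℕ} (hT : TransOff H s) (hD : finrank F D = s) (hs : s < k)
    (hR : ∀ D : Submodule F V, finrank F D = s + 1 → axisMeet H E D = D)
    {ξ0 : Dual F V} (hξ0 : ξ0 ∈ annNonzero D) {z0 : V} (hz0 : z0 ∉ D) (h0 : IsPolar H E D ξ0 z0)
    {ξ ψ : Dual F V} (hξ : ξ ∈ annNonzero D) (hψ : ψ ∈ annNonzero D) {z : V} (hz : z ∉ D)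
    (h1 : IsPolar H E D ξ z) (h2 : IsPolar H E D ψ z) : ψ ∈ Submodule.span F {ξ} := by
  have hq := Fintype.one_lt_card (α := F)
  have hpt : ∀ {ξ z z'}, z ∉ D → z' ∉ D → IsPolar H E D ξ z → IsPolar H E D ξ z' →
      D ⊔ Submodule.span F {z'} = D ⊔ Submodule.span F {z} := by
    intro ξ z z' hz hz' h h'
    rw [← hR (D ⊔ Submodule.span F {z}) (by rw [Submodule.finrank_sup_span_singleton hz, hD]),
      ← hR (D ⊔ Submodule.span F {z'}) (by rw [Submodule.finrank_sup_span_singleton hz', hD])]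
    unfold axisMeet
    rw [show framesOver H E (D ⊔ Submodule.span F {z'}) = framesOver H E (D ⊔ Submodule.span F {z})
      from h'.trans h.symm]
  have hc := ncard_mul_eq_ncard_mul (fun (ξ : Dual F V) z => IsPolar H E D ξ z) (annNonzero D)
    {z | z ∉ D} (x := Fintype.card F ^ s * (Fintype.card F - 1))
    (y := {ψ | ψ ∈ annNonzero D ∧ IsPolar H E D ψ z}.ncard)
    (fun χ hχ => by
      obtain ⟨h, hh, hd, hv⟩ := exists_dual_map hT hD hχ hξ0
      have h3 := (isPolar_map hh hd hv).2 h0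
      have hz3 : h z0 ∉ D := fun h4 => hz0 (by
        have := h.injective (hd _ h4)
        rwa [this] at h4)
      have h4 := ncard_sdiff (le_sup_left : D ≤ D ⊔ Submodule.span F {h z0})
      rw [Submodule.finrank_sup_span_singleton hz3, hD, Nat.add_sub_cancel_left, pow_one] at h4
      rw [← h4]
      congr 1
      ext z'
      constructor
      · rintro ⟨h5, h6⟩
        refine ⟨?_, h5⟩
        rw [← hpt hz3 h5 h3 h6]
        exact Submodule.mem_sup_right (Submodule.mem_span_singleton_self z')
      · rintro ⟨h5, h6⟩
        refine ⟨h6, ?_⟩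
        unfold IsPolar at h3 ⊢
        rw [← h3]
        have h7 : D ⊔ Submodule.span F {z'} = D ⊔ Submodule.span F {h z0} := by
          symm
          apply eq_sup_span_of_finrank le_sup_left hD _ h5 h6
          rw [Submodule.finrank_sup_span_singleton hz3, hD]
        rw [h7])
    (fun z' hz' => by
      obtain ⟨h, hh, hd, hv⟩ := hT D hD z' z hz' hz
      have hinj : Function.Injective fun ψ : Dual F V => ψ.comp h.symm.toLinearMap := by
        intro ψ χ hψχ
        ext v
        have := LinearMap.congr_fun hψχ (h v)
        simpa using this
      rw [← Set.ncard_image_of_injective _ hinj]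
      congr 1
      have hmem : ∀ ψ : Dual F V, ψ.comp h.symm.toLinearMap ∈ annNonzero D ∧
          IsPolar H E D (ψ.comp h.symm.toLinearMap) z ↔ ψ ∈ annNonzero D ∧ IsPolar H E D ψ z' := by
        intro ψ
        have e1 := isPolar_map (E := E) (z := z') hh hd (ξ := ψ.comp h.symm.toLinearMap) (ψ := ψ)
          (fun v => by simp)
        rw [hv] at e1
        rw [e1]
        refine and_congr (and_congr ?_ ?_) Iff.rfl
        · rw [not_iff_not]
          exact ⟨fun h => hinj (h.trans (LinearMap.zero_comp _).symm),
            fun h => by rw [h, LinearMap.zero_comp]⟩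
        · refine forall₂_congr fun d hdD => ?_
          have : h.symm d = d := by rw [LinearEquiv.symm_apply_eq, hd d hdD]
          simp [this]
      ext χ
      constructor
      · rintro ⟨ψ, hψ, rfl⟩
        exact (hmem ψ).2 hψ
      · intro hχ
        have : (χ.comp h.toLinearMap).comp h.symm.toLinearMap = χ := by
          ext v
          simp
        refine ⟨χ.comp h.toLinearMap, (hmem _).1 ?_, this⟩
        rw [this]
        exact hχ)
  rw [ncard_annNonzero, ncard_compl, hD] at hc
  have hpos : 0 < Fintype.card F ^ s * (Fintype.card F ^ (finrank F V - s) - 1) := by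
    have : 1 < Fintype.card F ^ (finrank F V - s) :=
      Nat.one_lt_pow (by rw [K.hk]; omega) hq
    have : 0 < Fintype.card F ^ (finrank F V - s) - 1 := by omega
    positivity
  have hc' := Nat.eq_of_mul_eq_mul_left hpos ((by rw [← hc]; ring :
    Fintype.card F ^ s * (Fintype.card F ^ (finrank F V - s) - 1) * (Fintype.card F - 1) = _))
  have h4 := ncard_sdiff (bot_le : ⊥ ≤ Submodule.span F {ξ})
  rw [finrank_bot, pow_zero, one_mul, Nat.sub_zero, finrank_span_singleton hξ.1, pow_one] at h4
  have hsub : ((Submodule.span F {ξ} : Set (Dual F V)) \ (⊥ : Submodule F (Dual F V))) ⊆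
      {ψ | ψ ∈ annNonzero D ∧ IsPolar H E D ψ z} := by
    rintro χ ⟨h5, h6⟩
    obtain ⟨c, rfl⟩ := Submodule.mem_span_singleton.1 h5
    have hc0 : c ≠ 0 := by
      rintro rfl
      exact h6 (by simp)
    refine ⟨⟨smul_ne_zero hc0 hξ.1, fun d hd => ?_⟩, ?_⟩
    · rw [LinearMap.smul_apply, hξ.2 d hd, smul_zero]
    · unfold IsPolar at h1 ⊢
      rw [h1]
      unfold framesUnder
      ext j
      simp [hc0]
  have := Set.eq_of_subset_of_ncard_le hsub (by rw [h4, hc']) (Set.toFinite _)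
  exact (this.symm ▸ (⟨hψ, h2⟩ : ψ ∈ {ψ | ψ ∈ annNonzero D ∧ IsPolar H E D ψ z}) :
    ψ ∈ ((Submodule.span F {ξ} : Set (Dual F V)) \ (⊥ : Submodule F (Dual F V)))).1

end RichGroup

end FrameGeometry

section FrameGeometry

open Module Polynomial

variable {F E V : Type*} [Field F] [Field E] [Algebra F E] [Fintype F] [Finite E]
  [AddCommGroup V] [Module F V] [Finite V] {m k : ℕ}

theorem exists_eq_smul_add_smul {L1 L2 L3 : Dual F V}
    (h : ∀ v, L1 v = 0 → L2 v = 0 → L3 v = 0) : ∃ s t : F, L3 = s • L1 + t • L2 := by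
  have h1 := mem_span_of_iInf_ker_le_ker (L := ![L1, L2]) (K := L3) (fun v hv => by
    rw [Submodule.mem_iInf] at hv
    exact h v (hv 0) (hv 1))
  rw [Matrix.range_cons, Matrix.range_cons, Matrix.range_empty, Set.union_empty,
    Set.singleton_union, Submodule.mem_span_pair] at h1
  obtain ⟨s, t, h⟩ := h1
  exact ⟨s, t, h.symm⟩

theorem exists_norm (hm : finrank F E = m) {a : E} (ha : a ≠ 0) :
    ∃ ν : F, algebraMap F E ν = a ^ (∑ j ∈ Finset.range m, Fintype.card F ^ j) := by
  have : Fintype E := Fintype.ofFinite E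
  have hq := Fintype.one_lt_card (α := F)
  apply mem_range_algebraMap_of_pow_card
  have h1 := geom_sum_mul_add (Fintype.card F - 1) m
  rw [Nat.sub_add_cancel (by omega)] at h1
  have h2 := FiniteField.pow_card_sub_one_eq_one a ha
  rw [Module.card_eq_pow_finrank (K := F) (V := E), hm, ← h1, Nat.add_sub_cancel, pow_mul] at h2
  calc (a ^ (∑ j ∈ Finset.range m, Fintype.card F ^ j)) ^ Fintype.card F
      = (a ^ (∑ j ∈ Finset.range m, Fintype.card F ^ j)) ^ (Fintype.card F - 1) *
        a ^ (∑ j ∈ Finset.range m, Fintype.card F ^ j) := by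
        rw [← pow_succ, Nat.sub_add_cancel (by omega)]
    _ = _ := by rw [h2, one_mul]

/-- There is no polarity of `E` compatible with the norm one group. -/
theorem no_norm_polarity (hm : finrank F E = m) (h7 : 7 ≤ m) (L : E → Dual F E)
    (h0 : ∀ a, a ≠ 0 → L a ≠ 0)
    (heq : ∀ y : E, y ^ (∑ a ∈ Finset.range m, Fintype.card F ^ a) = 1 → ∀ a, a ≠ 0 → ∀ x,
      L (y * a) (y * x) = 0 ↔ L a x = 0)
    (hdep : ∀ a, a ≠ 0 → 1 + a ≠ 0 → ∃ s t : F, L (1 + a) = s • L 1 + t • L a) : False := by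
  classical
  have : Fintype E := Fintype.ofFinite E
  have hq := Fintype.one_lt_card (α := F)
  set N := ∑ a ∈ Finset.range m, Fintype.card F ^ a with hN
  have hN0 : N ≠ 0 := by
    have : Fintype.card F ^ 0 ≤ N :=
      Finset.single_le_sum (f := fun a => Fintype.card F ^ a) (fun _ _ => Nat.zero_le _)
        (Finset.mem_range.2 (by omega))
    rw [pow_zero] at this
    omega
  let T : E →ₗ[F] Dual F E := (LinearMap.mul F E).compr₂ (L 1)
  have hT : ∀ b x, T b x = L 1 (b * x) := fun _ _ => rfl
  have hTi : Function.Injective T := by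
    rw [← LinearMap.ker_eq_bot, LinearMap.ker_eq_bot']
    intro b hb
    by_contra hb0
    apply h0 1 one_ne_zero
    ext x
    rw [← mul_inv_cancel_left₀ hb0 x, ← hT, hb]
    simp
  have hTs : Function.Surjective T :=
    (LinearMap.injective_iff_surjective_of_finrank_eq_finrank
      (Subspace.dual_finrank_eq (K := F) (V := E)).symm).1 hTi
  choose β hβ using fun a => hTs (L a)
  have hβ0 : ∀ a, a ≠ 0 → β a ≠ 0 := fun a ha h => h0 a ha (by rw [← hβ, h, map_zero])
  have hG : ∀ y : E, y ^ N = 1 → ∀ a, a ≠ 0 →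
      ∃ c : F, c ≠ 0 ∧ (y * a) * β (y * a) = c • (a * β a) := by
    intro y hy a ha
    have hy0 : y ≠ 0 := by
      rintro rfl
      rw [zero_pow hN0] at hy
      exact zero_ne_one hy
    obtain ⟨s, t, hst⟩ := exists_eq_smul_add_smul (L1 := L a) (L2 := L a)
      (L3 := T (y * β (y * a))) (fun x hx _ => by
        rw [hT, mul_comm y, mul_assoc, ← hT, hβ]
        exact (heq y hy a ha x).2 hx)
    rw [← add_smul, ← hβ a, ← map_smul] at hst
    have h1 := hTi hst
    refine ⟨s + t, fun h => ?_, ?_⟩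
    · rw [h, zero_smul] at h1
      exact mul_ne_zero hy0 (hβ0 _ (mul_ne_zero hy0 ha)) h1
    · rw [mul_right_comm, h1, smul_mul_assoc, mul_comm a]
  obtain ⟨γ, hγ⟩ : ∃ γ : F → E, ∀ a, a ≠ 0 → ∃ ν c : F, c ≠ 0 ∧ γ ν ≠ 0 ∧ a * β a = c • γ ν := by
    refine ⟨fun ν => if h : ∃ b : E, b ≠ 0 ∧ algebraMap F E ν = b ^ N then
      h.choose * β h.choose else 0, fun a ha => ?_⟩
    obtain ⟨ν, hν⟩ := exists_norm hm ha
    have h : ∃ b : E, b ≠ 0 ∧ algebraMap F E ν = b ^ N := ⟨a, ha, hν⟩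
    obtain ⟨c, hc, hca⟩ := hG (a / h.choose) (by
      rw [div_pow, ← h.choose_spec.2, ← hν, div_self]
      rw [hν]
      exact pow_ne_zero _ ha) h.choose h.choose_spec.1
    rw [div_mul_cancel₀ _ h.choose_spec.1] at hca
    refine ⟨ν, c, hc, ?_, ?_⟩
    · beta_reduce
      rw [dif_pos h]
      exact mul_ne_zero h.choose_spec.1 (hβ0 _ h.choose_spec.1)
    · beta_reduce
      rw [dif_pos h]
      exact hca
  let P : F × F × F × F → E[X] := fun x =>
    C (x.1 • β 1) * X ^ 2 + C (x.1 • β 1 + x.2.1 • γ x.2.2.1 - γ x.2.2.2) * X +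
      C (x.2.1 • γ x.2.2.1)
  have hroot : ∀ a : E, a ≠ 0 → 1 + a ≠ 0 → ∃ x, a ∈ (P x).roots.toFinset := by
    intro a ha ha1
    obtain ⟨s, t, hst⟩ := hdep a ha ha1
    rw [← hβ, ← hβ 1, ← hβ a, ← map_smul, ← map_smul, ← map_add] at hst
    have h1 := hTi hst
    obtain ⟨ν, c, hc, hγν, hca⟩ := hγ a ha
    obtain ⟨ν', c', hc', hγν', hca'⟩ := hγ (1 + a) ha1
    refine ⟨(c'⁻¹ * s, c'⁻¹ * t * c, ν, ν'), ?_⟩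
    have key : γ ν' * a = (1 + a) * ((c'⁻¹ * s) • (β 1) * a + (c'⁻¹ * t * c) • γ ν) := by
      have e1 : γ ν' = c'⁻¹ • ((1 + a) * β (1 + a)) := by rw [hca', inv_smul_smul₀ hc']
      rw [e1, h1, mul_assoc c'⁻¹ t c, mul_smul c'⁻¹ (t * c), mul_smul t c, ← hca]
      simp only [Algebra.smul_def, map_mul]
      ring
    rw [Multiset.mem_toFinset, mem_roots']
    refine ⟨fun h => hγν' ?_, ?_⟩
    · have h2 := congrArg (fun p => coeff p 2) h
      have h1 := congrArg (fun p => coeff p 1) h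
      have h0 := congrArg (fun p => coeff p 0) h
      simp only [P, coeff_add, coeff_C_mul, coeff_X_pow, coeff_X, coeff_C, coeff_zero] at h0 h1 h2
      norm_num at h0 h1 h2
      rcases h0 with h0 | h0 <;> rcases h2 with h2 | h2 <;> simp_all
    · simp only [P, IsRoot, eval_add, eval_mul, eval_C, eval_X, eval_pow]
      linear_combination -key
  have hdeg : ∀ x, (P x).roots.toFinset.card ≤ 2 := by
    intro x
    refine (Multiset.toFinset_card_le _).trans ((card_roots' _).trans ?_)
    exact natDegree_quadratic_le
  have hsub : (Finset.univ : Finset E) ⊆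
      (Finset.univ.biUnion fun x => (P x).roots.toFinset) ∪ {0, -1} := by
    intro a _
    by_cases ha : a = 0
    · simp [ha]
    by_cases ha1 : 1 + a = 0
    · rw [eq_neg_of_add_eq_zero_right ha1]
      simp
    obtain ⟨x, hx⟩ := hroot a ha ha1
    exact Finset.mem_union_left _ (Finset.mem_biUnion.2 ⟨x, Finset.mem_univ _, hx⟩)
  have h1 := (Finset.card_le_card hsub).trans (Finset.card_union_le _ _)
  have h2 := Finset.card_biUnion_le_card_mul Finset.univ (fun x => (P x).roots.toFinset) 2
    fun x _ => hdeg x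
  have h3 := Finset.card_le_two (a := (0 : E)) (b := -1)
  rw [Finset.card_univ] at h1 h2
  rw [Module.card_eq_pow_finrank (K := F) (V := E), hm] at h1
  simp only [Fintype.card_prod] at h2
  set q := Fintype.card F
  have h4 : q ^ 7 ≤ q ^ m := Nat.pow_le_pow_right (by omega) h7
  have h5 : 2 ^ 3 * (q * (q * (q * q))) ≤ q ^ 7 := by
    rw [show q ^ 7 = q ^ 3 * (q * (q * (q * q))) by ring]
    exact Nat.mul_le_mul_right _ (Nat.pow_le_pow_left hq 3)
  have h6 : 2 ^ 4 ≤ q * (q * (q * q)) := by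
    rw [show q * (q * (q * q)) = q ^ 4 by ring]
    exact Nat.pow_le_pow_left hq 4
  omega

end FrameGeometry

section FrameGeometry

open Module

variable {F E V : Type*} [Field F] [Field E] [Algebra F E] [Fintype F] [Finite E]
  [AddCommGroup V] [Module F V] [Finite V] {m k : ℕ} {H : Subgroup (V ≃ₗ[F] V)}

namespace RichGroup

variable {i : (V →ₗ[F] E) × (E →ₗ[F] V)}

/-- There is no invariant symmetric polarity modulo `D`. -/
theorem no_polarity (K : RichGroup H E m k i)
    {D : Submodule F V} {j} (hj : j ∈ framesOver H E D) (χ : V → Dual F V)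
    (h0 : ∀ z, z ∉ D → χ z ≠ 0) (hD : ∀ z, z ∉ D → ∀ d ∈ D, χ z d = 0)
    (hinv : ∀ h ∈ H, (∀ d ∈ D, h d = d) → ∀ z, z ∉ D → ∀ v, χ (h z) (h v) = 0 ↔ χ z v = 0)
    (hsymm : ∀ z, z ∉ D → ∀ v, v ∉ D → χ z v = 0 → χ v z = 0)
    (hker : ∀ z, z ∉ D → j.1 z = 0 → ∀ x, χ z (j.2 x) = 0) : False := by
  have hm := K.hm
  have hkm := K.hkm
  have h5 := K.h5
  have hσ : ∀ a, a ≠ 0 → j.2 a ∉ D := fun a ha h => ha (by rw [← hj.1 a]; exact hj.2.1 h)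
  refine no_norm_polarity hm (by omega) (fun a => (χ (j.2 a)).comp j.2) ?_ ?_ ?_
  · intro a ha h
    apply h0 _ (hσ a ha)
    ext v
    have hv : v = (v - j.2 (j.1 v)) + j.2 (j.1 v) := by abel
    have hu : j.1 (v - j.2 (j.1 v)) = 0 := by rw [map_sub, hj.1, sub_self]
    have h1 : χ (j.2 a) (j.2 (j.1 v)) = 0 := LinearMap.congr_fun h (j.1 v)
    rw [hv, map_add, h1, add_zero]
    by_cases hvD : v - j.2 (j.1 v) ∈ D
    · exact hD _ (hσ a ha) _ hvD
    · exact hsymm _ hvD _ (hσ a ha) (hker _ hvD hu a)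
  · intro y hy a ha x
    rw [← hm] at hy
    obtain ⟨h, hh, hv⟩ := hj.2.2 y hy
    have key : ∀ a, h (j.2 a) = j.2 (y * a) := fun a => by
      rw [hv, hj.1, ← map_add]
      congr 1
      ring
    have := hinv h hh (fun d hd => by
      have : j.1 d = 0 := hj.2.1 hd
      rw [hv, this, mul_zero, map_zero, add_zero]) (j.2 a) (hσ a ha) (j.2 x)
    rwa [key, key] at this
  · intro a ha ha1
    obtain ⟨s, t, hst⟩ := exists_eq_smul_add_smul (L1 := χ (j.2 1)) (L2 := χ (j.2 a))
      (L3 := χ (j.2 (1 + a))) (fun v h1 h2 => by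
        by_cases hvD : v ∈ D
        · exact hD _ (hσ _ ha1) v hvD
        · apply hsymm v hvD _ (hσ _ ha1)
          rw [map_add, map_add, hsymm _ (hσ 1 one_ne_zero) v hvD h1, hsymm _ (hσ a ha) v hvD h2,
            add_zero])
    exact ⟨s, t, by rw [hst]; rfl⟩

theorem exists_frame_over (K : RichGroup H E m k i)
    {s : ℕ} (hs : s ≤ k) (hT : ∀ j < s, TransOff H j) (D : Submodule F V)
    (hD : finrank F D = s) : ∃ j, j ∈ framesOver H E D := by
  obtain ⟨D0, -, hD0, hD0s⟩ := exists_between_finrank (bot_le : ⊥ ≤ LinearMap.ker i.1) (t := s)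
    (by simp) (by rw [K.finrank_ker]; omega)
  obtain ⟨h, hh, rfl⟩ := exists_map_eq hT D0 D hD0s hD
  exact ⟨_, conjFrame_mem hh (K.mem_framesOver hD0)⟩

theorem centerJoin_eq_top (K : RichGroup H E m k i)
    {s : ℕ} (hs : s + 3 ≤ k) (hT : ∀ j < s + 1, TransOff H j)
    (D1 : Submodule F V) (hD1 : finrank F D1 = s + 1) : centerJoin H E D1 = ⊤ := by
  have hm := K.hm
  have hkm := K.hkm
  have h5 := K.h5
  by_contra hne
  obtain ⟨ξ0, hξ0, hξM⟩ := Submodule.exists_le_ker_of_lt_top _ (lt_top_iff_ne_top.2 hne)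
  have hR := K.axisMeet_eq (s := s) (by omega) hT
  obtain ⟨D, -, hDle, hD⟩ := exists_between_finrank (bot_le : ⊥ ≤ D1 ⊓ LinearMap.ker ξ0) (t := s)
    (by simp) (by
      have h1 := Submodule.finrank_sup_add_finrank_inf_eq D1 (LinearMap.ker ξ0)
      have h2 := Submodule.finrank_le (D1 ⊔ LinearMap.ker ξ0)
      have h3 := LinearMap.finrank_range_add_finrank_ker ξ0
      have h4 := Submodule.finrank_le (LinearMap.range ξ0)
      rw [finrank_self] at h4
      omega)
  have hTs := hT s (by omega)
  have hlt : D < D1 := lt_of_le_of_ne (hDle.trans inf_le_left) (by rintro rfl; omega)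
  obtain ⟨z0, hz0, hz0D⟩ := SetLike.exists_of_lt hlt
  have hD1' := eq_sup_span_of_finrank hlt.le hD hD1 hz0 hz0D
  have hξ0' : ξ0 ∈ annNonzero D := ⟨hξ0, fun d hd => (hDle hd).2⟩
  have hpol0 : IsPolar H E D ξ0 z0 := K.isPolar_of_kills hTs hD (by omega) hξ0' hz0D
    (fun v hv => hξM (hD1' ▸ hv))
  have hex : ∀ z, ∃ ξ, z ∉ D → ξ ∈ annNonzero D ∧ IsPolar H E D ξ z := by
    intro z
    by_cases hz : z ∈ D
    · exact ⟨0, fun h => (h hz).elim⟩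
    obtain ⟨h, hh, hd, hv⟩ := hTs D hD z z0 hz hz0D
    have hsymm : ∀ d ∈ D, h.symm d = d := fun d hdD => by
      rw [LinearEquiv.symm_apply_eq, hd d hdD]
    refine ⟨ξ0.comp h.toLinearMap, fun _ => ⟨⟨fun h' => hξ0 ?_, fun d hdD => ?_⟩, ?_⟩⟩
    · ext v
      have := LinearMap.congr_fun h' (h.symm v)
      simpa using this
    · have := hξ0'.2 d hdD
      simpa [hd d hdD] using this
    · rw [← isPolar_map hh hd (ξ := ξ0) (fun v => rfl), hv]
      exact hpol0
  choose χ hχ using hex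
  have huniq : ∀ {z ψ}, z ∉ D → ψ ∈ annNonzero D → IsPolar H E D ψ z →
      ∀ v, ψ v = 0 ↔ χ z v = 0 := by
    have h1 : ∀ {z ψ φ}, z ∉ D → ψ ∈ annNonzero D → φ ∈ annNonzero D → IsPolar H E D ψ z →
        IsPolar H E D φ z → ∀ v, φ v = 0 → ψ v = 0 := by
      intro z ψ φ hz hψ hφ h1 h2 v hv
      obtain ⟨c, rfl⟩ := Submodule.mem_span_singleton.1
        (K.isPolar_unique hTs hD (by omega) hR hξ0' hz0D hpol0 hφ hψ hz h2 h1)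
      rw [LinearMap.smul_apply, hv, smul_zero]
    intro z ψ hz hψ h v
    exact ⟨h1 hz (hχ z hz).1 hψ (hχ z hz).2 h v, h1 hz hψ (hχ z hz).1 h (hχ z hz).2 v⟩
  have hinv : ∀ h ∈ H, (∀ d ∈ D, h d = d) → ∀ z, z ∉ D → ∀ v,
      χ (h z) (h v) = 0 ↔ χ z v = 0 := by
    intro h hh hd z hz v
    have hz' : h z ∉ D := fun h4 => hz (by
      have := h.injective (hd _ h4)
      rwa [this] at h4)
    have h1 := (hχ (h z) hz')
    refine huniq (ψ := (χ (h z)).comp h.toLinearMap) hz ⟨fun h' => h1.1.1 ?_, fun d hdD => ?_⟩ ?_ v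
    · ext v
      have := LinearMap.congr_fun h' (h.symm v)
      simpa using this
    · have := h1.1.2 d hdD
      simpa [hd d hdD] using this
    · exact (isPolar_map hh hd (fun v => rfl)).1 h1.2
  have hkills : ∀ z, z ∉ D → ∀ v ∈ centerJoin H E (D ⊔ Submodule.span F {z}), χ z v = 0 :=
    fun z hz => K.isPolar_kills (hχ z hz).2
  have hperp : ∀ z, z ∉ D → centerJoin H E (D ⊔ Submodule.span F {z}) ⊔ D =
      LinearMap.ker (χ z) := by
    intro z hz
    apply le_antisymm (sup_le (fun v hv => hkills z hz v hv) fun d hd => (hχ z hz).1.2 d hd)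
    intro v hv
    by_contra hv'
    obtain ⟨ψ, hψv, hψ⟩ := Submodule.exists_le_ker_of_notMem hv'
    have hψ' : ψ ∈ annNonzero D :=
      ⟨fun h => hψv (by rw [h]; rfl), fun d hd => hψ (Submodule.mem_sup_right hd)⟩
    have := K.isPolar_of_kills hTs hD (by omega) hψ' hz
      (fun v hv => hψ (Submodule.mem_sup_left hv))
    exact hψv ((huniq hz hψ' this v).2 hv)
  have hspan : ∀ z v, z ∉ D → v ∉ D → v ∈ D ⊔ Submodule.span F {z} → ∀ x,
      χ v x = 0 ↔ χ z x = 0 := by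
    intro z v hz hv hvz x
    have : D ⊔ Submodule.span F {z} = D ⊔ Submodule.span F {v} := by
      apply eq_sup_span_of_finrank le_sup_left hD _ hvz hv
      rw [Submodule.finrank_sup_span_singleton hz, hD]
    refine huniq hz (hχ v hv).1 ?_ x
    have h1 := (hχ v hv).2
    unfold IsPolar at h1 ⊢
    rw [this, h1]
  obtain ⟨j, hj⟩ := K.exists_frame_over (s := s) (by omega) (fun j hj => hT j (by omega)) D hD
  have hinj : Function.Injective j.2 := fun x y hxy => by rw [← hj.1 x, hxy, hj.1]
  have hwD : j.2 1 ∉ D := fun h => one_ne_zero (by rw [← hj.1 1]; exact hj.2.1 h)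
  have hkermem : ∀ z, z ∉ D → j.1 z = 0 → j ∈ framesOver H E (D ⊔ Submodule.span F {z}) :=
    fun z hz hzj => ⟨hj.1, sup_le hj.2.1 (by rwa [Submodule.span_singleton_le_iff_mem]), hj.2.2⟩
  have hsymm1 : ∃ z, z ∉ D ∧ ∀ v, v ∉ D → χ z v = 0 → χ v z = 0 := by
    obtain ⟨z, hz, hzD⟩ : ∃ z ∈ LinearMap.ker j.1 ⊓ LinearMap.ker (χ (j.2 1)), z ∉ D := by
      by_contra! hno
      have h1 := Submodule.finrank_mono (show LinearMap.ker j.1 ⊓ LinearMap.ker (χ (j.2 1)) ≤ D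
        from hno)
      have h2 := Submodule.finrank_sup_add_finrank_inf_eq (LinearMap.ker j.1)
        (LinearMap.ker (χ (j.2 1)))
      have h3 := LinearMap.finrank_range_add_finrank_ker (χ (j.2 1))
      have h4 := Submodule.finrank_le (LinearMap.range (χ (j.2 1)))
      have h5 := Submodule.finrank_le (LinearMap.ker j.1 ⊔ LinearMap.ker (χ (j.2 1)))
      rw [finrank_self] at h4
      rw [K.finrank_ker_of_mem hj] at h2
      omega
    refine ⟨z, hzD, fun v hv hzv => ?_⟩
    have hjz := hkermem z hzD hz.1
    set Dz := D ⊔ Submodule.span F {z} with hDz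
    have hDzs : finrank F Dz = s + 1 := by rw [Submodule.finrank_sup_span_singleton hzD, hD]
    have hwM : j.2 1 ∈ centerJoin H E Dz := le_centerJoin hjz ⟨1, rfl⟩
    by_cases hvz : v ∈ Dz
    · rw [hspan z v hzD hv hvz]
      obtain ⟨d, hd, y, hy, rfl⟩ := Submodule.mem_sup.1 hvz
      obtain ⟨c, rfl⟩ := Submodule.mem_span_singleton.1 hy
      have hc : c ≠ 0 := by
        rintro rfl
        rw [zero_smul, add_zero] at hv
        exact hv hd
      rw [map_add, (hχ z hzD).1.2 d hd, zero_add, map_smul, smul_eq_mul, mul_eq_zero] at hzv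
      exact hzv.resolve_left hc
    · obtain ⟨v', hv', d, hd, rfl⟩ := Submodule.mem_sup.1
        ((hperp z hzD).symm ▸ hzv : v ∈ centerJoin H E Dz ⊔ D)
      have hv'z : v' ∉ Dz := fun h => hvz (Dz.add_mem h (Submodule.mem_sup_left hd))
      have hv'D : v' ∉ D := fun h => hv'z (Submodule.mem_sup_left h)
      have hwz : j.2 1 ∉ Dz := fun h => one_ne_zero (by rw [← hj.1 1]; exact hjz.2.1 h)
      have hmM : m ≤ finrank F (centerJoin H E Dz) := by
        rw [← hm, ← LinearMap.finrank_range_of_inj hinj]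
        exact Submodule.finrank_mono (le_centerJoin hjz)
      obtain ⟨k', hk'⟩ := Nat.exists_eq_add_of_le hmM
      have h1 := Submodule.finrank_sup_add_finrank_inf_eq Dz (centerJoin H E Dz)
      have h2 : finrank F (LinearMap.ker (χ z)) ≤
          finrank F (Dz ⊔ centerJoin H E Dz : Submodule F V) := by
        rw [← hperp z hzD, sup_comm Dz]
        exact Submodule.finrank_mono (sup_le_sup_left le_sup_left _)
      have h3 := LinearMap.finrank_range_add_finrank_ker (χ z)
      have h4 := Submodule.finrank_le (LinearMap.range (χ z))
      have h5 := Submodule.finrank_le (centerJoin H E Dz)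
      rw [finrank_self] at h4
      rw [K.hk] at h3 h5
      obtain ⟨h, hh, hd', hw⟩ := trans_centerJoin hm (by omega) hk' (by omega) (hR Dz hDzs)
        (by omega) hwM hv' hwz hv'z
      have hhz : h z = z := hd' z (Submodule.mem_sup_right (Submodule.mem_span_singleton_self z))
      have h6 := (hinv h hh (fun d hd => hd' d (Submodule.mem_sup_left hd)) (j.2 1) hwD z).2 hz.2
      rw [hw, hhz] at h6
      exact (hspan v' (v' + d) hv'D hv (Submodule.add_mem _
        (Submodule.mem_sup_right (Submodule.mem_span_singleton_self v'))
        (Submodule.mem_sup_left hd)) z).2 h6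
  have hsymm : ∀ z, z ∉ D → ∀ v, v ∉ D → χ z v = 0 → χ v z = 0 := by
    obtain ⟨z1, hz1, hz1s⟩ := hsymm1
    intro z hz v hv hzv
    obtain ⟨h, hh, hd, hzz⟩ := hTs D hD z z1 hz hz1
    have hv' : h v ∉ D := fun h4 => hv (by
      have := h.injective (hd _ h4)
      rwa [this] at h4)
    rw [← hinv h hh hd z hz, hzz] at hzv
    rw [← hinv h hh hd v hv, hzz]
    exact hz1s _ hv' hzv
  exact K.no_polarity hj χ (fun z hz => (hχ z hz).1.1) (fun z hz => (hχ z hz).1.2) hinv hsymm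
    (fun z hz hzj x => hkills z hz _ (le_centerJoin (hkermem z hz hzj) ⟨x, rfl⟩))

/-- The pointwise stabilizers of small subspaces are transitive off the subspace. -/
theorem transOff (K : RichGroup H E m k i) (t : ℕ) (ht : t + 2 ≤ k) : TransOff H t := by
  induction t using Nat.strong_induction_on with
  | _ t ih =>
    rcases t with _ | s
    · exact K.transOff_zero
    have hT : ∀ j < s + 1, TransOff H j := fun j hj => ih j hj (by omega)
    exact transOff_of K.hm K.hk (by have := K.hkm; have := K.h5; omega) K.hkm (by omega)
      (fun D hD => K.axisMeet_eq (by omega) hT D hD)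
      (fun D hD => K.centerJoin_eq_top (by omega) hT D hD)

end RichGroup

end FrameGeometry

section SylowTorus

open Module

/-- If a cyclic group generated by `t` is a Sylow subgroup, and a subgroup `L` contains `t` and its
conjugate by `h`, then some element of `L * h` normalizes it. -/
theorem exists_mem_normalizer {G : Type*} [Group G] [Finite G] {r a : ℕ} (hr : r.Prime)
    (hG : ¬ r ^ (a + 1) ∣ Nat.card G) {t : G} (ht : orderOf t = r ^ a) {L : Subgroup G}
    (htL : t ∈ L) {h : G} (hh : h * t * h⁻¹ ∈ L) :
    ∃ g ∈ L, g * h ∈ Subgroup.normalizer (Subgroup.zpowers t : Set G) := by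
  have : Fact r.Prime := ⟨hr⟩
  have hord : orderOf (⟨t, htL⟩ : L) = r ^ a := by rw [← ht, Subgroup.orderOf_mk]
  have hfac : (Nat.card L).factorization r = a := by
    apply le_antisymm
    · by_contra! hlt
      exact hG ((pow_dvd_pow r hlt).trans
        ((Nat.ordProj_dvd _ r).trans (Subgroup.card_subgroup_dvd_card L)))
    · rw [← hr.pow_dvd_iff_le_factorization Nat.card_pos.ne', ← hord]
      exact orderOf_dvd_natCard _
  let P : Sylow r L := Sylow.ofCard (Subgroup.zpowers (⟨t, htL⟩ : L)) (by
    rw [Nat.card_zpowers, hord, hfac])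
  have hp : IsPGroup r (Subgroup.zpowers (⟨h * t * h⁻¹, hh⟩ : L)) := by
    apply IsPGroup.of_card (n := a)
    rw [Nat.card_zpowers, Subgroup.orderOf_mk, ← ht]
    exact orderOf_injective (MulAut.conj h).toMonoidHom (MulAut.conj h).injective t
  obtain ⟨Q, hQ⟩ := hp.exists_le_sylow
  obtain ⟨g, hg⟩ := MulAction.exists_smul_eq L Q P
  have hmem : MulAut.conj g (⟨h * t * h⁻¹, hh⟩ : L) ∈ (P : Subgroup L) := by
    rw [← hg, Sylow.smul_def, Sylow.pointwise_smul_def]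
    exact Subgroup.smul_mem_pointwise_smul _ _ _ (hQ (Subgroup.mem_zpowers _))
  obtain ⟨z, hz⟩ := Subgroup.mem_zpowers_iff.1 hmem
  refine ⟨g, g.2, Subgroup.mem_normalizer_fintype ?_⟩
  rintro _ ⟨j, rfl⟩
  have hz' : t ^ z = g * (h * t * h⁻¹) * (g : G)⁻¹ := by
    have := congrArg (Subtype.val) hz
    simpa using this
  refine ⟨z * j, ?_⟩
  change t ^ (z * j) = (g * h) * t ^ j * (g * h)⁻¹
  rw [zpow_mul, hz', ← conj_zpow]
  congr 1
  group

theorem card_linearEquiv {F V : Type*} [Field F] [Fintype F] [AddCommGroup V] [Module F V]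
    [Finite V] : Nat.card (V ≃ₗ[F] V) =
      ∏ j : Fin (finrank F V), (Fintype.card F ^ finrank F V - Fintype.card F ^ (j : ℕ)) := by
  classical
  rw [← Matrix.card_GL_field]
  exact Nat.card_congr ((LinearMap.GeneralLinearGroup.generalLinearEquiv F V).symm.trans
    (Units.mapEquiv (algEquivMatrix (finBasis F V)).toMulEquiv)).toEquiv

theorem not_dvd_pow_sub_one {r q m s : ℕ} (hm : 0 < m) (hrm : r ∣ q ^ m - 1)
    (hr : ∀ j, 0 < j → j < m → ¬ r ∣ q ^ j - 1) (hs : ¬ m ∣ s) : ¬ r ∣ q ^ s - 1 := by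
  intro h
  have h1 := Nat.dvd_gcd hrm h
  rw [Nat.pow_sub_one_gcd_pow_sub_one] at h1
  refine hr _ (Nat.gcd_pos_of_pos_left s hm) ?_ h1
  refine lt_of_le_of_ne (Nat.gcd_le_left _ hm) fun h => hs ?_
  rw [← h]
  exact Nat.gcd_dvd_right m s

/-- The `r`-part of the general linear group for a prime `r` of multiplicative order `m`. -/
theorem not_dvd_card_linearEquiv {F V : Type*} [Field F] [Fintype F] [AddCommGroup V] [Module F V]
    [Finite V] {r a m : ℕ} (hr : r.Prime) (hm : 0 < m) (hmV : finrank F V < 2 * m)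
    (hmV' : m ≤ finrank F V)
    (hrm : r ∣ Fintype.card F ^ m - 1)
    (hrj : ∀ j, 0 < j → j < m → ¬ r ∣ Fintype.card F ^ j - 1)
    (ha : ¬ r ^ (a + 1) ∣ Fintype.card F ^ m - 1) : ¬ r ^ (a + 1) ∣ Nat.card (V ≃ₗ[F] V) := by
  set q := Fintype.card F
  have hq : 2 ≤ q := Fintype.one_lt_card
  set n := finrank F V with hn
  have hrq : ¬ r ∣ q := by
    intro h
    have h1 : r ∣ q ^ m := dvd_pow h hm.ne'
    have h2 := (Nat.dvd_sub h1 hrm)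
    rw [Nat.sub_sub_self (Nat.one_le_pow _ _ (by omega))] at h2
    exact hr.one_lt.ne' (Nat.dvd_one.1 h2)
  have hfac : ∀ j : Fin n, q ^ n - q ^ (j : ℕ) = q ^ (j : ℕ) * (q ^ (n - j) - 1) := by
    intro j
    rw [Nat.mul_sub, ← pow_add, mul_one, Nat.add_sub_cancel' j.2.le]
  rw [card_linearEquiv]
  change ¬ r ^ (a + 1) ∣ ∏ j : Fin n, (q ^ n - q ^ (j : ℕ))
  have hlt : n - m < n := by omega
  rw [← Finset.mul_prod_erase _ _ (Finset.mem_univ (⟨n - m, hlt⟩ : Fin n))]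
  intro h
  apply ha
  have hcop : Nat.Coprime (r ^ (a + 1))
      (∏ x ∈ Finset.univ.erase (⟨n - m, hlt⟩ : Fin n), (q ^ n - q ^ (x : ℕ))) := by
    apply Nat.Coprime.pow_left
    rw [hr.coprime_iff_not_dvd, hr.prime.dvd_finsetProd_iff]
    rintro ⟨j, hj, hd⟩
    rw [hfac, hr.dvd_mul] at hd
    rcases hd with hd | hd
    · exact hrq (hr.dvd_of_dvd_pow hd)
    · refine not_dvd_pow_sub_one hm hrm hrj ?_ hd
      rintro ⟨c, hc⟩
      have hjn := j.2
      have : c = 1 := by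
        have h1 : c < 2 := by
          by_contra! h2
          have := Nat.mul_le_mul_left m h2
          omega
        have h2 : c ≠ 0 := by
          rintro rfl
          omega
        omega
      subst this
      apply Finset.ne_of_mem_erase hj
      ext
      simp only
      omega
  have h2 := hcop.dvd_of_dvd_mul_right h
  rw [hfac] at h2
  simp only [Nat.sub_sub_self hmV'] at h2
  exact ((Nat.Coprime.pow_left _ ((hr.coprime_iff_not_dvd).2 hrq)).pow_right _).dvd_of_dvd_mul_left h2

end SylowTorus

section TorusNormalizer

open Module
open scoped commutatorElement

theorem commutator_apply {F V : Type*} [Field F] [AddCommGroup V] [Module F V] {n₁ n₂ : V ≃ₗ[F] V}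
    (w : V) : ⁅n₁, n₂⁆ (n₂ (n₁ w)) = n₁ (n₂ w) := by
  have : ⁅n₁, n₂⁆ * (n₂ * n₁) = n₁ * n₂ := by rw [commutatorElement_def]; group
  exact LinearEquiv.congr_fun this w

variable {F E V : Type*} [Field F] [Field E] [Algebra F E] [Fintype F] [Finite E]
  [AddCommGroup V] [Module F V] [Finite V] {m k : ℕ} {H : Subgroup (V ≃ₗ[F] V)}

instance finite_linearEquiv : Finite (V ≃ₗ[F] V) := DFunLike.finite _

/-- Partial isometries in the sense of Witt: any map on a subspace of dimension less than `k` is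
induced by `H`. -/
theorem exists_eq_on {s : ℕ} (hT : ∀ j < s, TransOff H j) (A : Submodule F V)
    (hA : finrank F A = s) (θ : V ≃ₗ[F] V) : ∃ h ∈ H, ∀ a ∈ A, h a = θ a := by
  induction s generalizing A with
  | zero =>
    rw [Submodule.finrank_eq_zero] at hA
    refine ⟨1, H.one_mem, fun a ha => ?_⟩
    rw [hA, Submodule.mem_bot] at ha
    rw [ha, map_zero, map_zero]
  | succ s ih =>
    obtain ⟨C, z, hz, hC, rfl⟩ := exists_eq_sup_span hA
    obtain ⟨h, hh, hhC⟩ := ih (fun j hj => hT j (by omega)) C hC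
    have hθ : finrank F (C.map θ.toLinearMap) = s := by
      rw [← hC]
      exact LinearEquiv.finrank_map_eq θ C
    have h1 : θ z ∉ C.map θ.toLinearMap := by
      rintro ⟨c, hc, hcz⟩
      exact hz (by rwa [← θ.injective hcz])
    have h2 : h z ∉ C.map θ.toLinearMap := by
      rintro ⟨c, hc, hcz⟩
      have : h c = h z := by rw [hhC c hc]; exact hcz
      exact hz (by rwa [← h.injective this])
    obtain ⟨g, hg, hgC, hgz⟩ := hT s (by omega) _ hθ (h z) (θ z) h2 h1
    refine ⟨g * h, H.mul_mem hg hh, fun a ha => ?_⟩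
    obtain ⟨c, hc, w, hw, rfl⟩ := Submodule.mem_sup.1 ha
    obtain ⟨b, rfl⟩ := Submodule.mem_span_singleton.1 hw
    change g (h (c + b • z)) = θ (c + b • z)
    rw [map_add, map_add, map_add, map_smul, map_smul, map_smul, hgz, hhC c hc]
    congr 1
    exact hgC _ ⟨c, hc, rfl⟩

variable {π : V →ₗ[F] E} {σ : E →ₗ[F] V} {t : V ≃ₗ[F] V} {y : E}

theorem exists_lift {r a s : ℕ} (hT : ∀ j < s, TransOff H j) (hr : r.Prime)
    (hG : ¬ r ^ (a + 1) ∣ Nat.card (V ≃ₗ[F] V)) (ht : orderOf t = r ^ a) (htH : t ∈ H)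
    (htv : ∀ v, t v = v + σ ((y - 1) * π v)) (A : Submodule F V) (hA : finrank F A = s)
    (θ : V ≃ₗ[F] V) (h1 : ∀ a ∈ A, π a = 0) (h2 : ∀ a ∈ A, π (θ a) = 0) :
    ∃ n ∈ H, n ∈ Subgroup.normalizer (Subgroup.zpowers t : Set (V ≃ₗ[F] V)) ∧
      ∀ a ∈ A, n a = θ a := by
  obtain ⟨h, hh, hhA⟩ := exists_eq_on hT A hA θ
  have htfix : ∀ v, π v = 0 → t v = v := fun v hv => by rw [htv, hv, mul_zero, map_zero, add_zero]
  obtain ⟨g, hg, hgn⟩ := exists_mem_normalizer hr hG ht (L := fixSub H (A.map θ.toLinearMap))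
    (h := h) ⟨htH, by
      rintro _ ⟨v, hv, rfl⟩
      exact htfix _ (h2 v hv)⟩ ⟨H.mul_mem (H.mul_mem hh htH) (H.inv_mem hh), by
      rintro _ ⟨v, hv, rfl⟩
      change h (t (h.symm (θ v))) = θ v
      rw [← hhA v hv, h.symm_apply_apply, htfix _ (h1 v hv)]⟩
  refine ⟨g * h, H.mul_mem hg.1 hh, hgn, fun v hv => ?_⟩
  change g (h v) = θ v
  rw [hhA v hv]
  exact hg.2 _ ⟨v, hv, rfl⟩

theorem pow_torus_apply (hπ : ∀ x, π (σ x) = x) (htv : ∀ v, t v = v + σ ((y - 1) * π v)) (j : ℕ)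
    (v : V) : (t ^ j) v = v + σ ((y ^ j - 1) * π v) := by
  induction j with
  | zero => simp
  | succ j ih =>
    rw [pow_succ']
    change t ((t ^ j) v) = _
    rw [ih, htv, add_assoc, ← map_add, map_add π, hπ]
    congr 2
    ring

theorem mem_zpowers_torus (hπ : ∀ x, π (σ x) = x) (htv : ∀ v, t v = v + σ ((y - 1) * π v))
    {s : V ≃ₗ[F] V} (hs : s ∈ Subgroup.zpowers t) : ∃ z, ∀ v, s v = v + σ (z * π v) := by
  rw [← mem_powers_iff_mem_zpowers] at hs
  obtain ⟨j, rfl⟩ := hs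
  exact ⟨_, pow_torus_apply hπ htv j⟩

theorem normalizer_ker (hπ : ∀ x, π (σ x) = x) (htv : ∀ v, t v = v + σ ((y - 1) * π v))
    (hy : y ≠ 1) {n : V ≃ₗ[F] V}
    (hn : n ∈ Subgroup.normalizer (Subgroup.zpowers t : Set (V ≃ₗ[F] V))) {u : V} (hu : π u = 0) :
    π (n u) = 0 := by
  have h1 := (Subgroup.mem_normalizer_iff.1 (Subgroup.inv_mem _ hn) t).1 (Subgroup.mem_zpowers t)
  obtain ⟨z, hz⟩ := mem_zpowers_torus hπ htv h1
  have h2 := hz u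
  rw [hu, mul_zero, map_zero, add_zero, inv_inv] at h2
  change n.symm (t (n u)) = u at h2
  rw [LinearEquiv.symm_apply_eq, htv, add_eq_left] at h2
  have h3 := congrArg π h2
  rw [hπ, map_zero, mul_eq_zero] at h3
  exact h3.resolve_left (sub_ne_zero.2 hy)

theorem normalizer_range (hπ : ∀ x, π (σ x) = x) (htv : ∀ v, t v = v + σ ((y - 1) * π v))
    (hy : y ≠ 1) {n : V ≃ₗ[F] V}
    (hn : n ∈ Subgroup.normalizer (Subgroup.zpowers t : Set (V ≃ₗ[F] V))) (x : E) :
    n (σ x) = σ (π (n (σ x))) := by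
  have h1 := (Subgroup.mem_normalizer_iff.1 hn t).1 (Subgroup.mem_zpowers t)
  obtain ⟨z, hz⟩ := mem_zpowers_torus hπ htv h1
  have hy' := sub_ne_zero.2 hy
  have h2 := hz (n (σ ((y - 1)⁻¹ * x)))
  change n (t (n.symm (n (σ ((y - 1)⁻¹ * x))))) = _ at h2
  rw [n.symm_apply_apply, htv, hπ, mul_inv_cancel_left₀ hy', map_add, add_right_inj] at h2
  rw [h2, hπ]

/-- Commutators of elements normalizing a cyclic group centralize it. -/
theorem commute_commutator {G : Type*} [Group G] {t n₁ n₂ : G}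
    (h₁ : n₁ ∈ Subgroup.normalizer (Subgroup.zpowers t : Set G))
    (h₂ : n₂ ∈ Subgroup.normalizer (Subgroup.zpowers t : Set G)) : ⁅n₁, n₂⁆ * t = t * ⁅n₁, n₂⁆ := by
  have key : ∀ {n}, n ∈ Subgroup.normalizer (Subgroup.zpowers t : Set G) →
      ∃ z : ℤ, n * t = t ^ z * n := by
    intro n hn
    obtain ⟨z, hz⟩ := (Subgroup.mem_normalizer_iff.1 hn t).1 (Subgroup.mem_zpowers t)
    refine ⟨z, ?_⟩
    change t ^ z = _ at hz
    rw [hz]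
    group
  have hpow : ∀ {n : G} {z : ℤ} (w : ℤ), n * t = t ^ z * n → n * t ^ w = t ^ (z * w) * n := by
    intro n z w h
    have : SemiconjBy n t (t ^ z) := h
    rw [zpow_mul]
    exact this.zpow_right w
  obtain ⟨z, hz⟩ := key (Subgroup.inv_mem _ (Subgroup.mul_mem _ h₂ h₁))
  obtain ⟨a, ha⟩ := key h₁
  obtain ⟨b, hb⟩ := key h₂
  have e1 : n₁ * n₂ * t ^ z = n₂ * n₁ * t ^ z * (n₂ * n₁)⁻¹ * (n₁ * n₂) := by
    rw [mul_assoc n₁, hpow z hb, ← mul_assoc, hpow _ ha, mul_assoc n₂, hpow z ha, ← mul_assoc n₂,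
      hpow _ hb, ← mul_assoc a, ← mul_assoc b, mul_comm a b]
    group
  calc ⁅n₁, n₂⁆ * t = n₁ * n₂ * ((n₂ * n₁)⁻¹ * t) := by rw [commutatorElement_def]; group
    _ = n₁ * n₂ * t ^ z * (n₂ * n₁)⁻¹ := by rw [hz]; group
    _ = n₂ * n₁ * (t ^ z * (n₂ * n₁)⁻¹) * (n₁ * n₂) * (n₂ * n₁)⁻¹ := by rw [e1]; group
    _ = t * ⁅n₁, n₂⁆ := by rw [← hz, commutatorElement_def]; group

theorem adjoin_eq_top_of_dvd {m r : ℕ} (hm : finrank F E = m)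
    (hrj : ∀ j, 0 < j → j < m → ¬ r ∣ Fintype.card F ^ j - 1) (hy0 : y ≠ 0)
    (hy : r ∣ orderOf y) : Algebra.adjoin F {y} = ⊤ := by
  have : FiniteDimensional F E := inferInstance
  have halg : IsAlgebraic F y := Algebra.IsAlgebraic.isAlgebraic y
  set L := IntermediateField.adjoin F {y} with hL
  have hyL : y ∈ L := IntermediateField.mem_adjoin_simple_self F y
  have hcard : Nat.card L = Fintype.card F ^ finrank F L := by
    rw [← Nat.card_eq_fintype_card]
    exact Module.natCard_eq_pow_finrank
  have h1 : y ^ (Fintype.card F ^ finrank F L - 1) = 1 := by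
    have : Fintype L := Fintype.ofFinite L
    have := FiniteField.pow_card_sub_one_eq_one (⟨y, hyL⟩ : L) (fun h => hy0 (congrArg Subtype.val h))
    rw [← Nat.card_eq_fintype_card, hcard] at this
    exact congrArg Subtype.val this
  have h2 : finrank F L = m := by
    have hle : finrank F L ≤ m := hm ▸ Submodule.finrank_le (Subalgebra.toSubmodule L.toSubalgebra)
    by_contra hne
    exact hrj _ finrank_pos (by omega) (hy.trans (orderOf_dvd_of_pow_eq_one h1))
  have h3 : L = ⊤ := by
    apply IntermediateField.toSubalgebra_injective
    rw [IntermediateField.top_toSubalgebra, ← Algebra.toSubmodule_eq_top]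
    exact Submodule.eq_top_of_finrank_eq (h2.trans hm.symm)
  rw [← IntermediateField.adjoin_simple_toSubalgebra_of_isAlgebraic halg, ← hL, h3,
    IntermediateField.top_toSubalgebra]

/-- An element centralizing the torus acts on its center by a scalar of `E`. -/
theorem centralizer_range (hπ : ∀ x, π (σ x) = x) (htv : ∀ v, t v = v + σ ((y - 1) * π v))
    (hadj : Algebra.adjoin F {y} = ⊤) {c : V ≃ₗ[F] V} (hct : c * t = t * c)
    (hc : ∀ x, c (σ x) = σ (π (c (σ x)))) : ∃ e, ∀ x, c (σ x) = σ (x * e) := by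
  have hyx : ∀ x, t (σ x) = σ (y * x) := fun x => by
    rw [htv, hπ, ← map_add]
    congr 1
    ring
  have key : ∀ a x, c (σ (a * x)) = σ (a * π (c (σ x))) := by
    intro a
    have ha : a ∈ Algebra.adjoin F {y} := hadj ▸ Algebra.mem_top
    induction ha using Algebra.adjoin_induction with
    | mem a ha =>
      intro x
      rw [Set.mem_singleton_iff.1 ha, ← hyx]
      have : c (t (σ x)) = t (c (σ x)) := LinearEquiv.congr_fun hct (σ x)
      rw [this, hc, hyx, hπ]
    | algebraMap b =>
      intro x
      rw [← Algebra.smul_def, ← Algebra.smul_def, map_smul, map_smul, map_smul, ← hc]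
    | add a b _ _ ha hb =>
      intro x
      rw [add_mul, map_add, map_add, ha, hb, ← map_add, add_mul]
    | mul a b _ _ ha hb =>
      intro x
      rw [mul_assoc, ha, hb, hπ, mul_assoc]
  refine ⟨π (c (σ 1)), fun x => ?_⟩
  rw [← key, mul_one]

theorem double_commutator_range (hπ : ∀ x, π (σ x) = x) (htv : ∀ v, t v = v + σ ((y - 1) * π v))
    (hadj : Algebra.adjoin F {y} = ⊤) (hy : y ≠ 1) {n₁ n₂ n₃ n₄ : V ≃ₗ[F] V}
    (h₁ : n₁ ∈ Subgroup.normalizer (Subgroup.zpowers t : Set (V ≃ₗ[F] V)))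
    (h₂ : n₂ ∈ Subgroup.normalizer (Subgroup.zpowers t : Set (V ≃ₗ[F] V)))
    (h₃ : n₃ ∈ Subgroup.normalizer (Subgroup.zpowers t : Set (V ≃ₗ[F] V)))
    (h₄ : n₄ ∈ Subgroup.normalizer (Subgroup.zpowers t : Set (V ≃ₗ[F] V))) (x : E) :
    ⁅⁅n₁, n₂⁆, ⁅n₃, n₄⁆⁆ (σ x) = σ x := by
  have hcomm : ∀ {a b : V ≃ₗ[F] V},
      a ∈ Subgroup.normalizer (Subgroup.zpowers t : Set (V ≃ₗ[F] V)) →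
      b ∈ Subgroup.normalizer (Subgroup.zpowers t : Set (V ≃ₗ[F] V)) →
      ∃ e, ∀ x, ⁅a, b⁆ (σ x) = σ (x * e) := by
    intro a b ha hb
    refine centralizer_range hπ htv hadj (commute_commutator ha hb) ?_
    refine normalizer_range hπ htv hy ?_
    rw [commutatorElement_def]
    exact Subgroup.mul_mem _ (Subgroup.mul_mem _ (Subgroup.mul_mem _ ha hb) (Subgroup.inv_mem _ ha))
      (Subgroup.inv_mem _ hb)
  obtain ⟨e, he⟩ := hcomm h₁ h₂
  obtain ⟨f, hf⟩ := hcomm h₃ h₄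
  have hne : ∀ {e : E} {c : V ≃ₗ[F] V}, (∀ x, c (σ x) = σ (x * e)) → e ≠ 0 := by
    rintro e c hc rfl
    have h1 := hc 1
    rw [mul_zero, map_zero, LinearEquiv.map_eq_zero_iff] at h1
    have := hπ 1
    rw [h1, map_zero] at this
    exact zero_ne_one this
  have he0 := hne he
  have hf0 := hne hf
  have := commutator_apply (n₁ := ⁅n₁, n₂⁆) (n₂ := ⁅n₃, n₄⁆) (σ (x * (e * f)⁻¹))
  rw [he, hf, hf, he] at this
  rw [show x * (e * f)⁻¹ * e * f = x by field_simp, show x * (e * f)⁻¹ * f * e = x by field_simp]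
    at this
  exact this

end TorusNormalizer

section ElementaryLifts

open Module
open scoped commutatorElement

variable {F V : Type*} [Field F] [AddCommGroup V] [Module F V]

/-- The map `n` agrees with the transvection with functional `f` and vector `e` on `A`. -/
def ActsAs (n : V ≃ₗ[F] V) (A : Submodule F V) (f : Dual F V) (e : V) : Prop :=
  ∀ a ∈ A, n a = a + f a • e

theorem ActsAs.commutator {n₁ n₂ : V ≃ₗ[F] V} {A : Submodule F V} {f₁ f₂ : Dual F V} {e₁ e₂ : V}
    (h₁ : ActsAs n₁ A f₁ e₁) (h₂ : ActsAs n₂ A f₂ e₂) (he₁ : e₁ ∈ A) (he₂ : e₂ ∈ A)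
    (h11 : f₁ e₁ = 0) (h22 : f₂ e₂ = 0) (h12 : f₁ e₂ = 1) (h21 : f₂ e₁ = 0) :
    ActsAs ⁅n₁, n₂⁆ A f₂ e₁ := by
  have hsurj : ∀ {n : V ≃ₗ[F] V} {f : Dual F V} {e : V}, ActsAs n A f e → e ∈ A → f e = 0 →
      ∀ a ∈ A, ∃ w ∈ A, n w = a := by
    intro n f e h he hfe a ha
    refine ⟨a - f a • e, A.sub_mem ha (A.smul_mem _ he), ?_⟩
    rw [h _ (A.sub_mem ha (A.smul_mem _ he)), map_sub, map_smul, hfe, smul_zero, sub_zero,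
      sub_add_cancel]
  intro a ha
  obtain ⟨b, hb, rfl⟩ := hsurj h₂ he₂ h22 a ha
  obtain ⟨w, hw, rfl⟩ := hsurj h₁ he₁ h11 b hb
  rw [commutator_apply]
  have h2w : n₂ w ∈ A := by
    rw [h₂ w hw]
    exact A.add_mem hw (A.smul_mem _ he₂)
  rw [h₁ _ h2w, h₂ _ hb, h₂ _ hw, h₁ _ hw]
  simp only [map_add, map_smul, h12, h21, h22, smul_eq_mul, mul_zero, mul_one, add_zero,
    add_smul]
  abel

/-- On `U`, the pair of functionals `(f, p)` is transformed by an affine map with parameters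
`(c, s)`. -/
def ActsAffinely (n : V ≃ₗ[F] V) (U : Submodule F V) (f p : Dual F V) (c s : F) : Prop :=
  (∀ u, u ∈ U → n u ∈ U) ∧ (∀ u ∈ U, ∃ w ∈ U, n w = u) ∧
    ∀ u ∈ U, f (n u) = c * f u ∧ p (n u) = p u + s * f u

theorem ActsAffinely.commutator {n₁ n₂ : V ≃ₗ[F] V} {U : Submodule F V} {f p : Dual F V}
    {c₁ c₂ s₁ s₂ : F} (hc₁ : c₁ ≠ 0) (hc₂ : c₂ ≠ 0) (h₁ : ActsAffinely n₁ U f p c₁ s₁)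
    (h₂ : ActsAffinely n₂ U f p c₂ s₂) : ActsAffinely ⁅n₁, n₂⁆ U f p 1
      ((s₂ + s₁ * c₂ - s₁ - s₂ * c₁) * (c₁ * c₂)⁻¹) := by
  have hex : ∀ u ∈ U, ∃ w ∈ U, n₂ (n₁ w) = u := by
    intro u hu
    obtain ⟨b, hb, rfl⟩ := h₂.2.1 u hu
    obtain ⟨w, hw, rfl⟩ := h₁.2.1 b hb
    exact ⟨w, hw, rfl⟩
  have hex' : ∀ u ∈ U, ∃ w ∈ U, n₁ (n₂ w) = u := by
    intro u hu
    obtain ⟨b, hb, rfl⟩ := h₁.2.1 u hu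
    obtain ⟨w, hw, rfl⟩ := h₂.2.1 b hb
    exact ⟨w, hw, rfl⟩
  refine ⟨fun u hu => ?_, fun u hu => ?_, fun u hu => ?_⟩
  · obtain ⟨w, hw, rfl⟩ := hex u hu
    rw [commutator_apply]
    exact h₁.1 _ (h₂.1 _ hw)
  · obtain ⟨w, hw, rfl⟩ := hex' u hu
    exact ⟨n₂ (n₁ w), h₂.1 _ (h₁.1 _ hw), commutator_apply w⟩
  · obtain ⟨w, hw, rfl⟩ := hex u hu
    rw [commutator_apply, (h₁.2.2 _ (h₂.1 _ hw)).1, (h₁.2.2 _ (h₂.1 _ hw)).2,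
      (h₂.2.2 _ (h₁.1 _ hw)).1, (h₂.2.2 _ (h₁.1 _ hw)).2, (h₁.2.2 _ hw).1, (h₁.2.2 _ hw).2,
      (h₂.2.2 _ hw).1, (h₂.2.2 _ hw).2]
    constructor
    · ring
    · field_simp
      ring

theorem ActsAffinely.double_commutator {n₁ n₂ n₃ n₄ : V ≃ₗ[F] V} {U : Submodule F V}
    {f p : Dual F V} (h₁ : ∃ c s, c ≠ 0 ∧ ActsAffinely n₁ U f p c s)
    (h₂ : ∃ c s, c ≠ 0 ∧ ActsAffinely n₂ U f p c s) (h₃ : ∃ c s, c ≠ 0 ∧ ActsAffinely n₃ U f p c s)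
    (h₄ : ∃ c s, c ≠ 0 ∧ ActsAffinely n₄ U f p c s) :
    ActsAffinely ⁅⁅n₁, n₂⁆, ⁅n₃, n₄⁆⁆ U f p 1 0 := by
  obtain ⟨c₁, s₁, hc₁, h₁⟩ := h₁
  obtain ⟨c₂, s₂, hc₂, h₂⟩ := h₂
  obtain ⟨c₃, s₃, hc₃, h₃⟩ := h₃
  obtain ⟨c₄, s₄, hc₄, h₄⟩ := h₄
  have := ActsAffinely.commutator one_ne_zero one_ne_zero (h₁.commutator hc₁ hc₂ h₂)
    (h₃.commutator hc₃ hc₄ h₄)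
  convert this using 1
  ring

/-- The commutator of two elements acting as elementary maps, both trivial modulo
`B = ker f ⊓ ker p ⊓ U`, is a transvection. -/
theorem exists_transvection {g h : V ≃ₗ[F] V} {U A : Submodule F V} {f p f₁ : Dual F V}
    {e₁ e₂ : V} (hA : ∀ u, u ∈ A ↔ u ∈ U ∧ f u = 0) (W : Submodule F V) (hUW : U ⊔ W = ⊤)
    (hgW : ∀ w ∈ W, g w = w) (hhW : ∀ w ∈ W, h w = w) (hg : ActsAffinely g U f p 1 0)
    (hh : ActsAffinely h U f p 1 0) (hgA : ActsAs g A f₁ e₂) (hhA : ActsAs h A p e₁) :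
    ∀ v, ⁅g, h⁆ v = v + f₁ (h v - v) • e₂ := by
  have hB : ∀ {n : V ≃ₗ[F] V}, (∀ w ∈ W, n w = w) → ActsAffinely n U f p 1 0 → ∀ v,
      n v - v ∈ A ∧ p (n v - v) = 0 := by
    intro n hW hn v
    obtain ⟨u, hu, w, hw, rfl⟩ := Submodule.mem_sup.1 (hUW ▸ Submodule.mem_top : v ∈ U ⊔ W)
    have h1 := hn.2.2 u hu
    rw [map_add, hW w hw, add_sub_add_right_eq_sub, hA, map_sub, map_sub, h1.1, h1.2]
    refine ⟨⟨U.sub_mem (hn.1 u hu) hu, ?_⟩, ?_⟩ <;> ring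
  have hh0 : ∀ b ∈ A, p b = 0 → h b = b := fun b hb hpb => by
    rw [hhA b hb, hpb, zero_smul, add_zero]
  have hhadd : ∀ v b, b ∈ A → p b = 0 → h (v + b) - (v + b) = h v - v := by
    intro v b hb hpb
    rw [map_add, hh0 b hb hpb]
    abel
  intro v
  obtain ⟨b, rfl⟩ := h.surjective v
  obtain ⟨w, rfl⟩ := g.surjective b
  rw [commutator_apply]
  have e1 := hB hhW hh
  have e2 := hB hgW hg
  have h1 : h (g w) - g w = h w - w := by
    have := hhadd w (g w - w) (e2 w).1 (e2 w).2
    rwa [add_sub_cancel] at this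
  have h2 : h (h (g w)) - h (g w) = h w - w := by
    have := hhadd (g w) (h (g w) - g w) (e1 _).1 (e1 _).2
    rw [add_sub_cancel] at this
    rw [this, h1]
  rw [h2]
  have h3 : h w = w + (h w - w) := by abel
  have h4 : h (g w) = g w + (h w - w) := by rw [← h1]; abel
  rw [h4]
  conv_lhs => rw [h3]
  rw [map_add, hgA _ (e1 w).1, add_assoc]

end ElementaryLifts

section RichTransvections

open Module
open scoped commutatorElement

variable {F E V : Type*} [Field F] [Field E] [Algebra F E] [Fintype F] [Finite E]
  [AddCommGroup V] [Module F V] [Finite V] {m k : ℕ} {H : Subgroup (V ≃ₗ[F] V)}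

/-- An element of order the full `r`-part of the multiplicative group, of norm one. -/
theorem exists_norm_one_of_prime {r : ℕ} (hr : r.Prime) (hm : finrank F E = m) (hm1 : 1 < m)
    (hrm : r ∣ Fintype.card F ^ m - 1)
    (hrj : ∀ j, 0 < j → j < m → ¬ r ∣ Fintype.card F ^ j - 1) :
    ∃ (y : E) (a : ℕ), ¬ r ^ (a + 1) ∣ Fintype.card F ^ m - 1 ∧ 0 < a ∧ y ≠ 0 ∧ orderOf y = r ^ a ∧
      y ^ (∑ a ∈ Finset.range m, Fintype.card F ^ a) = 1 := by
  have hq : 2 ≤ Fintype.card F := Fintype.one_lt_card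
  have hE : Nat.card Eˣ = Fintype.card F ^ m - 1 := by
    rw [Nat.card_units, Module.natCard_eq_pow_finrank (K := F) (V := E), hm, Nat.card_eq_fintype_card]
  have hpos : Fintype.card F ^ m - 1 ≠ 0 := by
    have := Nat.pow_le_pow_left hq m
    have := Nat.pow_le_pow_right (n := 2) (by norm_num) hm1
    omega
  set a := (Fintype.card F ^ m - 1).factorization r with ha
  have ha1 : ¬ r ^ (a + 1) ∣ Fintype.card F ^ m - 1 := Nat.pow_succ_factorization_not_dvd hpos hr
  have ha2 : r ^ a ∣ Fintype.card F ^ m - 1 := Nat.ordProj_dvd _ _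
  obtain ⟨g, hg⟩ := IsCyclic.exists_ofOrder_eq_natCard (α := Eˣ)
  rw [hE] at hg
  obtain ⟨c, hc⟩ := ha2
  have hc0 : c ≠ 0 := by
    rintro rfl
    exact hpos (by rw [hc, mul_zero])
  have hord : orderOf (g ^ c) = r ^ a := by
    rw [orderOf_pow_of_dvd hc0 (hg ▸ ⟨r ^ a, by rw [hc, mul_comm]⟩), hg, hc,
      Nat.mul_div_cancel _ (Nat.pos_of_ne_zero hc0)]
  have hsum : r ^ a ∣ ∑ a ∈ Finset.range m, Fintype.card F ^ a := by
    have hcop : Nat.Coprime (r ^ a) (Fintype.card F - 1) := by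
      apply Nat.Coprime.pow_left
      rw [hr.coprime_iff_not_dvd]
      have := hrj 1 one_pos hm1
      rwa [pow_one] at this
    apply hcop.dvd_of_dvd_mul_left
    have h1 := geom_sum_mul_add (Fintype.card F - 1) m
    rw [Nat.sub_add_cancel (by omega)] at h1
    rw [mul_comm, eq_tsub_of_add_eq h1, hc]
    exact dvd_mul_right _ _
  refine ⟨(g ^ c : Eˣ), a, ha1, ?_, Units.ne_zero _, ?_, ?_⟩
  · exact hr.factorization_pos_of_dvd hpos hrm
  · rw [orderOf_units, hord]
  · rw [← Units.val_pow_eq_pow_val, (orderOf_dvd_iff_pow_eq_one).1 (hord ▸ hsum), Units.val_one]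

/-- Dual systems of vectors in a subspace with given complement. -/
theorem exists_dual_system {π : V →ₗ[F] E} {σ : E →ₗ[F] V} (hπ : ∀ x, π (σ x) = x)
    {d : ℕ} (hk : d ≤ finrank F (LinearMap.ker π)) : ∃ (e : Fin d → V) (f : Fin d → Dual F V),
      (∀ i j, f i (e j) = if i = j then 1 else 0) ∧ (∀ j, π (e j) = 0) ∧ ∀ j x, f j (σ x) = 0 := by
  classical
  let b := finBasis F (LinearMap.ker π)
  let P : V →ₗ[F] LinearMap.ker π := LinearMap.codRestrict _ (LinearMap.id - σ.comp π) (fun v => by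
    simp [hπ])
  refine ⟨fun j => b (Fin.castLE hk j), fun j => (b.coord (Fin.castLE hk j)).comp P,
    fun i j => ?_, fun j => (b _).2, fun j x => ?_⟩
  · have : P (b (Fin.castLE hk j)) = b (Fin.castLE hk j) := by
      ext
      have h0 : π (b (Fin.castLE hk j)) = 0 := (b (Fin.castLE hk j)).2
      simp [P, h0]
    rw [LinearMap.comp_apply, this, Basis.coord_apply, Basis.repr_self, Finsupp.single_apply]
    simp only [Fin.castLE_inj, eq_comm]
  · have : P (σ x) = 0 := by
      ext
      simp [P, hπ]
    rw [LinearMap.comp_apply, this, map_zero]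

namespace RichGroup

variable {i : (V →ₗ[F] E) × (E →ₗ[F] V)}

theorem exists_transvection_mem (K : RichGroup H E m k i)
    {r : ℕ} (hr : r.Prime) (hrm : r ∣ Fintype.card F ^ m - 1)
    (hrj : ∀ j, 0 < j → j < m → ¬ r ∣ Fintype.card F ^ j - 1) :
    ∃ h ∈ H, ∃ (f : Dual F V) (u : V), f ≠ 0 ∧ u ≠ 0 ∧ f u = 0 ∧ ∀ v, h v = v + f v • u := by
  have hm := K.hm
  have hkm := K.hkm
  have h5 := K.h5
  have hk := K.hk
  obtain ⟨y, a, ha, ha0, hy0, hya, hyn⟩ := exists_norm_one_of_prime hr hm (by omega) hrm hrj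
  have hπ := K.frame.1
  obtain ⟨t, htH, htv⟩ := K.frame.2.2 y (by rwa [hm])
  have hy1 : y ≠ 1 := by
    rintro rfl
    rw [orderOf_one] at hya
    have := Nat.one_lt_pow ha0.ne' hr.one_lt
    omega
  have hadj := adjoin_eq_top_of_dvd hm hrj hy0 (hya ▸ dvd_pow_self r ha0.ne')
  have hG := not_dvd_card_linearEquiv (F := F) (V := V) hr (by omega) (by omega) (by omega) hrm hrj ha
  have htord : orderOf t = r ^ a := by
    rw [← hya]
    apply orderOf_eq_orderOf_iff.2
    intro j
    constructor
    · intro h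
      have := pow_torus_apply hπ htv j (i.2 1)
      rw [h, LinearEquiv.coe_one, id, left_eq_add, hπ, mul_one] at this
      have := congrArg i.1 this
      rwa [hπ, map_zero, sub_eq_zero] at this
    · intro h
      ext v
      rw [pow_torus_apply hπ htv, h, sub_self, zero_mul, map_zero, add_zero]
      rfl
  obtain ⟨e, f, hfe, he, hfσ⟩ := exists_dual_system hπ (d := 5) (by rw [K.finrank_ker]; exact h5)
  set U := LinearMap.ker i.1 with hU
  have heU : ∀ j, e j ∈ U := he
  set A := U ⊓ LinearMap.ker (f 4) with hAdef
  have hA : ∀ u, u ∈ A ↔ u ∈ U ∧ f 4 u = 0 := fun u => Iff.rfl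
  have heA : ∀ j, j ≠ 4 → e j ∈ A := fun j hj => (hA _).2 ⟨he j, by
    rw [hfe, if_neg hj.symm]⟩
  have hdec : ∀ u ∈ U, u - f 4 u • e 4 ∈ A := fun u hu =>
    (hA _).2 ⟨U.sub_mem hu (U.smul_mem _ (heU 4)), by
      rw [map_sub, map_smul, hfe, if_pos rfl, smul_eq_mul, mul_one, sub_self]⟩
  have hAfin : finrank F A = k - 1 := by
    have h1 : A ⊔ Submodule.span F {e 4} = U := by
      apply le_antisymm (sup_le inf_le_left (by
        rw [Submodule.span_singleton_le_iff_mem]; exact heU 4))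
      intro u hu
      rw [← sub_add_cancel u (f 4 u • e 4)]
      exact Submodule.add_mem_sup (hdec u hu) (Submodule.smul_mem _ _
        (Submodule.mem_span_singleton_self _))
    have h2 : e 4 ∉ A := fun h => by
      have := ((hA _).1 h).2
      rw [hfe, if_pos rfl] at this
      exact one_ne_zero this
    have := Submodule.finrank_sup_span_singleton h2
    rw [h1, K.finrank_ker] at this
    omega
  have hlift : ∀ a b : Fin 5, a ≠ 4 → a ≠ 0 → b ≠ 4 → a ≠ b → ∃ n ∈ H,
      n ∈ Subgroup.normalizer (Subgroup.zpowers t : Set (V ≃ₗ[F] V)) ∧ ActsAs n A (f b) (e a) ∧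
      ∃ c s, c ≠ 0 ∧ ActsAffinely n U (f 4) (f 0) c s := by
    intro a b ha4 ha0 hb4 hab
    have h0 : f b (e a) = 0 := by rw [hfe, if_neg hab.symm]
    obtain ⟨n, hn, hnn, hnA⟩ := exists_lift (fun j hj => K.transOff j (by omega)) hr hG htord htH
      htv A hAfin (LinearEquiv.transvection h0) (fun a ha => ha.1) (fun v hv => by
        rw [LinearEquiv.transvection.apply, map_add, map_smul, he, smul_zero, add_zero]
        exact hv.1)
    have hact : ActsAs n A (f b) (e a) := fun v hv => by
      rw [hnA v hv, LinearEquiv.transvection.apply]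
    have hpres : ∀ u ∈ U, n u ∈ U := fun u hu => normalizer_ker hπ htv hy1 hnn hu
    have hsurj : ∀ u ∈ U, ∃ w ∈ U, n w = u := fun u hu =>
      ⟨n.symm u, normalizer_ker hπ htv hy1 (Subgroup.inv_mem _ hnn) hu, n.apply_symm_apply u⟩
    have haff : ∀ u ∈ U, f 4 (n u) = f 4 (n (e 4)) * f 4 u ∧
        f 0 (n u) = f 0 u + f 0 (n (e 4)) * f 4 u := by
      intro u hu
      have h1 : n u = n (u - f 4 u • e 4) + f 4 u • n (e 4) := by
        rw [← map_smul, ← map_add, sub_add_cancel]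
      rw [h1, hact _ (hdec u hu)]
      simp only [map_add, map_sub, map_smul, hfe, if_pos, smul_eq_mul, ha4.symm, ha0.symm,
        if_false, show ¬ (0 : Fin 5) = 4 by decide]
      constructor <;> ring
    refine ⟨n, hn, hnn, hact, f 4 (n (e 4)), f 0 (n (e 4)), fun hc => ?_, hpres, hsurj, haff⟩
    obtain ⟨w, hw, hwe⟩ := hsurj _ (heU 4)
    have := (haff w hw).1
    rw [hwe, hfe, if_pos rfl, hc, zero_mul] at this
    exact one_ne_zero this
  obtain ⟨n13, h13, N13, A13, Q13⟩ := hlift 1 3 (by decide) (by decide) (by decide) (by decide)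
  obtain ⟨n32, h32, N32, A32, Q32⟩ := hlift 3 2 (by decide) (by decide) (by decide) (by decide)
  obtain ⟨n23, h23, N23, A23, Q23⟩ := hlift 2 3 (by decide) (by decide) (by decide) (by decide)
  obtain ⟨n30, h30, N30, A30, Q30⟩ := hlift 3 0 (by decide) (by decide) (by decide) (by decide)
  obtain ⟨n21, h21, N21, A21, Q21⟩ := hlift 2 1 (by decide) (by decide) (by decide) (by decide)
  have hcA : ∀ {g₁ g₂ : V ≃ₗ[F] V} (a b c : Fin 5), a ≠ 4 → b ≠ 4 → a ≠ b → b ≠ c → c ≠ a →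
      ActsAs g₁ A (f b) (e a) → ActsAs g₂ A (f c) (e b) → ActsAs ⁅g₁, g₂⁆ A (f c) (e a) := by
    intro g₁ g₂ a b c ha hb hab hbc hca h1 h2
    refine h1.commutator h2 (heA a ha) (heA b hb) ?_ ?_ ?_ ?_
    · rw [hfe, if_neg hab.symm]
    · rw [hfe, if_neg hbc.symm]
    · rw [hfe, if_pos rfl]
    · rw [hfe, if_neg hca]
  have hcH : ∀ {g₁ g₂ : V ≃ₗ[F] V}, g₁ ∈ H → g₂ ∈ H → ⁅g₁, g₂⁆ ∈ H := by
    intro g₁ g₂ h1 h2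
    rw [commutatorElement_def]
    exact H.mul_mem (H.mul_mem (H.mul_mem h1 h2) (H.inv_mem h1)) (H.inv_mem h2)
  have key := exists_transvection (g := ⁅⁅n21, n13⁆, ⁅n32, n21⁆⁆) (h := ⁅⁅n13, n32⁆, ⁅n23, n30⁆⁆) hA
    (LinearMap.range i.2) (by
      rw [eq_top_iff]
      intro v _
      rw [← sub_add_cancel v (i.2 (i.1 v))]
      refine Submodule.add_mem_sup ?_ ⟨_, rfl⟩
      rw [hU, LinearMap.mem_ker, map_sub, hπ, sub_self])
    (by
      rintro _ ⟨x, rfl⟩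
      exact double_commutator_range hπ htv hadj hy1 N21 N13 N32 N21 x)
    (by
      rintro _ ⟨x, rfl⟩
      exact double_commutator_range hπ htv hadj hy1 N13 N32 N23 N30 x)
    (ActsAffinely.double_commutator Q21 Q13 Q32 Q21)
    (ActsAffinely.double_commutator Q13 Q32 Q23 Q30)
    (hcA 2 3 1 (by decide) (by decide) (by decide) (by decide) (by decide)
      (hcA 2 1 3 (by decide) (by decide) (by decide) (by decide) (by decide) A21 A13)
      (hcA 3 2 1 (by decide) (by decide) (by decide) (by decide) (by decide) A32 A21))
    (hcA 1 2 0 (by decide) (by decide) (by decide) (by decide) (by decide)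
      (hcA 1 3 2 (by decide) (by decide) (by decide) (by decide) (by decide) A13 A32)
      (hcA 2 3 0 (by decide) (by decide) (by decide) (by decide) (by decide) A23 A30))
  have hA10 : ActsAs ⁅⁅n13, n32⁆, ⁅n23, n30⁆⁆ A (f 0) (e 1) :=
    (hcA 1 2 0 (by decide) (by decide) (by decide) (by decide) (by decide)
      (hcA 1 3 2 (by decide) (by decide) (by decide) (by decide) (by decide) A13 A32)
      (hcA 2 3 0 (by decide) (by decide) (by decide) (by decide) (by decide) A23 A30))
  refine ⟨_, hcH (hcH (hcH h21 h13) (hcH h32 h21)) (hcH (hcH h13 h32) (hcH h23 h30)),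
    (f 1).comp (LinearEquiv.toLinearMap ⁅⁅n13, n32⁆, ⁅n23, n30⁆⁆ - LinearMap.id), e 2, ?_, ?_, ?_,
    key⟩
  · intro h
    have h1 := LinearMap.congr_fun h (e 0)
    rw [LinearMap.comp_apply, LinearMap.sub_apply, LinearEquiv.coe_coe, LinearMap.id_apply,
      hA10 _ (heA 0 (by decide)), add_sub_cancel_left, map_smul, hfe, hfe] at h1
    simp at h1
  · intro h
    have h1 := hfe 2 2
    rw [h] at h1
    simp at h1
  · rw [LinearMap.comp_apply, LinearMap.sub_apply, LinearEquiv.coe_coe, LinearMap.id_apply,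
      hA10 _ (heA 2 (by decide)), add_sub_cancel_left, map_smul, hfe, hfe]
    simp

end RichGroup

end RichTransvections

section SpecialLinear

open Module

/-- Diagonal matrices of determinant one are products of transvections. -/
theorem diagonal_of_transvections {ι F : Type*} [Field F] [Fintype ι] [DecidableEq ι]
    (P : Matrix ι ι F → Prop) (h1 : P 1) (ht : ∀ i j (_ : i ≠ j) c, P (Matrix.transvection i j c))
    (hmul : ∀ A B, P A → P B → P (A * B)) (D : ι → F) (hD : ∏ i, D i = 1) :
    P (Matrix.diagonal D) := by
  have hpair : ∀ i j, i ≠ j → ∀ a : F, a ≠ 0 →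
      P (Matrix.diagonal (fun l => if l = i then a else if l = j then a⁻¹ else 1)) := by
    intro i j hij a ha
    have : Matrix.diagonal (fun l => if l = i then a else if l = j then a⁻¹ else 1) =
        Matrix.transvection i j 1 * Matrix.transvection j i (a - 1) *
          (Matrix.transvection i j (-a⁻¹) * Matrix.transvection j i (a - a ^ 2)) := by
      simp only [Matrix.transvection, add_mul, mul_add, one_mul, mul_one,
        Matrix.single_mul_single_same, Matrix.single_mul_single_of_ne _ _ _ _ hij,
        Matrix.single_mul_single_of_ne _ _ _ _ hij.symm, add_zero]
      ext x z
      simp only [Matrix.diagonal_apply, Matrix.add_apply, Matrix.one_apply, Matrix.single_apply]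
      by_cases hxz : x = z
      · subst hxz
        by_cases hx : x = i
        · subst hx
          simp [hij.symm]
          field_simp
          ring
        · by_cases hx' : x = j
          · subst hx'
            simp [hx, Ne.symm hx]
            field_simp
            ring
          · simp [hx, hx', Ne.symm hx, Ne.symm hx']
      · by_cases hx : x = i
        · subst hx
          by_cases hz : z = j
          · subst hz
            simp [hxz, Ne.symm hxz]
            field_simp
            ring
          · simp [hxz, Ne.symm hz, hij.symm]
        · by_cases hx' : x = j
          · subst hx'
            by_cases hz : z = i
            · subst hz
              simp [hxz, Ne.symm hxz]
              field_simp
              ring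
            · simp [hxz, Ne.symm hz, hij]
          · simp [hxz, Ne.symm hx, Ne.symm hx']
    rw [this]
    exact hmul _ _ (hmul _ _ (ht i j hij _) (ht j i hij.symm _))
      (hmul _ _ (ht i j hij _) (ht j i hij.symm _))
  have key : ∀ (s : Finset ι) (D : ι → F), (∀ l, l ∉ s → D l = 1) → ∏ i, D i = 1 →
      P (Matrix.diagonal D) := by
    intro s
    induction s using Finset.induction_on with
    | empty =>
      intro D hD _
      rwa [show D = fun _ => 1 from funext fun l => hD l (Finset.notMem_empty l),
        Matrix.diagonal_one]
    | insert i s his ih =>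
      intro D hDs hD
      have hne : D i ≠ 0 := fun h => by
        rw [Finset.prod_eq_zero (Finset.mem_univ i) h] at hD
        exact zero_ne_one hD
      rcases s.eq_empty_or_nonempty with rfl | ⟨j, hj⟩
      · have : D = fun _ => 1 := by
          funext l
          by_cases hl : l = i
          · subst hl
            rw [← hD, Finset.prod_eq_single_of_mem l (Finset.mem_univ l)]
            intro b _ hb
            exact hDs b (by simpa using hb)
          · exact hDs l (by simpa using hl)
        rwa [this, Matrix.diagonal_one]
      · have hij : i ≠ j := fun h => his (h ▸ hj)
        have hpr : Matrix.diagonal D =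
            Matrix.diagonal (fun l => if l = i then D i else if l = j then (D i)⁻¹ else 1) *
            Matrix.diagonal (fun l => D l * if l = i then (D i)⁻¹ else if l = j then D i else 1) := by
          rw [Matrix.diagonal_mul_diagonal]
          congr 1
          funext l
          by_cases hl : l = i
          · subst hl
            simp [hne]
          · by_cases hl' : l = j
            · subst hl'
              simp only [hl, if_false, if_true]
              field_simp
            · simp [hl, hl']
        rw [hpr]
        apply hmul _ _ (hpair i j hij _ hne)
        apply ih
        · intro l hl
          by_cases hl' : l = i
          · subst hl'
            simp [hne]
          · have : l ≠ j := fun h => hl (h ▸ hj)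
            simp [hl', this, hDs l (by simp [hl', hl])]
        · rw [Finset.prod_mul_distrib, hD, one_mul]
          rw [← Finset.mul_prod_erase _ _ (Finset.mem_univ i),
            ← Finset.mul_prod_erase _ _ (Finset.mem_erase.2 ⟨hij.symm, Finset.mem_univ j⟩),
            Finset.prod_eq_one]
          · simp [hij.symm, hne]
          · intro l hl
            simp only [Finset.mem_erase] at hl
            simp [hl.1, hl.2.1]
  exact key Finset.univ D (fun l hl => (hl (Finset.mem_univ l)).elim) hD

variable {F V : Type*} [Field F] [Fintype F] [AddCommGroup V] [Module F V] [Finite V]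
  {H : Subgroup (V ≃ₗ[F] V)}

/-- A group containing a transvection and transitive enough contains all transvections. -/
theorem transvection_mem (h0 : TransOff H 0) (h1 : TransOff H 1) {τ : V ≃ₗ[F] V} (hτ : τ ∈ H)
    {f : Dual F V} {u : V} (hf : f ≠ 0) (hu : u ≠ 0) (hfu : f u = 0)
    (hτv : ∀ v, τ v = v + f v • u) (ψ : Dual F V) (w : V) (hψw : ψ w = 0) :
    ∃ h ∈ H, ∀ v, h v = v + ψ v • w := by
  by_cases hψ : ψ = 0
  · exact ⟨1, H.one_mem, fun v => by rw [hψ]; simp⟩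
  by_cases hw : w = 0
  · exact ⟨1, H.one_mem, fun v => by rw [hw]; simp⟩
  obtain ⟨g, hg, -, hgu⟩ := h0 ⊥ (by simp) u w (by simpa using hu) (by simpa using hw)
  have hspan : ∀ {φ : Dual F V}, φ w = 0 → ∀ d ∈ Submodule.span F {w}, φ d = 0 := by
    intro φ hφ d hd
    obtain ⟨c, rfl⟩ := Submodule.mem_span_singleton.1 hd
    rw [map_smul, hφ, smul_zero]
  obtain ⟨g', hg', hfix, hv⟩ := exists_dual_map h1 (D := Submodule.span F {w})
    (finrank_span_singleton hw) (ξ := f.comp g.symm.toLinearMap) (ψ := ψ)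
    ⟨fun h => hf (by
      ext v
      have := LinearMap.congr_fun h (g v)
      simpa using this), hspan (by rw [← hgu]; simpa using hfu)⟩ ⟨hψ, hspan hψw⟩
  refine ⟨g'⁻¹ * (g * τ * g⁻¹) * g', H.mul_mem (H.mul_mem (H.inv_mem hg')
    (H.mul_mem (H.mul_mem hg hτ) (H.inv_mem hg))) hg', fun v => ?_⟩
  change g'.symm (g (τ (g.symm (g' v)))) = _
  have h2 : f (g.symm (g' v)) = ψ v := hv v
  rw [LinearEquiv.symm_apply_eq, hτv, h2, map_add, g.apply_symm_apply, map_smul, hgu, map_add,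
    map_smul, hfix w (Submodule.mem_span_singleton_self w)]

theorem mem_of_det_eq_one (hH : ∀ (ψ : Dual F V) (w : V), ψ w = 0 → ∃ h ∈ H, ∀ v, h v = v + ψ v • w)
    (g : V ≃ₗ[F] V) (hg : LinearMap.det g.toLinearMap = 1) : g ∈ H := by
  classical
  set b := finBasis F V
  set P : Matrix (Fin (finrank F V)) (Fin (finrank F V)) F → Prop := fun M =>
    ∃ h ∈ H, LinearMap.toMatrix b b h.toLinearMap = M with hP
  have hmul : ∀ A B, P A → P B → P (A * B) := by
    rintro _ _ ⟨a, ha, rfl⟩ ⟨c, hc, rfl⟩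
    refine ⟨a * c, H.mul_mem ha hc, ?_⟩
    rw [← LinearMap.toMatrix_comp]
    rfl
  have ht : ∀ i j (_ : i ≠ j) c, P (Matrix.transvection i j c) := by
    intro i j hij c
    obtain ⟨h, hh, hv⟩ := hH (c • b.coord j) (b i) (by simp [hij])
    refine ⟨h, hh, ?_⟩
    ext x z
    rw [LinearMap.toMatrix_apply, LinearEquiv.coe_coe, hv]
    simp only [Matrix.transvection, Matrix.add_apply, Matrix.one_apply, Matrix.single_apply,
      map_add, map_smul, Basis.repr_self, LinearMap.smul_apply, Basis.coord_apply,
      Finsupp.add_apply, Finsupp.smul_apply, Finsupp.single_apply, smul_eq_mul]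
    by_cases h1 : z = x <;> by_cases h2 : z = j <;> by_cases h3 : i = x <;>
      simp [h1, h2, h3, eq_comm]
    all_goals aesop
  have h1 : P 1 := ⟨1, H.one_mem, by
    rw [← LinearMap.toMatrix_id b]
    rfl⟩
  obtain ⟨h, hh, heq⟩ : P (LinearMap.toMatrix b b g.toLinearMap) := by
    apply Matrix.diagonal_transvection_induction P
    · intro D hD
      apply diagonal_of_transvections P h1 ht hmul
      rw [← Matrix.det_diagonal, hD, LinearMap.det_toMatrix, hg]
    · intro t
      exact ht t.i t.j t.hij t.c
    · exact hmul
  have : h = g := LinearEquiv.toLinearMap_injective ((LinearMap.toMatrix b b).injective heq)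
  rwa [← this]

variable {E : Type*} [Field E] [Algebra F E] [Finite E] {m k : ℕ}
  {i : (V →ₗ[F] E) × (E →ₗ[F] V)}

theorem RichGroup.mem_of_det (K : RichGroup H E m k i) {r : ℕ} (hr : r.Prime)
    (hrm : r ∣ Fintype.card F ^ m - 1)
    (hrj : ∀ j, 0 < j → j < m → ¬ r ∣ Fintype.card F ^ j - 1) (g : V ≃ₗ[F] V)
    (hg : LinearMap.det g.toLinearMap = 1) : g ∈ H := by
  have h5 := K.h5
  obtain ⟨τ, hτ, f, u, hf, hu, hfu, hτv⟩ := K.exists_transvection_mem hr hrm hrj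
  exact mem_of_det_eq_one (transvection_mem (K.transOff 0 (by omega)) (K.transOff 1 (by omega)) hτ
    hf hu hfu hτv) g hg

end SpecialLinear

section PrimitivePrimes

open Polynomial

theorem mul_add_one_le_pow {r : ℕ} (hr : 5 ≤ r) {x : ℝ} (hx : 2 ≤ x) : r * (x + 1) ≤ x ^ r - 1 := by
  induction r, hr using Nat.le_induction with
  | base =>
    have h1 : (2 : ℝ) ^ 4 ≤ x ^ 4 := pow_le_pow_left₀ (by norm_num) hx 4
    push_cast
    nlinarith
  | succ r hr ih =>
    have hr' : (5 : ℝ) ≤ r := by exact_mod_cast hr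
    rw [pow_succ]
    push_cast
    have h1 := mul_le_mul_of_nonneg_right ih (by linarith : (0 : ℝ) ≤ x)
    have h2 : r * (x + 1) * 2 ≤ r * (x + 1) * x :=
      mul_le_mul_of_nonneg_left hx (by positivity)
    have h3 : 1 * (x + 1) ≤ r * (x + 1) :=
      mul_le_mul_of_nonneg_right (by linarith) (by linarith)
    linarith

theorem lt_eval_cyclotomic {r k : ℕ} (hr : r.Prime) (hk : r ∣ k ∨ k ∣ r - 1) (h3 : 3 ≤ k * r)
    (h6 : k * r ≠ 6) {x : ℝ} (hx : 2 ≤ x) : (r : ℝ) < (cyclotomic (k * r) ℝ).eval x := by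
  have hr2 := hr.two_le
  have hk0 : k ≠ 0 := by
    rintro rfl
    omega
  by_cases hrk : r ∣ k
  · rw [← cyclotomic_expand_eq_cyclotomic hr hrk, expand_eval]
    have hk2 : 2 ≤ k := hr2.trans (Nat.le_of_dvd (Nat.pos_of_ne_zero hk0) hrk)
    have h2r : (r : ℝ) + 1 ≤ x ^ r := by
      have h1 : (r : ℝ) + 1 ≤ 2 ^ r := by exact_mod_cast Nat.lt_two_pow_self
      exact h1.trans (pow_le_pow_left₀ (by norm_num) hx r)
    have hr1 : (1 : ℝ) < r := by exact_mod_cast hr.one_lt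
    have h1 := sub_one_pow_totient_lt_cyclotomic_eval hk2 (q := x ^ r) (by linarith)
    have h2 : x ^ r - 1 ≤ (x ^ r - 1) ^ k.totient :=
      le_self_pow₀ (by linarith) (Nat.totient_pos.2 (Nat.pos_of_ne_zero hk0)).ne'
    linarith
  · have hkr := hk.resolve_left hrk
    have hle : k ≤ r - 1 := Nat.le_of_dvd (by omega) hkr
    have hexp : (cyclotomic k ℝ).eval (x ^ r) =
        (cyclotomic (k * r) ℝ).eval x * (cyclotomic k ℝ).eval x := by
      rw [← expand_eval, cyclotomic_expand_eq_cyclotomic_mul hr hrk, eval_mul]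
    have hr0 : (0 : ℝ) < r := by exact_mod_cast hr.pos
    by_contra! hle'
    rcases (by omega : k = 1 ∨ k = 2 ∨ 3 ≤ k) with rfl | rfl | hk3
    · rw [cyclotomic_one] at hexp
      simp only [eval_sub, eval_X, eval_one] at hexp
      obtain ⟨s, rfl⟩ : ∃ s, r = s + 1 := ⟨r - 1, by omega⟩
      have hb := one_add_mul_le_pow (by linarith : (-2 : ℝ) ≤ x - 1) s
      rw [add_sub_cancel] at hb
      have hs : (1 : ℝ) ≤ s := by exact_mod_cast (by omega : 1 ≤ s)
      rw [pow_succ] at hexp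
      push_cast at hle'
      nlinarith [mul_le_mul_of_nonneg_right hle' (by linarith : (0 : ℝ) ≤ x - 1),
        mul_le_mul_of_nonneg_right hb (by linarith : (0 : ℝ) ≤ x), mul_pos (by linarith : (0:ℝ) < s)
        (mul_pos (by linarith : (0:ℝ) < x - 1) (by linarith : (0:ℝ) < x - 1))]
    · have hr5 : 5 ≤ r := by
        by_contra! h
        have : r ≠ 4 := by rintro rfl; norm_num at hr
        omega
      rw [cyclotomic_two] at hexp
      simp only [eval_add, eval_X, eval_one] at hexp
      have h1 := mul_add_one_le_pow hr5 hx
      nlinarith [mul_le_mul_of_nonneg_right hle' (by linarith : (0 : ℝ) ≤ x + 1)]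
    · have hr5 : 5 ≤ r := by
        have : r ≠ 4 := by rintro rfl; norm_num at hr
        omega
      have h1 := mul_add_one_le_pow hr5 hx
      have hr5' : (5 : ℝ) ≤ r := by exact_mod_cast hr5
      have h2 := sub_one_pow_totient_lt_cyclotomic_eval (by omega : 2 ≤ k) (q := x ^ r)
        (by nlinarith)
      have h3 := cyclotomic_eval_lt_add_one_pow_totient hk3 (q := x) (by linarith)
      have h4 : (r : ℝ) ≤ (r : ℝ) ^ k.totient :=
        le_self_pow₀ (by linarith) (Nat.totient_pos.2 (by omega)).ne'
      have h5 : (r * (x + 1)) ^ k.totient ≤ (x ^ r - 1) ^ k.totient :=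
        pow_le_pow_left₀ (by positivity) h1 _
      rw [mul_pow] at h5
      have h6 : 0 < (cyclotomic k ℝ).eval x := cyclotomic_pos hk3 x
      have h7 : 0 < (x + 1) ^ k.totient := by positivity
      nlinarith [mul_le_mul_of_nonneg_right hle' h6.le, mul_le_mul_of_nonneg_right h4 h7.le,
        mul_le_mul_of_nonneg_left h3.le hr0.le]

/-- A prime dividing both `Φ_m(q)` and `m` divides the former exactly once. -/
theorem sq_not_dvd_cyclotomic {r m q : ℕ} (hr : r.Prime) (hq : 2 ≤ q) (hm : 3 ≤ m) (hrm : r ∣ m)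
    (h4 : r = 2 → 4 ∣ m) (hd : (r : ℤ) ∣ (cyclotomic m ℤ).eval (q : ℤ)) :
    ¬ ((r : ℤ) ^ 2 ∣ (cyclotomic m ℤ).eval (q : ℤ)) := by
  have : Fact r.Prime := ⟨hr⟩
  intro hsq
  obtain ⟨d, rfl⟩ := hrm
  have hd0 : 0 < d := Nat.pos_of_ne_zero (by rintro rfl; omega)
  have hprop : d ∈ (r * d).properDivisors :=
    Nat.mem_properDivisors.2 ⟨dvd_mul_left _ _, by nlinarith [hr.two_le]⟩
  have hdvd : ((q : ℤ) ^ d - 1) * (cyclotomic (r * d) ℤ).eval (q : ℤ) ∣ (q : ℤ) ^ (r * d) - 1 := by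
    have := eval_dvd (x := (q : ℤ)) (X_pow_sub_one_mul_cyclotomic_dvd_X_pow_sub_one_of_dvd ℤ hprop)
    simpa using this
  have hpos : (0 : ℤ) < (q : ℤ) ^ d - 1 := by
    have : (1 : ℤ) < (q : ℤ) ^ d := one_lt_pow₀ (by exact_mod_cast hq) hd0.ne'
    linarith
  have hrq : (r : ℤ) ∣ (q : ℤ) ^ (r * d) - 1 := (hd.mul_left _).trans hdvd
  have hrq' : (r : ℤ) ∣ (q : ℤ) ^ d - 1 := by
    rw [← ZMod.intCast_zmod_eq_zero_iff_dvd] at hrq ⊢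
    push_cast at hrq ⊢
    rwa [mul_comm, pow_mul, ZMod.pow_card] at hrq
  have hrx : ¬ (r : ℤ) ∣ (q : ℤ) ^ d := by
    intro h
    have := (dvd_sub h hrq')
    rw [sub_sub_cancel] at this
    exact hr.one_lt.ne' (by exact_mod_cast Int.eq_one_of_dvd_one (by positivity) this)
  rcases hr.eq_two_or_odd' with rfl | hodd
  · have h1 : (cyclotomic (2 * d) ℤ).eval (q : ℤ) ∣ (q : ℤ) ^ d + 1 := by
      rw [show (q : ℤ) ^ (2 * d) - 1 = ((q : ℤ) ^ d - 1) * ((q : ℤ) ^ d + 1) by ring] at hdvd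
      exact (mul_dvd_mul_iff_left hpos.ne').1 hdvd
    have h2 := hsq.trans h1
    obtain ⟨e, rfl⟩ : 2 ∣ d := by have := h4 rfl; omega
    have h5 : ((q : ℤ) ^ (2 * e) + 1) % 4 = 0 := by
      apply Int.emod_eq_zero_of_dvd
      simpa using h2
    rw [mul_comm 2 e, pow_mul, Int.add_emod, pow_two, Int.mul_emod] at h5
    have h6 : (q : ℤ) ^ e % 4 = 0 ∨ (q : ℤ) ^ e % 4 = 1 ∨ (q : ℤ) ^ e % 4 = 2 ∨
        (q : ℤ) ^ e % 4 = 3 := by omega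
    rcases h6 with h | h | h | h <;> rw [h] at h5 <;> norm_num at h5
  · have hlte := Int.emultiplicity_pow_sub_pow hr hodd (x := (q : ℤ) ^ d) (y := 1) hrq' hrx r
    rw [one_pow, ← pow_mul, mul_comm d] at hlte
    have hfin : FiniteMultiplicity (r : ℤ) ((q : ℤ) ^ d - 1) :=
      Int.finiteMultiplicity_iff.2 ⟨by simpa using hr.one_lt.ne', hpos.ne'⟩
    obtain ⟨c, hc⟩ : ∃ c : ℕ, emultiplicity (r : ℤ) ((q : ℤ) ^ d - 1) = c :=
      ⟨_, hfin.emultiplicity_eq_multiplicity⟩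
    have hself : emultiplicity r r = 1 := by
      have := emultiplicity_pow_self (p := r) hr.ne_zero (by simpa using hr.ne_one) 1
      simpa using this
    rw [hself, hc] at hlte
    have h2 : (r : ℤ) ^ (c + 2) ∣ (q : ℤ) ^ (r * d) - 1 := by
      rw [pow_add]
      exact (mul_dvd_mul (pow_dvd_of_le_emultiplicity hc.ge) hsq).trans hdvd
    have h3 := le_emultiplicity_of_pow_dvd h2
    rw [hlte] at h3
    norm_cast at h3
    omega

/-- Zsigmondy's theorem for `q ^ m - 1` with `m ≥ 3`, `m ≠ 6`. -/
theorem exists_primitive_prime {q m : ℕ} (hq : 2 ≤ q) (hm : 3 ≤ m) (h6 : m ≠ 6) :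
    ∃ r : ℕ, r.Prime ∧ r ∣ q ^ m - 1 ∧ ∀ j, 0 < j → j < m → ¬ r ∣ q ^ j - 1 := by
  set N := ((cyclotomic m ℤ).eval (q : ℤ)).natAbs with hN
  have hN1 : 1 < N := by
    have h1 := sub_one_pow_totient_lt_natAbs_cyclotomic_eval (by omega : 1 < m)
      (by omega : q ≠ 1)
    have h2 := Nat.one_le_pow m.totient (q - 1) (by omega)
    omega
  have hroot : ∀ {r : ℕ} (hr : r.Prime), r ∣ N →
      (cyclotomic m (ZMod r)).IsRoot (q : ZMod r) := by
    intro r hr h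
    rw [IsRoot.def, ← map_cyclotomic_int m (ZMod r), ← Int.cast_natCast, eval_intCast_map,
      eq_intCast, ZMod.intCast_zmod_eq_zero_iff_dvd]
    exact Int.natCast_dvd.2 h
  by_cases hex : ∃ r : ℕ, r.Prime ∧ r ∣ N ∧ ¬ r ∣ m
  · obtain ⟨r, hr, hrN, hrm⟩ := hex
    have : Fact r.Prime := ⟨hr⟩
    have : NeZero (m : ZMod r) := ⟨fun h => hrm ((ZMod.natCast_eq_zero_iff _ _).1 h)⟩
    have hprim := isRoot_cyclotomic_iff.1 (hroot hr hrN)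
    have hiff : ∀ j, r ∣ q ^ j - 1 ↔ (q : ZMod r) ^ j = 1 := by
      intro j
      rw [← ZMod.natCast_eq_zero_iff, Nat.cast_sub (Nat.one_le_pow _ _ (by omega)), sub_eq_zero]
      push_cast
      rfl
    refine ⟨r, hr, (hiff m).2 hprim.pow_eq_one, fun j h0 hj h => ?_⟩
    exact hprim.pow_ne_one_of_pos_of_lt h0.ne' hj ((hiff j).1 h)
  · push Not at hex
    exfalso
    have hdec : ∀ {r : ℕ}, r.Prime → r ∣ N → ∃ a m', m = r ^ (a + 1) * m' ∧ m' ∣ r - 1 := by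
      intro r hr hrN
      have : Fact r.Prime := ⟨hr⟩
      obtain ⟨a, m', hm', hmm⟩ := Nat.exists_eq_pow_mul_and_not_dvd (by omega : m ≠ 0) r hr.ne_one
      have ha : a ≠ 0 := by
        rintro rfl
        rw [pow_zero, one_mul] at hmm
        exact hm' (hmm ▸ hex r hr hrN)
      obtain ⟨a, rfl⟩ := Nat.exists_eq_succ_of_ne_zero ha
      refine ⟨a, m', hmm, ?_⟩
      have : NeZero (m' : ZMod r) := ⟨fun h => hm' ((ZMod.natCast_eq_zero_iff _ _).1 h)⟩
      have hrt := hroot hr hrN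
      rw [hmm, isRoot_cyclotomic_prime_pow_mul_iff_of_charP] at hrt
      rw [hrt.eq_orderOf]
      apply ZMod.orderOf_dvd_card_sub_one
      intro h0
      have h1 := hrt.pow_eq_one
      rw [h0, zero_pow (by rintro rfl; simp at hm')] at h1
      exact zero_ne_one h1
    have hlt : ∀ {r s : ℕ}, r.Prime → r ∣ N → s.Prime → s ∣ N → s ≠ r → s < r := by
      intro r s hr hrN hs hsN hne
      obtain ⟨a, m', hmm, hd⟩ := hdec hr hrN
      have h1 : s ∣ m' := by
        have := hex s hs hsN
        rw [hmm, hs.dvd_mul] at this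
        refine this.resolve_left fun h => hne ?_
        exact (Nat.prime_dvd_prime_iff_eq hs hr).1 (hs.dvd_of_dvd_pow h)
      have := Nat.le_of_dvd (by have := hr.two_le; omega) (h1.trans hd)
      have := hr.two_le
      omega
    set r := N.minFac with hrdef
    have hr : r.Prime := Nat.minFac_prime hN1.ne'
    have hrN : r ∣ N := Nat.minFac_dvd N
    have hNpow := Nat.eq_prime_pow_of_unique_prime_dvd (p := r) (by omega : N ≠ 0) (fun {s} hs hsN => by
      by_contra hne
      have h1 := hlt hr hrN hs hsN hne
      have h2 := hlt hs hsN hr hrN (Ne.symm hne)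
      omega)
    have hsq := sq_not_dvd_cyclotomic hr hq hm (hex r hr hrN) (fun h2 => by
      obtain ⟨a, m', hmm, hd⟩ := hdec hr hrN
      rw [h2] at hmm hd
      have : m' = 1 := by simpa using hd
      rw [this, mul_one] at hmm
      have ha : a ≠ 0 := by
        rintro rfl
        omega
      obtain ⟨c, rfl⟩ := Nat.exists_eq_succ_of_ne_zero ha
      exact ⟨2 ^ c, by rw [hmm, Nat.succ_eq_add_one]; ring⟩) (Int.natCast_dvd.2 hrN)
    have hle : N ≤ r := by
      rw [hNpow]
      set b := N.primeFactorsList.length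
      have hb : b < 2 := by
        by_contra! hb
        apply hsq
        have h1 : r ^ 2 ∣ N := hNpow ▸ pow_dvd_pow r hb
        have := Int.natCast_dvd (m := r ^ 2) (n := (cyclotomic m ℤ).eval (q : ℤ))
        push_cast at this
        exact this.2 h1
      calc r ^ b ≤ r ^ 1 := Nat.pow_le_pow_right hr.pos (by omega)
        _ = r := pow_one r
    obtain ⟨a, m', hmm, hd⟩ := hdec hr hrN
    have hmk : m = (r ^ a * m') * r := by rw [hmm]; ring
    have hsize := lt_eval_cyclotomic (k := r ^ a * m') (x := q) hr (by
      rcases Nat.eq_zero_or_pos a with rfl | ha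
      · right; simpa using hd
      · left; exact (dvd_pow_self r ha.ne').mul_right _) (hmk ▸ hm) (hmk ▸ h6) (by exact_mod_cast hq)
    rw [← hmk] at hsize
    have hcast : (cyclotomic m ℝ).eval (q : ℝ) = N := by
      have h1 : (cyclotomic m ℝ).eval ((q : ℤ) : ℝ) = (((cyclotomic m ℤ).eval (q : ℤ) : ℤ) : ℝ) := by
        rw [← map_cyclotomic_int m ℝ, eval_intCast_map]
        rfl
      have h2 : (0 : ℤ) < (cyclotomic m ℤ).eval (q : ℤ) := cyclotomic_pos (by omega) _
      rw [Int.cast_natCast] at h1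
      rw [h1, hN]
      have : (((cyclotomic m ℤ).eval (q : ℤ)).natAbs : ℤ) = (cyclotomic m ℤ).eval (q : ℤ) :=
        Int.natAbs_of_nonneg h2.le
      conv_lhs => rw [← this]
      rw [Int.cast_natCast]
    rw [hcast] at hsize
    have : r < N := by exact_mod_cast hsize
    omega

end PrimitivePrimes

section BlockElements

open Module

variable {F E V : Type*} [Field F] [Field E] [Algebra F E] [Fintype F] [Finite E]
  [AddCommGroup V] [Module F V] [Finite V] {m k : ℕ} {H : Subgroup (V ≃ₗ[F] V)}

theorem eq_bot_or_top_of_adjoin {y : E} (hy : Algebra.adjoin F {y} = ⊤) (S : Submodule F E)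
    (hS : ∀ x ∈ S, y * x ∈ S) : S = ⊥ ∨ S = ⊤ := by
  have hall : ∀ z : E, ∀ x ∈ S, z * x ∈ S := by
    intro z
    have hz : z ∈ Algebra.adjoin F {y} := hy ▸ Algebra.mem_top
    induction hz using Algebra.adjoin_induction with
    | mem a ha => rw [Set.mem_singleton_iff.1 ha]; exact hS
    | algebraMap a => intro x hx; rw [← Algebra.smul_def]; exact S.smul_mem a hx
    | add a b _ _ ha hb => intro x hx; rw [add_mul]; exact S.add_mem (ha x hx) (hb x hx)
    | mul a b _ _ ha hb => intro x hx; rw [mul_assoc]; exact ha _ (hb x hx)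
  by_contra! h
  obtain ⟨x, hx, hx0⟩ := S.exists_mem_ne_zero_of_ne_bot h.1
  apply h.2
  rw [eq_top_iff]
  intro z _
  have := hall (z * x⁻¹) x hx
  rwa [inv_mul_cancel_right₀ hx0] at this

/-- Multiplication by `y` on an algebra without proper invariant subspaces or fixed vectors. -/
structure IsBlockUnit (F : Type*) {D : Type*} [Field F] [CommRing D] [Algebra F D] (y : D) :
    Prop where
  irr : ∀ S : Submodule F D, (∀ x ∈ S, y * x ∈ S) → S = ⊥ ∨ S = ⊤
  fix : ∀ x, (y - 1) * x = 0 → x = 0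

theorem IsBlockUnit.dichotomy {D : Type*} [CommRing D] [Algebra F D] {y : D}
    (hy : IsBlockUnit F y) {ρ : V →ₗ[F] D} {ι : D →ₗ[F] V} (h : ∀ x, ρ (ι x) = x)
    {W : Submodule F V} (hW : ∀ w ∈ W, w + ι ((y - 1) * ρ w) ∈ W) :
    (∀ x, ι x ∈ W) ∨ ∀ w ∈ W, ρ w = 0 := by
  rcases hy.irr (W.comap ι) (fun x hx => by
    have := hW _ hx
    rwa [h, ← map_add, sub_mul, one_mul, add_sub_cancel] at this) with h1 | h1
  · right
    intro w hw
    apply hy.fix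
    have h2 := (W.sub_mem (hW w hw) hw)
    rw [add_sub_cancel_left] at h2
    have h3 : (y - 1) * ρ w ∈ W.comap ι := h2
    rwa [h1, Submodule.mem_bot] at h3
  · left
    intro x
    have : x ∈ W.comap ι := h1 ▸ Submodule.mem_top
    exact this

/-- Two complementary blocks of the axis of a frame, with the elements moving only one of them. -/
structure BlockPair (H : Subgroup (V ≃ₗ[F] V)) {D D' : Type*} [CommRing D] [Algebra F D]
    [CommRing D'] [Algebra F D'] (y : D) (y' : D') (π : V →ₗ[F] E) (σ : E →ₗ[F] V)
    (ρ : V →ₗ[F] D) (ι : D →ₗ[F] V) (ρ' : V →ₗ[F] D') (ι' : D' →ₗ[F] V) : Prop where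
  unit : IsBlockUnit F y
  unit' : IsBlockUnit F y'
  hι : ∀ x, ρ (ι x) = x
  hι' : ∀ x, ρ' (ι' x) = x
  hπι : ∀ x, π (ι x) = 0
  hπι' : ∀ x, π (ι' x) = 0
  hρσ : ∀ x, ρ (σ x) = 0
  hρι' : ∀ x, ρ (ι' x) = 0
  hρσ' : ∀ x, ρ' (σ x) = 0
  hρι : ∀ x, ρ' (ι x) = 0
  dec : ∀ v, ι (ρ v) + ι' (ρ' v) + σ (π v) = v
  mem : ∃ h ∈ H, ∀ v, h v = v + ι ((y - 1) * ρ v)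
  mem' : ∃ h ∈ H, ∀ v, h v = v + ι' ((y' - 1) * ρ' v)

variable {D D' : Type*} [CommRing D] [Algebra F D] [CommRing D'] [Algebra F D'] {y : D} {y' : D'}
  {π : V →ₗ[F] E} {σ : E →ₗ[F] V} {ρ : V →ₗ[F] D} {ι : D →ₗ[F] V} {ρ' : V →ₗ[F] D'}
  {ι' : D' →ₗ[F] V}

theorem BlockPair.symm (B : BlockPair H y y' π σ ρ ι ρ' ι') : BlockPair H y' y π σ ρ' ι' ρ ι :=
  ⟨B.unit', B.unit, B.hι', B.hι, B.hπι', B.hπι, B.hρσ', B.hρι, B.hρσ, B.hρι',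
    fun v => by rw [add_comm (ι' _)]; exact B.dec v, B.mem', B.mem⟩

theorem BlockPair.aux (B : BlockPair H y y' π σ ρ ι ρ' ι') {e : ℕ} (he : ¬ e ∣ finrank F D)
    (h2 : 2 ≤ finrank F D) :
    ∃ c ∈ H, ∃ A B : Submodule F V, IsCompl A B ∧
      A ≤ LinearMap.ker π ∧ LinearMap.range σ ≤ B ∧ (∀ b ∈ B, c b = b) ∧ (∀ a ∈ A, c a ∈ A) ∧
      (∀ S ≤ A, (∀ v ∈ S, c v ∈ S) → S = ⊥ ∨ S = A) ∧ ¬ e ∣ finrank F A ∧ 2 ≤ finrank F A ∧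
      ∀ S, A ≤ S → S ≤ LinearMap.ker π →
        (∀ h ∈ H, (∀ a ∈ A, h a = a) → ∀ v ∈ S, h v ∈ S) → S = A ∨ S = LinearMap.ker π := by
  obtain ⟨c, hcH, hc⟩ := B.mem
  obtain ⟨c', hc'H, hc'⟩ := B.mem'
  have hrank : finrank F (LinearMap.range ι) = finrank F D :=
    LinearMap.finrank_range_of_inj (Function.LeftInverse.injective B.hι)
  refine ⟨c, hcH, LinearMap.range ι, LinearMap.ker ρ, ?_, ?_, ?_, ?_, ?_, ?_, ?_, ?_, ?_⟩
  · refine IsCompl.of_eq (eq_bot_iff.2 ?_) (eq_top_iff.2 ?_)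
    · rintro _ ⟨⟨x, rfl⟩, hx⟩
      rw [SetLike.mem_coe, LinearMap.mem_ker, B.hι] at hx
      simp [hx]
    · intro v _
      refine Submodule.mem_sup.2 ⟨ι (ρ v), ⟨_, rfl⟩, v - ι (ρ v), ?_, by abel⟩
      rw [LinearMap.mem_ker, map_sub, B.hι, sub_self]
  · rintro _ ⟨x, rfl⟩
    exact B.hπι x
  · rintro _ ⟨x, rfl⟩
    exact B.hρσ x
  · intro b hb
    rw [hc, LinearMap.mem_ker.1 hb, mul_zero, map_zero, add_zero]
  · rintro _ ⟨x, rfl⟩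
    exact ⟨x + (y - 1) * x, by rw [hc, map_add, B.hι]⟩
  · intro S hS hcS
    rcases B.unit.dichotomy B.hι (W := S) (fun w hw => hc w ▸ hcS w hw) with h | h
    · right
      apply le_antisymm hS
      rintro _ ⟨x, rfl⟩
      exact h x
    · left
      rw [eq_bot_iff]
      intro v hv
      obtain ⟨x, rfl⟩ := hS hv
      have := h _ hv
      rw [B.hι] at this
      simp [this]
  · rwa [hrank]
  · rwa [hrank]
  · intro S hAS hSk hS
    have hA : ∀ a ∈ LinearMap.range ι, c' a = a := by
      rintro _ ⟨x, rfl⟩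
      rw [hc', B.hρι, mul_zero, map_zero, add_zero]
    have hk : ∀ v ∈ LinearMap.ker π, v = ι (ρ v) + ι' (ρ' v) := by
      intro v hv
      have := B.dec v
      rwa [LinearMap.mem_ker.1 hv, map_zero, add_zero, eq_comm] at this
    rcases B.unit'.dichotomy B.hι' (W := S) (fun w hw => hc' w ▸ hS c' hc'H hA w hw) with h | h
    · right
      apply le_antisymm hSk
      intro v hv
      rw [hk v hv]
      exact S.add_mem (hAS ⟨_, rfl⟩) (h _)
    · left
      apply le_antisymm _ hAS
      intro v hv
      rw [hk v (hSk hv), h v hv, map_zero, add_zero]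
      exact ⟨_, rfl⟩

theorem BlockPair.rich [Module.Finite F D] [Module.Finite F D']
    (B : BlockPair H y y' π σ ρ ι ρ' ι')
    (hm : finrank F E = m) (hk : finrank F V = m + k) (hkm : k + 1 < m) (h5 : 5 ≤ k)
    (irr : ∀ S : Submodule F V, (∀ h ∈ H, ∀ v ∈ S, h v ∈ S) → S = ⊥ ∨ S = ⊤) (ndvd : ¬ k ∣ m)
    (frame : (π, σ) ∈ framesOver H E ⊥) (h1 : finrank F D = 0 ∨ 2 ≤ finrank F D)
    (h2 : finrank F D' = 0 ∨ 2 ≤ finrank F D')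
    (hg : ∀ e, e ∣ finrank F D → e ∣ finrank F D' → e ∣ m → e = 1) :
    RichGroup H E m k (π, σ) := by
  refine ⟨hm, hk, hkm, h5, irr, ndvd, frame, fun e he hem => ?_⟩
  by_cases he1 : e ∣ finrank F D
  · have he2 : ¬ e ∣ finrank F D' := fun h => he.ne' (hg e he1 h hem)
    exact B.symm.aux he2 (h2.resolve_left fun h => he2 (h ▸ dvd_zero e))
  · exact B.aux he1 (h1.resolve_left fun h => he1 (h ▸ dvd_zero e))

end BlockElements

section ModelElements

open Module

variable {F : Type*} [Field F] [Fintype F]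

theorem exists_finite_extension (F : Type*) [Field F] [Fintype F] {k : ℕ} (hk : k ≠ 0) :
    ∃ (D : Type) (_ : Field D) (_ : Algebra F D), Finite D ∧ finrank F D = k := by
  obtain ⟨p, hp⟩ := CharP.exists F
  have : Fact p.Prime := ⟨CharP.char_is_prime F p⟩
  have : NeZero k := ⟨hk⟩
  exact ⟨FiniteField.Extension F p k, inferInstance, inferInstance, inferInstance,
    FiniteField.finrank_extension F p k⟩

/-- A block of dimension `k` with an irreducible element of norm one. -/
theorem exists_block (F : Type*) [Field F] [Fintype F] {k : ℕ} (hk : k = 0 ∨ (3 ≤ k ∧ k ≠ 6)) :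
    ∃ (D : Type) (_ : CommRing D) (_ : Algebra F D) (a : Dˣ) (R : ℕ), Finite D ∧ finrank F D = k ∧
      a ^ R = 1 ∧ Algebra.norm F (a : D) = 1 ∧ R ∣ Fintype.card F ^ k - 1 ∧
      (∀ t, Nat.Coprime t R → IsBlockUnit F ((a : D) ^ t)) ∧
      ∀ s, (k ≠ 0 → ¬ k ∣ s) → Nat.Coprime R (Fintype.card F ^ s - 1) := by
  rcases hk with rfl | ⟨h3, h6⟩
  · refine ⟨PUnit, inferInstance, inferInstance, 1, 1, inferInstance, finrank_zero_of_subsingleton,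
      Subsingleton.elim _ _, map_one _, one_dvd _, fun t _ => ⟨fun S _ => ?_, fun x _ => Subsingleton.elim _ _⟩,
      fun s _ => Nat.coprime_one_left _⟩
    exact Or.inl (Subsingleton.elim _ _)
  · obtain ⟨D, _, _, _, hD⟩ := exists_finite_extension F (k := k) (by omega)
    obtain ⟨r, hr, hrk, hrj⟩ := exists_primitive_prime (q := Fintype.card F) Fintype.one_lt_card h3 h6
    have hcard : Nat.card Dˣ = Fintype.card F ^ k - 1 := by
      rw [Nat.card_units, Module.natCard_eq_pow_finrank (K := F) (V := D), hD,
        Nat.card_eq_fintype_card]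
    have : Fact r.Prime := ⟨hr⟩
    obtain ⟨a, ha⟩ := exists_prime_orderOf_dvd_card' (G := Dˣ) r (hcard ▸ hrk)
    have har : a ^ r = 1 := ha ▸ pow_orderOf_eq_one a
    have hcop : ∀ s, ¬ k ∣ s → Nat.Coprime r (Fintype.card F ^ s - 1) := fun s hs =>
      (Nat.Prime.coprime_iff_not_dvd hr).2 (not_dvd_pow_sub_one (by omega) hrk hrj hs)
    refine ⟨D, inferInstance, inferInstance, a, r, inferInstance, hD, har, ?_, hrk, ?_,
      fun s hs => hcop s (hs (by omega))⟩
    · have h1 : Units.map (Algebra.norm F (S := D)) a = 1 := by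
        rw [← orderOf_eq_one_iff]
        apply Nat.eq_one_of_dvd_coprimes (hcop 1 (by rw [Nat.dvd_one]; omega))
        · apply orderOf_dvd_of_pow_eq_one
          rw [← map_pow, har, map_one]
        · rw [pow_one, ← Nat.card_eq_fintype_card, ← Nat.card_units]
          exact orderOf_dvd_natCard _
      exact congrArg Units.val h1
    · intro t ht
      have hord : orderOf ((a : D) ^ t) = r := by
        rw [← Units.val_pow_eq_pow_val, orderOf_units, orderOf_pow, ha, Nat.gcd_comm, ht, Nat.div_one]
      refine ⟨eq_bot_or_top_of_adjoin (adjoin_eq_top_of_dvd hD hrj ?_ hord.symm.dvd), ?_⟩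
      · exact pow_ne_zero _ a.ne_zero
      · intro x hx
        refine (mul_eq_zero.1 hx).resolve_left fun h => hr.one_lt.ne ?_
        rw [← hord, sub_eq_zero.1 h, orderOf_one]

/-- An element of an extension whose powers contain the norm one elements. -/
theorem exists_norm_generator (E : Type*) [Field E] [Algebra F E] [Finite E] {m : ℕ}
    (hm : finrank F E = m) (Δ : Subgroup Fˣ) :
    ∃ b : Eˣ, Units.map (Algebra.norm F (S := E)) b ∈ Δ ∧
      Δ ≤ Subgroup.zpowers (Units.map (Algebra.norm F (S := E)) b) ∧
      ∀ y : E, y ^ (∑ a ∈ Finset.range m, Fintype.card F ^ a) = 1 → ∃ u : ℕ, (b : E) ^ u = y := by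
  set N : Eˣ →* Fˣ := Units.map (Algebra.norm F (S := E)) with hN
  obtain ⟨b, hb⟩ := (inferInstance : IsCyclic (Δ.comap N)).exists_generator
  refine ⟨b, b.2, fun d hd => ?_, fun y hy => ?_⟩
  · obtain ⟨x, rfl⟩ := FiniteField.unitsMap_norm_surjective F E d
    obtain ⟨j, hj⟩ := Subgroup.mem_zpowers_iff.1 (hb ⟨x, hd⟩)
    refine ⟨j, ?_⟩
    beta_reduce
    have : (b : Eˣ) ^ j = x := congrArg Subtype.val hj
    rw [← map_zpow, this]
  · have : Fintype E := Fintype.ofFinite E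
    have hm0 : m ≠ 0 := hm ▸ finrank_pos.ne'
    have hy0 : y ≠ 0 := by
      rintro rfl
      refine zero_ne_one (α := E) ?_
      rw [← hy, zero_pow]
      rw [← Nat.pos_iff_ne_zero]
      exact Finset.sum_pos (fun a _ => pow_pos Fintype.card_pos a) (Finset.nonempty_range_iff.2 hm0)
    have hq := Fintype.one_lt_card (α := F)
    have hgs : ∑ a ∈ Finset.range m, Fintype.card F ^ a =
        (Nat.card E - 1) / (Nat.card F - 1) := by
      rw [Module.natCard_eq_pow_finrank (K := F) (V := E), hm, Nat.card_eq_fintype_card,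
        Nat.geomSum_eq hq]
    have h1 : Units.mk0 y hy0 ∈ Δ.comap N := by
      rw [Subgroup.mem_comap]
      convert Δ.one_mem
      ext
      apply (algebraMap F E).injective
      rw [hN, Units.coe_map, Units.val_mk0, FiniteField.algebraMap_norm_eq_pow, ← hgs, hy]
      simp
    obtain ⟨j, hj⟩ := (mem_powers_iff_mem_zpowers.2 (hb ⟨_, h1⟩))
    refine ⟨j, ?_⟩
    have := congrArg (fun x : Δ.comap N => ((x : Eˣ) : E)) hj
    simpa using this

end ModelElements

section ModelElements

open Module

variable {F : Type*} [Field F] [Fintype F]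

theorem finrank_prod_submodule {A B : Type*} [AddCommGroup A] [Module F A] [AddCommGroup B]
    [Module F B] [Finite A] [Finite B] (p : Submodule F A) (q : Submodule F B) :
    finrank F (p.prod q) = finrank F p + finrank F q := by
  have e : (p.prod q) ≃ₗ[F] p × q :=
    { toFun := fun x => (⟨x.1.1, x.2.1⟩, ⟨x.1.2, x.2.2⟩)
      map_add' := fun _ _ => rfl
      map_smul' := fun _ _ => rfl
      invFun := fun x => ⟨(x.1.1, x.2.1), x.1.2, x.2.2⟩
      left_inv := fun _ => rfl
      right_inv := fun _ => rfl }
  rw [e.finrank_eq, Module.finrank_prod]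

theorem eq_prod_of_blocks {A B : Type*} [AddCommGroup A] [Module F A] [AddCommGroup B]
    [Module F B] {W : Submodule F (A × B)} {p : Submodule F A} {q : Submodule F B}
    (hp : ∀ x ∈ p, (x, (0 : B)) ∈ W) (hq : ∀ x ∈ q, ((0 : A), x) ∈ W) (h : ∀ w ∈ W, w.1 ∈ p ∧ w.2 ∈ q) :
    W = p.prod q := by
  ext w
  refine ⟨fun hw => h w hw, fun hw => ?_⟩
  have := W.add_mem (hp _ hw.1) (hq _ hw.2)
  simpa using this

theorem exists_model_element (F : Type*) [Field F] [Fintype F] (Δ : Subgroup Fˣ) {k₁ k₂ m : ℕ}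
    (h1 : k₁ = 0 ∨ (3 ≤ k₁ ∧ k₁ ≠ 6)) (h2 : k₂ = 0 ∨ (3 ≤ k₂ ∧ k₂ ≠ 6)) (hm3 : 3 ≤ m) (hm6 : m ≠ 6)
    (hne : k₁ = k₂ → k₁ = 0) (h1m : k₁ ≠ 0 → ¬ k₁ ∣ m) (h2m : k₂ ≠ 0 → ¬ k₂ ∣ m) :
    ∃ (V : Type) (_ : AddCommGroup V) (_ : Module F V), Finite V ∧ finrank F V = k₁ + k₂ + m ∧
    ∃ g : V ≃ₗ[F] V, LinearEquiv.det g ∈ Δ ∧ Δ ≤ Subgroup.zpowers (LinearEquiv.det g) ∧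
      (∀ W : Submodule F V, (∀ w ∈ W, g w ∈ W) → ∃ d : ℕ, (d = 0 ∨ d = k₁ ∨ d = k₂ ∨ d = k₁ + k₂) ∧
        (finrank F W = d ∨ finrank F W = m + (k₁ + k₂) - d)) ∧
      (k₁ + k₂ + 1 < m → 5 ≤ k₁ + k₂ → ¬ (k₁ + k₂) ∣ m → (∀ e, e ∣ k₁ → e ∣ k₂ → e ∣ m → e = 1) →
        ∀ H : Subgroup (V ≃ₗ[F] V), g ∈ H →
        (∀ S : Submodule F V, (∀ h ∈ H, ∀ v ∈ S, h v ∈ S) → S = ⊥ ∨ S = ⊤) →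
        ∀ h : V ≃ₗ[F] V, LinearMap.det h.toLinearMap = 1 → h ∈ H) := by
  have hq := Fintype.one_lt_card (α := F)
  obtain ⟨D₁, _, _, a₁, R₁, _, hD₁, haR₁, hN₁, hR₁, hu₁, hc₁⟩ := exists_block F h1
  obtain ⟨D₂, _, _, a₂, R₂, _, hD₂, haR₂, hN₂, hR₂, hu₂, hc₂⟩ := exists_block F h2
  obtain ⟨E, _, _, _, hE⟩ := exists_finite_extension F (k := m) (by omega)
  obtain ⟨b, hbΔ, hΔb, hb⟩ := exists_norm_generator E hE Δ
  obtain ⟨r, hr, hrm, hrj⟩ := exists_primitive_prime hq hm3 hm6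
  obtain ⟨y₀, c, -, hc0, hy₀, hy₀r, hy₀1⟩ := exists_norm_one_of_prime hr hE (by omega) hrm hrj
  have hbQ : b ^ (Fintype.card F ^ m - 1) = 1 := by
    rw [← hE, ← Nat.card_eq_fintype_card, ← Module.natCard_eq_pow_finrank, ← Nat.card_units]
    exact pow_card_eq_one'
  have hcop : Nat.Coprime R₁ R₂ := by
    by_cases h : k₁ ≠ 0 → ¬ k₁ ∣ k₂
    · exact (hc₁ k₂ h).coprime_dvd_right hR₂
    · push Not at h
      refine ((hc₂ k₁ fun h0 h' => ?_).coprime_dvd_right hR₁).symm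
      exact h.1 (hne (Nat.dvd_antisymm h.2 h'))
  have hcm₁ := hc₁ m h1m
  have hcm₂ := hc₂ m h2m
  set Q := Fintype.card F ^ m - 1 with hQ
  set M := ∑ a ∈ Finset.range m, Fintype.card F ^ a with hM
  have hMQ : M ∣ Q := by
    have := geom_sum_mul_add (Fintype.card F - 1) m
    rw [Nat.sub_add_cancel hq.le, ← hM] at this
    exact ⟨Fintype.card F - 1, by rw [hQ]; omega⟩
  let g : ((D₁ × D₂) × E) ≃ₗ[F] ((D₁ × D₂) × E) :=
    ((DistribMulAction.toLinearEquiv F D₁ a₁).prodCongr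
      (DistribMulAction.toLinearEquiv F D₂ a₂)).prodCongr (DistribMulAction.toLinearEquiv F E b)
  have hpow : ∀ (t : ℕ) (v : (D₁ × D₂) × E), (g ^ t) v =
      (((a₁ : D₁) ^ t * v.1.1, (a₂ : D₂) ^ t * v.1.2), (b : E) ^ t * v.2) := by
    intro t
    induction t with
    | zero => intro v; simp
    | succ t ih =>
      intro v
      rw [pow_succ', LinearEquiv.mul_apply, ih]
      simp only [g, LinearEquiv.prodCongr_apply, DistribMulAction.toLinearEquiv_apply,
        Units.smul_def, smul_eq_mul]
      simp only [pow_succ', mul_assoc]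
  -- projections and injections of the three blocks
  let π : ((D₁ × D₂) × E) →ₗ[F] E := LinearMap.snd F _ _
  let σ : E →ₗ[F] ((D₁ × D₂) × E) := LinearMap.inr F _ _
  let ρ₁ : ((D₁ × D₂) × E) →ₗ[F] D₁ := LinearMap.fst F _ _ ∘ₗ LinearMap.fst F _ _
  let ι₁ : D₁ →ₗ[F] ((D₁ × D₂) × E) := LinearMap.inl F _ _ ∘ₗ LinearMap.inl F _ _
  let ρ₂ : ((D₁ × D₂) × E) →ₗ[F] D₂ := LinearMap.snd F _ _ ∘ₗ LinearMap.fst F _ _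
  let ι₂ : D₂ →ₗ[F] ((D₁ × D₂) × E) := LinearMap.inl F _ _ ∘ₗ LinearMap.inr F _ _
  have ha₁ : ∀ t, R₁ ∣ t → (a₁ : D₁) ^ t = 1 := by
    rintro _ ⟨s, rfl⟩
    rw [pow_mul, ← Units.val_pow_eq_pow_val, haR₁, Units.val_one, one_pow]
  have ha₂ : ∀ t, R₂ ∣ t → (a₂ : D₂) ^ t = 1 := by
    rintro _ ⟨s, rfl⟩
    rw [pow_mul, ← Units.val_pow_eq_pow_val, haR₂, Units.val_one, one_pow]
  have hbt : ∀ t, Q ∣ t → (b : E) ^ t = 1 := by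
    rintro _ ⟨s, rfl⟩
    rw [pow_mul, ← Units.val_pow_eq_pow_val, hbQ, Units.val_one, one_pow]
  have hg₁ : ∃ t : ℕ, IsBlockUnit F ((a₁ : D₁) ^ t) ∧
      ∀ v, (g ^ t) v = v + ι₁ (((a₁ : D₁) ^ t - 1) * ρ₁ v) := by
    refine ⟨R₂ * Q, hu₁ _ (hcop.mul_right hcm₁).symm, fun v => ?_⟩
    rw [hpow, ha₂ _ (dvd_mul_right _ _), hbt _ (dvd_mul_left _ _)]
    ext <;> simp [ι₁, ρ₁, sub_mul]
  have hg₂ : ∃ t : ℕ, IsBlockUnit F ((a₂ : D₂) ^ t) ∧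
      ∀ v, (g ^ t) v = v + ι₂ (((a₂ : D₂) ^ t - 1) * ρ₂ v) := by
    refine ⟨R₁ * Q, hu₂ _ (hcop.symm.mul_right hcm₂).symm, fun v => ?_⟩
    rw [hpow, ha₁ _ (dvd_mul_right _ _), hbt _ (dvd_mul_left _ _)]
    ext <;> simp [ι₂, ρ₂, sub_mul]
  have hgE : ∀ y : E, y ^ M = 1 → ∃ t : ℕ, ∀ v, (g ^ t) v = v + σ ((y - 1) * π v) := by
    intro y hy
    have hcM : Nat.Coprime (R₁ * R₂) M :=
      Nat.Coprime.mul_left (hcm₁.coprime_dvd_right hMQ) (hcm₂.coprime_dvd_right hMQ)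
    obtain ⟨s, hs⟩ := exists_pow_eq_self_of_coprime (x := y) (n := R₁ * R₂)
      (hcM.coprime_dvd_right (orderOf_dvd_of_pow_eq_one hy))
    obtain ⟨u, hu⟩ := hb y hy
    refine ⟨u * (R₁ * R₂) * s, fun v => ?_⟩
    rw [hpow, ha₁ _ ⟨u * R₂ * s, by ring⟩, ha₂ _ ⟨u * R₁ * s, by ring⟩, mul_assoc u, pow_mul, hu,
      pow_mul, hs]
    ext <;> simp [σ, π, sub_mul]
  obtain ⟨t₁, hbu₁, ht₁⟩ := hg₁
  obtain ⟨t₂, hbu₂, ht₂⟩ := hg₂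
  obtain ⟨t₀, ht₀⟩ := hgE y₀ hy₀1
  have hrank : finrank F ((D₁ × D₂) × E) = k₁ + k₂ + m := by
    rw [Module.finrank_prod, Module.finrank_prod, hD₁, hD₂, hE]
  have hbu₀ : IsBlockUnit F y₀ := by
    refine ⟨eq_bot_or_top_of_adjoin (adjoin_eq_top_of_dvd hE hrj hy₀ (hy₀r ▸ dvd_pow_self r hc0.ne')),
      fun x hx => (mul_eq_zero.1 hx).resolve_left fun h => ?_⟩
    have := hy₀r
    rw [sub_eq_zero.1 h, orderOf_one] at this
    exact (Nat.one_lt_pow hc0.ne' hr.one_lt).ne this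
  have hdet : LinearEquiv.det g = Units.map (Algebra.norm F (S := E)) b := by
    ext
    have e₁ : LinearMap.det (DistribMulAction.toLinearEquiv F D₁ a₁).toLinearMap = 1 := hN₁
    have e₂ : LinearMap.det (DistribMulAction.toLinearEquiv F D₂ a₂).toLinearMap = 1 := hN₂
    have e₃ : LinearMap.det (DistribMulAction.toLinearEquiv F E b).toLinearMap =
      Algebra.norm F (b : E) := rfl
    have : g.toLinearMap = LinearMap.prodMap (LinearMap.prodMap
      (DistribMulAction.toLinearEquiv F D₁ a₁).toLinearMap
      (DistribMulAction.toLinearEquiv F D₂ a₂).toLinearMap)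
      (DistribMulAction.toLinearEquiv F E b).toLinearMap := rfl
    rw [LinearEquiv.coe_det, this, LinearMap.det_prodMap, LinearMap.det_prodMap, e₁, e₂, e₃]
    simp
  refine ⟨(D₁ × D₂) × E, inferInstance, inferInstance, inferInstance, hrank, g, ?_, ?_, ?_, ?_⟩
  · rwa [hdet]
  · rwa [hdet]
  · intro W hW
    have hWt : ∀ t : ℕ, ∀ w ∈ W, (g ^ t) w ∈ W := by
      intro t
      induction t with
      | zero => intro w hw; simpa using hw
      | succ t ih => intro w hw; rw [pow_succ']; exact hW _ (ih w hw)
    have d₁ := hbu₁.dichotomy (ρ := ρ₁) (ι := ι₁) (fun x => rfl) (W := W) fun w hw => ht₁ w ▸ hWt t₁ w hw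
    have d₂ := hbu₂.dichotomy (ρ := ρ₂) (ι := ι₂) (fun x => rfl) (W := W) fun w hw => ht₂ w ▸ hWt t₂ w hw
    have d₀ := hbu₀.dichotomy (ρ := π) (ι := σ) (fun x => rfl) (W := W) fun w hw => ht₀ w ▸ hWt t₀ w hw
    have main : ∀ (p₁ : Submodule F D₁) (p₂ : Submodule F D₂) (p₀ : Submodule F E),
        (∀ x ∈ p₁, ι₁ x ∈ W) → (∀ x ∈ p₂, ι₂ x ∈ W) → (∀ x ∈ p₀, σ x ∈ W) →
        (∀ w ∈ W, ρ₁ w ∈ p₁) → (∀ w ∈ W, ρ₂ w ∈ p₂) → (∀ w ∈ W, π w ∈ p₀) →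
        finrank F W = finrank F p₁ + finrank F p₂ + finrank F p₀ := by
      intro p₁ p₂ p₀ i₁ i₂ i₀ j₁ j₂ j₀
      have : W = (p₁.prod p₂).prod p₀ := by
        apply eq_prod_of_blocks
        · rintro ⟨x, x'⟩ hx
          have := W.add_mem (i₁ x hx.1) (i₂ x' hx.2)
          simpa [ι₁, ι₂] using this
        · exact fun x hx => i₀ x hx
        · exact fun w hw => ⟨⟨j₁ w hw, j₂ w hw⟩, j₀ w hw⟩
      rw [this, finrank_prod_submodule, finrank_prod_submodule]
    have hsel : ∀ {D : Type} [CommRing D] [Algebra F D] [Finite D] (ρ : ((D₁ × D₂) × E) →ₗ[F] D)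
        (ι : D →ₗ[F] ((D₁ × D₂) × E)), ((∀ x, ι x ∈ W) ∨ ∀ w ∈ W, ρ w = 0) →
        ∃ p : Submodule F D, (∀ x ∈ p, ι x ∈ W) ∧ (∀ w ∈ W, ρ w ∈ p) ∧
          (finrank F p = 0 ∨ finrank F p = finrank F D) := by
      intro D _ _ _ ρ ι h
      rcases h with h | h
      · exact ⟨⊤, fun x _ => h x, fun _ _ => Submodule.mem_top, Or.inr (finrank_top F D)⟩
      · refine ⟨⊥, fun x hx => ?_, fun w hw => by rw [h w hw]; exact Submodule.zero_mem _,
          Or.inl (finrank_bot F D)⟩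
        rw [(Submodule.mem_bot F).1 hx, map_zero]
        exact W.zero_mem
    obtain ⟨p₁, i₁, j₁, f₁⟩ := hsel _ _ d₁
    obtain ⟨p₂, i₂, j₂, f₂⟩ := hsel _ _ d₂
    obtain ⟨p₀, i₀, j₀, f₀⟩ := hsel _ _ d₀
    have hf := main p₁ p₂ p₀ i₁ i₂ i₀ j₁ j₂ j₀
    rw [hD₁] at f₁
    rw [hD₂] at f₂
    rw [hE] at f₀
    rcases f₁ with f₁ | f₁ <;> rcases f₂ with f₂ | f₂ <;> rcases f₀ with f₀ | f₀ <;>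
      rw [f₁, f₂, f₀] at hf
    · exact ⟨0, by omega, by omega⟩
    · exact ⟨k₁ + k₂, by omega, by omega⟩
    · exact ⟨k₂, by omega, by omega⟩
    · exact ⟨k₁, by omega, by omega⟩
    · exact ⟨k₁, by omega, by omega⟩
    · exact ⟨k₂, by omega, by omega⟩
    · exact ⟨k₁ + k₂, by omega, by omega⟩
    · exact ⟨0, by omega, by omega⟩
  · intro hkm h5 hnd hgcd H hgH hirr h hh
    have B : BlockPair H ((a₁ : D₁) ^ t₁) ((a₂ : D₂) ^ t₂) π σ ρ₁ ι₁ ρ₂ ι₂ :=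
      { unit := hbu₁
        unit' := hbu₂
        hι := fun x => rfl
        hι' := fun x => rfl
        hπι := fun x => rfl
        hπι' := fun x => rfl
        hρσ := fun x => rfl
        hρι' := fun x => rfl
        hρσ' := fun x => rfl
        hρι := fun x => rfl
        dec := fun v => by simp [ι₁, ρ₁, ι₂, ρ₂, σ, π]
        mem := ⟨g ^ t₁, H.pow_mem hgH _, ht₁⟩
        mem' := ⟨g ^ t₂, H.pow_mem hgH _, ht₂⟩ }
    have K := B.rich hE (hrank.trans (add_comm _ _)) hkm h5 hirr hnd
      ⟨fun x => rfl, bot_le, fun y hy => by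
        obtain ⟨t, ht⟩ := hgE y (by rw [hM, ← hE]; exact hy)
        exact ⟨g ^ t, H.pow_mem hgH _, ht⟩⟩ (by omega) (by omega) (by rwa [hD₁, hD₂])
    exact K.mem_of_det hr hrm hrj h hh

end ModelElements

section MatrixElements

open Module Matrix

variable {F : Type*} [Field F]

theorem mem_SLinGL {n : ℕ} {x : GL (Fin n) F} :
    x ∈ SLinGL n F ↔ Matrix.GeneralLinearGroup.det x = 1 := by
  constructor
  · rintro ⟨s, rfl⟩
    ext
    exact s.2
  · intro h
    exact ⟨⟨x.1, congrArg Units.val h⟩, by ext; rfl⟩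

/-- The submodules of `Fⁿ` invariant under a matrix. -/
def MatInvariant {n : ℕ} (x : GL (Fin n) F) (W : Submodule F (Fin n → F)) : Prop :=
  ∀ w ∈ W, x.1 *ᵥ w ∈ W

theorem exists_matrix_element [Fintype F] {n : ℕ} (Δ : Subgroup Fˣ) {k₁ k₂ m : ℕ}
    (hn : k₁ + k₂ + m = n)
    (h1 : k₁ = 0 ∨ (3 ≤ k₁ ∧ k₁ ≠ 6)) (h2 : k₂ = 0 ∨ (3 ≤ k₂ ∧ k₂ ≠ 6)) (hm3 : 3 ≤ m) (hm6 : m ≠ 6)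
    (hne : k₁ = k₂ → k₁ = 0) (h1m : k₁ ≠ 0 → ¬ k₁ ∣ m) (h2m : k₂ ≠ 0 → ¬ k₂ ∣ m) :
    ∃ g : GL (Fin n) F, Matrix.GeneralLinearGroup.det g ∈ Δ ∧
      Δ ≤ Subgroup.zpowers (Matrix.GeneralLinearGroup.det g) ∧
      (∀ W, MatInvariant g W → ∃ d : ℕ, (d = 0 ∨ d = k₁ ∨ d = k₂ ∨ d = k₁ + k₂) ∧
        (finrank F W = d ∨ finrank F W = n - d)) ∧
      (k₁ + k₂ + 1 < m → 5 ≤ k₁ + k₂ → ¬ (k₁ + k₂) ∣ m → (∀ e, e ∣ k₁ → e ∣ k₂ → e ∣ m → e = 1) →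
        ∀ H : Subgroup (GL (Fin n) F), g ∈ H →
        (∀ S, (∀ h ∈ H, MatInvariant h S) → S = ⊥ ∨ S = ⊤) → SLinGL n F ≤ H) := by
  obtain ⟨V, _, _, _, hV, g, hgΔ, hΔg, hinv, hrich⟩ :=
    exists_model_element F Δ h1 h2 hm3 hm6 hne h1m h2m
  let φ : V ≃ₗ[F] (Fin n → F) := LinearEquiv.ofFinrankEq _ _ (by rw [hV, hn, Module.finrank_fin_fun])
  let e : GL (Fin n) F ≃* (V ≃ₗ[F] V) := Matrix.GeneralLinearGroup.toLin.trans
    ((LinearMap.GeneralLinearGroup.congrLinearEquiv φ.symm).trans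
      (LinearMap.GeneralLinearGroup.generalLinearEquiv F V))
  have he : ∀ x v, e x v = φ.symm (x.1 *ᵥ φ v) := fun x v => rfl
  have hdet : ∀ x, LinearEquiv.det (e x) = Matrix.GeneralLinearGroup.det x := by
    intro x
    ext
    rw [LinearEquiv.coe_det]
    have : (e x).toLinearMap = φ.symm.toLinearMap ∘ₗ (Matrix.toLin' x.1) ∘ₗ φ.symm.symm.toLinearMap := by
      ext v
      rw [LinearEquiv.coe_coe, he]
      simp
    rw [this, LinearMap.det_conj, LinearMap.det_toLin']
    rfl
  have hcomap : ∀ (x : GL (Fin n) F) (W : Submodule F (Fin n → F)),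
      MatInvariant x W ↔ ∀ w ∈ W.comap φ.toLinearMap, e x w ∈ W.comap φ.toLinearMap := by
    intro x W
    constructor
    · intro h w hw
      have := h _ hw
      rw [Submodule.mem_comap, he]
      simpa using this
    · intro h w hw
      have := h (φ.symm w) (by simpa using hw)
      rw [Submodule.mem_comap, he] at this
      simpa using this
  have heg : e (e.symm g) = g := e.apply_symm_apply g
  refine ⟨e.symm g, ?_, ?_, fun W hW => ?_, fun a1 a2 a3 a4 H hgH hirr x hx => ?_⟩
  · rwa [← hdet, heg]
  · rwa [← hdet, heg]
  · obtain ⟨d, hd, h⟩ := hinv (W.comap φ.toLinearMap) (by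
      have := (hcomap _ W).1 hW
      rwa [heg] at this)
    have hr : finrank F (W.comap φ.toLinearMap) = finrank F W := by
      rw [Submodule.comap_equiv_eq_map_symm]
      exact LinearEquiv.finrank_map_eq _ _
    rw [hr] at h
    exact ⟨d, hd, by omega⟩
  · have := hrich a1 a2 a3 a4 (H.map e.toMonoidHom) ⟨_, hgH, heg⟩ (fun S hS => by
      have hSS : S = (S.map φ.toLinearMap).comap φ.toLinearMap :=
        (Submodule.comap_map_eq_of_injective φ.injective S).symm
      have h1 := hirr (S.map φ.toLinearMap) fun h hh => by
        rw [hcomap, ← hSS]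
        exact hS _ ⟨h, hh, rfl⟩
      rcases h1 with h1 | h1
      · left
        rw [hSS, h1]
        exact LinearMap.ker_eq_bot.2 φ.injective
      · right
        rw [hSS, h1, Submodule.comap_top]) (e x) (by
      have h1 := hdet x
      rw [mem_SLinGL.1 hx] at h1
      rw [← LinearEquiv.coe_det, h1]
      rfl)
    obtain ⟨x', hx', hxx⟩ := this
    rwa [← e.injective hxx]

end MatrixElements

section TwoBlocks

/-- Block sizes `a`, `b` (with `b = 0` allowed) for which the block-diagonal element with blocks
of sizes `a`, `b` and `n - (a + b)` generates a group containing `SL_n` with any irreducible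
subgroup containing it. -/
structure GoodPair (n a b : ℕ) : Prop where
  three_le : 3 ≤ a
  ne_six : a ≠ 6
  right : b = 0 ∨ (3 ≤ b ∧ b ≠ 6)
  ne : a ≠ b
  five_le : 5 ≤ a + b
  lt : 2 * (a + b) + 1 < n
  not_dvd_left : ¬ a ∣ n - (a + b)
  not_dvd_right : b ≠ 0 → ¬ b ∣ n - (a + b)
  not_dvd_add : ¬ (a + b) ∣ n - (a + b)
  coprime : ∀ e, e ∣ a → e ∣ b → e ∣ n - (a + b) → e = 1

theorem GoodPair.of_coprime {n k : ℕ} (h5 : 5 ≤ k) (h6 : k ≠ 6) (hlt : 2 * k + 1 < n)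
    (hc : n.Coprime k) : GoodPair n k 0 := by
  have hd : ∀ e, e ∣ k → e ∣ n - k → e = 1 := by
    intro e h1 h2
    have h3 : e ∣ n := (Nat.dvd_sub_iff_left (by omega) h1).1 h2
    exact Nat.dvd_one.1 (hc ▸ Nat.dvd_gcd h3 h1)
  have hk : ¬ k ∣ n - k := fun h => by
    have := hd k dvd_rfl h
    omega
  exact ⟨by omega, h6, Or.inl rfl, by omega, by omega, by omega, hk, fun h => absurd rfl h, hk,
    fun e h1 _ h3 => hd e h1 h3⟩

theorem exists_prime_ge_of_card {S : Finset ℕ} (hS : ∀ p ∈ S, p.Prime) {m : ℕ}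
    (hm : ((Finset.range m).filter Nat.Prime).card < S.card) : ∃ p ∈ S, m ≤ p := by
  by_contra! h
  refine absurd (Finset.card_le_card (s := S) (t := (Finset.range m).filter Nat.Prime) ?_)
    (by omega)
  intro p hp
  simp [h p hp, hS p hp]

theorem prod_bounds_step {S : Finset ℕ} (hS : ∀ p ∈ S, p.Prime) {r m : ℕ} {b : ℚ} {P : ℕ}
    (hm : ((Finset.range m).filter Nat.Prime).card = r) (hm0 : 0 < m) (hb : 0 ≤ b)
    (ih : ∀ T : Finset ℕ, (∀ p ∈ T, p.Prime) → T.card = r →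
      b ≤ ∏ p ∈ T, (1 - (p : ℚ)⁻¹) ∧ P ≤ ∏ p ∈ T, p) (hr : S.card = r + 1) :
    b * (1 - (m : ℚ)⁻¹) ≤ ∏ p ∈ S, (1 - (p : ℚ)⁻¹) ∧ P * m ≤ ∏ p ∈ S, p := by
  obtain ⟨p, hp, hmp⟩ := exists_prime_ge_of_card hS (m := m) (by omega)
  obtain ⟨h1, h2⟩ := ih (S.erase p) (fun q hq => hS q (Finset.mem_of_mem_erase hq))
    (by rw [Finset.card_erase_of_mem hp]; omega)
  rw [← Finset.prod_erase_mul _ _ hp, ← Finset.prod_erase_mul _ _ hp]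
  refine ⟨?_, Nat.mul_le_mul h2 hmp⟩
  have h3 : (p : ℚ)⁻¹ ≤ (m : ℚ)⁻¹ := by
    apply inv_anti₀
    · exact_mod_cast hm0
    · exact_mod_cast hmp
  have h4 : (m : ℚ)⁻¹ ≤ 1 := by
    apply inv_le_one_of_one_le₀
    exact_mod_cast hm0
  exact mul_le_mul h1 (by linarith) (by linarith) (hb.trans h1)

theorem prod_bounds {S : Finset ℕ} (hS : ∀ p ∈ S, p.Prime) :
    (S.card ≤ 5 → (16 / 77 : ℚ) ≤ ∏ p ∈ S, (1 - (p : ℚ)⁻¹)) ∧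
    (S.card ≤ 6 → (192 / 1001 : ℚ) ≤ ∏ p ∈ S, (1 - (p : ℚ)⁻¹)) ∧
    (S.card = 6 → 30030 ≤ ∏ p ∈ S, p) := by
  have H0 : ∀ T : Finset ℕ, (∀ p ∈ T, p.Prime) → T.card = 0 →
      (1 : ℚ) ≤ ∏ p ∈ T, (1 - (p : ℚ)⁻¹) ∧ 1 ≤ ∏ p ∈ T, p := by
    intro T _ h
    rw [Finset.card_eq_zero] at h
    simp [h]
  have H1 := fun (T : Finset ℕ) (hT : ∀ p ∈ T, p.Prime) => prod_bounds_step hT (m := 2) (by decide) (by norm_num)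
    (by norm_num) H0
  have H2 := fun (T : Finset ℕ) (hT : ∀ p ∈ T, p.Prime) => prod_bounds_step hT (m := 3) (by decide) (by norm_num)
    (by norm_num) H1
  have H3 := fun (T : Finset ℕ) (hT : ∀ p ∈ T, p.Prime) => prod_bounds_step hT (m := 5) (by decide) (by norm_num)
    (by norm_num) H2
  have H4 := fun (T : Finset ℕ) (hT : ∀ p ∈ T, p.Prime) => prod_bounds_step hT (m := 7) (by decide) (by norm_num)
    (by norm_num) H3
  have H5 := fun (T : Finset ℕ) (hT : ∀ p ∈ T, p.Prime) => prod_bounds_step hT (m := 11) (by decide)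
    (by norm_num) (by norm_num) H4
  have H6 := fun (T : Finset ℕ) (hT : ∀ p ∈ T, p.Prime) => prod_bounds_step hT (m := 13) (by decide)
    (by norm_num) (by norm_num) H5
  norm_num at H1 H2 H3 H4 H5 H6
  have h5 : S.card ≤ 5 → (16 / 77 : ℚ) ≤ ∏ p ∈ S, (1 - (p : ℚ)⁻¹) := by
    intro h
    have hcases : S.card = 0 ∨ S.card = 1 ∨ S.card = 2 ∨ S.card = 3 ∨ S.card = 4 ∨ S.card = 5 := by
      omega
    rcases hcases with h | h | h | h | h | h
    · linarith [(H0 S hS h).1]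
    · linarith [(H1 S hS h).1]
    · linarith [(H2 S hS h).1]
    · linarith [(H3 S hS h).1]
    · linarith [(H4 S hS h).1]
    · linarith [(H5 S hS h).1]
  refine ⟨h5, fun h => ?_, fun h => (H6 S hS h).2⟩
  rcases Nat.lt_or_ge 5 S.card with h' | h'
  · linarith [(H6 S hS (by omega)).1]
  · linarith [h5 h']

theorem card_primeFactors_le_five {n : ℕ} (h0 : n ≠ 0) (hn : n < 30030) :
    n.primeFactors.card ≤ 5 := by
  by_contra! h
  obtain ⟨T, hT, hc⟩ := Finset.exists_subset_card_eq (s := n.primeFactors) (n := 6) (by omega)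
  have h1 := (prod_bounds (S := T) fun p hp => Nat.prime_of_mem_primeFactors (hT hp)).2.2 hc
  have h2 : ∏ p ∈ T, p ∣ n := (Finset.prod_dvd_prod_of_subset _ _ _ hT).trans
    (Nat.prod_primeFactors_dvd n)
  have := Nat.le_of_dvd (by omega) h2
  omega

theorem totient_le_two_mul_card {n : ℕ} (hn : 2 < n) :
    n.totient ≤ 2 * ((Finset.range n).filter fun k => n.Coprime k ∧ 2 * k < n).card := by
  have h1 := Finset.card_filter_add_card_filter_not
    (s := (Finset.range n).filter fun k => n.Coprime k)
    (fun k => 2 * k < n)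
  rw [Finset.filter_filter, Finset.filter_filter] at h1
  have h2 : ((Finset.range n).filter fun k => n.Coprime k ∧ ¬ 2 * k < n).card ≤
      ((Finset.range n).filter fun k => n.Coprime k ∧ 2 * k < n).card := by
    refine Finset.card_le_card_of_injOn (fun k => n - k) ?_ ?_
    · intro k hk
      simp only [Finset.coe_filter, Finset.mem_range, Set.mem_ofPred_eq] at hk ⊢
      obtain ⟨hk1, hk2, hk3⟩ := hk
      have hne : 2 * k ≠ n := by
        rintro rfl
        have : k ∣ 1 := by
          rw [← hk2]
          exact Nat.dvd_gcd (Dvd.intro_left 2 rfl) dvd_rfl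
        have := Nat.dvd_one.1 this
        omega
      refine ⟨by omega, ?_, by omega⟩
      exact (Nat.coprime_self_sub_right hk1.le).2 hk2
    · intro k hk l hl hkl
      simp only [Finset.coe_filter, Finset.mem_range, Set.mem_ofPred_eq] at hk hl hkl
      omega
  have h3 : n.totient = ((Finset.range n).filter fun k => n.Coprime k).card := rfl
  omega

theorem exists_goodPair_of_lt {n : ℕ} (h20 : 20 ≤ n) (hn : n < 30030) (K : Finset ℕ)
    (hK : (K.card + 1) * 98696 ≤ 10000 * n) : ∃ a, GoodPair n a 0 ∧ a ∉ K := by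
  set C := (Finset.range n).filter fun k => n.Coprime k ∧ 2 * k < n
  suffices ∃ E : Finset ℕ, K.card + E.card < C.card ∧
      ∀ k ∈ C, k ∉ E → 5 ≤ k ∧ k ≠ 6 ∧ 2 * k + 1 < n by
    obtain ⟨E, hE, h⟩ := this
    obtain ⟨k, hk, hk'⟩ := Finset.exists_mem_notMem_of_card_lt_card
      ((Finset.card_union_le K E).trans_lt hE)
    rw [Finset.mem_union, not_or] at hk'
    obtain ⟨h1, h2, h3⟩ := h k hk hk'.2
    exact ⟨k, .of_coprime h1 h2 h3 (Finset.mem_filter.1 hk).2.1, hk'.1⟩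
  by_cases h60 : n < 60
  · refine ⟨C.filter fun k => ¬ (5 ≤ k ∧ k ≠ 6 ∧ 2 * k + 1 < n), ?_, fun k hk hk' => ?_⟩
    · have h1 := Finset.card_filter_add_card_filter_not (s := C)
        (fun k => 5 ≤ k ∧ k ≠ 6 ∧ 2 * k + 1 < n)
      have h2 : 10000 * n < 98696 *
          ((C.filter fun k => 5 ≤ k ∧ k ≠ 6 ∧ 2 * k + 1 < n).card + 1) := by
        clear hK h1
        subst C
        interval_cases n <;> decide +kernel
      omega
    · rw [Finset.mem_filter, not_and, not_not] at hk'
      exact hk' hk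
  have hφ := totient_le_two_mul_card (n := n) (by omega)
  have hφ' := Nat.totient_eq_mul_prod_factors n
  have hp : ∀ p ∈ n.primeFactors, p.Prime := fun p => Nat.prime_of_mem_primeFactors
  have hω := card_primeFactors_le_five (n := n) (by omega) hn
  have hCq : (n.totient : ℚ) ≤ 2 * C.card := by exact_mod_cast hφ
  have hKq : ((K.card : ℚ) + 1) * 98696 ≤ 10000 * n := by exact_mod_cast hK
  have hnq : (60 : ℚ) ≤ n := by exact_mod_cast not_lt.1 h60
  have hins : ∀ q, q.Prime → ¬ q ∣ n →
      (192 / 1001 : ℚ) ≤ (1 - (q : ℚ)⁻¹) * ∏ p ∈ n.primeFactors, (1 - (p : ℚ)⁻¹) := by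
    intro q hq hqn
    have hq' : q ∉ n.primeFactors := fun h => hqn (Nat.dvd_of_mem_primeFactors h)
    rw [← Finset.prod_insert (f := fun p : ℕ => 1 - (p : ℚ)⁻¹) hq']
    refine (prod_bounds fun p hp' => ?_).2.1 ?_
    · rcases Finset.mem_insert.1 hp' with rfl | h
      · exact hq
      · exact hp p h
    · rw [Finset.card_insert_of_notMem hq']
      omega
  have hnot : ∀ {d k : ℕ}, k ∈ C → d ∣ n → d ∣ k → d = 1 := fun {d k} hk h1 h2 =>
    Nat.dvd_one.1 ((Finset.mem_filter.1 hk).2.1 ▸ Nat.dvd_gcd h1 h2)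
  by_cases h2 : 2 ∣ n
  · by_cases h3 : 3 ∣ n
    · refine ⟨{1}, ?_, fun k hk hk' => ?_⟩
      · have := (prod_bounds hp).1 hω
        have h : (n : ℚ) * (16 / 77) ≤ n.totient := by
          rw [hφ']
          gcongr
        rw [← Nat.cast_lt (α := ℚ)]
        push_cast [Finset.card_singleton]
        linarith
      · have hk2 : ¬ 2 ∣ k := fun h => absurd (hnot hk h2 h) (by norm_num)
        have hk3 : ¬ 3 ∣ k := fun h => absurd (hnot hk h3 h) (by norm_num)
        have := (Finset.mem_filter.1 hk).2.2
        rw [Finset.mem_singleton] at hk'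
        omega
    · refine ⟨{1, 3}, ?_, fun k hk hk' => ?_⟩
      · have := hins 3 (by norm_num) h3
        have h : (n : ℚ) * (288 / 1001) ≤ n.totient := by
          rw [hφ']
          gcongr
          push_cast at this
          linarith
        rw [← Nat.cast_lt (α := ℚ)]
        push_cast [Finset.card_pair (show 1 ≠ 3 by norm_num)]
        linarith
      · have hk2 : ¬ 2 ∣ k := fun h => absurd (hnot hk h2 h) (by norm_num)
        have := (Finset.mem_filter.1 hk).2.2
        simp only [Finset.mem_insert, Finset.mem_singleton, not_or] at hk'
        omega
  · refine ⟨{1, 2, 3, 4, 6, (n - 1) / 2}, ?_, fun k hk hk' => ?_⟩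
    · have := hins 2 (by norm_num) h2
      have h : (n : ℚ) * (384 / 1001) ≤ n.totient := by
        rw [hφ']
        gcongr
        push_cast at this
        linarith
      have hE : ({1, 2, 3, 4, 6, (n - 1) / 2} : Finset ℕ).card ≤ 6 := Finset.card_le_six
      have hEq : (({1, 2, 3, 4, 6, (n - 1) / 2} : Finset ℕ).card : ℚ) ≤ 6 := by
        exact_mod_cast hE
      rw [← Nat.cast_lt (α := ℚ), Nat.cast_add]
      linarith
    · have h0 : k ≠ 0 := by
        rintro rfl
        have := hnot hk dvd_rfl (dvd_zero n)
        omega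
      have := (Finset.mem_filter.1 hk).2.2
      simp only [Finset.mem_insert, Finset.mem_singleton] at hk'
      omega

end TwoBlocks

section ThreeBlocks

theorem card_divisors_filter_lt_le {m T : ℕ} (hm : 0 < m) (hT : m < (T + 1) * (T + 1)) :
    (m.divisors.filter fun d => T < d).card ≤ T := by
  have : (m.divisors.filter fun d => T < d).card ≤ (Finset.Icc 1 T).card := by
    refine Finset.card_le_card_of_injOn (fun d => m / d) ?_ ?_
    · intro d hd
      simp only [Finset.coe_filter, Nat.mem_divisors, Set.mem_ofPred_eq] at hd
      obtain ⟨⟨hd1, -⟩, hd2⟩ := hd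
      rw [Finset.coe_Icc, Set.mem_Icc]
      refine ⟨Nat.div_pos (Nat.le_of_dvd hm hd1) (by omega), ?_⟩
      have : m / d < T + 1 := (Nat.div_lt_iff_lt_mul (by omega)).2
        (hT.trans_le (Nat.mul_le_mul_left _ hd2))
      exact Nat.lt_succ_iff.1 this
    · intro d hd e he hde
      simp only [Finset.coe_filter, Nat.mem_divisors, Set.mem_ofPred_eq] at hd he hde
      have h1 := Nat.div_mul_cancel hd.1.1
      have h2 := Nat.div_mul_cancel he.1.1
      rw [← hde] at h2
      have : 0 < m / d := Nat.div_pos (Nat.le_of_dvd hm hd.1.1) (by omega)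
      exact Nat.eq_of_mul_eq_mul_left this (h1.trans h2.symm)
  simpa using this

theorem card_divisors_le {m T : ℕ} (hT : m < (T + 1) * (T + 1)) : m.divisors.card ≤ 2 * T := by
  rcases Nat.eq_zero_or_pos m with rfl | hm
  · simp
  have h1 := Finset.card_filter_add_card_filter_not (s := m.divisors) (fun d => T < d)
  have h2 := card_divisors_filter_lt_le hm hT
  have h3 : (m.divisors.filter fun d => ¬ T < d).card ≤ (Finset.Icc 1 T).card := by
    refine Finset.card_le_card fun d hd => ?_
    rw [Finset.mem_filter] at hd
    rw [Finset.mem_Icc]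
    exact ⟨Nat.pos_of_mem_divisors hd.1, not_lt.1 hd.2⟩
  rw [Nat.card_Icc] at h3
  omega

theorem card_odd_divisors_le {n T : ℕ} (hn : 0 < n) (hT : n < (T + 1) * (T + 1)) (u J : ℕ) :
    2 * ((Finset.Ico u J).filter fun j => 2 * j + 1 ∣ n).card ≤ 3 * T + 1 := by
  have h1 := Finset.card_filter_add_card_filter_not
    (s := (Finset.Ico u J).filter fun j => 2 * j + 1 ∣ n) (fun j => T < 2 * j + 1)
  have h2 : (((Finset.Ico u J).filter fun j => 2 * j + 1 ∣ n).filter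
      fun j => T < 2 * j + 1).card ≤ (n.divisors.filter fun d => T < d).card := by
    refine Finset.card_le_card_of_injOn (fun j => 2 * j + 1) ?_ ?_
    · intro j hj
      simp only [Finset.coe_filter, Finset.mem_filter, Set.mem_ofPred_eq] at hj
      simp only [Finset.coe_filter, Nat.mem_divisors, Set.mem_ofPred_eq]
      exact ⟨⟨hj.1.2, hn.ne'⟩, hj.2⟩
    · intro i _ j _ hij
      simp only at hij
      omega
  have h2' := card_divisors_filter_lt_le hn hT
  have h3 : (((Finset.Ico u J).filter fun j => 2 * j + 1 ∣ n).filter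
      fun j => ¬ T < 2 * j + 1).card ≤ (Finset.range ((T + 1) / 2)).card := by
    refine Finset.card_le_card fun j hj => ?_
    simp only [Finset.mem_filter] at hj
    rw [Finset.mem_range]
    omega
  rw [Finset.card_range] at h3
  omega

/-- Indices `j` with `2 * j + 1` such that at least half of all integers are coprime to
`gcd (2 * j + 1) n`. -/
def SieveIndex (n j : ℕ) : Prop :=
  ∑ p ∈ (Nat.gcd (2 * j + 1) n).primeFactors, (p : ℚ)⁻¹ ≤ 1 / 2

theorem sum_inv_sq_le (S : Finset ℕ) (hS : ∀ p ∈ S, p % 2 = 1 ∧ 3 ≤ p) :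
    ∑ p ∈ S, ((p : ℚ) ^ 2)⁻¹ ≤ 1 / 4 := by
  have key : ∀ M : ℕ, ∑ i ∈ Finset.range M, (((2 * (i + 1) + 1 : ℕ) : ℚ) ^ 2)⁻¹ ≤
      1 / 4 - 1 / (4 * (M + 1)) := by
    intro M
    induction M with
    | zero => norm_num
    | succ M ih =>
      rw [Finset.sum_range_succ]
      have : (((2 * (M + 1) + 1 : ℕ) : ℚ) ^ 2)⁻¹ ≤
          1 / (4 * ((M : ℚ) + 1)) - 1 / (4 * ((M : ℚ) + 1 + 1)) := by
        have h : 1 / (4 * ((M : ℚ) + 1)) - 1 / (4 * ((M : ℚ) + 1 + 1)) =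
            (4 * ((M : ℚ) + 1) * (M + 1 + 1))⁻¹ := by
          field_simp
          ring
        rw [h]
        apply inv_anti₀ (by positivity)
        push_cast
        nlinarith
      push_cast at this ih ⊢
      linarith
  obtain ⟨M, hM⟩ : ∃ M, ∀ p ∈ S, p < M := ⟨S.sup id + 1, fun p hp =>
    Nat.lt_succ_of_le (Finset.le_sup (f := id) hp)⟩
  calc ∑ p ∈ S, ((p : ℚ) ^ 2)⁻¹
      ≤ ∑ p ∈ (Finset.range M).image (fun i : ℕ => 2 * (i + 1) + 1), ((p : ℚ) ^ 2)⁻¹ := by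
        refine Finset.sum_le_sum_of_subset_of_nonneg (fun p hp => ?_) fun _ _ _ => by positivity
        have := hS p hp
        have := hM p hp
        exact Finset.mem_image.2 ⟨(p - 3) / 2, by rw [Finset.mem_range]; omega, by omega⟩
    _ = ∑ i ∈ Finset.range M, (((2 * (i + 1) + 1 : ℕ) : ℚ) ^ 2)⁻¹ :=
        Finset.sum_image fun a _ b _ h => by omega
    _ ≤ 1 / 4 - 1 / (4 * (M + 1)) := key M
    _ ≤ 1 / 4 := by
        have : (0 : ℚ) ≤ 1 / (4 * (M + 1)) := by positivity
        linarith

theorem card_filter_dvd_odd_le {p : ℕ} (hp : p.Prime) (u J : ℕ) :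
    ((Finset.Ico u J).filter fun j => p ∣ 2 * j + 1).card ≤ (J - u) / p + 1 := by
  rw [← Finset.card_range ((J - u) / p + 1)]
  refine Finset.card_le_card_of_injOn (fun j => (j - u) / p) ?_ ?_
  · intro j hj
    simp only [Finset.coe_filter, Finset.mem_Ico, Set.mem_ofPred_eq] at hj
    rw [Finset.coe_range, Set.mem_Iio, Nat.lt_succ_iff]
    exact Nat.div_le_div_right (by omega)
  · intro i hi j hj hij
    simp only [Finset.coe_filter, Finset.mem_Ico, Set.mem_ofPred_eq] at hi hj hij
    by_contra hne
    wlog hlt : i < j generalizing i j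
    · exact this (hi := hj) (hj := hi) (hij := hij.symm) (hne := Ne.symm hne) (by omega)
    have h1 : p ∣ 2 * (j - i) := by
      have := Nat.dvd_sub hj.2 hi.2
      rwa [show 2 * j + 1 - (2 * i + 1) = 2 * (j - i) by omega] at this
    have h2 : p ∣ j - i := by
      rcases (Nat.Prime.dvd_mul hp).1 h1 with h | h
      · have h3 : p ∣ 1 := by
          have := (Nat.dvd_sub hi.2 (h.mul_right i))
          rwa [show 2 * i + 1 - 2 * i = 1 by omega] at this
        exact absurd (Nat.dvd_one.1 h3) hp.one_lt.ne'
      · exact h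
    have h3 := Nat.le_of_dvd (by omega) h2
    have h4 : (i - u + p) / p ≤ (j - u) / p := Nat.div_le_div_right (by omega)
    rw [Nat.add_div_right _ hp.pos] at h4
    omega

open Classical in
theorem card_not_sieveIndex_le {n : ℕ} (hn : n ≠ 0) {u J : ℕ} (huJ : u ≤ J) :
    (((Finset.Ico u J).filter fun j => ¬ SieveIndex n j).card : ℚ) ≤
      ((J : ℚ) - u) / 2 + 2 / 3 * n.primeFactors.card := by
  set P := n.primeFactors.filter fun p => p ≠ 2
  have hP : ∀ p ∈ P, p.Prime ∧ p % 2 = 1 ∧ 3 ≤ p := by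
    intro p hp
    rw [Finset.mem_filter] at hp
    have h1 := Nat.prime_of_mem_primeFactors hp.1
    have h2 := h1.eq_two_or_odd
    have h3 := h1.two_le
    exact ⟨h1, by omega, by omega⟩
  have h1 : ∀ j, (∑ p ∈ (Nat.gcd (2 * j + 1) n).primeFactors, (p : ℚ)⁻¹) ≤
      ∑ p ∈ P, if p ∣ 2 * j + 1 then (p : ℚ)⁻¹ else 0 := by
    intro j
    rw [← Finset.sum_filter]
    refine Finset.sum_le_sum_of_subset_of_nonneg (fun p hp => ?_) fun _ _ _ => by positivity
    rw [Nat.mem_primeFactors, Nat.dvd_gcd_iff] at hp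
    rw [Finset.mem_filter, Finset.mem_filter, Nat.mem_primeFactors]
    refine ⟨⟨⟨hp.1, hp.2.1.2, hn⟩, ?_⟩, hp.2.1.1⟩
    rintro rfl
    have := hp.2.1.1
    omega
  have hL : ((J - u : ℕ) : ℚ) = (J : ℚ) - u := Nat.cast_sub huJ
  calc (((Finset.Ico u J).filter fun j => ¬ SieveIndex n j).card : ℚ)
      = ∑ j ∈ (Finset.Ico u J).filter (fun j => ¬ SieveIndex n j), 1 := by simp
    _ ≤ ∑ j ∈ (Finset.Ico u J).filter (fun j => ¬ SieveIndex n j),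
          2 * ∑ p ∈ P, if p ∣ 2 * j + 1 then (p : ℚ)⁻¹ else 0 := by
        refine Finset.sum_le_sum fun j hj => ?_
        have := (Finset.mem_filter.1 hj).2
        rw [SieveIndex, not_le] at this
        linarith [h1 j]
    _ ≤ ∑ j ∈ Finset.Ico u J, 2 * ∑ p ∈ P, if p ∣ 2 * j + 1 then (p : ℚ)⁻¹ else 0 := by
        refine Finset.sum_le_sum_of_subset_of_nonneg (Finset.filter_subset _ _) fun _ _ _ => ?_
        refine mul_nonneg (by norm_num) (Finset.sum_nonneg fun p _ => ?_)
        split_ifs <;> positivity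
    _ = 2 * ∑ p ∈ P, (p : ℚ)⁻¹ * ((Finset.Ico u J).filter fun j => p ∣ 2 * j + 1).card := by
        rw [← Finset.mul_sum, Finset.sum_comm]
        congr 1
        refine Finset.sum_congr rfl fun p _ => ?_
        rw [← Finset.sum_filter, Finset.sum_const, nsmul_eq_mul, mul_comm]
    _ ≤ 2 * ∑ p ∈ P, (((J : ℚ) - u) * ((p : ℚ) ^ 2)⁻¹ + 1 / 3) := by
        refine mul_le_mul_of_nonneg_left (Finset.sum_le_sum fun p hp => ?_) (by norm_num)
        obtain ⟨hp1, -, hp3⟩ := hP p hp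
        have hp3' : (3 : ℚ) ≤ p := by exact_mod_cast hp3
        have h2 : (((Finset.Ico u J).filter fun j => p ∣ 2 * j + 1).card : ℚ) ≤
            ((J : ℚ) - u) * (p : ℚ)⁻¹ + 1 := by
          have h3 : (((Finset.Ico u J).filter fun j => p ∣ 2 * j + 1).card : ℚ) ≤
              ((J - u) / p + 1 : ℕ) := by exact_mod_cast card_filter_dvd_odd_le hp1 u J
          have h4 : (((J - u) / p : ℕ) : ℚ) ≤ ((J - u : ℕ) : ℚ) / p := Nat.cast_div_le
          rw [hL, div_eq_mul_inv] at h4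
          push_cast at h3
          linarith
        calc (p : ℚ)⁻¹ * (((Finset.Ico u J).filter fun j => p ∣ 2 * j + 1).card : ℚ)
            ≤ (p : ℚ)⁻¹ * (((J : ℚ) - u) * (p : ℚ)⁻¹ + 1) := by gcongr
          _ = ((J : ℚ) - u) * ((p : ℚ) ^ 2)⁻¹ + (p : ℚ)⁻¹ := by ring
          _ ≤ _ := by
              have : (p : ℚ)⁻¹ ≤ 3⁻¹ := inv_anti₀ (by norm_num) hp3'
              linarith
    _ = 2 * (((J : ℚ) - u) * ∑ p ∈ P, ((p : ℚ) ^ 2)⁻¹ + P.card * (1 / 3)) := by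
        rw [Finset.sum_add_distrib, ← Finset.mul_sum, Finset.sum_const, nsmul_eq_mul]
    _ ≤ _ := by
        have h2 := sum_inv_sq_le P fun p hp => (hP p hp).2
        have h3 : (P.card : ℚ) ≤ n.primeFactors.card := by
          exact_mod_cast Finset.card_le_card (Finset.filter_subset _ _)
        have h4 : (0 : ℚ) ≤ (J : ℚ) - u := by
          rw [← hL]
          positivity
        nlinarith [mul_le_mul_of_nonneg_left h2 h4]

theorem card_coprime_gcd_ge {n j : ℕ} (hj : SieveIndex n j) :
    2 * j + 1 ≤ 2 * ((Finset.Icc 1 (2 * j + 1)).filter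
      fun x => x.Coprime (Nat.gcd (2 * j + 1) n)).card := by
  set c := 2 * j + 1 with hc
  set d := Nat.gcd c n
  have hd : d ≠ 0 := Nat.gcd_ne_zero_left (by omega)
  have h1 := Finset.card_filter_add_card_filter_not (s := Finset.Icc 1 c) (fun x => x.Coprime d)
  rw [Nat.card_Icc] at h1
  have h2 : ((Finset.Icc 1 c).filter fun x => ¬ x.Coprime d) ⊆
      d.primeFactors.biUnion fun p => (Finset.Ioc 0 c).filter fun x => p ∣ x := by
    intro x hx
    rw [Finset.mem_filter, Finset.mem_Icc] at hx
    obtain ⟨p, hp, hpx, hpd⟩ := Nat.Prime.not_coprime_iff_dvd.1 hx.2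
    rw [Finset.mem_biUnion]
    refine ⟨p, Nat.mem_primeFactors.2 ⟨hp, hpd, hd⟩, ?_⟩
    rw [Finset.mem_filter, Finset.mem_Ioc]
    exact ⟨by omega, hpx⟩
  have h3 := (Finset.card_le_card h2).trans Finset.card_biUnion_le
  have h4 : (((Finset.Icc 1 c).filter fun x => ¬ x.Coprime d).card : ℚ) ≤ (c : ℚ) / 2 := by
    calc (((Finset.Icc 1 c).filter fun x => ¬ x.Coprime d).card : ℚ)
        ≤ ((∑ p ∈ d.primeFactors, ((Finset.Ioc 0 c).filter fun x => p ∣ x).card : ℕ) : ℚ) := by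
          exact_mod_cast h3
      _ = ∑ p ∈ d.primeFactors, ((c / p : ℕ) : ℚ) := by
          rw [Nat.cast_sum]
          exact Finset.sum_congr rfl fun p _ => by rw [Nat.Ioc_filter_dvd_card_eq_div]
      _ ≤ ∑ p ∈ d.primeFactors, (c : ℚ) * (p : ℚ)⁻¹ :=
          Finset.sum_le_sum fun p _ => by rw [← div_eq_mul_inv]; exact Nat.cast_div_le
      _ ≤ (c : ℚ) / 2 := by
          rw [← Finset.mul_sum]
          have hcq : (0 : ℚ) ≤ c := by positivity
          have := mul_le_mul_of_nonneg_left hj hcq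
          linarith
  have h5 : 2 * ((Finset.Icc 1 c).filter fun x => ¬ x.Coprime d).card ≤ c := by
    have : (2 : ℚ) * ((Finset.Icc 1 c).filter fun x => ¬ x.Coprime d).card ≤ c := by linarith
    exact_mod_cast this
  omega

end ThreeBlocks

section ThreeBlocksChoice

theorem le_card_of_no_goodPair {n T j : ℕ} (hT : n < (T + 1) * (T + 1)) (hj : 3 ≤ j)
    (hjn : 4 * j + 3 < n) (hs : SieveIndex n j) (hdvd : ¬ (2 * j + 1) ∣ n) {K : Finset ℕ}
    (hK : ∀ a b, GoodPair n a b → a ∈ K ∨ b ∈ K ∨ a + b ∈ K) (hjK : 2 * j + 1 ∉ K) :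
    2 * j + 1 ≤ 14 + 8 * T + 4 * (K.filter fun x => x < 2 * j + 1).card := by
  have h1 := card_coprime_gcd_ge hs
  set c := 2 * j + 1 with hc
  set K' := K.filter fun x => x < c
  set D := (n - c).divisors
  have hD : D.card ≤ 2 * T := card_divisors_le (by omega)
  set E : Finset ℕ := {1, 2, 6} ∪ {c - 1, c - 2, c - 6, c}
  have hE : E.card ≤ 7 := (Finset.card_union_le _ _).trans
    (add_le_add Finset.card_le_three Finset.card_le_four)
  have h2 : ((Finset.Icc 1 c).filter fun x => x.Coprime (Nat.gcd c n)) ⊆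
      E ∪ (D ∪ (D.image fun x => c - x)) ∪ (K' ∪ (K'.image fun x => c - x)) := by
    intro x hx
    rw [Finset.mem_filter, Finset.mem_Icc] at hx
    obtain ⟨⟨hx1, hxc⟩, hxg⟩ := hx
    by_contra h
    simp only [Finset.mem_union, not_or, Finset.mem_image, not_exists, not_and] at h
    obtain ⟨⟨hE, hD1, hD2⟩, hK1, hK2⟩ := h
    simp only [E, Finset.mem_union, Finset.mem_insert, Finset.mem_singleton, not_or] at hE
    have hx0 : n - c ≠ 0 := by omega
    have hd1 : ¬ x ∣ n - c := fun h => hD1 (Nat.mem_divisors.2 ⟨h, hx0⟩)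
    have hd2 : ¬ (c - x) ∣ n - c := fun h => hD2 _ (Nat.mem_divisors.2 ⟨h, hx0⟩) (by omega)
    have hxy : x + (c - x) = c := by omega
    have hgood : GoodPair n x (c - x) := by
      refine ⟨by omega, by omega, Or.inr (by omega), by omega, by omega, by omega, ?_, ?_, ?_, ?_⟩
      · rwa [hxy]
      · rw [hxy]
        exact fun _ => hd2
      · rw [hxy]
        exact fun h => hdvd ((Nat.dvd_sub_iff_left (by omega) dvd_rfl).1 h)
      · rw [hxy]
        intro e h1 h2 h3
        have h4 : e ∣ c := hxy ▸ dvd_add h1 h2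
        have h5 : e ∣ n := (Nat.dvd_sub_iff_left (by omega) h4).1 h3
        exact Nat.dvd_one.1 (hxg ▸ Nat.dvd_gcd h1 (Nat.dvd_gcd h4 h5))
    rcases hK _ _ hgood with h | h | h
    · exact hK1 (Finset.mem_filter.2 ⟨h, by omega⟩)
    · exact hK2 _ (Finset.mem_filter.2 ⟨h, by omega⟩) (by omega)
    · exact hjK (hxy ▸ h)
  have h3 := Finset.card_le_card h2
  have h4 := Finset.card_union_le (E ∪ (D ∪ (D.image fun x => c - x)))
    (K' ∪ (K'.image fun x => c - x))
  have h5 := Finset.card_union_le E (D ∪ (D.image fun x => c - x))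
  have h6 := Finset.card_union_le D (D.image fun x => c - x)
  have h7 := Finset.card_union_le K' (K'.image fun x => c - x)
  have h8 : (D.image fun x => c - x).card ≤ D.card := Finset.card_image_le
  have h9 : (K'.image fun x => c - x).card ≤ K'.card := Finset.card_image_le
  omega

theorem card_primeFactors_mul_le {n : ℕ} (hn : 30030 ≤ n) : 1000 * n.primeFactors.card ≤ n := by
  have h1 : 2 ^ n.primeFactors.card ≤ n := by
    calc 2 ^ n.primeFactors.card ≤ ∏ p ∈ n.primeFactors, p :=
          Finset.pow_card_le_prod _ _ _ fun p hp => (Nat.prime_of_mem_primeFactors hp).two_le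
      _ ≤ n := Nat.le_of_dvd (by omega) (Nat.prod_primeFactors_dvd n)
  generalize n.primeFactors.card = w at h1 ⊢
  rcases Nat.lt_or_ge w 14 with h | h
  · omega
  · refine le_trans ?_ h1
    induction w, h using Nat.le_induction with
    | base => norm_num
    | succ w hw ih =>
      have := ih ((Nat.pow_le_pow_right (by norm_num) (Nat.le_succ w)).trans h1)
      rw [pow_succ]
      omega

open Classical in
theorem exists_goodPair_of_ge {n : ℕ} (hn : 30030 ≤ n) (K : Finset ℕ)
    (hK : (K.card + 1) * 98696 ≤ 10000 * n) :
    ∃ a b, GoodPair n a b ∧ a ∉ K ∧ b ∉ K ∧ a + b ∉ K := by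
  by_contra! hno
  have hno' : ∀ a b, GoodPair n a b → a ∈ K ∨ b ∈ K ∨ a + b ∈ K := by
    intro a b h
    by_contra! h'
    exact h'.2.2 (hno a b h h'.1 h'.2.1)
  set T := Nat.sqrt n
  have hT : n < (T + 1) * (T + 1) := Nat.lt_succ_sqrt n
  have hT' : T * T ≤ n := Nat.sqrt_le n
  set J := n / 4
  have hex : ∃ u, 3 ≤ u ∧ u ≤ J ∧ ∀ j, u ≤ j → j < J → SieveIndex n j →
      ¬ (2 * j + 1) ∣ n → 2 * j + 1 ∈ K := ⟨J, by omega, le_rfl, fun j h1 h2 => by omega⟩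
  obtain ⟨hu3, huJ, hu⟩ := Nat.find_spec hex
  have hmin := fun v => Nat.find_min (m := v) hex
  set u := Nat.find hex
  have hlow : 2 * u - 1 ≤ 14 + 8 * T + 4 * (K.filter fun x => x < 2 * u - 1).card := by
    rcases hu3.eq_or_lt with h | h
    · omega
    · have h1 := hmin (u - 1) (by omega)
      have hfail : SieveIndex n (u - 1) ∧ ¬ (2 * (u - 1) + 1) ∣ n ∧ 2 * (u - 1) + 1 ∉ K := by
        by_contra hcon
        refine h1 ⟨by omega, by omega, fun j hj1 hj2 hj3 hj4 => ?_⟩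
        rcases hj1.eq_or_lt with h | h
        · subst h
          by_contra hj5
          exact hcon ⟨hj3, hj4, hj5⟩
        · exact hu j (by omega) hj2 hj3 hj4
      obtain ⟨hf1, hf2, hf3⟩ := hfail
      have := le_card_of_no_goodPair hT (by omega) (by omega) hf1 hf2 hno' hf3
      rwa [show 2 * (u - 1) + 1 = 2 * u - 1 by omega] at this
  have hhigh : J - u ≤ (K.filter fun x => ¬ x < 2 * u - 1).card +
      ((Finset.Ico u J).filter fun j => ¬ SieveIndex n j).card +
      ((Finset.Ico u J).filter fun j => 2 * j + 1 ∣ n).card := by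
    have h1 : Finset.Ico u J ⊆ ((Finset.Ico u J).filter fun j => 2 * j + 1 ∈ K) ∪
        ((Finset.Ico u J).filter fun j => ¬ SieveIndex n j) ∪
        ((Finset.Ico u J).filter fun j => 2 * j + 1 ∣ n) := by
      intro j hj
      have hj' := Finset.mem_Ico.1 hj
      simp only [Finset.mem_union, Finset.mem_filter, hj, true_and]
      by_contra! h
      exact h.1.1 (hu j hj'.1 hj'.2 h.1.2 h.2)
    have h2 := Finset.card_le_card h1
    rw [Nat.card_Ico] at h2
    refine h2.trans ((Finset.card_union_le _ _).trans ?_)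
    refine Nat.add_le_add_right ((Finset.card_union_le _ _).trans ?_) _
    refine Nat.add_le_add_right ?_ _
    refine Finset.card_le_card_of_injOn (fun j => 2 * j + 1) ?_ ?_
    · intro j hj
      simp only [Finset.coe_filter, Finset.mem_Ico, Set.mem_ofPred_eq] at hj ⊢
      exact ⟨hj.2, by omega⟩
    · intro i _ j _ hij
      simp only at hij
      omega
  have hsplit := Finset.card_filter_add_card_filter_not (s := K) (fun x => x < 2 * u - 1)
  have hodd := card_odd_divisors_le (by omega) hT u J
  have hbad := card_not_sieveIndex_le (n := n) (by omega) huJ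
  have hω := card_primeFactors_mul_le hn
  have hJ : n ≤ 4 * J + 3 := by omega
  generalize (K.filter fun x => x < 2 * u - 1).card = A at *
  generalize (K.filter fun x => ¬ x < 2 * u - 1).card = B at *
  generalize ((Finset.Ico u J).filter fun j => ¬ SieveIndex n j).card = C at *
  generalize ((Finset.Ico u J).filter fun j => 2 * j + 1 ∣ n).card = D at *
  generalize n.primeFactors.card = w at *
  rw [← hsplit] at hK
  have e1 : (2 : ℚ) * u ≤ 15 + 8 * T + 4 * A := by
    have : 2 * u ≤ 15 + 8 * T + 4 * A := by omega
    exact_mod_cast this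
  have e2 : (J : ℚ) ≤ u + B + C + D := by
    have : J ≤ u + B + C + D := by omega
    exact_mod_cast this
  have e3 : (2 : ℚ) * D ≤ 3 * T + 1 := by exact_mod_cast hodd
  have e4 : (1000 : ℚ) * w ≤ n := by exact_mod_cast hω
  have e5 : (n : ℚ) ≤ 4 * J + 3 := by exact_mod_cast hJ
  have e6 : ((A : ℚ) + B + 1) * 98696 ≤ 10000 * n := by exact_mod_cast hK
  have e7 : (T : ℚ) * T ≤ n := by exact_mod_cast hT'
  have e8 : (30030 : ℚ) ≤ n := by exact_mod_cast hn
  have e9 : (346 : ℚ) * T ≤ n + 173 * 173 := by nlinarith [sq_nonneg ((T : ℚ) - 173)]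
  linarith

theorem exists_goodPair {n : ℕ} (h20 : 20 ≤ n) (K : Finset ℕ) (h0 : 0 ∉ K)
    (hK : (K.card + 1) * 98696 ≤ 10000 * n) :
    ∃ a b, GoodPair n a b ∧ a ∉ K ∧ b ∉ K ∧ a + b ∉ K := by
  rcases Nat.lt_or_ge n 30030 with hn | hn
  · obtain ⟨a, h1, h2⟩ := exists_goodPair_of_lt h20 hn K hK
    exact ⟨a, 0, h1, h2, h0, h2⟩
  · exact exists_goodPair_of_ge hn K hK

end ThreeBlocksChoice

section NormalCovers

theorem IsNormalCover.pos {G : Type*} [Group G] {k : ℕ} (h : IsNormalCover G k) : 0 < k := by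
  obtain ⟨H, -, h⟩ := h
  obtain ⟨i, -⟩ := h 1
  exact i.pos

theorem exists_forall_conj_notMem {G : Type*} [Group G] [Finite G] {H : Subgroup G} (hH : H ≠ ⊤) :
    ∃ g : G, ∀ x : G, x * g * x⁻¹ ∉ H := by
  classical
  have := Fintype.ofFinite G
  by_contra! hcon
  have hb := MulAction.sum_card_fixedBy_eq_card_orbits_mul_card_group G (G ⧸ H)
  have horb : Fintype.card (MulAction.orbitRel.Quotient G (G ⧸ H)) ≤ 1 :=
    Fintype.card_le_one_iff_subsingleton.2
      ((MulAction.pretransitive_iff_subsingleton_quotient G (G ⧸ H)).1 inferInstance)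
  have hfix : ∀ g : G, 1 ≤ Fintype.card (MulAction.fixedBy (G ⧸ H) g) := by
    intro g
    obtain ⟨x, hx⟩ := hcon g
    refine Fintype.card_pos_iff.2 ⟨⟨((x⁻¹ : G) : G ⧸ H), ?_⟩⟩
    rw [MulAction.mem_fixedBy, MulAction.Quotient.smul_coe, smul_eq_mul, eq_comm,
      QuotientGroup.eq]
    simpa [mul_assoc] using hx
  have hone : 1 < Fintype.card (MulAction.fixedBy (G ⧸ H) (1 : G)) := by
    have h1 : Fintype.card (MulAction.fixedBy (G ⧸ H) (1 : G)) = H.index := by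
      rw [Subgroup.index, Nat.card_eq_fintype_card]
      refine Fintype.card_congr ((Equiv.setCongr ?_).trans (Equiv.Set.univ _))
      ext
      simp
    rw [h1]
    exact Subgroup.one_lt_index_of_ne_top hH
  have hlt : ∑ _g : G, 1 < ∑ g : G, Fintype.card (MulAction.fixedBy (G ⧸ H) g) :=
    Finset.sum_lt_sum (fun g _ => hfix g) ⟨1, Finset.mem_univ _, hone⟩
  rw [hb, Finset.sum_const, Finset.card_univ, smul_eq_mul, mul_one] at hlt
  refine absurd (hlt.trans_le (Nat.mul_le_mul_right (Fintype.card G) horb)) ?_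
  rw [one_mul]
  exact lt_irrefl _

theorem not_isNormalCover_one {G : Type*} [Group G] [Finite G] : ¬ IsNormalCover G 1 := by
  rintro ⟨H, hH, h⟩
  obtain ⟨g, hg⟩ := exists_forall_conj_notMem (hH 0)
  obtain ⟨i, x, hx⟩ := h g
  rw [Subsingleton.elim i 0] at hx
  exact hg x hx

theorem isNormalCover_gammaCover {G : Type*} [Group G] [Finite G]
    (hG : ∃ a b : G, a * b ≠ b * a) : IsNormalCover G (gammaCover G) := by
  refine Nat.sInf_mem (s := {k | IsNormalCover G k}) ⟨Nat.card G, ?_⟩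
  refine ⟨fun i => Subgroup.zpowers ((Finite.equivFin G).symm i), fun i hi => ?_, fun g => ?_⟩
  · obtain ⟨a, b, hab⟩ := hG
    beta_reduce at hi
    obtain ⟨s, rfl⟩ := Subgroup.mem_zpowers_iff.1 (hi ▸ Subgroup.mem_top a :
      a ∈ Subgroup.zpowers ((Finite.equivFin G).symm i))
    obtain ⟨t, rfl⟩ := Subgroup.mem_zpowers_iff.1 (hi ▸ Subgroup.mem_top b :
      b ∈ Subgroup.zpowers ((Finite.equivFin G).symm i))
    exact hab (by rw [← zpow_add, ← zpow_add, add_comm])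
  · exact ⟨Finite.equivFin G g, 1, by simp⟩

end NormalCovers

section CoversOfLinearGroups

open Module Matrix

variable {F : Type*} [Field F]

theorem exists_noncommuting {n : ℕ} (hn : 2 ≤ n) (G : Subgroup (GL (Fin n) F))
    (hG : SLinGL n F ≤ G) : ∃ a b : G, a * b ≠ b * a := by
  have hij : (⟨0, by omega⟩ : Fin n) ≠ ⟨1, by omega⟩ := by simp
  generalize (⟨0, by omega⟩ : Fin n) = i at hij
  generalize (⟨1, by omega⟩ : Fin n) = j at hij
  let a : SpecialLinearGroup (Fin n) F := ⟨transvection i j 1, det_transvection_of_ne i j hij 1⟩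
  let b : SpecialLinearGroup (Fin n) F := ⟨transvection j i 1, det_transvection_of_ne j i hij.symm 1⟩
  refine ⟨⟨SpecialLinearGroup.toGL a, hG ⟨a, rfl⟩⟩, ⟨SpecialLinearGroup.toGL b, hG ⟨b, rfl⟩⟩,
    fun h => ?_⟩
  have h1 : transvection i j (1 : F) * transvection j i 1 =
      transvection j i 1 * transvection i j 1 :=
    congrArg (fun x : G => (x : GL (Fin n) F).1) h
  have h2 := congrFun (congrFun h1 i) i
  simp [transvection, add_mul, mul_add, hij.symm] at h2

/-- Pullback of a subspace along an invertible matrix. -/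
def pullback {n : ℕ} (x : GL (Fin n) F) (S : Submodule F (Fin n → F)) :
    Submodule F (Fin n → F) := S.comap x.1.mulVecLin

theorem mem_pullback {n : ℕ} {x : GL (Fin n) F} {S : Submodule F (Fin n → F)} {w : Fin n → F} :
    w ∈ pullback x S ↔ x.1 *ᵥ w ∈ S := Iff.rfl

theorem finrank_pullback {n : ℕ} (x : GL (Fin n) F) (S : Submodule F (Fin n → F)) :
    finrank F (pullback x S) = finrank F S := by
  let e : (Fin n → F) ≃ₗ[F] (Fin n → F) := LinearMap.GeneralLinearGroup.generalLinearEquiv F _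
    (Matrix.GeneralLinearGroup.toLin x)
  have h : pullback x S = S.comap e.toLinearMap := rfl
  rw [h, Submodule.comap_equiv_eq_map_symm]
  exact LinearEquiv.finrank_map_eq _ _

theorem matInvariant_pullback {n : ℕ} {x g : GL (Fin n) F} {S : Submodule F (Fin n → F)}
    (h : MatInvariant (x * g * x⁻¹) S) : MatInvariant g (pullback x S) := by
  intro w hw
  rw [mem_pullback] at hw ⊢
  have h1 := h _ hw
  rw [mulVec_mulVec, ← Units.val_mul, inv_mul_cancel_right, Units.val_mul] at h1
  rwa [mulVec_mulVec]

theorem eq_bot_or_top_of_finrank {n : ℕ} {S : Submodule F (Fin n → F)}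
    (h : finrank F S = 0 ∨ finrank F S = n) : S = ⊥ ∨ S = ⊤ := by
  rcases h with h | h
  · exact Or.inl (Submodule.finrank_eq_zero.1 h)
  · exact Or.inr (Submodule.eq_top_of_finrank_eq (by rw [h, finrank_fin_fun]))

theorem finrank_of_eq_bot_or_top {n : ℕ} {S : Submodule F (Fin n → F)}
    (h : S = ⊥ ∨ S = ⊤) : finrank F S = 0 ∨ finrank F S = n := by
  rcases h with rfl | rfl
  · exact Or.inl (finrank_bot F _)
  · exact Or.inr (by rw [finrank_top, finrank_fin_fun])

theorem mem_of_det_mem {n : ℕ} {H : Subgroup (GL (Fin n) F)} (hH : SLinGL n F ≤ H)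
    {g h : GL (Fin n) F} (hh : h ∈ H)
    (hd : Matrix.GeneralLinearGroup.det g = Matrix.GeneralLinearGroup.det h) : g ∈ H := by
  have h1 : g * h⁻¹ ∈ H := hH (mem_SLinGL.2 (by rw [map_mul, map_inv, hd, mul_inv_cancel]))
  simpa using H.mul_mem h1 hh

/-- An irreducible subgroup acting on `F ^ n`. -/
def MatIrreducible {n : ℕ} (H : Subgroup (GL (Fin n) F)) : Prop :=
  ∀ S : Submodule F (Fin n → F), (∀ h ∈ H, MatInvariant h S) → S = ⊥ ∨ S = ⊤

theorem MatIrreducible.comap_conj {n : ℕ} {H : Subgroup (GL (Fin n) F)} (hH : MatIrreducible H)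
    (x : GL (Fin n) F) : MatIrreducible (H.comap (MulAut.conj x).toMonoidHom) := by
  intro S hS
  have h1 := finrank_of_eq_bot_or_top (hH (pullback x⁻¹ S) fun h hh =>
    matInvariant_pullback (hS _ (by
      rw [Subgroup.mem_comap]
      simpa [mul_assoc] using hh)))
  rw [finrank_pullback] at h1
  exact eq_bot_or_top_of_finrank h1

theorem lt_of_isNormalCover [Fintype F] {n k : ℕ} (hn : 20 ≤ n) {G : Subgroup (GL (Fin n) F)}
    (hG : SLinGL n F ≤ G) (hk : IsNormalCover G k) : 10000 * n < k * 98696 := by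
  classical
  by_contra! hlt
  have hk0 := hk.pos
  obtain ⟨H, hH, hcov⟩ := hk
  let H' : Fin k → Subgroup (GL (Fin n) F) := fun i => (H i).map G.subtype
  have hcov' : ∀ g ∈ G, ∃ i x, x * g * x⁻¹ ∈ H' i := by
    intro g hg
    obtain ⟨i, x, hx⟩ := hcov ⟨g, hg⟩
    exact ⟨i, x, _, hx, rfl⟩
  set Δ := G.map Matrix.GeneralLinearGroup.det with hΔ
  have hmem : ∀ g, Matrix.GeneralLinearGroup.det g ∈ Δ → g ∈ G := by
    rintro g ⟨y, hy, hyg⟩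
    exact mem_of_det_mem hG hy hyg.symm
  have hproper : ∀ i, ¬ MatIrreducible (H' i) → ∃ S : Submodule F (Fin n → F),
      (∀ h ∈ H' i, MatInvariant h S) ∧ 0 < finrank F S ∧ finrank F S < n := by
    intro i hi
    rw [MatIrreducible] at hi
    push Not at hi
    obtain ⟨S, hS, h1, h2⟩ := hi
    have h3 : ¬ (finrank F S = 0 ∨ finrank F S = n) := fun h => by
      rcases eq_bot_or_top_of_finrank h with h | h
      · exact h1 h
      · exact h2 h
    have h4 := Submodule.finrank_le S
    rw [finrank_fin_fun] at h4
    exact ⟨S, hS, by omega, by omega⟩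
  choose! S hS hS0 hSn using hproper
  obtain ⟨s, hsΔ, -, hsinv, -⟩ := exists_matrix_element (F := F) (n := n) Δ (k₁ := 0) (k₂ := 0)
    (m := n) (by omega) (Or.inl rfl) (Or.inl rfl) (by omega) (by omega) (fun _ => rfl)
    (fun h => absurd rfl h) (fun h => absurd rfl h)
  obtain ⟨i₀, x₀, hx₀⟩ := hcov' s (hmem s hsΔ)
  have hi₀ : MatIrreducible (H' i₀) := by
    by_contra hi
    obtain ⟨d, hd, h⟩ := hsinv _ (matInvariant_pullback (hS i₀ hi _ hx₀))
    rw [finrank_pullback] at h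
    have := hS0 i₀ hi
    have := hSn i₀ hi
    omega
  set K : Finset ℕ := (Finset.univ.filter fun i => ¬ MatIrreducible (H' i)).image fun i =>
    min (finrank F (S i)) (n - finrank F (S i)) with hKdef
  have hK : K.card + 1 ≤ k := by
    have h1 : K.card ≤ (Finset.univ.erase i₀ : Finset (Fin k)).card :=
      Finset.card_image_le.trans (Finset.card_le_card fun i hi => by
        rw [Finset.mem_erase]
        refine ⟨?_, Finset.mem_univ _⟩
        rintro rfl
        exact (Finset.mem_filter.1 hi).2 hi₀)
    rw [Finset.card_erase_of_mem (Finset.mem_univ _), Finset.card_univ, Fintype.card_fin] at h1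
    omega
  have hK0 : 0 ∉ K := by
    intro h
    obtain ⟨i, hi, h⟩ := Finset.mem_image.1 h
    have hi := (Finset.mem_filter.1 hi).2
    have := hS0 i hi
    have := hSn i hi
    omega
  obtain ⟨a, b, hab, ha, hb, hab'⟩ := exists_goodPair hn K hK0
    ((Nat.mul_le_mul_right _ hK).trans hlt)
  obtain ⟨g, hgΔ, hΔg, hginv, hgbig⟩ := exists_matrix_element (F := F) (n := n) Δ (k₁ := a)
    (k₂ := b) (m := n - (a + b)) (by have := hab.lt; omega)
    (Or.inr ⟨hab.three_le, hab.ne_six⟩) hab.right (by have := hab.lt; have := hab.five_le; omega)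
    (by have := hab.lt; have := hab.five_le; omega) (fun h => absurd h hab.ne)
    (fun _ => hab.not_dvd_left) hab.not_dvd_right
  obtain ⟨i, x, hx⟩ := hcov' g (hmem g hgΔ)
  have hi : MatIrreducible (H' i) := by
    by_contra hi
    obtain ⟨d, hd, h⟩ := hginv _ (matInvariant_pullback (hS i hi _ hx))
    rw [finrank_pullback] at h
    have h0 := hS0 i hi
    have h1 := hSn i hi
    have h2 : min (finrank F (S i)) (n - finrank F (S i)) ∈ K :=
      Finset.mem_image.2 ⟨i, Finset.mem_filter.2 ⟨Finset.mem_univ _, hi⟩, rfl⟩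
    have h3 := hab.lt
    have h4 : d ≠ 0 → min (finrank F (S i)) (n - finrank F (S i)) = d := by omega
    rcases hd with rfl | rfl | rfl | rfl
    · omega
    · exact ha (h4 (by have := hab.three_le; omega) ▸ h2)
    · by_cases hb0 : d = 0
      · omega
      · exact hb (h4 hb0 ▸ h2)
    · exact hab' (h4 (by have := hab.three_le; omega) ▸ h2)
  have hSL := hgbig (by have := hab.lt; omega) hab.five_le hab.not_dvd_add hab.coprime
    ((H' i).comap (MulAut.conj x).toMonoidHom) hx (hi.comap_conj x)
  have hSL' : SLinGL n F ≤ H' i := by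
    intro y hy
    have h1 : x⁻¹ * y * x ∈ SLinGL n F := mem_SLinGL.2 (by
      rw [map_mul, map_mul, mem_SLinGL.1 hy, mul_one, map_inv, inv_mul_cancel])
    have h2 := hSL h1
    rw [Subgroup.mem_comap] at h2
    simpa [mul_assoc] using h2
  refine hH i ((Subgroup.eq_top_iff' _).2 fun z => ?_)
  obtain ⟨t, ht⟩ := Subgroup.mem_zpowers_iff.1 (hΔg ⟨z.1, z.2, rfl⟩)
  obtain ⟨z', hz', hzz⟩ := mem_of_det_mem (g := z.1) hSL' ((H' i).zpow_mem hx t) (by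
    rw [map_zpow, map_mul, map_mul, map_inv, mul_inv_cancel_comm, ht])
  rwa [← Subtype.ext hzz]

end CoversOfLinearGroups

theorem pi_squared_lower_bound
    (n q : ℕ) (hn : 2 ≤ n) (hq : IsPrimePow q)
    (F : Type*) [Field F] [Fintype F] (hF : Fintype.card F = q)
    (G : Subgroup (GL (Fin n) F)) (hG : SLinGL n F ≤ G) :
    (n : ℝ) / Real.pi ^ 2 < (gammaCover G : ℝ) := by
  have hcov := isNormalCover_gammaCover (exists_noncommuting hn G hG)
  have hpi : (9.8696 : ℝ) < Real.pi ^ 2 := by nlinarith [Real.pi_gt_d6]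
  have key : 10000 * n < gammaCover G * 98696 := by
    rcases Nat.lt_or_ge n 20 with h | h
    · have h1 := hcov.pos
      have h2 : gammaCover G ≠ 1 := fun h => not_isNormalCover_one (h ▸ hcov)
      omega
    · exact lt_of_isNormalCover h hG hcov
  have key' : (10000 : ℝ) * n < gammaCover G * 98696 := by exact_mod_cast key
  rw [div_lt_iff₀ (by positivity)]
  have h0 : (0 : ℝ) ≤ gammaCover G := by positivity
  nlinarith [mul_le_mul_of_nonneg_left hpi.le h0]
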